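/- Let n ≥ 1 and let Ω ⊂ ℝ^n be open. Then the functionals κ_ε(·, Ω) Γ_∞-converge as ε → 0 to the functional f ↦ (1/4)·|D^a f|(Ω) + (1/4)·|D^c f|(Ω) + (1/2)·|D^j f|(Ω) on L^1_loc(Ω); that is: (i) for every f ∈ L^1_loc(Ω) and every family {f_ε}_{ε>0} with f_ε − f ∈ L^∞_loc(Ω) and f_ε − f → 0 in L^∞_loc(Ω), one has liminf_{ε→0} κ_ε(f_ε, Ω) ≥ (1/4)·|D^a f|(Ω) + (1/4)·|D^c f|(Ω) + (1/2)·|D^j f|(Ω); and (ii) for every f ∈ L^1_loc(Ω) there exists a family {f_ε}_{ε>0} with f_ε − f ∈ L^∞_loc(Ω), f_ε − f → 0 in L^∞_loc(Ω), and limsup_{ε→0} κ_ε(f_ε, Ω) ≤ (1/4)·|D^a f|(Ω) + (1/4)·|D^c f|(Ω) + (1/2)·|D^j f|(Ω). -/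

import Mathlib

open MeasureTheory Filter Topology Metric
open scoped ENNReal RealInnerProductSpace Classical

noncomputable section

/-- An open cube in `ℝⁿ` with side length `ε` and arbitrary orientation. -/
def IsCube (n : ℕ) (ε : ℝ) (Q : Set (EuclideanSpace ℝ (Fin n))) : Prop :=
  ∃ (T : EuclideanSpace ℝ (Fin n) ≃ₗᵢ[ℝ] EuclideanSpace ℝ (Fin n))
    (x : EuclideanSpace ℝ (Fin n)),
    Q = (fun y => x + T y) '' {y : EuclideanSpace ℝ (Fin n) | ∀ i, |y i| < ε / 2}

/-- The BMO-type functional `κ_ε(f, Ω)`. -/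
def kappa (n : ℕ) (ε : ℝ) (f : EuclideanSpace ℝ (Fin n) → ℝ)
    (Ω : Set (EuclideanSpace ℝ (Fin n))) : ℝ≥0∞ :=
  ENNReal.ofReal (ε ^ (n - 1)) *
    ⨆ (F : Set (Set (EuclideanSpace ℝ (Fin n))))
      (_ : ∀ Q ∈ F, IsCube n ε Q ∧ Q ⊆ Ω) (_ : F.Pairwise Disjoint),
      ∑' Q : F, ENNReal.ofReal
        (⨍ x in (Q : Set (EuclideanSpace ℝ (Fin n))),
          |f x - ⨍ y in (Q : Set (EuclideanSpace ℝ (Fin n))), f y ∂volume| ∂volume)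

/-- The divergence of a vector field on `ℝⁿ`. -/
def vdiv (n : ℕ) (Φ : EuclideanSpace ℝ (Fin n) → EuclideanSpace ℝ (Fin n))
    (x : EuclideanSpace ℝ (Fin n)) : ℝ :=
  ∑ i : Fin n, fderiv ℝ Φ x (EuclideanSpace.single i 1) i

/-- The variation `Var(f, Ω)`. -/
def variation (n : ℕ) (f : EuclideanSpace ℝ (Fin n) → ℝ)
    (Ω : Set (EuclideanSpace ℝ (Fin n))) : ℝ≥0∞ :=
  ⨆ (Φ : EuclideanSpace ℝ (Fin n) → EuclideanSpace ℝ (Fin n))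
    (_ : ContDiff ℝ 1 Φ) (_ : HasCompactSupport Φ) (_ : tsupport Φ ⊆ Ω)
    (_ : ∀ x, ‖Φ x‖ ≤ 1),
    ENNReal.ofReal (∫ x in Ω, f x * vdiv n Φ x)

/-- The approximate jump set `J_f`. -/
def jumpSet (n : ℕ) (f : EuclideanSpace ℝ (Fin n) → ℝ) : Set (EuclideanSpace ℝ (Fin n)) :=
  {x | ∃ ν : EuclideanSpace ℝ (Fin n), ‖ν‖ = 1 ∧ ∃ a b : ℝ, a ≠ b ∧
    Tendsto (fun r : ℝ =>
        ⨍ y in {y ∈ ball x r | 0 < ⟪y - x, ν⟫}, |f y - a| ∂volume)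
      (𝓝[>] 0) (𝓝 0) ∧
    Tendsto (fun r : ℝ =>
        ⨍ y in {y ∈ ball x r | ⟪y - x, ν⟫ < 0}, |f y - b| ∂volume)
      (𝓝[>] 0) (𝓝 0)}

/-- The approximate discontinuity set `S_f` (the set of non-Lebesgue points). -/
def approxDiscontSet (n : ℕ) (f : EuclideanSpace ℝ (Fin n) → ℝ) :
    Set (EuclideanSpace ℝ (Fin n)) :=
  {x | ¬ ∃ c : ℝ,
    Tendsto (fun r : ℝ => ⨍ y in ball x r, |f y - c| ∂volume) (𝓝[>] 0) (𝓝 0)}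

/-- `(μ, σ)` is the polar decomposition `Df = σ |Df|` of the gradient measure of `f` on `Ω`:
`μ` plays the role of the total variation measure `|Df|` and `σ` of the polar vector field. -/
def IsVariationPair (n : ℕ) (f : EuclideanSpace ℝ (Fin n) → ℝ)
    (Ω : Set (EuclideanSpace ℝ (Fin n))) (μ : Measure (EuclideanSpace ℝ (Fin n)))
    (σ : EuclideanSpace ℝ (Fin n) → EuclideanSpace ℝ (Fin n)) : Prop :=
  IsFiniteMeasure μ ∧ μ Ωᶜ = 0 ∧ AEStronglyMeasurable σ μ ∧ (∀ᵐ x ∂μ, ‖σ x‖ = 1) ∧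
  ∀ Φ : EuclideanSpace ℝ (Fin n) → EuclideanSpace ℝ (Fin n),
    ContDiff ℝ 1 Φ → HasCompactSupport Φ → tsupport Φ ⊆ Ω →
    ∫ x in Ω, f x * vdiv n Φ x = - ∫ x, ⟪Φ x, σ x⟫ ∂μ

/-- `|D^a f|(Ω)`, the total variation of the absolutely continuous part of `Df`,
with the convention that it is `∞` if `f` is not of bounded variation in `Ω`. -/
def absVar (n : ℕ) (f : EuclideanSpace ℝ (Fin n) → ℝ)
    (Ω : Set (EuclideanSpace ℝ (Fin n))) : ℝ≥0∞ :=
  if h : ∃ p : Measure (EuclideanSpace ℝ (Fin n)) ×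
      (EuclideanSpace ℝ (Fin n) → EuclideanSpace ℝ (Fin n)),
      IsVariationPair n f Ω p.1 p.2 then
    volume.withDensity ((h.choose.1).rnDeriv volume) Ω
  else ⊤

/-- `|D^c f|(Ω)`, the total variation of the Cantor part of `Df`,
with the convention that it is `∞` if `f` is not of bounded variation in `Ω`. -/
def cantorVar (n : ℕ) (f : EuclideanSpace ℝ (Fin n) → ℝ)
    (Ω : Set (EuclideanSpace ℝ (Fin n))) : ℝ≥0∞ :=
  if h : ∃ p : Measure (EuclideanSpace ℝ (Fin n)) ×
      (EuclideanSpace ℝ (Fin n) → EuclideanSpace ℝ (Fin n)),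
      IsVariationPair n f Ω p.1 p.2 then
    (h.choose.1.singularPart volume) (Ω \ approxDiscontSet n f)
  else ⊤

/-- `|D^j f|(Ω)`, the total variation of the jump part of `Df`,
with the convention that it is `∞` if `f` is not of bounded variation in `Ω`. -/
def jumpVar (n : ℕ) (f : EuclideanSpace ℝ (Fin n) → ℝ)
    (Ω : Set (EuclideanSpace ℝ (Fin n))) : ℝ≥0∞ :=
  if h : ∃ p : Measure (EuclideanSpace ℝ (Fin n)) ×
      (EuclideanSpace ℝ (Fin n) → EuclideanSpace ℝ (Fin n)),
      IsVariationPair n f Ω p.1 p.2 then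
    (h.choose.1.singularPart volume) (jumpSet n f ∩ Ω)
  else ⊤

/-- `g` is the weak (distributional) gradient of `u` on `Ω`. -/
def HasWeakGradientOn (n : ℕ) (u : EuclideanSpace ℝ (Fin n) → ℝ)
    (g : EuclideanSpace ℝ (Fin n) → EuclideanSpace ℝ (Fin n))
    (Ω : Set (EuclideanSpace ℝ (Fin n))) : Prop :=
  ∀ φ : EuclideanSpace ℝ (Fin n) → ℝ,
    ContDiff ℝ 1 φ → HasCompactSupport φ → tsupport φ ⊆ Ω →
    ∀ k : Fin n,
      ∫ x in Ω, u x * fderiv ℝ φ x (EuclideanSpace.single k 1) =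
        - ∫ x in Ω, φ x * g x k

/-- `f ∈ BV(Ω)`: `f` is integrable on `Ω` and has finite variation in `Ω`. -/
def IsBVOn (n : ℕ) (f : EuclideanSpace ℝ (Fin n) → ℝ)
    (Ω : Set (EuclideanSpace ℝ (Fin n))) : Prop :=
  IntegrableOn f Ω volume ∧ variation n f Ω < ⊤

/-- `f ∈ SBV(Ω)`: `f ∈ BV(Ω)` and the Cantor part of `Df` vanishes. -/
def IsSBVOn (n : ℕ) (f : EuclideanSpace ℝ (Fin n) → ℝ)
    (Ω : Set (EuclideanSpace ℝ (Fin n))) : Prop :=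
  IsBVOn n f Ω ∧ cantorVar n f Ω = 0

namespace BMOGamma

open ENNReal (ofReal ofReal_of_nonpos ofReal_le_ofReal ofReal_add_le ofReal_le_iff_le_toReal
  ofReal_mul toReal_ofReal toReal_mul toReal_mono mul_iSup add_ne_top ofReal_ne_top ofReal_pow
  pow_lt_top ofReal_lt_top ofReal_div_of_pos continuous_ofReal div_le_of_le_mul coe_pos ofReal_mul'
  mul_div_le summable ofReal_one ofReal_add ofReal_le_ofReal_iff ofReal_eq_zero toReal_pos
  ofReal_zero mul_ne_top ofReal_pos ofReal_ofNat inv_ne_top mul_top ofReal_max)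
open Set (inter_subset_left indicator subset_inter inter_subset_right sdiff_subset Subset mem_iUnion
  univ Icc indicator_of_mem Ioi Ioc indicator_of_notMem Ioo mem_Ioo range sep_subset)
open Finset (sum_congr mul_sum mem_univ mem_image mem_coe induction_on mem_filter prod_ite_eq'
  prod_eq_zero prod_mul_distrib mem_union mem_insert_of_mem mem_insert_self sum_le_sum sum_mul
  card_univ)
open Real (norm_eq_abs norm_of_nonneg dist_eq exp cos sin)
open ContinuousLinearMap (mul_apply' opNorm_comp_le opNorm_le_bound smulRight_apply)
open EuclideanSpace (basisFun proj inner_single_left norm_sq_eq)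
open Function (support uncurry onFun comp_def)

variable {n : ℕ}

/-- Euclidean space of dimension `n`. -/
abbrev E (n : ℕ) := EuclideanSpace ℝ (Fin n)

/-- Orthonormal bases of `ℝⁿ`. -/
abbrev Frame (n : ℕ) := OrthonormalBasis (Fin n) ℝ (E n)

/-- Local integrability on `Ω` with respect to Lebesgue measure. -/
abbrev LocInt (f : E n → ℝ) (Ω : Set (E n)) : Prop := LocallyIntegrableOn f Ω volume

/-- Scalar test functions of class `C¹` with compact support in `Ω`. -/
structure IsTest (Ω : Set (E n)) (φ : E n → ℝ) : Prop where
  contDiff : ContDiff ℝ 1 φ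
  hasCompactSupport : HasCompactSupport φ
  tsupport_subset : tsupport φ ⊆ Ω

variable {ε R r δ r₀ η τ α β : ℝ} {x z e ν : E n} {f u v φ : E n → ℝ}
  {Ω A U Q K : Set (E n)} {μ : Measure (E n)} {σ : E n → E n} {F : ℝ → E n → ℝ} {i₀ : Fin n}
  {b : Frame n}

namespace IsTest
variable {ψ : E n → ℝ}

lemma mono (h : IsTest Ω φ) (hU : Ω ⊆ U) : IsTest U φ :=
  ⟨h.1, h.2, h.3.trans hU⟩

lemma continuous (h : IsTest Ω φ) : Continuous φ := h.1.continuous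

lemma differentiable (h : IsTest Ω φ) : Differentiable ℝ φ := h.1.differentiable (by simp)

lemma continuous_fderiv (h : IsTest Ω φ) (e : E n) : Continuous fun x => fderiv ℝ φ x e :=
  (h.1.continuous_fderiv (by simp)).clm_apply continuous_const

lemma hasCompactSupport_fderiv (h : IsTest Ω φ) (e : E n) :
    HasCompactSupport fun x => fderiv ℝ φ x e :=
  h.2.fderiv_apply (𝕜 := ℝ) e

lemma eq_zero (h : IsTest Ω φ) (hx : x ∉ Ω) : φ x = 0 :=
  image_eq_zero_of_notMem_tsupport fun hx' => hx (h.3 hx')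

lemma tsupport_fderiv_subset (e : E n) : tsupport (fun x => fderiv ℝ φ x e) ⊆ tsupport φ :=
  _root_.tsupport_fderiv_apply_subset ℝ e

lemma fderiv_eq_zero (h : IsTest Ω φ) (hx : x ∉ Ω) (e : E n) : fderiv ℝ φ x e = 0 :=
  image_eq_zero_of_notMem_tsupport (f := fun x => fderiv ℝ φ x e)
    fun hx' => hx (h.3 (tsupport_fderiv_subset e hx'))

lemma comp_add (h : IsTest Ω φ) (v : E n) (hU : ∀ x, x + v ∈ Ω → x ∈ U) :
    IsTest U fun x => φ (x + v) := by
  refine ⟨h.1.comp (contDiff_id.add contDiff_const), h.2.comp_homeomorph (Homeomorph.addRight v), ?_⟩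
  have : tsupport (fun x => φ (x + v)) = (fun x => x + v) ⁻¹' tsupport φ := by
    have := (Homeomorph.addRight v).preimage_closure (support φ)
    exact this.symm
  intro x hx
  rw [this] at hx
  exact hU x (h.3 hx)

lemma exists_bound (h : IsTest Ω φ) : ∃ C, 0 ≤ C ∧ ∀ x, |φ x| ≤ C := by
  obtain ⟨C, hC⟩ := h.2.exists_bound_of_continuous h.continuous
  exact ⟨C, (norm_nonneg _).trans (hC 0), hC⟩

end IsTest

/-- Products of a locally integrable function with a continuous function compactly supported
in the domain are integrable. -/
lemma integrable_mul_of_tsupport {m : Measure (E n)} {g : E n → ℝ}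
    (hf : LocallyIntegrableOn f Ω m) (hg : Continuous g) (hgc : HasCompactSupport g)
    (hs : tsupport g ⊆ Ω) : Integrable (fun x => f x * g x) m := by
  have hK : IsCompact (tsupport g) := hgc
  have h1 : IntegrableOn f (tsupport g) m := hf.integrableOn_compact_subset hs hK
  have h2 : IntegrableOn (fun x => f x * g x) (tsupport g) m := by
    exact h1.mul_continuousOn hg.continuousOn hK
  rw [integrableOn_iff_integrable_of_support_subset] at h2
  · exact h2
  · intro x hx
    apply subset_tsupport
    intro h0
    apply hx
    simp [h0]

lemma IsTest.integrable_mul (h : IsTest Ω φ) {m : Measure (E n)}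
    (hf : LocallyIntegrableOn f Ω m) : Integrable (fun x => f x * φ x) m :=
  integrable_mul_of_tsupport hf h.continuous h.2 h.3

lemma IsTest.integrable_mul_fderiv (h : IsTest Ω φ) {m : Measure (E n)}
    (hf : LocallyIntegrableOn f Ω m) (e : E n) : Integrable (fun x => f x * fderiv ℝ φ x e) m :=
  integrable_mul_of_tsupport hf (h.continuous_fderiv e) (h.hasCompactSupport_fderiv e)
    ((IsTest.tsupport_fderiv_subset e).trans h.3)

/-- Scalar form of `IsVariationPair`. -/
structure IsPair (f : E n → ℝ) (Ω : Set (E n)) (μ : Measure (E n)) (σ : E n → E n) : Prop where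
  finite : IsFiniteMeasure μ
  null : μ Ωᶜ = 0
  aesm : AEStronglyMeasurable σ μ
  norm_eq : ∀ᵐ x ∂μ, ‖σ x‖ = 1
  integral_eq : ∀ φ, IsTest Ω φ → ∀ e,
    ∫ x, f x * fderiv ℝ φ x e = - ∫ x, φ x * ⟪e, σ x⟫ ∂μ

lemma setIntegral_eq_integral_of_test {g : E n → ℝ} (h : ∀ x ∉ Ω, g x = 0) :
    ∫ x in Ω, f x * g x = ∫ x, f x * g x :=
  setIntegral_eq_integral_of_forall_compl_eq_zero fun x hx => by simp [h x hx]

lemma vdiv_smul_const (hφ : Differentiable ℝ φ) (e x : E n) :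
    vdiv n (fun x => φ x • e) x = fderiv ℝ φ x e := by
  have h1 : ∀ v, fderiv ℝ (fun x => φ x • e) x v = fderiv ℝ φ x v • e := fun v => by
    rw [fderiv_smul_const (hφ x)]; rfl
  conv_rhs => rw [← (basisFun (Fin n) ℝ).sum_repr e]
  simp only [vdiv, h1, map_sum, map_smul]
  refine sum_congr rfl fun i _ => ?_
  simp [mul_comm]

lemma isTest_coord {Φ : E n → E n} (h1 : ContDiff ℝ 1 Φ) (h2 : HasCompactSupport Φ)
    (h3 : tsupport Φ ⊆ Ω) (i : Fin n) : IsTest Ω fun x => Φ x i := by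
  have hsub : support (fun x => Φ x i) ⊆ support Φ := by
    intro x hx h0
    apply hx
    simp [h0]
  refine ⟨?_, h2.mono hsub, (closure_mono hsub).trans h3⟩
  exact (contDiff_euclidean.1 h1) i

lemma vdiv_eq_sum {Φ : E n → E n} (h1 : Differentiable ℝ Φ) (x : E n) :
    vdiv n Φ x = ∑ i, fderiv ℝ (fun x => Φ x i) x (EuclideanSpace.single i 1) := by
  refine sum_congr rfl fun i _ => ?_
  have : (fun x => Φ x i) = fun x => (proj i : E n →L[ℝ] ℝ) (Φ x) := rfl
  rw [this]
  have h := ((proj i : E n →L[ℝ] ℝ).hasFDerivAt.comp x (h1 x).hasFDerivAt).fderiv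
  rw [show (fun x => (proj i : E n →L[ℝ] ℝ) (Φ x)) =
    (proj i : E n →L[ℝ] ℝ) ∘ Φ from rfl, h]
  rfl

lemma inner_eq_sum (a b : E n) : ⟪a, b⟫ = ∑ i, a i * b i := by
  simp [PiLp.inner_apply, mul_comm]

lemma inner_single_one (i : Fin n) (v : E n) : ⟪EuclideanSpace.single i (1:ℝ), v⟫ = v i := by
  simp [inner_single_left]

lemma IsVariationPair.isPair (h : IsVariationPair n f Ω μ σ) : IsPair f Ω μ σ := by
  obtain ⟨h1, h2, h3, h4, h5⟩ := h
  refine ⟨h1, h2, h3, h4, fun φ hφ e => ?_⟩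
  have hsub : support (fun x => φ x • e) ⊆ support φ := by
    intro x hx h0
    exact hx (by simp [h0])
  have := h5 (fun x => φ x • e) (hφ.1.smul contDiff_const) (hφ.2.mono hsub)
    ((closure_mono hsub).trans hφ.3)
  simp only [vdiv_smul_const hφ.differentiable, inner_smul_left] at this
  rw [setIntegral_eq_integral_of_test (fun x hx => hφ.fderiv_eq_zero hx e)] at this
  simpa using this

lemma IsPair.integrable_mul_inner (h : IsPair f Ω μ σ) (hφ : Continuous φ)
    (hb : ∃ C, ∀ x, |φ x| ≤ C) (e : E n) : Integrable (fun x => φ x * ⟪e, σ x⟫) μ := by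
  obtain ⟨C, hC⟩ := hb
  have := h.finite
  refine Integrable.of_bound (C := C * ‖e‖) ?_ ?_
  · exact hφ.aestronglyMeasurable.mul (aestronglyMeasurable_const.inner h.aesm)
  · filter_upwards [h.norm_eq] with x hx
    rw [norm_mul]
    refine mul_le_mul (hC x) ?_ (norm_nonneg _) ((abs_nonneg _).trans (hC x))
    simpa [hx] using norm_inner_le_norm (𝕜 := ℝ) e (σ x)

lemma IsPair.isVariationPair (hf : LocInt f Ω) (h : IsPair f Ω μ σ) :
    IsVariationPair n f Ω μ σ := by
  refine ⟨h.1, h.2, h.3, h.4, fun Φ h1 h2 h3 => ?_⟩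
  have hd : Differentiable ℝ Φ := h1.differentiable (by simp)
  have ht := isTest_coord h1 h2 h3
  have hz : ∀ x ∉ Ω, vdiv n Φ x = 0 := fun x hx => by
    rw [vdiv_eq_sum hd]
    exact Finset.sum_eq_zero fun i _ => (ht i).fderiv_eq_zero hx _
  rw [setIntegral_eq_integral_of_test hz]
  simp only [vdiv_eq_sum hd, mul_sum]
  rw [integral_finsetSum _ fun i _ => (ht i).integrable_mul_fderiv hf _]
  simp only [h.integral_eq _ (ht _), inner_single_one]
  rw [Finset.sum_neg_distrib, ← integral_finsetSum]
  · simp [inner_eq_sum]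
  · intro i _
    obtain ⟨C, _, hC⟩ := (ht i).exists_bound
    have := h.integrable_mul_inner (ht i).continuous ⟨C, hC⟩ (EuclideanSpace.single i 1)
    simpa only [inner_single_one] using this

lemma exists_test_one_of_isCompact (hK : IsCompact K) (hU : IsOpen U) (hKU : K ⊆ U) :
    ∃ g : E n → ℝ, IsTest U g ∧ (∀ x, 0 ≤ g x) ∧ (∀ x, g x ≤ 1) ∧
      ∀ᶠ x in 𝓝ˢ K, g x = 1 := by
  obtain ⟨L, hL, hKL, hLU⟩ := exists_compact_between hK hU hKU
  obtain ⟨f, h1, h0, h01⟩ := exists_contMDiffMap_one_nhds_of_subset_interior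
    (modelWithCornersSelf ℝ (E n)) (n := 1) hK.isClosed hKL
  have hs : support f ⊆ L := fun x hx => by
    by_contra hxL
    exact hx (h0 x hxL)
  have ht : tsupport f ⊆ L := closure_minimal hs hL.isClosed
  refine ⟨f, ⟨f.contMDiff.contDiff, ?_, ht.trans hLU⟩, fun x => (h01 x).1,
    fun x => (h01 x).2, h1⟩
  exact HasCompactSupport.of_support_subset_isCompact hL hs

/-- The integral of the positive part of a function is controlled by its integrals against
test functions with values in `[0, 1]`. -/
lemma lintegral_ofReal_le_of_forall_test {m : Measure (E n)} (hA : IsOpen A) {s : E n → ℝ}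
    (hs : LocallyIntegrableOn s A m) {M : ℝ≥0∞}
    (h : ∀ g, IsTest A g → (∀ x, 0 ≤ g x) → (∀ x, g x ≤ 1) → ofReal (∫ x, g x * s x ∂m) ≤ M) :
    ∫⁻ x in A, ofReal (s x) ∂m ≤ M := by
  have key : ∀ L ⊆ A, IsCompact L → ∫⁻ x in interior L, ofReal (s x) ∂m ≤ M := by
    intro L hLA hL
    have hsL : IntegrableOn s L m := hs.integrableOn_compact_subset hLA hL
    have hsI : IntegrableOn s (interior L) m := hsL.mono_set interior_subset
    set t := hsI.1.mk s with ht
    have htm : StronglyMeasurable t := hsI.1.stronglyMeasurable_mk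
    have hst : s =ᵐ[m.restrict (interior L)] t := hsI.1.ae_eq_mk
    set P : Set (E n) := interior L ∩ {x | 0 < t x} with hP
    have hPm : MeasurableSet P :=
      isOpen_interior.measurableSet.inter (measurableSet_lt measurable_const htm.measurable)
    set ρ : Measure (E n) := (m.restrict (interior L)).withDensity (fun x => ‖s x‖ₑ) with hρ
    have hρf : IsFiniteMeasure ρ := isFiniteMeasure_withDensity hsI.2.ne
    have e1 : ∫⁻ x in interior L, ofReal (s x) ∂m = ofReal (∫ x in P, s x ∂m) := by
      have hsP : s =ᵐ[m.restrict P] t := ae_mono (Measure.restrict_mono inter_subset_left le_rfl) hst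
      rw [setIntegral_congr_ae₀ (g := t) hPm.nullMeasurableSet
        ((ae_restrict_iff' hPm).1 hsP), ofReal_integral_eq_lintegral_ofReal,
        lintegral_congr_ae (g := fun x => ofReal (t x))
          (hst.mono fun x hx => by simp only [hx]), hP]
      · rw [Set.inter_comm, ← Measure.restrict_restrict
          (measurableSet_lt measurable_const htm.measurable),
          ← lintegral_indicator (measurableSet_lt measurable_const htm.measurable)]
        refine lintegral_congr fun x => ?_
        by_cases hx : 0 < t x
        · simp [indicator, hx]
        · simp [indicator, hx, ofReal_of_nonpos (not_lt.1 hx)]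
      · exact (hsI.mono_set inter_subset_left).congr hsP
      · exact (ae_restrict_iff' hPm).2 (.of_forall fun x hx => hx.2.le)
    rw [e1]
    refine ENNReal.le_of_forall_pos_le_add fun ε hε _ => ?_
    have hε2 : (ofReal (ε / 2)) ≠ 0 := by simpa using hε
    obtain ⟨K, hKP, hK, hKε⟩ := hPm.exists_isCompact_sdiff_lt (measure_ne_top ρ P) hε2
    obtain ⟨U, hKU, hU, hUε'⟩ := hK.exists_isOpen_lt_add (μ := ρ) hε2
    have hUε : ρ (U \ K) < ofReal (ε / 2) := by
      have := measure_sdiff hKU hK.measurableSet.nullMeasurableSet (measure_ne_top ρ K)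
      rw [this]
      exact ENNReal.sub_lt_of_lt_add (measure_mono hKU) (by rwa [add_comm])
    have hbd : ∀ B, MeasurableSet B → ρ B < ofReal (ε / 2) → B ⊆ interior L →
        ∫ x in B, |s x| ∂m ≤ ε / 2 := by
      intro B hB hBε hBL
      rw [hρ, withDensity_apply _ hB, Measure.restrict_restrict hB,
        Set.inter_eq_left.2 hBL] at hBε
      have h3 := integral_norm_eq_lintegral_enorm (hsI.mono_set hBL).1
      simp only [norm_eq_abs] at h3
      rw [h3]
      exact ENNReal.toReal_le_of_le_ofReal (by positivity) hBε.le
    obtain ⟨g, hg, hg0, hg1, hgK⟩ := exists_test_one_of_isCompact hK (hU.inter isOpen_interior)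
      (subset_inter hKU (hKP.trans inter_subset_left))
    have hgK' : ∀ x ∈ K, g x = 1 := fun x hx => hgK.self_of_nhdsSet x hx
    have hgA : IsTest A g := hg.mono (inter_subset_right.trans (interior_subset.trans hLA))
    have hgs := hgA.integrable_mul hs
    have i1 : ∫ x, g x * s x ∂m = ∫ x in K, s x ∂m + ∫ x in (U ∩ interior L) \ K, g x * s x ∂m := by
      have hm : MeasurableSet ((U ∩ interior L) \ K) :=
        (hU.measurableSet.inter isOpen_interior.measurableSet).diff hK.measurableSet
      rw [← setIntegral_congr_fun (f := fun x => g x * s x) hK.measurableSet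
        (fun x hx => by simp [hgK' x hx]),
        ← setIntegral_union disjoint_sdiff_self_right hm, Set.union_sdiff_self,
        setIntegral_eq_integral_of_forall_compl_eq_zero]
      · intro x hx
        rw [hg.eq_zero (fun hx' => hx (Or.inr hx')), zero_mul]
      · simpa only [mul_comm] using hgs.integrableOn
      · simpa only [mul_comm] using hgs.integrableOn
    have i2 : ∫ x in P, s x ∂m = ∫ x in K, s x ∂m + ∫ x in P \ K, s x ∂m := by
      have hKint : IntegrableOn s P m := hsI.mono_set inter_subset_left
      rw [← setIntegral_union disjoint_sdiff_self_right (hPm.diff hK.measurableSet)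
        (hKint.mono_set hKP) (hKint.mono_set sdiff_subset), Set.union_sdiff_self,
        Set.union_eq_self_of_subset_left hKP]
    have i3 : ∫ x in P \ K, s x ∂m ≤ ε / 2 := by
      refine le_trans ?_ (hbd (P \ K) (hPm.diff hK.measurableSet) hKε
        (sdiff_subset.trans inter_subset_left))
      have hI : IntegrableOn s (P \ K) m :=
        hsI.mono_set (sdiff_subset.trans inter_subset_left)
      exact integral_mono hI hI.norm fun x => le_abs_self _
    have i4 : -(ε / 2) ≤ ∫ x in (U ∩ interior L) \ K, g x * s x ∂m := by
      have hsub : (U ∩ interior L) \ K ⊆ interior L := fun x hx => hx.1.2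
      have hI : IntegrableOn s ((U ∩ interior L) \ K) m := hsI.mono_set hsub
      have := hbd ((U ∩ interior L) \ K)
        ((hU.measurableSet.inter isOpen_interior.measurableSet).diff hK.measurableSet)
        ((measure_mono (Set.sdiff_subset_sdiff_left inter_subset_left)).trans_lt hUε) hsub
      have h4 : -∫ x in (U ∩ interior L) \ K, |s x| ∂m ≤
          ∫ x in (U ∩ interior L) \ K, g x * s x ∂m := by
        rw [← integral_neg]
        refine integral_mono hI.norm.neg
          (by simpa only [mul_comm, IntegrableOn] using hgs.integrableOn) ?_
        intro x
        have h5 : |g x * s x| ≤ |s x| := by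
          rw [abs_mul, abs_of_nonneg (hg0 x)]
          exact mul_le_of_le_one_left (abs_nonneg _) (hg1 x)
        simpa using (neg_le_neg h5).trans (neg_abs_le _)
      linarith
    calc ofReal (∫ x in P, s x ∂m)
        ≤ ofReal ((∫ x, g x * s x ∂m) + ε) :=
          ofReal_le_ofReal (by rw [i1, i2]; linarith)
      _ ≤ ofReal (∫ x, g x * s x ∂m) + ofReal ε := ofReal_add_le
      _ ≤ M + ε := by
          rw [ENNReal.ofReal_coe_nnreal]
          gcongr
          exact h g hgA hg0 hg1
  obtain ⟨L, hL⟩ : ∃ L : ℕ → Set (E n), (∀ k, IsCompact (L k)) ∧ Monotone L ∧ (∀ k, L k ⊆ A) ∧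
      ⋃ k, interior (L k) = A := by
    have := hA.locallyCompactSpace
    let C := CompactExhaustion.choice A
    refine ⟨fun k => Subtype.val '' C k, fun k => (C.isCompact k).image continuous_subtype_val,
      fun i j hij => Set.image_mono (C.subset hij), fun k => Subtype.coe_image_subset _ _, ?_⟩
    refine Subset.antisymm (Set.iUnion_subset fun k =>
      interior_subset.trans (Subtype.coe_image_subset _ _)) fun x hx => ?_
    obtain ⟨k, hk⟩ := C.exists_mem ⟨x, hx⟩
    refine mem_iUnion.2 ⟨k + 1, ?_⟩
    have h2 : Subtype.val '' interior (C (k + 1)) ⊆ interior (Subtype.val '' C (k + 1)) :=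
      interior_maximal (Set.image_mono interior_subset)
        (hA.isOpenMap_subtype_val _ isOpen_interior)
    exact h2 ⟨⟨x, hx⟩, C.subset_interior_succ k hk, rfl⟩
  obtain ⟨hLc, hLm, hLA, hLU⟩ := hL
  rw [← hLU, setLIntegral_iUnion_of_directed]
  · exact iSup_le fun k => key _ (hLA k) (hLc k)
  · exact Monotone.directed_le fun i j hij => interior_mono (hLm hij)

lemma hasDerivAt_integral_translate {g : E n → ℝ} (hv : Integrable v) (hg : IsTest Ω g)
    (h : E n) (θ : ℝ) : HasDerivAt (fun θ : ℝ => ∫ x, v x * g (x - θ • h))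
      (-∫ x, v x * fderiv ℝ g (x - θ • h) h) θ := by
  obtain ⟨C, hC⟩ := (hg.hasCompactSupport_fderiv h).exists_bound_of_continuous
    (hg.continuous_fderiv h)
  obtain ⟨C', -, hC'⟩ := hg.exists_bound
  have hc : ∀ θ : ℝ, Continuous fun x : E n => g (x - θ • h) := fun θ =>
    hg.continuous.comp (continuous_id.sub continuous_const)
  have := hasDerivAt_integral_of_dominated_loc_of_deriv_le (μ := (volume : Measure (E n)))
    (F := fun (θ : ℝ) (x : E n) => v x * g (x - θ • h))
    (F' := fun (θ : ℝ) (x : E n) => v x * -(fderiv ℝ g (x - θ • h) h)) (x₀ := θ)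
    (s := univ) (bound := fun x => |v x| * C) univ_mem
    (.of_forall fun θ => hv.1.mul (hc θ).aestronglyMeasurable)
    (hv.mul_bdd (c := C') (hc θ).aestronglyMeasurable (.of_forall fun x => hC' _))
    (hv.1.mul (((hg.continuous_fderiv h).comp
      (continuous_id.sub continuous_const)).neg).aestronglyMeasurable)
    (.of_forall fun x θ _ => by
      rw [norm_mul, norm_neg]
      exact mul_le_mul_of_nonneg_left (hC _) (norm_nonneg _))
    (hv.abs.mul_const C) (.of_forall fun x θ _ => ?_)
  · have h2 := this.2
    simp only [mul_neg, integral_neg] at h2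
    exact h2
  · have h1 : HasDerivAt (fun θ : ℝ => x - θ • h) (-h) θ := by
      simpa using ((hasDerivAt_id θ).smul_const h).const_sub x
    have h2 := (hg.differentiable (x - θ • h)).hasFDerivAt.comp_hasDerivAt θ h1
    simpa using h2.const_mul (v x)

lemma fderiv_comp_sub_apply (g : E n → ℝ) (w x h : E n) :
    fderiv ℝ (fun y => g (y - w)) x h = fderiv ℝ g (x - w) h := by
  rw [fderiv_comp_sub]

lemma IsTest.comp_sub (h : IsTest Ω φ) (v : E n) (hU : ∀ x ∈ Ω, x + v ∈ U) :
    IsTest U fun x => φ (x - v) := by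
  simp only [sub_eq_add_neg]
  refine h.comp_add (-v) fun x hx => ?_
  simpa using hU _ hx

/-- One-sided directional variation of `u` in the direction `h`. -/
def pvar (u : E n → ℝ) (U : Set (E n)) (h : E n) : ℝ≥0∞ :=
  ⨆ (φ : E n → ℝ) (_ : IsTest U φ) (_ : ∀ x, 0 ≤ φ x) (_ : ∀ x, φ x ≤ 1),
    ofReal (-∫ x, u x * fderiv ℝ φ x h)

lemma le_pvar (h : E n) (hφ : IsTest U φ) (h0 : ∀ x, 0 ≤ φ x) (h1 : ∀ x, φ x ≤ 1) :
    ofReal (-∫ x, u x * fderiv ℝ φ x h) ≤ pvar u U h :=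
  le_iSup_of_le φ <| le_iSup_of_le hφ <| le_iSup_of_le h0 <| le_iSup_of_le h1 le_rfl

lemma locallyIntegrableOn_comp_add (hA : IsOpen A) (hu : LocInt u U) {h : E n}
    (hAU : ∀ x ∈ A, x + h ∈ U) : LocInt (fun x => u (x + h)) A := by
  refine (locallyIntegrableOn_iff hA.isLocallyClosed).2 ?_
  intro K hKA hK
  have hK' : IsCompact ((fun x => x + h) '' K) := hK.image (continuous_id.add continuous_const)
  have h1 : IntegrableOn u ((fun x => x + h) '' K) volume := by
    refine hu.integrableOn_compact_subset ?_ hK'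
    rintro _ ⟨x, hx, rfl⟩
    exact hAU x (hKA hx)
  have hmp : MeasurePreserving (fun x : E n => x + h) volume volume :=
    measurePreserving_add_right volume h
  have := (hmp.integrableOn_image (Homeomorph.addRight h).measurableEmbedding (f := u) (s := K)).1 h1
  exact this

/-- Compact sets swept by translating a compact set. -/
lemma isCompact_sweep (hK : IsCompact K) (h : E n) (a b : ℝ) :
    IsCompact ((fun p : E n × ℝ => p.1 + p.2 • h) '' (K ×ˢ Icc a b)) :=
  (hK.prod isCompact_Icc).image (continuous_fst.add (continuous_snd.smul continuous_const))

lemma exists_hasDerivAt_translate (hu : LocInt u U) {g : E n → ℝ} (hg : IsTest A g) (h : E n)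
    {a b : ℝ} (hab : ∀ x ∈ tsupport g, ∀ θ ∈ Icc a b, x + θ • h ∈ U) :
    ∃ k : ℝ → ℝ, (∀ θ ∈ Icc a b, k θ = ∫ x, u x * g (x - θ • h)) ∧
      (∀ θ ∈ Icc a b, k θ = ∫ x, u (x + θ • h) * g x) ∧
      (∀ θ, DifferentiableAt ℝ k θ) ∧
      ∀ θ ∈ Icc a b, deriv k θ = -∫ x, u x * fderiv ℝ g (x - θ • h) h := by
  set K := (fun p : E n × ℝ => p.1 + p.2 • h) '' (tsupport g ×ˢ Icc a b) with hKdef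
  have hK : IsCompact K := isCompact_sweep hg.2 h a b
  have hKU : K ⊆ U := by
    rintro _ ⟨⟨x, θ⟩, ⟨hx, hθ⟩, rfl⟩
    exact hab x hx θ hθ
  set v := K.indicator u with hv
  have hvi : Integrable v :=
    (integrable_indicator_iff hK.measurableSet).2 (hu.integrableOn_compact_subset hKU hK)
  have hmem : ∀ θ ∈ Icc a b, ∀ x, x ∉ K → x - θ • h ∉ tsupport g := by
    intro θ hθ x hx hx'
    exact hx ⟨(x - θ • h, θ), ⟨hx', hθ⟩, by simp⟩
  have heq : ∀ θ ∈ Icc a b, ∫ x, v x * g (x - θ • h) = ∫ x, u x * g (x - θ • h) := by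
    intro θ hθ
    refine integral_congr_ae (.of_forall fun x => ?_)
    by_cases hx : x ∈ K
    · simp [hv, hx]
    · simp [image_eq_zero_of_notMem_tsupport (hmem θ hθ x hx)]
  refine ⟨fun θ => ∫ x, v x * g (x - θ • h), heq, fun θ hθ => ?_,
    fun θ => (hasDerivAt_integral_translate hvi hg h θ).differentiableAt, fun θ hθ => ?_⟩
  · simp only
    rw [heq θ hθ, ← integral_add_right_eq_self (μ := (volume : Measure (E n)))
      (fun x => u x * g (x - θ • h)) (θ • h)]
    simp
  · rw [(hasDerivAt_integral_translate hvi hg h θ).deriv]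
    congr 1
    refine integral_congr_ae (.of_forall fun x => ?_)
    by_cases hx : x ∈ K
    · simp [hv, hx]
    · have := image_eq_zero_of_notMem_tsupport (f := fun y => fderiv ℝ g y h)
        (fun hx' => hmem θ hθ x hx (IsTest.tsupport_fderiv_subset h hx'))
      simp only at this ⊢
      rw [this]; simp

/-- Translation estimate: differences of `u` are controlled by the directional variation. -/
lemma lintegral_translate_le_pvar (hA : IsOpen A) (hu : LocInt u U) {h : E n}
    (hAU : ∀ x ∈ A, ∀ θ ∈ Icc (0:ℝ) 1, x + θ • h ∈ U) :
    ∫⁻ x in A, ofReal (u (x + h) - u x) ≤ pvar u U h := by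
  have h0U : A ⊆ U := fun x hx => by simpa using hAU x hx 0 (by simp)
  have h1U : ∀ x ∈ A, x + h ∈ U := fun x hx => by simpa using hAU x hx 1 (by simp)
  have hl1 := locallyIntegrableOn_comp_add hA hu h1U
  refine lintegral_ofReal_le_of_forall_test hA (hl1.sub (hu.mono_set h0U)) fun g hg hg0 hg1 => ?_
  by_cases htop : pvar u U h = ⊤
  · simp [htop]
  obtain ⟨k, hk1, hk2, hkd, hk'⟩ := exists_hasDerivAt_translate hu hg h (a := 0) (b := 1)
    fun x hx θ hθ => hAU x (hg.3 hx) θ hθ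
  have hd : ∀ θ ∈ interior (Icc (0:ℝ) 1), deriv k θ ≤ (pvar u U h).toReal := by
    intro θ hθ
    have hθ' := interior_subset hθ
    rw [hk' θ hθ', ← ofReal_le_iff_le_toReal htop]
    have := le_pvar (u := u) h (hg.comp_sub (θ • h) fun x hx => hAU x hx θ hθ')
      (fun x => hg0 _) (fun x => hg1 _)
    simpa only [fderiv_comp_sub_apply] using this
  have hmv := (convex_Icc (0:ℝ) 1).image_sub_le_mul_sub_of_deriv_le
    (fun θ _ => (hkd θ).continuousAt.continuousWithinAt)
    (fun θ _ => (hkd θ).differentiableWithinAt) hd 0 (by simp) 1 (by simp) zero_le_one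
  rw [hk2 1 (by simp), hk2 0 (by simp)] at hmv
  rw [ofReal_le_iff_le_toReal htop]
  have e1 : ∫ x, g x * (u (x + h) - u x) =
      (∫ x, u (x + (1:ℝ) • h) * g x) - ∫ x, u (x + (0:ℝ) • h) * g x := by
    rw [← integral_sub]
    · refine integral_congr_ae (.of_forall fun x => ?_)
      simp only [one_smul, zero_smul, add_zero]; ring
    · simpa using hg.integrable_mul hl1
    · simpa using hg.integrable_mul (hu.mono_set h0U)
  change ∫ x, g x * (u (x + h) - u x) ≤ _
  linarith

lemma ofReal_integral_le_lintegral_ofReal {α : Type*} [MeasurableSpace α] {m : Measure α}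
    (f : α → ℝ) : ofReal (∫ x, f x ∂m) ≤ ∫⁻ x, ofReal (f x) ∂m := by
  by_cases hf : Integrable f m
  · rw [integral_eq_lintegral_pos_part_sub_lintegral_neg_part hf]
    refine (ofReal_le_ofReal (sub_le_self _ ENNReal.toReal_nonneg)).trans ?_
    exact ENNReal.ofReal_toReal_le
  · simp [integral_undef hf]

lemma ofReal_integral_test_mul_le {m : Measure (E n)} (hU : MeasurableSet U)
    (hφ : ∀ x ∉ U, φ x = 0) (h0 : ∀ x, 0 ≤ φ x) (h1 : ∀ x, φ x ≤ 1) (w : E n → ℝ) :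
    ofReal (∫ x, φ x * w x ∂m) ≤ ∫⁻ x in U, ofReal (w x) ∂m := by
  refine (ofReal_integral_le_lintegral_ofReal _).trans ?_
  rw [← lintegral_indicator hU]
  refine lintegral_mono fun x => ?_
  by_cases hx : x ∈ U
  · rw [indicator_of_mem hx, ofReal_mul (h0 x)]
    exact mul_le_of_le_one_left' (by simpa using h1 x)
  · simp [hφ x hx]

lemma IsPair.pvar_le (hp : IsPair f Ω μ σ) (hU : IsOpen U) (hUΩ : U ⊆ Ω) (h : E n) :
    pvar f U h ≤ ∫⁻ x in U, ofReal ⟪h, σ x⟫ ∂μ := by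
  refine iSup_le fun φ => iSup_le fun hφ => iSup_le fun h0 => iSup_le fun h1 => ?_
  rw [hp.integral_eq φ (hφ.mono hUΩ) h, neg_neg]
  exact ofReal_integral_test_mul_le hU.measurableSet (fun x hx => hφ.eq_zero hx) h0 h1 _

lemma IsTest.exists_margin (hA : IsOpen A) (hφ : IsTest A φ) :
    ∃ B δ, IsOpen B ∧ 0 < δ ∧ IsTest B φ ∧ B ⊆ A ∧ ∀ x ∈ B, ∀ y, dist y x < δ → y ∈ A := by
  obtain ⟨δ, hδ, hs⟩ := hφ.2.isCompact.exists_thickening_subset_open hA hφ.3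
  refine ⟨thickening (δ / 2) (tsupport φ), δ / 2, isOpen_thickening, by positivity,
    ⟨hφ.1, hφ.2, self_subset_thickening (by positivity) _⟩,
    (thickening_mono (by linarith) _).trans hs, fun x hx y hy => hs ?_⟩
  rw [mem_thickening_iff] at hx ⊢
  obtain ⟨z, hz, hxz⟩ := hx
  exact ⟨z, hz, by linarith [dist_triangle y x z]⟩

/-- The directional variation is at most the lower limit of the difference quotients. -/
lemma pvar_le_of_frequently (hA : IsOpen A) (hu : LocInt u A) (h : E n) {M : ℝ≥0∞}
    (hM : ∃ᶠ t in 𝓝[>] (0:ℝ), ∫⁻ x in A, ofReal (u (x + t • h) - u x) ≤ ofReal t * M) :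
    pvar u A h ≤ M := by
  refine iSup_le fun φ => iSup_le fun hφ => iSup_le fun h0 => iSup_le fun h1 => ?_
  by_cases htop : M = ⊤
  · simp [htop]
  obtain ⟨B, δ, hB, hδ, hφB, hBA, hBδ⟩ := hφ.exists_margin hA
  set b : ℝ := δ / (2 * (‖h‖ + 1)) with hb
  have hb0 : 0 < b := by positivity
  have hmem : ∀ x ∈ B, ∀ θ ∈ Icc 0 b, x + θ • h ∈ A := by
    intro x hx θ hθ
    refine hBδ x hx _ ?_
    rw [dist_eq_norm, add_sub_cancel_left, norm_smul, norm_of_nonneg hθ.1]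
    calc θ * ‖h‖ ≤ b * (‖h‖ + 1) := by
          exact mul_le_mul hθ.2 (by linarith) (norm_nonneg _) hb0.le
      _ = δ / 2 := by rw [hb]; field_simp
      _ < δ := by linarith
  obtain ⟨k, -, hk2, hkd, hk'⟩ := exists_hasDerivAt_translate hu hφB h (a := 0) (b := b)
    fun x hx => hmem x (hφB.3 hx)
  rw [ofReal_le_iff_le_toReal htop]
  have h00 : (0:ℝ) ∈ Icc 0 b := ⟨le_rfl, hb0.le⟩
  have hkz := hk' 0 h00
  simp only [zero_smul, sub_zero] at hkz
  rw [← hkz]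
  have hlim := (hasDerivAt_iff_tendsto_slope.1 (hkd 0).hasDerivAt).mono_left
    (nhdsWithin_mono (0:ℝ) (show Ioi 0 ⊆ {0}ᶜ from fun x hx => ne_of_gt hx))
  refine le_of_tendsto_of_frequently hlim ?_
  have hev : ∀ᶠ t in 𝓝[>] (0:ℝ), t ∈ Ioc 0 b := Ioc_mem_nhdsGT hb0
  refine (hM.and_eventually hev).mono ?_
  rintro t ⟨ht, ht0, htb⟩
  have hti : t ∈ Icc 0 b := ⟨ht0.le, htb⟩
  rw [slope_def_field, sub_zero, div_le_iff₀ ht0, hk2 t hti, hk2 0 h00]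
  have hl1 := locallyIntegrableOn_comp_add hB hu (h := t • h) fun x hx => hmem x hx t hti
  have e1 : (∫ x, u (x + t • h) * φ x) - ∫ x, u (x + (0:ℝ) • h) * φ x =
      ∫ x, φ x * (u (x + t • h) - u x) := by
    rw [← integral_sub]
    · refine integral_congr_ae (.of_forall fun x => ?_)
      simp only [zero_smul, add_zero]; ring
    · simpa using hφB.integrable_mul hl1
    · simpa using hφB.integrable_mul (hu.mono_set hBA)
  rw [e1, mul_comm, ← toReal_ofReal ht0.le, ← toReal_mul,
    ← ofReal_le_iff_le_toReal (by finiteness), toReal_ofReal ht0.le]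
  exact (ofReal_integral_test_mul_le hA.measurableSet (fun x hx => hφ.eq_zero hx) h0 h1 _).trans ht

lemma pvar_neg_fun (u : E n → ℝ) (U : Set (E n)) (h : E n) :
    pvar (fun x => -u x) U h = pvar u U (-h) := by
  simp [pvar]

lemma ofReal_abs_eq (a : ℝ) : ofReal |a| = ofReal a + ofReal (-a) := by
  rcases le_total 0 a with h | h
  · simp [abs_of_nonneg h, ofReal_of_nonpos (neg_nonpos.2 h)]
  · simp [abs_of_nonpos h, ofReal_of_nonpos h]

/-- Two-sided directional variation. -/
def tvar (u : E n → ℝ) (U : Set (E n)) (h : E n) : ℝ≥0∞ := pvar u U h + pvar u U (-h)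

lemma lintegral_abs_translate_le_tvar (hA : IsOpen A) (hu : LocInt u U) {h : E n}
    (hAU : ∀ x ∈ A, ∀ θ ∈ Icc (0:ℝ) 1, x + θ • h ∈ U) :
    ∫⁻ x in A, ofReal |u (x + h) - u x| ≤ tvar u U h := by
  have h0U : A ⊆ U := fun x hx => by simpa using hAU x hx 0 (by simp)
  have h1U : ∀ x ∈ A, x + h ∈ U := fun x hx => by simpa using hAU x hx 1 (by simp)
  have hm : AEMeasurable (fun x => ofReal (u (x + h) - u x)) (volume.restrict A) :=
    (((locallyIntegrableOn_comp_add hA hu h1U).sub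
      (hu.mono_set h0U)).aestronglyMeasurable.aemeasurable).ennreal_ofReal
  simp only [ofReal_abs_eq]
  rw [lintegral_add_left' hm, tvar, ← pvar_neg_fun]
  refine add_le_add (lintegral_translate_le_pvar hA hu hAU) ?_
  refine le_trans (le_of_eq ?_) (lintegral_translate_le_pvar hA hu.neg hAU)
  refine lintegral_congr fun x => ?_
  congr 1
  simp; ring

lemma IsPair.tvar_le (hp : IsPair f Ω μ σ) (hU : IsOpen U) (hUΩ : U ⊆ Ω) (h : E n) :
    tvar f U h ≤ ∫⁻ x in U, ofReal |⟪h, σ x⟫| ∂μ := by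
  have hm : AEMeasurable (fun x => ofReal ⟪h, σ x⟫) (μ.restrict U) :=
    ((aestronglyMeasurable_const.inner hp.aesm).aemeasurable.ennreal_ofReal).restrict
  simp only [ofReal_abs_eq]
  rw [lintegral_add_left' hm]
  refine add_le_add (hp.pvar_le hU hUΩ h) ((hp.pvar_le hU hUΩ (-h)).trans (le_of_eq ?_))
  simp only [inner_neg_left]

lemma IsPair.tvar_le_mul (hp : IsPair f Ω μ σ) (hU : IsOpen U) (hUΩ : U ⊆ Ω) (h : E n) :
    tvar f U h ≤ ofReal ‖h‖ * μ U := by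
  refine (hp.tvar_le hU hUΩ h).trans ?_
  rw [← setLIntegral_const]
  refine lintegral_mono_ae (ae_restrict_of_ae ?_)
  filter_upwards [hp.norm_eq] with x hx
  refine ofReal_le_ofReal ?_
  simpa [hx] using abs_real_inner_le_norm h (σ x)

lemma locallyIntegrableOn_of_abs_le {m : Measure (E n)} {s t : E n → ℝ}
    (hs : LocallyIntegrableOn s A m) (ht : AEStronglyMeasurable t (m.restrict A))
    (h : ∀ x, |t x| ≤ |s x|) : LocallyIntegrableOn t A m := by
  intro x hx
  obtain ⟨U, hU, hsU⟩ := hs x hx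
  refine ⟨U ∩ A, inter_mem hU self_mem_nhdsWithin, ?_⟩
  exact Integrable.mono (hsU.mono_set inter_subset_left)
    (ht.mono_measure (Measure.restrict_mono inter_subset_right le_rfl))
    (.of_forall h)

lemma locallyIntegrableOn_lipschitz_comp {m : Measure (E n)} {s : E n → ℝ}
    (hs : LocallyIntegrableOn s A m) {F : ℝ → ℝ} (hF : Continuous F) (h : ∀ x, |F x| ≤ |x|) :
    LocallyIntegrableOn (fun x => F (s x)) A m :=
  locallyIntegrableOn_of_abs_le hs (hF.comp_aestronglyMeasurable hs.aestronglyMeasurable)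
    fun _ => h _

/-- Vague compactness of bounded families of measures along ultrafilters. -/
lemma exists_vague_limit {ι : Type*} (l : Ultrafilter ι) (ρ : ι → Measure (E n)) {C : ℝ≥0∞}
    (hC : C ≠ ⊤) (hρ : ∀ i, ρ i univ ≤ C) :
    ∃ lam : Measure (E n), IsFiniteMeasure lam ∧ ∀ g : E n → ℝ, Continuous g →
      HasCompactSupport g → Tendsto (fun i => ∫ x, g x ∂ρ i) l (𝓝 (∫ x, g x ∂lam)) := by
  have hfin : ∀ i, IsFiniteMeasure (ρ i) := fun i => ⟨(hρ i).trans_lt hC.lt_top⟩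
  have hint : ∀ (g : CompactlySupportedContinuousMap (E n) ℝ) i, Integrable g (ρ i) :=
    fun g i => g.continuous.integrable_of_hasCompactSupport g.hasCompactSupport
  have hbd : ∀ (g : CompactlySupportedContinuousMap (E n) ℝ) (B : ℝ), (∀ x, |g x| ≤ B) → ∀ i,
      |∫ x, g x ∂ρ i| ≤ B * C.toReal := by
    intro g B hB i
    have hB0 : 0 ≤ B := (abs_nonneg _).trans (hB 0)
    refine (norm_integral_le_of_norm_le_const (μ := ρ i) (f := fun x => g x)
      (.of_forall hB)).trans ?_
    exact mul_le_mul_of_nonneg_left (toReal_mono hC (hρ i)) hB0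
  have hlim : ∀ g : CompactlySupportedContinuousMap (E n) ℝ,
      ∃ a, Tendsto (fun i => ∫ x, g x ∂ρ i) l (𝓝 a) := by
    intro g
    obtain ⟨B, hB⟩ := g.hasCompactSupport.exists_bound_of_continuous g.continuous
    have := isCompact_iff_ultrafilter_le_nhds'.1
      (isCompact_Icc (a := -(B * C.toReal)) (b := B * C.toReal))
      (l.map fun i => ∫ x, g x ∂ρ i)
      (Ultrafilter.mem_map.2 (univ_mem' fun i => abs_le.1 (hbd g B hB i)))
    obtain ⟨a, -, ha⟩ := this
    exact ⟨a, ha⟩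
  choose T hT using hlim
  let Λ : CompactlySupportedContinuousMap (E n) ℝ →ₚ[ℝ] ℝ := PositiveLinearMap.mk₀
    { toFun := T
      map_add' := fun g g' => by
        refine tendsto_nhds_unique (hT (g + g')) ?_
        refine ((hT g).add (hT g')).congr fun i => ?_
        rw [← integral_add (hint g i) (hint g' i)]; rfl
      map_smul' := fun c g => by
        refine tendsto_nhds_unique (hT (c • g)) ?_
        refine ((hT g).const_mul c).congr fun i => ?_
        rw [← integral_const_mul]; rfl }
    (fun g hg => ge_of_tendsto' (hT g) fun i => integral_nonneg hg)
  have hΛ : ∀ g, Λ g = T g := fun g => rfl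
  refine ⟨RealRMK.rieszMeasure Λ, ⟨?_⟩, fun g hg hgc => ?_⟩
  · have h1 : ∀ k : ℕ, RealRMK.rieszMeasure Λ (closedBall 0 k) ≤ C := by
      intro k
      obtain ⟨g, hg, hg0, hg1, hgK⟩ := exists_test_one_of_isCompact
        (isCompact_closedBall (0 : E n) k) isOpen_univ (Set.subset_univ _)
      let G : CompactlySupportedContinuousMap (E n) ℝ := ⟨⟨g, hg.continuous⟩, hg.2⟩
      refine (RealRMK.rieszMeasure_le_of_eq_one Λ (f := G) hg0 (isCompact_closedBall 0 _)
        fun x hx => hgK.self_of_nhdsSet x hx).trans ?_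
      rw [hΛ, ofReal_le_iff_le_toReal hC]
      refine le_of_tendsto' (hT G) fun i => ?_
      have := hbd G 1 (fun x => by
        change |g x| ≤ 1
        rw [abs_of_nonneg (hg0 x)]; exact hg1 x) i
      linarith [le_abs_self (∫ x, G x ∂ρ i)]
    have h2 : (⋃ k : ℕ, closedBall (0 : E n) k) = univ := iUnion_closedBall_nat 0
    rw [← h2, Monotone.measure_iUnion]
    · exact (iSup_le h1).trans_lt hC.lt_top
    · exact fun i j hij => closedBall_subset_closedBall (by exact_mod_cast hij)
  · let G : CompactlySupportedContinuousMap (E n) ℝ := ⟨⟨g, hg⟩, hgc⟩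
    have := RealRMK.integral_rieszMeasure Λ G
    have h3 : ∫ x, g x ∂(RealRMK.rieszMeasure Λ) = T G := this
    rw [h3]
    exact hT G

/-- Points whose distance to the complement of `Ω` exceeds `r`. -/
def innerSet (Ω : Set (E n)) (r : ℝ) : Set (E n) := {x | ofReal r < infEDist x Ωᶜ}

lemma isOpen_innerSet (Ω : Set (E n)) (r : ℝ) : IsOpen (innerSet Ω r) :=
  isOpen_lt continuous_const continuous_infEDist

lemma mem_of_mem_innerSet {y : E n} (hx : x ∈ innerSet Ω r) (hy : dist x y ≤ r) : y ∈ Ω := by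
  by_contra hyΩ
  have h1 : infEDist x Ωᶜ ≤ edist x y := infEDist_le_edist_of_mem hyΩ
  rw [edist_dist] at h1
  exact absurd (hx.trans_le h1) (not_lt.2 (ofReal_le_ofReal hy))

lemma pvar_smul (u : E n → ℝ) (U : Set (E n)) {t : ℝ} (ht : 0 < t) (h : E n) :
    pvar u U (t • h) = ofReal t * pvar u U h := by
  simp only [pvar, mul_iSup, map_smul, smul_eq_mul, ← ofReal_mul ht.le]
  refine iSup_congr fun φ => ?_
  have : -∫ x, u x * (t * fderiv ℝ φ x h) = t * -∫ x, u x * fderiv ℝ φ x h := by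
    rw [mul_neg, ← integral_const_mul]
    congr 2 with x
    ring
  rw [this]

/-- If the one-sided variations of `f` are finite, its directional derivative is represented by
a difference of finite measures. -/
lemma exists_measure_of_tvar_lt_top (hΩ : IsOpen Ω) (hf : LocInt f Ω) (e : E n)
    (h : tvar f Ω e ≠ ⊤) :
    ∃ m₁ m₂ : Measure (E n), IsFiniteMeasure m₁ ∧ IsFiniteMeasure m₂ ∧ ∀ φ, IsTest Ω φ →
      ∫ x, f x * fderiv ℝ φ x e = ∫ x, φ x ∂m₂ - ∫ x, φ x ∂m₁ := by
  set A : ℝ → Set (E n) := fun t => innerSet Ω (t * ‖e‖) with hA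
  have hAm : ∀ t, 0 < t → ∀ x ∈ A t, ∀ θ ∈ Icc (0:ℝ) 1, x + θ • t • e ∈ Ω := by
    intro t ht x hx θ hθ
    refine mem_of_mem_innerSet hx ?_
    rw [dist_eq_norm, sub_add_cancel_left, norm_neg, norm_smul, norm_smul,
      norm_of_nonneg hθ.1, norm_of_nonneg ht.le]
    exact mul_le_of_le_one_left (by positivity) hθ.2
  have hpos : ∀ u : E n → ℝ, LocInt u Ω → pvar u Ω e ≠ ⊤ →
      ∃ m : Measure (E n), IsFiniteMeasure m ∧ ∀ g : E n → ℝ, Continuous g → HasCompactSupport g →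
        Tendsto (fun t : ℝ => t⁻¹ * ∫ x in A t, g x * max (u (x + t • e) - u x) 0)
          (Ultrafilter.of (𝓝[>] (0:ℝ))) (𝓝 (∫ x, g x ∂m)) := by
    intro u hu hp
    set ρ : ℝ → Measure (E n) := fun t => if 0 < t then (volume.restrict (A t)).withDensity
      (fun x => ofReal t⁻¹ * ofReal (u (x + t • e) - u x)) else 0 with hρ
    have haem : ∀ t, 0 < t → AEMeasurable (fun x => u (x + t • e) - u x)
        (volume.restrict (A t)) := by
      intro t ht
      have h0U : A t ⊆ Ω := fun x hx => by simpa using hAm t ht x hx 0 (by simp)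
      have h1U : ∀ x ∈ A t, x + t • e ∈ Ω := fun x hx => by simpa using hAm t ht x hx 1 (by simp)
      exact ((locallyIntegrableOn_comp_add (isOpen_innerSet _ _) hu h1U).sub
        (hu.mono_set h0U)).aestronglyMeasurable.aemeasurable
    have hle : ∀ t, ρ t univ ≤ pvar u Ω e := by
      intro t
      by_cases ht : 0 < t
      · simp only [hρ, if_pos ht]
        rw [withDensity_apply _ MeasurableSet.univ, Measure.restrict_univ,
          lintegral_const_mul'' _ (haem t ht).ennreal_ofReal]
        have := lintegral_translate_le_pvar (isOpen_innerSet _ _) hu (hAm t ht)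
        rw [pvar_smul u Ω ht] at this
        refine (mul_le_mul_right this _).trans ?_
        rw [← mul_assoc, ← ofReal_mul (by positivity), inv_mul_cancel₀ ht.ne']
        simp
      · simp [hρ, ht]
    obtain ⟨m, hm, hmg⟩ := exists_vague_limit (Ultrafilter.of (𝓝[>] (0:ℝ))) ρ hp hle
    refine ⟨m, hm, fun g hg hgc => (hmg g hg hgc).congr' ?_⟩
    have hev : ∀ᶠ t in (Ultrafilter.of (𝓝[>] (0:ℝ)) : Filter ℝ), 0 < t :=
      (Ultrafilter.of_le _) self_mem_nhdsWithin
    filter_upwards [hev] with t ht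
    simp only [hρ, if_pos ht]
    rw [integral_withDensity_eq_integral_toReal_smul₀
      ((haem t ht).ennreal_ofReal.const_mul _)
      (.of_forall fun x => by finiteness), ← integral_const_mul]
    refine integral_congr_ae (.of_forall fun x => ?_)
    simp only [toReal_mul, ENNReal.toReal_ofReal',
      max_eq_left (inv_nonneg.2 ht.le), smul_eq_mul]
    ring
  rw [tvar, add_ne_top, ← pvar_neg_fun] at h
  obtain ⟨m₁, hm₁, h₁⟩ := hpos f hf h.1
  obtain ⟨m₂, hm₂, h₂⟩ := hpos _ hf.neg h.2
  refine ⟨m₁, m₂, hm₁, hm₂, fun φ hφ => ?_⟩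
  have hd := (h₁ φ hφ.continuous hφ.2).sub (h₂ φ hφ.continuous hφ.2)
  obtain ⟨B, δ, hB, hδ, hφB, hBA, hBδ⟩ := hφ.exists_margin hΩ
  set b : ℝ := δ / (2 * (‖e‖ + 1)) with hb
  have hb0 : 0 < b := by positivity
  have hbe : ∀ t ∈ Icc 0 b, t * ‖e‖ < δ := by
    intro t ht
    calc t * ‖e‖ ≤ b * (‖e‖ + 1) := mul_le_mul ht.2 (by linarith) (norm_nonneg _) hb0.le
      _ = δ / 2 := by rw [hb]; field_simp
      _ < δ := by linarith
  have hmem : ∀ x ∈ B, ∀ θ ∈ Icc 0 b, x + θ • e ∈ Ω := by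
    intro x hx θ hθ
    refine hBδ x hx _ ?_
    rw [dist_eq_norm, add_sub_cancel_left, norm_smul, norm_of_nonneg hθ.1]
    exact hbe θ hθ
  obtain ⟨k, -, hk2, hkd, hk'⟩ := exists_hasDerivAt_translate hf hφB e (a := 0) (b := b)
    fun x hx => hmem x (hφB.3 hx)
  have h00 : (0:ℝ) ∈ Icc 0 b := ⟨le_rfl, hb0.le⟩
  have hkz := hk' 0 h00
  simp only [zero_smul, sub_zero] at hkz
  have hlim := (hasDerivAt_iff_tendsto_slope.1 (hkd 0).hasDerivAt).mono_left
    (nhdsWithin_mono (0:ℝ) (show Ioi 0 ⊆ {0}ᶜ from fun x hx => ne_of_gt hx))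
  have hlim' := hlim.mono_left (Ultrafilter.of_le (𝓝[>] (0:ℝ)))
  have heq : deriv k 0 = ∫ x, φ x ∂m₁ - ∫ x, φ x ∂m₂ := by
    refine tendsto_nhds_unique (hlim'.congr' ?_) hd
    have hev : ∀ᶠ t in (Ultrafilter.of (𝓝[>] (0:ℝ)) : Filter ℝ), t ∈ Ioc 0 b :=
      (Ultrafilter.of_le _) (Ioc_mem_nhdsGT hb0)
    filter_upwards [hev] with t ht
    have hti : t ∈ Icc 0 b := ⟨ht.1.le, ht.2⟩
    have hl1 := locallyIntegrableOn_comp_add hB hf (h := t • e) fun x hx => hmem x hx t hti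
    have hBAt : B ⊆ A t := by
      intro x hx
      refine ((ENNReal.ofReal_lt_ofReal_iff hδ).2 (hbe t hti)).trans_le ?_
      refine le_infEDist.2 fun y hy => ?_
      rw [edist_dist]
      refine ofReal_le_ofReal ?_
      by_contra! hlt
      exact hy (hBδ x hx y (by rwa [dist_comm]))
    have hz : ∀ x ∉ A t, φ x = 0 := fun x hx => hφB.eq_zero fun hx' => hx (hBAt hx')
    have hs := hl1.sub (hf.mono_set hBA)
    have hi1 : Integrable fun x => φ x * max (f (x + t • e) - f x) 0 := by
      have := hφB.integrable_mul (locallyIntegrableOn_lipschitz_comp hs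
        (F := fun r => max r 0) (by fun_prop) fun r => by
          rw [abs_of_nonneg (le_max_right _ _)]; exact max_le (le_abs_self _) (abs_nonneg _))
      simpa only [mul_comm, Pi.sub_apply] using this
    have hi2 : Integrable fun x => φ x * max ((-f) (x + t • e) - (-f) x) 0 := by
      have := hφB.integrable_mul (locallyIntegrableOn_lipschitz_comp hs
        (F := fun r => max (-r) 0) (by fun_prop) fun r => by
          rw [abs_of_nonneg (le_max_right _ _)]; exact max_le (neg_le_abs _) (abs_nonneg _))
      refine this.congr (.of_forall fun x => ?_)
      simp only [Pi.sub_apply, Pi.neg_apply]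
      rw [mul_comm]; congr 2; ring
    rw [setIntegral_eq_integral_of_forall_compl_eq_zero fun x hx => by simp [hz x hx],
      setIntegral_eq_integral_of_forall_compl_eq_zero fun x hx => by simp [hz x hx],
      slope_def_field, hk2 t hti, hk2 0 h00, ← mul_sub, ← integral_sub hi1 hi2, sub_zero,
      div_eq_inv_mul, ← integral_sub]
    · congr 2 with x
      rw [← mul_sub, show (-f) (x + t • e) - (-f) x = -(f (x + t • e) - f x) by
        simp only [Pi.neg_apply]; ring,
        max_zero_sub_max_neg_zero_eq_self]
      simp; ring
    · simpa using hφB.integrable_mul hl1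
    · simpa using hφB.integrable_mul (hf.mono_set hBA)
  rw [hkz] at heq
  linarith

lemma exists_isPair_of_density (hΩ : MeasurableSet Ω) {m : Measure (E n)} {g : E n → E n}
    (hg : Measurable g) (hgi : Integrable g m)
    (h : ∀ φ, IsTest Ω φ → ∀ e, ∫ x, f x * fderiv ℝ φ x e = -∫ x, φ x * ⟪e, g x⟫ ∂m) :
    ∃ μ σ, IsPair f Ω μ σ := by
  refine ⟨(m.restrict Ω).withDensity fun x => (‖g x‖₊ : ℝ≥0∞), fun x => ‖g x‖⁻¹ • g x, ?_⟩
  refine ⟨?_, ?_, ?_, ?_, ?_⟩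
  · refine isFiniteMeasure_withDensity ?_
    exact hgi.restrict.2.ne
  · rw [withDensity_apply _ hΩ.compl, Measure.restrict_restrict hΩ.compl]
    simp
  · exact (hg.norm.inv.smul hg).aestronglyMeasurable
  · rw [ae_withDensity_iff hg.nnnorm.coe_nnreal_ennreal]
    refine Eventually.of_forall fun x hx => ?_
    have : g x ≠ 0 := by simpa using hx
    exact norm_smul_inv_norm (𝕜 := ℝ) this
  · intro φ hφ e
    rw [h φ hφ e, integral_withDensity_eq_integral_smul hg.nnnorm]
    congr 1
    rw [← integral_indicator hΩ]
    congr 1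
    ext x
    by_cases hx : x ∈ Ω
    · rw [indicator_of_mem hx, inner_smul_right, NNReal.smul_def, smul_eq_mul, coe_nnnorm]
      by_cases h0 : g x = 0
      · simp [h0]
      · have : ‖g x‖ ≠ 0 := by simpa using h0
        field_simp
    · rw [indicator_of_notMem hx, hφ.eq_zero hx, zero_mul]

lemma exists_isPair_of_tvar (hΩ : IsOpen Ω) (hf : LocInt f Ω)
    (h : ∀ i, tvar f Ω (EuclideanSpace.single i 1) ≠ ⊤) : ∃ μ σ, IsPair f Ω μ σ := by
  choose m₁ m₂ hm₁ hm₂ hm using fun i => exists_measure_of_tvar_lt_top hΩ hf _ (h i)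
  have := hm₁
  have := hm₂
  set m : Measure (E n) := ∑ i, (m₁ i + m₂ i) with hmdef
  have hfin : IsFiniteMeasure m := by
    constructor
    rw [hmdef, Measure.finsetSum_apply]
    refine ENNReal.sum_lt_top.2 fun i _ => ?_
    exact measure_lt_top _ _
  have hle : ∀ i, m₁ i + m₂ i ≤ m := fun i => by
    rw [hmdef]
    exact Finset.single_le_sum (f := fun i => m₁ i + m₂ i) (fun j _ => bot_le) (mem_univ i)
  have ha₁ : ∀ i, m₁ i ≪ m := fun i =>
    ((Measure.le_add_right le_rfl).trans (hle i)).absolutelyContinuous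
  have ha₂ : ∀ i, m₂ i ≪ m := fun i =>
    ((Measure.le_add_left le_rfl).trans (hle i)).absolutelyContinuous
  set r : Fin n → E n → ℝ := fun i x =>
    ((m₁ i).rnDeriv m x).toReal - ((m₂ i).rnDeriv m x).toReal with hr
  have hrm : ∀ i, Measurable (r i) := fun i =>
    (Measure.measurable_rnDeriv _ _).ennreal_toReal.sub
      (Measure.measurable_rnDeriv _ _).ennreal_toReal
  have hri : ∀ i, Integrable (r i) m := fun i =>
    Measure.integrable_toReal_rnDeriv.sub Measure.integrable_toReal_rnDeriv
  set g : E n → E n := fun x => ∑ i, r i x • EuclideanSpace.single i (1:ℝ) with hg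
  have hgm : Measurable g := by
    rw [hg]
    exact Finset.measurable_sum _ fun i _ => (hrm i).smul measurable_const
  have hgi : Integrable g m := by
    rw [hg]
    exact integrable_finsetSum _ fun i _ => (hri i).smul_const _
  refine exists_isPair_of_density hΩ.measurableSet hgm hgi fun φ hφ e => ?_
  obtain ⟨C, hC0, hC⟩ := hφ.exists_bound
  have hφi : ∀ i, Integrable (fun x => φ x * r i x) m := fun i =>
    (hri i).bdd_mul (c := C) hφ.continuous.aestronglyMeasurable (.of_forall hC)
  have key : ∀ i, ∫ x, f x * fderiv ℝ φ x (EuclideanSpace.single i 1) =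
      -∫ x, φ x * r i x ∂m := by
    intro i
    have hl₁ : (m₁ i).HaveLebesgueDecomposition m :=
      Measure.haveLebesgueDecomposition_of_sigmaFinite _ _
    have hl₂ : (m₂ i).HaveLebesgueDecomposition m :=
      Measure.haveLebesgueDecomposition_of_sigmaFinite _ _
    rw [hm i φ hφ, ← integral_rnDeriv_smul (ha₁ i), ← integral_rnDeriv_smul (ha₂ i),
      ← integral_sub, ← integral_neg]
    · congr 1
      ext x
      simp only [hr, smul_eq_mul]
      ring
    · simpa [mul_comm] using (Measure.integrable_toReal_rnDeriv (μ := m₂ i) (ν := m)).bdd_mul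
        (c := C) hφ.continuous.aestronglyMeasurable (.of_forall hC)
    · simpa [mul_comm] using (Measure.integrable_toReal_rnDeriv (μ := m₁ i) (ν := m)).bdd_mul
        (c := C) hφ.continuous.aestronglyMeasurable (.of_forall hC)
  have he : e = ∑ i, e i • EuclideanSpace.single i (1:ℝ) := by
    ext j
    simp [Finset.sum_apply, Pi.single_apply]
  have h1 : ∀ x, f x * fderiv ℝ φ x e =
      ∑ i, e i * (f x * fderiv ℝ φ x (EuclideanSpace.single i 1)) := by
    intro x
    conv_lhs => rw [he]
    rw [map_sum, mul_sum]
    refine sum_congr rfl fun i _ => ?_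
    rw [map_smul, smul_eq_mul]; ring
  have h2 : ∀ x, φ x * ⟪e, g x⟫ = ∑ i, e i * (φ x * r i x) := by
    intro x
    rw [hg, inner_sum, mul_sum]
    refine sum_congr rfl fun i _ => ?_
    rw [inner_smul_right, real_inner_comm, inner_single_one]; ring
  simp only [h1, h2]
  rw [integral_finsetSum _ fun i _ => (hφ.integrable_mul_fderiv hf _).const_mul _,
    integral_finsetSum _ fun i _ => (hφi i).const_mul _, ← Finset.sum_neg_distrib]
  refine sum_congr rfl fun i _ => ?_
  rw [integral_const_mul, integral_const_mul, key i]; ring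

/-- The open cube with centre `z`, side length `ε` and axes given by `b`. -/
def cube (b : Frame n) (z : E n) (ε : ℝ) : Set (E n) :=
  {x | ∀ i, |⟪b i, x - z⟫| < ε / 2}

/-- Mean oscillation of `u` on `Q`. -/
def osc (u : E n → ℝ) (Q : Set (E n)) : ℝ := ⨍ x in Q, |u x - ⨍ y in Q, u y|

/-- Coordinates with respect to an orthonormal basis. -/
def coords (b : Frame n) (x : E n) : Fin n → ℝ := fun i => ⟪b i, x⟫

lemma measurePreserving_coords (b : Frame n) : MeasurePreserving (coords b) := by
  have h : coords b = WithLp.ofLp ∘ b.repr := by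
    funext x i
    simp [coords, b.repr_apply_apply]
  rw [h]
  exact (PiLp.volume_preserving_ofLp (Fin n)).comp b.measurePreserving_repr

lemma measurableEmbedding_coords (b : Frame n) : MeasurableEmbedding (coords b) := by
  have := (MeasurableEquiv.toLp 2 (Fin n → ℝ)).symm.measurableEmbedding.comp
    b.repr.toHomeomorph.measurableEmbedding
  convert this using 1
  funext x i
  simp [coords, b.repr_apply_apply]

lemma cube_eq_preimage (b : Frame n) (z : E n) (ε : ℝ) : cube b z ε = coords b ⁻¹' univ.pi
      (fun i => Ioo (⟪b i, z⟫ - ε / 2) (⟪b i, z⟫ + ε / 2)) := by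
  ext x
  simp only [cube, Set.mem_ofPred_eq, coords, Set.mem_preimage, Set.mem_univ_pi, mem_Ioo,
    abs_lt, inner_sub_right]
  exact forall_congr' fun i => ⟨fun h => ⟨by linarith [h.1], by linarith [h.2]⟩,
    fun h => ⟨by linarith [h.1], by linarith [h.2]⟩⟩

lemma isOpen_cube (b : Frame n) (z : E n) (ε : ℝ) : IsOpen (cube b z ε) := by
  simp only [cube, Set.ofPred_forall]
  exact isOpen_iInter_of_finite fun i =>
    isOpen_lt (by fun_prop) continuous_const

lemma volume_cube (b : Frame n) (z : E n) : volume (cube b z ε) = ofReal ε ^ n := by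
  rw [cube_eq_preimage, (measurePreserving_coords b).measure_preimage
    (MeasurableSet.univ_pi fun _ => measurableSet_Ioo).nullMeasurableSet, Real.volume_pi_Ioo]
  simp

lemma volume_real_cube (b : Frame n) (z : E n) (hε : 0 ≤ ε) :
    volume.real (cube b z ε) = ε ^ n := by
  rw [measureReal_def, volume_cube, ENNReal.toReal_pow, toReal_ofReal hε]

lemma mem_cube_self (b : Frame n) (z : E n) (hε : 0 < ε) : z ∈ cube b z ε := by simp [cube, hε]

lemma norm_le_of_mem_cube (hx : x ∈ cube b z ε) : ‖x - z‖ ≤ n * ε := by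
  rw [← b.sum_repr' (x - z)]
  refine (norm_sum_le _ _).trans ?_
  have : ∀ i ∈ Finset.univ, ‖⟪b i, x - z⟫ • b i‖ ≤ ε := by
    intro i _
    rw [norm_smul, b.norm_eq_one, mul_one, norm_eq_abs]
    have := hx i
    linarith [abs_nonneg ⟪b i, x - z⟫]
  simpa using Finset.sum_le_card_nsmul _ _ _ this

lemma cube_subset_closedBall (b : Frame n) (z : E n) (ε : ℝ) :
    cube b z ε ⊆ closedBall z (n * ε) := fun x hx => by
  rw [mem_closedBall, dist_eq_norm]; exact norm_le_of_mem_cube hx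

lemma isCube_cube (b : Frame n) (z : E n) (ε : ℝ) : IsCube n ε (cube b z ε) := by
  refine ⟨b.repr.symm, z, ?_⟩
  ext x
  simp only [cube, Set.mem_ofPred_eq, Set.mem_image]
  constructor
  · intro h
    refine ⟨b.repr (x - z), fun i => ?_, by simp⟩
    rw [b.repr_apply_apply]; exact h i
  · rintro ⟨y, hy, rfl⟩ i
    rw [add_sub_cancel_left, ← b.repr_apply_apply]
    simpa using hy i

lemma exists_eq_cube_of_isCube (h : IsCube n ε Q) : ∃ b z, Q = cube b z ε := by
  obtain ⟨T, z, rfl⟩ := h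
  refine ⟨(basisFun (Fin n) ℝ).map T, z, ?_⟩
  ext x
  simp only [cube, Set.mem_ofPred_eq, Set.mem_image]
  constructor
  · rintro ⟨y, hy, rfl⟩ i
    rw [add_sub_cancel_left]
    simpa [inner_single_left] using hy i
  · intro h
    refine ⟨T.symm (x - z), fun i => ?_, by simp⟩
    have := h i
    rw [← T.apply_symm_apply (x - z)] at this
    rw [OrthonormalBasis.map_apply, T.inner_map_map] at this
    simpa [inner_single_left] using this

lemma sum_osc_le_kappa (hε : 0 < ε) {ι : Type*} (s : Finset ι) (b : ι → Frame n) (z : ι → E n)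
    (u : E n → ℝ) (hA : ∀ i ∈ s, cube (b i) (z i) ε ⊆ A)
    (hd : ∀ i ∈ s, ∀ j ∈ s, i ≠ j → Disjoint (cube (b i) (z i) ε) (cube (b j) (z j) ε)) :
    ofReal (ε ^ (n - 1)) * ∑ i ∈ s, ofReal (osc u (cube (b i) (z i) ε)) ≤
      kappa n ε u A := by
  have hinj : Set.InjOn (fun i => cube (b i) (z i) ε) s := by
    intro i hi j hj hij
    by_contra hne
    have := Set.disjoint_left.1 (hd i hi j hj hne) (mem_cube_self (b i) (z i) hε)
    exact this (by dsimp only at hij; rw [← hij]; exact mem_cube_self (b i) (z i) hε)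
  set F : Finset (Set (E n)) := s.image fun i => cube (b i) (z i) ε with hF
  unfold kappa
  gcongr
  refine le_iSup_of_le (F : Set (Set (E n))) <| le_iSup_of_le ?_ <| le_iSup_of_le ?_ ?_
  · intro Q hQ
    obtain ⟨i, hi, rfl⟩ := mem_image.1 (mem_coe.1 hQ)
    exact ⟨isCube_cube _ _ _, hA i hi⟩
  · intro Q hQ Q' hQ' hne
    obtain ⟨i, hi, rfl⟩ := mem_image.1 (mem_coe.1 hQ)
    obtain ⟨j, hj, rfl⟩ := mem_image.1 (mem_coe.1 hQ')
    exact hd i hi j hj fun h => hne (by rw [h])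
  · have h1 : ∑' Q : (F : Set (Set (E n))), ofReal (osc u (Q : Set (E n))) =
        ∑ Q ∈ F, ofReal (osc u Q) :=
      Finset.tsum_subtype F fun Q => ofReal (osc u Q)
    have h2 : ∑ Q ∈ F, ofReal (osc u Q) =
        ∑ i ∈ s, ofReal (osc u (cube (b i) (z i) ε)) := Finset.sum_image hinj
    rw [← h2, ← h1]
    exact le_rfl

lemma kappa_le_of_forall {M : ℝ≥0∞}
    (h : ∀ F : Finset (Set (E n)), (∀ Q ∈ F, ∃ b z, Q = cube b z ε ∧ Q ⊆ A) → (F : Set (Set (E n))).Pairwise Disjoint → ∑ Q ∈ F, ofReal (ε ^ (n - 1)) * ofReal (osc u Q) ≤ M) :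
    kappa n ε u A ≤ M := by
  unfold kappa
  rw [mul_iSup]
  refine iSup_le fun F => ?_
  rw [mul_iSup]
  refine iSup_le fun hF => ?_
  rw [mul_iSup]
  refine iSup_le fun hd => ?_
  rw [← ENNReal.tsum_mul_left, ENNReal.tsum_eq_iSup_sum]
  refine iSup_le fun s => ?_
  have := h (s.map (Function.Embedding.subtype _)) ?_ ?_
  · rw [Finset.sum_map] at this
    exact this
  · intro Q hQ
    obtain ⟨⟨Q', hQ'⟩, _, rfl⟩ := Finset.mem_map.1 hQ
    obtain ⟨hc, hs⟩ := hF Q' hQ'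
    obtain ⟨b, z, hbz⟩ := exists_eq_cube_of_isCube hc
    exact ⟨b, z, hbz, hs⟩
  · refine hd.mono ?_
    intro Q hQ
    obtain ⟨⟨Q', hQ'⟩, _, rfl⟩ := Finset.mem_map.1 (mem_coe.1 hQ)
    exact hQ'

lemma le_osc_of_mul {s : E n → ℝ} (hQ : volume Q ≠ ⊤) (hu : IntegrableOn u Q volume)
    (hsm : AEStronglyMeasurable s (volume.restrict Q)) (hs : ∀ x, |s x| ≤ 1)
    (hs0 : ∫ x in Q, s x = 0) : (volume.real Q)⁻¹ * ∫ x in Q, u x * s x ≤ osc u Q := by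
  have hfin : IsFiniteMeasure (volume.restrict Q) := ⟨by simpa using hQ.lt_top⟩
  set c := ⨍ y in Q, u y
  have hsi : Integrable s (volume.restrict Q) := Integrable.of_bound hsm 1 (.of_forall hs)
  have hus : Integrable (fun x => u x * s x) (volume.restrict Q) := by
    simpa [mul_comm] using hu.bdd_mul (c := 1) hsm (.of_forall hs)
  have h1 : ∫ x in Q, u x * s x = ∫ x in Q, (u x - c) * s x := by
    simp only [sub_mul]
    rw [integral_sub hus (hsi.const_mul c), integral_const_mul, hs0, mul_zero, sub_zero]
  unfold osc
  rw [setAverage_eq, smul_eq_mul, h1]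
  refine mul_le_mul_of_nonneg_left ?_ (by positivity)
  have huc : Integrable (fun x => u x - c) (volume.restrict Q) := hu.sub (integrable_const c)
  refine integral_mono (by simpa [mul_comm] using huc.bdd_mul (c := 1) hsm (.of_forall hs))
    huc.abs fun x => (le_abs_self _).trans ?_
  rw [abs_mul]
  exact mul_le_of_le_one_right (abs_nonneg _) (hs x)

lemma sum_lintegral_le {α ι : Type*} [MeasurableSpace α] {m : Measure α} (s : Finset ι)
    (F : ι → α → ℝ≥0∞) : ∑ i ∈ s, ∫⁻ x, F i x ∂m ≤ ∫⁻ x, ∑ i ∈ s, F i x ∂m := by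
  induction s using induction_on with
  | empty => simp
  | insert a s ha ih =>
    simp only [Finset.sum_insert ha]
    exact (add_le_add le_rfl ih).trans (le_lintegral_add _ _)

/-- The basis `ε b`, with coordinates `⟪b i, x⟫ / ε`. -/
def scaledBasis (b : Frame n) {ε : ℝ} (hε : ε ≠ 0) :
    Module.Basis (Fin n) ℝ (E n) :=
  .ofEquivFun (b.toBasis.equivFun.trans (LinearEquiv.smulOfNeZero ℝ (Fin n → ℝ) ε⁻¹
    (inv_ne_zero hε)))

lemma scaledBasis_repr (b : Frame n) (hε : ε ≠ 0) (x : E n) (i : Fin n) :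
    (scaledBasis b hε).repr x i = ε⁻¹ * ⟪b i, x⟫ := by
  simp [scaledBasis, b.repr_apply_apply]

lemma volume_fundamentalDomain_le (b : Frame n) (hε : 0 < ε) :
    volume (ZSpan.fundamentalDomain (scaledBasis b hε.ne')) ≤ ofReal ε ^ n := by
  have h : ZSpan.fundamentalDomain (scaledBasis b hε.ne') ⊆
      coords b ⁻¹' univ.pi fun _ => Set.Ico 0 ε := by
    intro x hx i _
    have := ZSpan.mem_fundamentalDomain _ |>.1 hx i
    rw [scaledBasis_repr] at this
    have h1 := this.1
    have h2 := this.2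
    rw [inv_mul_lt_iff₀ hε, mul_one] at h2
    exact ⟨by simpa [coords] using (mul_nonneg_iff_of_pos_left (inv_pos.2 hε)).1 h1, h2⟩
  refine (measure_mono h).trans ?_
  rw [(measurePreserving_coords b).measure_preimage
    (MeasurableSet.univ_pi fun _ => measurableSet_Ico).nullMeasurableSet, Real.volume_pi_Ico]
  simp

lemma disjoint_cube {z' : E n} {i : Fin n} (h : ε ≤ |⟪b i, z - z'⟫|) :
    Disjoint (cube b z ε) (cube b z' ε) := by
  rw [Set.disjoint_left]
  intro x hx hx'
  have h1 := hx i
  have h2 := hx' i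
  have : ⟪b i, z - z'⟫ = ⟪b i, x - z'⟫ - ⟪b i, x - z⟫ := by
    rw [← inner_sub_right]; congr 1; abel
  rw [this] at h
  have := abs_sub ⟪b i, x - z'⟫ ⟪b i, x - z⟫
  linarith

lemma disjoint_cube_lattice (hε : 0 < ε)
    {g g' : Submodule.span ℤ (range (scaledBasis b hε.ne'))} (hne : g ≠ g') (z : E n) :
    Disjoint (cube b (g + z) ε) (cube b (g' + z) ε) := by
  have hg := ((scaledBasis b hε.ne').mem_span_iff_repr_mem ℤ _).1 g.2
  have hg' := ((scaledBasis b hε.ne').mem_span_iff_repr_mem ℤ _).1 g'.2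
  have : ∃ i, (scaledBasis b hε.ne').repr g i ≠ (scaledBasis b hε.ne').repr g' i := by
    by_contra! h
    exact hne (Subtype.ext ((scaledBasis b hε.ne').repr.injective (Finsupp.ext h)))
  obtain ⟨i, hi⟩ := this
  obtain ⟨k, hk⟩ := hg i
  obtain ⟨k', hk'⟩ := hg' i
  rw [← hk, ← hk'] at hi
  rw [scaledBasis_repr] at hk hk'
  refine disjoint_cube (i := i) ?_
  rw [add_sub_add_right_eq_sub, inner_sub_right]
  have e1 : ⟪b i, (g : E n)⟫ = ε * k := by
    have : (k : ℝ) = ε⁻¹ * ⟪b i, (g : E n)⟫ := hk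
    rw [this]; field_simp
  have e2 : ⟪b i, (g' : E n)⟫ = ε * k' := by
    have : (k' : ℝ) = ε⁻¹ * ⟪b i, (g' : E n)⟫ := hk'
    rw [this]; field_simp
  rw [e1, e2, ← mul_sub, abs_mul, abs_of_pos hε]
  refine le_mul_of_one_le_right hε.le ?_
  have : k - k' ≠ 0 := sub_ne_zero.2 fun h => hi (by rw [h])
  have := Int.one_le_abs this
  exact_mod_cast this

lemma sum_indicator_osc_le (b : Frame n) (hε : 0 < ε) {S : Set (E n)}
    (hSA : ∀ z ∈ S, cube b z ε ⊆ A) (u : E n → ℝ)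
    (s : Finset (Submodule.span ℤ (range (scaledBasis b hε.ne')))) (z : E n) :
    ∑ g ∈ s, S.indicator (fun z => ofReal (osc u (cube b z ε))) ((g : E n) + z) ≤
      (ofReal (ε ^ (n - 1)))⁻¹ * kappa n ε u A := by
  have hp : ofReal (ε ^ (n - 1)) ≠ 0 := by simpa using pow_pos hε (n - 1)
  rw [← ENNReal.mul_le_iff_le_inv hp ofReal_ne_top]
  simp only [Set.indicator_apply, ← Finset.sum_filter]
  refine sum_osc_le_kappa (ι := Submodule.span ℤ (range (scaledBasis b hε.ne'))) hε _
    (fun _ => b) (fun g => (g : E n) + z) u ?_ ?_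
  · intro g hg
    exact hSA _ (mem_filter.1 hg).2
  · intro g _ g' _ hne
    exact disjoint_cube_lattice hε hne z

lemma lintegral_osc_le_kappa (hn : 1 ≤ n) (b : Frame n) (hε : 0 < ε) {S : Set (E n)}
    (hS : MeasurableSet S) (hSA : ∀ z ∈ S, cube b z ε ⊆ A) (u : E n → ℝ) :
    ∫⁻ z in S, ofReal (osc u (cube b z ε)) ≤ ofReal ε * kappa n ε u A := by
  have hD := ZSpan.isAddFundamentalDomain (scaledBasis b hε.ne') volume
  have : Countable (Submodule.span ℤ (range (scaledBasis b hε.ne'))) := inferInstance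
  have : VAddInvariantMeasure (Submodule.span ℤ (range (scaledBasis b hε.ne'))) (E n) volume :=
    ⟨fun c s _ => measure_preimage_add volume (c : E n) s⟩
  rw [← lintegral_indicator hS, hD.lintegral_eq_tsum'', ENNReal.tsum_eq_iSup_sum]
  refine iSup_le fun s => (sum_lintegral_le _ _).trans ?_
  have hp : ofReal (ε ^ (n - 1)) ≠ 0 := by simpa using pow_pos hε (n - 1)
  refine (lintegral_mono fun z => sum_indicator_osc_le b hε hSA u s z).trans ?_
  rw [lintegral_const, Measure.restrict_apply_univ]
  refine (mul_le_mul_right (volume_fundamentalDomain_le b hε) _).trans (le_of_eq ?_)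
  obtain ⟨k, rfl⟩ : ∃ k, n = k + 1 := ⟨n - 1, by omega⟩
  simp only [Nat.add_sub_cancel] at hp ⊢
  rw [pow_succ, ← ofReal_pow hε.le]
  calc _ = (ofReal (ε ^ k))⁻¹ * ofReal (ε ^ k) *
        (ofReal ε * kappa (k + 1) ε u A) := by ring
    _ = _ := by rw [ENNReal.inv_mul_cancel hp ofReal_ne_top, one_mul]

lemma measurable_real_sign : Measurable Real.sign := by
  unfold Real.sign
  exact Measurable.ite measurableSet_Iio measurable_const
    (Measurable.ite measurableSet_Ioi measurable_const measurable_const)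

lemma abs_real_sign_le (t : ℝ) : |Real.sign t| ≤ 1 := by
  rcases Real.sign_apply_eq t with h | h | h <;> rw [h] <;> simp

lemma integral_prod_cube (b : Frame n) (ε : ℝ) (g : Fin n → ℝ → ℝ) :
    ∫ w in cube b 0 ε, ∏ i, g i ⟪b i, w⟫ = ∏ i, ∫ t in Ioo (-(ε / 2)) (ε / 2), g i t := by
  have h := (measurePreserving_coords b).setIntegral_preimage_emb (measurableEmbedding_coords b)
    (fun v => ∏ i, g i (v i)) (univ.pi fun i => Ioo (⟪b i, (0 : E n)⟫ - ε / 2)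
      (⟪b i, (0 : E n)⟫ + ε / 2))
  rw [← cube_eq_preimage] at h
  refine h.trans ?_
  rw [volume_pi, Measure.restrict_pi_pi, integral_fintype_prod_eq_prod]
  simp

lemma integral_Ioo_sign (a : ℝ) : ∫ t in Ioo (-a) a, Real.sign t = 0 := by
  have h : ∫ t in Ioo (-a) a, Real.sign (-t) = ∫ t in Ioo (-a) a, Real.sign t := by
    have := (Measure.measurePreserving_neg (volume : Measure ℝ)).setIntegral_preimage_emb
      (MeasurableEquiv.neg ℝ).measurableEmbedding Real.sign (Ioo (-a) a)
    simpa using this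
  simp only [Real.sign_neg, integral_neg] at h
  linarith

lemma integral_Ioo_abs {a : ℝ} (ha : 0 ≤ a) : ∫ t in Ioo (-a) a, |t| = a ^ 2 := by
  rw [← integral_Ioc_eq_integral_Ioo, ← intervalIntegral.integral_of_le (by linarith),
    ← intervalIntegral.integral_add_adjacent_intervals (b := 0)
      (continuous_abs.intervalIntegrable _ _) (continuous_abs.intervalIntegrable _ _)]
  have h1 : ∫ t in (0:ℝ)..a, |t| = a ^ 2 / 2 := by
    rw [intervalIntegral.integral_congr (g := fun t => t) fun t ht => abs_of_nonneg ?_]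
    · simp
    · rw [Set.uIcc_of_le ha] at ht; exact ht.1
  have h2 : ∫ t in (-a)..0, |t| = a ^ 2 / 2 := by
    rw [← h1]
    have := intervalIntegral.integral_comp_neg (a := 0) (b := a) (fun t : ℝ => |t|)
    simpa using this.symm
  rw [h1, h2]; ring

lemma integral_cube_sign (b : Frame n) (ε : ℝ) (i₀ : Fin n) :
    ∫ w in cube b 0 ε, Real.sign ⟪b i₀, w⟫ = 0 := by
  have := integral_prod_cube b ε fun i t => if i = i₀ then Real.sign t else 1
  simp only [prod_ite_eq', mem_univ, if_true] at this
  rw [this]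
  exact prod_eq_zero (mem_univ i₀) (by simp [integral_Ioo_sign])

lemma integral_cube_sign_mul (hn : 1 ≤ n) (b : Frame n) (hε : 0 < ε) (i₀ j : Fin n) :
    ∫ w in cube b 0 ε, Real.sign ⟪b i₀, w⟫ * ⟪b j, w⟫ =
      if j = i₀ then ε ^ (n + 1) / 4 else 0 := by
  have := integral_prod_cube b ε fun i t =>
    (if i = i₀ then Real.sign t else 1) * (if i = j then t else 1)
  simp only [prod_mul_distrib, prod_ite_eq', mem_univ, if_true] at this
  rw [this]
  split_ifs with h
  · subst h
    have h1 : ∀ i, (∫ t in Ioo (-(ε / 2)) (ε / 2), (if i = j then Real.sign t else 1) *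
        (if i = j then t else 1)) = if i = j then ε ^ 2 / 4 else ε := by
      intro i
      split_ifs with hi
      · have : ∀ t : ℝ, Real.sign t * t = |t| := fun t => by
          rcases lt_trichotomy t 0 with ht | rfl | ht
          · rw [Real.sign_of_neg ht, abs_of_neg ht]; ring
          · simp
          · rw [Real.sign_of_pos ht, abs_of_pos ht]; ring
        simp only [this]
        rw [integral_Ioo_abs (by positivity)]; ring
      · simp [hε.le]
    simp only [h1]
    rw [Finset.prod_ite]
    simp [Finset.filter_eq', Finset.filter_ne']
    obtain ⟨k, rfl⟩ : ∃ k, n = k + 1 := ⟨n - 1, by omega⟩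
    simp; ring
  · exact prod_eq_zero (mem_univ i₀) (by simp [Ne.symm h, integral_Ioo_sign])

lemma IsTest.exists_uniform_fderiv (hφ : IsTest Ω φ) (hη : 0 < η) :
    ∃ δ, 0 < δ ∧ ∀ x w : E n, ‖w‖ < δ →
      |φ (x + w) - φ x - fderiv ℝ φ x w| ≤ η * ‖w‖ := by
  have hc : Continuous (fderiv ℝ φ) := hφ.1.continuous_fderiv (by simp)
  have hu : UniformContinuous (fderiv ℝ φ) :=
    (hφ.2.fderiv (𝕜 := ℝ)).uniformContinuous_of_continuous hc
  obtain ⟨δ, hδ, h⟩ := Metric.uniformContinuous_iff.1 hu η hη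
  refine ⟨δ, hδ, fun x w hw => ?_⟩
  have := (convex_ball x δ).norm_image_sub_le_of_norm_fderiv_le' (𝕜 := ℝ) (f := φ)
    (φ := fderiv ℝ φ x) (C := η) (x := x) (y := x + w) (fun y _ => hφ.differentiable y)
    (fun y hy => by rw [← dist_eq_norm]; exact (h hy).le) (mem_ball_self hδ)
    (by simpa [mem_ball, dist_eq_norm] using hw)
  simpa using this

lemma IsTest.exists_uniform_sign_average (hn : 1 ≤ n) (b : Frame n) (i₀ : Fin n)
    (hφ : IsTest Ω φ) (hη : 0 < η) : ∃ ε₀, 0 < ε₀ ∧ ∀ ε, 0 < ε → ε < ε₀ → ∀ x,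
      |(∫ w in cube b 0 ε, Real.sign ⟪b i₀, w⟫ * φ (x - w)) +
        ε ^ (n + 1) / 4 * fderiv ℝ φ x (b i₀)| ≤ η * ε ^ (n + 1) := by
  have hn' : (0:ℝ) < n := by exact_mod_cast hn
  obtain ⟨δ, hδ, h⟩ := hφ.exists_uniform_fderiv (η := η / n) (by positivity)
  refine ⟨δ / n, by positivity, fun ε hε hεδ x => ?_⟩
  rw [lt_div_iff₀ hn'] at hεδ
  have hfin : IsFiniteMeasure (volume.restrict (cube b 0 ε)) :=
    ⟨by rw [Measure.restrict_apply_univ, volume_cube]; exact pow_lt_top ofReal_lt_top⟩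
  have hsm : Measurable fun w : E n => Real.sign ⟪b i₀, w⟫ :=
    measurable_real_sign.comp (by fun_prop)
  have hint : ∀ g : E n → ℝ, Continuous g → 
      Integrable (fun w => Real.sign ⟪b i₀, w⟫ * g w) (volume.restrict (cube b 0 ε)) := by
    intro g hg
    have hgi : IntegrableOn g (cube b 0 ε) volume :=
      (hg.continuousOn.integrableOn_compact (isCompact_closedBall 0 (n * ε))).mono_set
        (cube_subset_closedBall _ _ _)
    exact hgi.bdd_mul (c := 1) hsm.aestronglyMeasurable
      (.of_forall fun w => abs_real_sign_le _)
  have hlin : ∫ w in cube b 0 ε, Real.sign ⟪b i₀, w⟫ * fderiv ℝ φ x w =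
      ε ^ (n + 1) / 4 * fderiv ℝ φ x (b i₀) := by
    have : ∀ w, Real.sign ⟪b i₀, w⟫ * fderiv ℝ φ x w =
        ∑ j, Real.sign ⟪b i₀, w⟫ * ⟪b j, w⟫ * fderiv ℝ φ x (b j) := by
      intro w
      conv_lhs => rw [← b.sum_repr' w, map_sum, mul_sum, b.sum_repr' w]
      refine sum_congr rfl fun j _ => ?_
      rw [map_smul, smul_eq_mul, mul_assoc]
    simp only [this]
    rw [integral_finsetSum _ fun j _ => (hint _ (by fun_prop)).mul_const _]
    simp only [integral_mul_const, integral_cube_sign_mul hn b hε, ite_mul, zero_mul]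
    simp
  have hcs : Continuous fun w => φ (x - w) := hφ.continuous.comp (by fun_prop)
  have hD : Continuous fun w => fderiv ℝ φ x w := (fderiv ℝ φ x).continuous
  have h0 : ∫ w in cube b 0 ε, Real.sign ⟪b i₀, w⟫ * φ x = 0 := by
    rw [integral_mul_const, integral_cube_sign, zero_mul]
  have key : (∫ w in cube b 0 ε, Real.sign ⟪b i₀, w⟫ * φ (x - w)) +
        ε ^ (n + 1) / 4 * fderiv ℝ φ x (b i₀) =
      ∫ w in cube b 0 ε, Real.sign ⟪b i₀, w⟫ * (φ (x - w) - φ x + fderiv ℝ φ x w) := by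
    simp only [mul_add, mul_sub]
    have hi : Integrable (fun w => Real.sign ⟪b i₀, w⟫ * φ x) (volume.restrict (cube b 0 ε)) :=
      hint _ continuous_const
    have hi' : Integrable (fun w => Real.sign ⟪b i₀, w⟫ * φ (x - w) - Real.sign ⟪b i₀, w⟫ * φ x)
      (volume.restrict (cube b 0 ε)) := (hint _ hcs).sub hi
    rw [integral_add hi' (hint _ hD), integral_sub (hint _ hcs) hi, h0, hlin, sub_zero]
  rw [key, ← norm_eq_abs]
  have hb := norm_setIntegral_le_of_norm_le_const (μ := volume) (s := cube b 0 ε) (C := η * ε)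
    (f := fun w => Real.sign ⟪b i₀, w⟫ * (φ (x - w) - φ x + fderiv ℝ φ x w))
    (by rw [volume_cube]; exact pow_lt_top ofReal_lt_top) fun w hw => ?_
  · refine hb.trans (le_of_eq ?_)
    rw [volume_real_cube b 0 hε.le]; ring
  · have hwn := norm_le_of_mem_cube hw
    rw [sub_zero] at hwn
    have := h x (-w) (by rw [norm_neg]; linarith [mul_comm ε (n:ℝ)])
    rw [norm_neg, map_neg, sub_neg_eq_add, ← sub_eq_add_neg] at this
    rw [norm_mul]
    calc _ ≤ 1 * (η / n * ‖w‖) := mul_le_mul (abs_real_sign_le _) this (abs_nonneg _) zero_le_one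
      _ ≤ 1 * (η / n * (n * ε)) := by gcongr
      _ = η * ε := by field_simp

lemma exists_basis_of_norm_eq_one (he : ‖e‖ = 1) : ∃ (b : Frame n) (i₀ : Fin n), b i₀ = e := by
  have hn : 0 < n := by
    rcases Nat.eq_zero_or_pos n with rfl | h
    · have : e = 0 := Subsingleton.elim _ _
      simp [this] at he
    · exact h
  set i₀ : Fin n := ⟨0, hn⟩
  have ho : Orthonormal ℝ (({i₀} : Set (Fin n)).restrict fun _ => e) := by
    constructor
    · intro i; exact he
    · intro i j hij
      exact absurd (Subsingleton.elim i j) hij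
  obtain ⟨b, hb⟩ := ho.exists_orthonormalBasis_extension_of_card_eq (by simp)
  exact ⟨b, i₀, hb i₀ rfl⟩

/-- `F ε → f` locally uniformly (up to null sets) on `Ω`. -/
structure IsApprox (f : E n → ℝ) (Ω : Set (E n)) (F : ℝ → E n → ℝ) : Prop where
  locInt : ∀ ε, 0 < ε → LocInt (F ε) Ω
  close : ∀ K, IsCompact K → K ⊆ Ω → ∀ δ, 0 < δ →
    ∀ᶠ ε in 𝓝[>] (0:ℝ), ∀ᵐ x ∂volume.restrict K, |F ε x - f x| ≤ δ

lemma sum_sign_average_le (hn : 1 ≤ n) (b : Frame n) (i₀ : Fin n) (hφ : IsTest A φ)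
    (h0 : ∀ x, 0 ≤ φ x) (h1 : ∀ x, φ x ≤ 1) (hε : 0 < ε) (hK : MeasurableSet K) (hKA : K ⊆ A)
    (hKφ : ∀ z ∈ tsupport φ, cube b z ε ⊆ K) (hu : IntegrableOn u K volume) :
    ofReal (ε⁻¹ ^ (n + 1) * ∫ x in K, u x *
      ∫ w in cube b 0 ε, Real.sign ⟪b i₀, w⟫ * φ (x - w)) ≤ kappa n ε u A := by
  set s : E n → ℝ := fun w => Real.sign ⟪b i₀, w⟫ with hs
  have hsm : Measurable s := measurable_real_sign.comp (by fun_prop)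
  set h : E n → ℝ := (cube b 0 ε).indicator s with hh
  have hhm : Measurable h := hsm.indicator (isOpen_cube _ _ _).measurableSet
  have hh1 : ∀ w, |h w| ≤ 1 := fun w => by
    by_cases hw : w ∈ cube b 0 ε
    · rw [hh, indicator_of_mem hw]; exact abs_real_sign_le _
    · rw [hh, indicator_of_notMem hw]; simp
  have hcz : ∀ x z, x - z ∈ cube b 0 ε ↔ x ∈ cube b z ε := fun x z => by simp [cube]
  have hz : ∀ z ∈ tsupport φ, ∫ x in K, u x * h (x - z) = ∫ x in cube b z ε, u x * s (x - z) := by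
    intro z hz
    rw [← integral_indicator hK, ← integral_indicator (isOpen_cube _ _ _).measurableSet]
    congr 1
    ext x
    by_cases hx : x ∈ cube b z ε
    · rw [indicator_of_mem (hKφ z hz hx), indicator_of_mem hx, hh,
        indicator_of_mem ((hcz x z).2 hx)]
    · rw [indicator_of_notMem hx]
      by_cases hxK : x ∈ K
      · rw [indicator_of_mem hxK, hh, indicator_of_notMem (fun h' => hx ((hcz x z).1 h')),
          mul_zero]
      · rw [indicator_of_notMem hxK]
  have hosc : ∀ z ∈ tsupport φ, (ε ^ n)⁻¹ * (φ z * ∫ x in K, u x * h (x - z)) ≤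
      osc u (cube b z ε) := by
    intro z hzS
    rw [hz z hzS]
    have hv : volume (cube b z ε) ≠ ⊤ := by
      rw [volume_cube]; exact (pow_lt_top ofReal_lt_top).ne
    have h2 := le_osc_of_mul (s := fun x => s (x - z)) hv (hu.mono_set (hKφ z hzS))
      (hsm.comp (measurable_id.sub_const z)).aestronglyMeasurable (fun x => abs_real_sign_le _) (by
        have := (measurePreserving_sub_right volume z).setIntegral_preimage_emb
          (measurableEmbedding_subRight z) s (cube b 0 ε)
        have hpre : (fun x => x - z) ⁻¹' cube b 0 ε = cube b z ε := by
          ext x; exact hcz x z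
        rw [hpre] at this
        exact this.trans (integral_cube_sign b ε i₀))
    rw [volume_real_cube b z hε.le] at h2
    have h3 : 0 ≤ osc u (cube b z ε) := by
      unfold osc
      rw [setAverage_eq]
      exact smul_nonneg (by positivity) (integral_nonneg fun _ => abs_nonneg _)
    calc _ = φ z * ((ε ^ n)⁻¹ * ∫ x in cube b z ε, u x * s (x - z)) := by ring
      _ ≤ φ z * osc u (cube b z ε) := mul_le_mul_of_nonneg_left h2 (h0 z)
      _ ≤ _ := mul_le_of_le_one_left h3 (h1 z)
  have hJ : ∫ x in K, u x * ∫ w in cube b 0 ε, s w * φ (x - w) =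
      ∫ z, φ z * ∫ x in K, u x * h (x - z) := by
    have e1 : ∀ x, ∫ w in cube b 0 ε, s w * φ (x - w) = ∫ z, φ z * h (x - z) := by
      intro x
      rw [← integral_sub_left_eq_self (fun z => φ z * h (x - z)) volume x,
        ← integral_indicator (isOpen_cube _ _ _).measurableSet]
      congr 1
      ext w
      rw [sub_sub_cancel, hh]
      by_cases hw : w ∈ cube b 0 ε
      · rw [indicator_of_mem hw, indicator_of_mem hw, mul_comm]
      · rw [indicator_of_notMem hw, indicator_of_notMem hw, mul_zero]
    simp only [e1, ← integral_const_mul]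
    rw [integral_integral_swap]
    · congr 1; ext z; congr 1; ext x; ring
    · have hφi : Integrable φ := hφ.continuous.integrable_of_hasCompactSupport hφ.2
      have hp := (Integrable.mul_prod (μ := volume.restrict K) (ν := volume) hu hφi)
      have hb := hp.bdd_mul (c := 1) (f := fun p : E n × E n => h (p.1 - p.2))
        (hhm.comp (measurable_fst.sub measurable_snd)).aestronglyMeasurable
        (.of_forall fun p => hh1 _)
      refine hb.congr (.of_forall fun p => ?_)
      simp only [uncurry]; ring
  have hS : MeasurableSet (tsupport φ) := (isClosed_tsupport φ).measurableSet
  have hl := lintegral_osc_le_kappa hn b hε hS (A := A) (fun z hz => (hKφ z hz).trans hKA) u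
  have hle : ofReal ((ε ^ n)⁻¹ * ∫ z, φ z * ∫ x in K, u x * h (x - z)) ≤
      ofReal ε * kappa n ε u A := by
    refine le_trans ?_ hl
    rw [← integral_const_mul, ← setIntegral_eq_integral_of_forall_compl_eq_zero (s := tsupport φ)]
    · refine (ofReal_integral_le_lintegral_ofReal _).trans (setLIntegral_mono_ae' hS ?_)
      exact Eventually.of_forall fun z hz => ofReal_le_ofReal (hosc z hz)
    · intro z hz
      rw [image_eq_zero_of_notMem_tsupport hz]; simp
  rw [hJ, pow_succ', mul_assoc, ofReal_mul (inv_nonneg.2 hε.le), inv_pow]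
  refine (mul_le_mul_right hle _).trans ?_
  rw [← mul_assoc, ← ofReal_mul (inv_nonneg.2 hε.le), inv_mul_cancel₀ hε.ne']
  simp

lemma tendsto_integral_mul_of_uniform (hK : IsCompact K) {g : E n → ℝ} {G : ℝ → E n → ℝ}
    {l : Filter ℝ} (hf : IntegrableOn f K volume) (hF : ∀ᶠ ε in l, IntegrableOn (F ε) K volume)
    (hFf : ∀ δ, 0 < δ → ∀ᶠ ε in l, ∀ᵐ x ∂volume.restrict K, |F ε x - f x| ≤ δ)
    (hg : AEStronglyMeasurable g (volume.restrict K)) {C : ℝ} (hC : ∀ x, |g x| ≤ C)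
    (hG : ∀ᶠ ε in l, AEStronglyMeasurable (G ε) (volume.restrict K))
    (hGg : ∀ η, 0 < η → ∀ᶠ ε in l, ∀ x, |G ε x - g x| ≤ η) :
    Tendsto (fun ε => ∫ x in K, F ε x * G ε x) l (𝓝 (∫ x in K, f x * g x)) := by
  have hC0 : 0 ≤ C := (abs_nonneg _).trans (hC 0)
  have hfin : volume K ≠ ⊤ := hK.measure_lt_top.ne
  set V := volume.real K with hV
  set W := ∫ x in K, |f x| with hW
  have hV0 : 0 ≤ V := measureReal_nonneg
  have hW0 : 0 ≤ W := integral_nonneg fun _ => abs_nonneg _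
  have hfg : Integrable (fun x => f x * g x) (volume.restrict K) := by
    refine (hf.bdd_mul (c := C) hg (.of_forall hC)).congr (.of_forall fun x => ?_)
    exact mul_comm _ _
  rw [Metric.tendsto_nhds]
  intro r hr
  set δ := min 1 (r / (2 * (V * (C + 1) + W + 1))) with hδ
  have hD : 0 < V * (C + 1) + W + 1 := by positivity
  have hδ0 : 0 < δ := by rw [hδ]; positivity
  have hδ1 : δ ≤ 1 := min_le_left _ _
  have hδr : δ * (V * (C + 1) + W) < r := by
    have h1 : δ ≤ r / (2 * (V * (C + 1) + W + 1)) := min_le_right _ _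
    rw [le_div_iff₀ (by positivity)] at h1
    nlinarith
  filter_upwards [hF, hFf δ hδ0, hG, hGg δ hδ0] with ε h1 h2 h3 h4
  have hGb : ∀ x, |G ε x| ≤ C + δ := fun x => by
    have := h4 x; have := hC x
    calc |G ε x| = |(G ε x - g x) + g x| := by ring_nf
      _ ≤ _ := abs_add_le _ _
      _ ≤ C + δ := by linarith
  have hFG : Integrable (fun x => F ε x * G ε x) (volume.restrict K) := by
    refine (h1.bdd_mul (c := C + δ) h3 (.of_forall hGb)).congr
      (.of_forall fun x => ?_)
    exact mul_comm _ _
  rw [dist_eq, ← integral_sub hFG hfg]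
  refine lt_of_le_of_lt ?_ hδr
  calc |∫ x in K, (F ε x * G ε x - f x * g x)|
      ≤ ∫ x in K, |F ε x * G ε x - f x * g x| := abs_integral_le_integral_abs
    _ ≤ ∫ x in K, (δ * (C + 1) + δ * |f x|) := by
        refine integral_mono_ae (hFG.sub hfg).abs
          ((integrableOn_const hfin).add (hf.abs.const_mul δ)) ?_
        filter_upwards [h2] with x hx
        calc |F ε x * G ε x - f x * g x|
            = |(F ε x - f x) * G ε x + f x * (G ε x - g x)| := by ring_nf
          _ ≤ |(F ε x - f x) * G ε x| + |f x * (G ε x - g x)| := abs_add_le _ _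
          _ = |F ε x - f x| * |G ε x| + |f x| * |G ε x - g x| := by rw [abs_mul, abs_mul]
          _ ≤ δ * (C + 1) + |f x| * δ := by
              gcongr
              · exact (hGb x).trans (by linarith)
              · exact h4 x
          _ = _ := by ring
    _ = δ * (V * (C + 1) + W) := by
        have hci : Integrable (fun _ : E n => δ * (C + 1)) (volume.restrict K) :=
          integrableOn_const hfin
        rw [integral_add hci (hf.abs.const_mul δ), setIntegral_const, smul_eq_mul,
          integral_const_mul δ fun x => |f x|]
        ring

lemma quarter_integral_le_liminf (hn : 1 ≤ n) (hf : LocInt f Ω) (hF : IsApprox f Ω F)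
    (hA : IsOpen A) (hAΩ : A ⊆ Ω) (he : ‖e‖ = 1) (hφ : IsTest A φ) (h0 : ∀ x, 0 ≤ φ x)
    (h1 : ∀ x, φ x ≤ 1) : ofReal (-∫ x, f x * fderiv ℝ φ x e) / 4 ≤
      liminf (fun ε => kappa n ε (F ε) A) (𝓝[>] (0:ℝ)) := by
  obtain ⟨b, i₀, rfl⟩ := exists_basis_of_norm_eq_one he
  obtain ⟨δ, hδ, hδA⟩ := hφ.2.isCompact.exists_cthickening_subset_open hA hφ.3
  set K := cthickening δ (tsupport φ) with hKdef
  have hK : IsCompact K := hφ.2.isCompact.cthickening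
  have hKφ : ∀ᶠ ε in 𝓝[>] (0:ℝ), ∀ z ∈ tsupport φ, cube b z ε ⊆ K := by
    have hn' : (0:ℝ) < n := by exact_mod_cast hn
    filter_upwards [Ioo_mem_nhdsGT (show 0 < δ / n by positivity)] with ε hε z hz x hx
    refine mem_cthickening_of_dist_le x z δ _ hz ?_
    rw [dist_eq_norm]
    have := (lt_div_iff₀ hn').1 hε.2
    linarith [norm_le_of_mem_cube hx, mul_comm ε n]
  set Ψ : ℝ → E n → ℝ := fun ε x => ∫ w in cube b 0 ε, Real.sign ⟪b i₀, w⟫ * φ (x - w) with hΨ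
  have hlim : Tendsto (fun ε => ε⁻¹ ^ (n + 1) * ∫ x in K, F ε x * Ψ ε x) (𝓝[>] (0:ℝ))
      (𝓝 (-(1 / 4) * ∫ x, f x * fderiv ℝ φ x (b i₀))) := by
    have hsup : tsupport φ ⊆ K := self_subset_cthickening _
    have hc : -(1 / 4) * ∫ x, f x * fderiv ℝ φ x (b i₀) =
        ∫ x in K, f x * (-(1 / 4) * fderiv ℝ φ x (b i₀)) := by
      rw [← setIntegral_eq_integral_of_forall_compl_eq_zero (s := K), ← integral_const_mul]
      · congr 1; ext x; ring
      · intro x hx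
        rw [image_eq_zero_of_notMem_tsupport (f := fderiv ℝ φ)
          (fun h => hx (hsup (tsupport_fderiv_subset ℝ h)))]; simp
    rw [hc]
    simp only [← integral_const_mul]
    obtain ⟨C, hC0, hC⟩ : ∃ C, 0 ≤ C ∧ ∀ x, ‖fderiv ℝ φ x‖ ≤ C := by
      obtain ⟨C, hC⟩ := (hφ.1.continuous_fderiv one_ne_zero).bounded_above_of_compact_support
        (hφ.2.fderiv ℝ)
      exact ⟨C, (norm_nonneg _).trans (hC 0), hC⟩
    have key := tendsto_integral_mul_of_uniform (l := 𝓝[>] (0:ℝ)) hK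
      (f := f) (g := fun x => -(1 / 4) * fderiv ℝ φ x (b i₀)) (F := F)
      (G := fun ε x => ε⁻¹ ^ (n + 1) * Ψ ε x) (C := 1 / 4 * (C * 1))
      (hf.integrableOn_compact_subset (hδA.trans hAΩ) hK)
      (by
        filter_upwards [self_mem_nhdsWithin] with ε hε
        exact (hF.locInt ε hε).integrableOn_compact_subset (hδA.trans hAΩ) hK)
      (fun δ' h => hF.close K hK (hδA.trans hAΩ) δ' h)
      ((hφ.continuous_fderiv _).const_mul _).aestronglyMeasurable
      (fun x => by
        rw [abs_mul]
        gcongr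
        · norm_num
        · rw [← he]
          exact ((fderiv ℝ φ x).le_opNorm (b i₀)).trans
            (mul_le_mul_of_nonneg_right (hC x) (norm_nonneg _)))
      (.of_forall fun ε => by
        refine AEStronglyMeasurable.const_mul ?_ _
        have : StronglyMeasurable (uncurry fun (x w : E n) =>
            Real.sign ⟪b i₀, w⟫ * φ (x - w)) := by
          refine Measurable.stronglyMeasurable ?_
          refine Measurable.mul (measurable_real_sign.comp ?_) (hφ.continuous.measurable.comp ?_)
          · fun_prop
          · fun_prop
        exact this.integral_prod_right.aestronglyMeasurable)
      (fun η hη => by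
        obtain ⟨ε₀, hε₀, h⟩ := hφ.exists_uniform_sign_average hn b i₀ hη
        filter_upwards [Ioo_mem_nhdsGT hε₀] with ε hε
        intro x
        have hε' : (0:ℝ) < ε := hε.1
        have h1 : ε⁻¹ ^ (n + 1) * ε ^ (n + 1) = 1 := by
          rw [← mul_pow, inv_mul_cancel₀ hε'.ne', one_pow]
        have h2 : ε⁻¹ ^ (n + 1) * Ψ ε x - -(1 / 4) * fderiv ℝ φ x (b i₀) = ε⁻¹ ^ (n + 1) *
            (Ψ ε x + ε ^ (n + 1) / 4 * fderiv ℝ φ x (b i₀)) := by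
          linear_combination (-(1 / 4) * fderiv ℝ φ x (b i₀)) * h1
        rw [h2, abs_mul, abs_of_nonneg (by positivity)]
        calc _ ≤ ε⁻¹ ^ (n + 1) * (η * ε ^ (n + 1)) := by gcongr; exact h ε hε.1 hε.2 x
          _ = η := by rw [mul_left_comm, h1, mul_one])
    refine key.congr fun ε => ?_
    congr 1; ext x
    exact mul_left_comm _ _ _
  have h4 : ofReal (-∫ x, f x * fderiv ℝ φ x (b i₀)) / 4 =
      ofReal (-(1 / 4) * ∫ x, f x * fderiv ℝ φ x (b i₀)) := by
    rw [show (4 : ℝ≥0∞) = ofReal 4 by simp, ← ofReal_div_of_pos (by norm_num)]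
    congr 1; ring
  rw [h4, ← ((continuous_ofReal.tendsto _).comp hlim).liminf_eq]
  refine liminf_le_liminf ?_
  filter_upwards [hKφ, self_mem_nhdsWithin] with ε h1' (hε : 0 < ε)
  exact sum_sign_average_le hn b i₀ hφ h0 h1 hε hK.isClosed.measurableSet hδA h1'
    ((hF.locInt ε hε).integrableOn_compact_subset (hδA.trans hAΩ) hK)

lemma sum_le_kappa (u : E n → ℝ) (F : Finset (Set (E n)))
    (hF : ∀ Q ∈ F, ∃ b z, Q = cube b z ε ∧ Q ⊆ A) (hd : (F : Set (Set (E n))).Pairwise Disjoint) :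
    ∑ Q ∈ F, ofReal (ε ^ (n - 1)) * ofReal (osc u Q) ≤ kappa n ε u A := by
  rw [← mul_sum]
  unfold kappa
  gcongr
  refine le_iSup_of_le (F : Set (Set (E n))) <| le_iSup_of_le ?_ <| le_iSup_of_le hd ?_
  · intro Q hQ
    obtain ⟨b, z, rfl, h⟩ := hF Q (mem_coe.1 hQ)
    exact ⟨isCube_cube _ _ _, h⟩
  · have h1 : ∑' Q : (F : Set (Set (E n))), ofReal (osc u (Q : Set (E n))) =
        ∑ Q ∈ F, ofReal (osc u Q) :=
      Finset.tsum_subtype F fun Q => ofReal (osc u Q)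
    rw [← h1]
    exact le_rfl

lemma kappa_mono (ε : ℝ) (u : E n → ℝ) {B : Set (E n)} (h : A ⊆ B) :
    kappa n ε u A ≤ kappa n ε u B :=
  kappa_le_of_forall fun F hF hd => sum_le_kappa u F
    (fun Q hQ => (hF Q hQ).imp fun _ => .imp fun _ h' => ⟨h'.1, h'.2.trans h⟩) hd

lemma kappa_add_le (hε : 0 < ε) (u : E n → ℝ) {B : Set (E n)} (h : Disjoint A B) :
    kappa n ε u A + kappa n ε u B ≤ kappa n ε u (A ∪ B) := by
  by_cases ht : kappa n ε u (A ∪ B) = ⊤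
  · rw [ht]; exact le_top
  have hB : kappa n ε u B ≠ ⊤ := ne_top_of_le_ne_top ht (kappa_mono ε u Set.subset_union_right)
  refine add_le_of_le_tsub_right_of_le (kappa_mono ε u Set.subset_union_right) ?_
  refine kappa_le_of_forall fun F hF hFd => ENNReal.le_sub_of_add_le_right hB ?_
  set s := ∑ Q ∈ F, ofReal (ε ^ (n - 1)) * ofReal (osc u Q) with hs
  have hsle : s ≤ kappa n ε u (A ∪ B) := (sum_le_kappa u F hF hFd).trans
    (kappa_mono ε u Set.subset_union_left)
  rw [add_comm]
  refine add_le_of_le_tsub_right_of_le hsle (kappa_le_of_forall fun G hG hGd =>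
    ENNReal.le_sub_of_add_le_right (ne_top_of_le_ne_top ht hsle) ?_)
  have hFG : ∀ Q ∈ F, ∀ R ∈ G, Disjoint Q R := fun Q hQ R hR => by
    obtain ⟨_, _, _, h1⟩ := hF Q hQ
    obtain ⟨_, _, _, h2⟩ := hG R hR
    exact h.mono h1 h2
  have hdisj : Disjoint F G := by
    rw [Finset.disjoint_left]
    intro Q hQ hQ'
    obtain ⟨b, z, rfl, _⟩ := hF Q hQ
    exact Set.disjoint_left.1 (hFG _ hQ _ hQ') (mem_cube_self b z hε) (mem_cube_self b z hε)
  rw [add_comm, hs, ← Finset.sum_union hdisj]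
  refine sum_le_kappa u _ (fun Q hQ => ?_) ?_
  · rcases mem_union.1 hQ with h' | h'
    · exact (hF Q h').imp fun _ => .imp fun _ h' => ⟨h'.1, h'.2.trans Set.subset_union_left⟩
    · exact (hG Q h').imp fun _ => .imp fun _ h' => ⟨h'.1, h'.2.trans Set.subset_union_right⟩
  · intro Q hQ R hR hne
    rcases mem_union.1 (mem_coe.1 hQ) with hQ | hQ <;>
      rcases mem_union.1 (mem_coe.1 hR) with hR | hR
    · exact hFd hQ hR hne
    · exact hFG Q hQ R hR
    · exact (hFG R hR Q hQ).symm
    · exact hGd hQ hR hne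

/-- The asymptotic lower value `liminf κ_ε(F_ε, A)`. -/
def lowerKappa (F : ℝ → E n → ℝ) (A : Set (E n)) : ℝ≥0∞ :=
  liminf (fun ε => kappa n ε (F ε) A) (𝓝[>] (0:ℝ))

lemma lowerKappa_mono (F : ℝ → E n → ℝ) {B : Set (E n)} (h : A ⊆ B) :
    lowerKappa F A ≤ lowerKappa F B :=
  liminf_le_liminf (.of_forall fun ε => kappa_mono ε (F ε) h)

lemma ennreal_liminf_add_le {α : Type*} (u v : α → ℝ≥0∞) (l : Filter α) :
    liminf u l + liminf v l ≤ liminf (fun x => u x + v x) l := by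
  simp only [liminf_eq_iSup_iInf]
  refine ENNReal.biSup_add_biSup_le' ⟨univ, univ_mem⟩ ⟨univ, univ_mem⟩ fun s hs t ht => ?_
  refine le_trans ?_ (le_iSup₂ (s ∩ t) (inter_mem hs ht))
  refine le_iInf₂ fun x hx => ?_
  exact add_le_add (iInf₂_le x hx.1) (iInf₂_le x hx.2)

lemma lowerKappa_add_le (F : ℝ → E n → ℝ) {B : Set (E n)} (h : Disjoint A B) :
    lowerKappa F A + lowerKappa F B ≤ lowerKappa F (A ∪ B) := by
  refine le_trans ?_ (liminf_le_liminf (f := 𝓝[>] (0:ℝ))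
    (u := fun ε => kappa n ε (F ε) A + kappa n ε (F ε) B) ?_)
  · exact ennreal_liminf_add_le _ _ _
  · filter_upwards [self_mem_nhdsWithin] with ε hε
    exact kappa_add_le hε (F ε) h

lemma pvar_div_four_le_lowerKappa (hn : 1 ≤ n) (hf : LocInt f Ω) (hF : IsApprox f Ω F)
    (hA : IsOpen A) (hAΩ : A ⊆ Ω) (he : ‖e‖ = 1) : pvar f A e / 4 ≤ lowerKappa F A := by
  refine div_le_of_le_mul ?_
  refine iSup_le fun φ => iSup_le fun hφ => iSup_le fun h0 => iSup_le fun h1 => ?_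
  have := quarter_integral_le_liminf hn hf hF hA hAΩ he hφ h0 h1
  exact (ENNReal.div_le_iff (by norm_num) (by norm_num)).1 this

lemma exists_isPair_of_lowerKappa (hn : 1 ≤ n) (hΩ : IsOpen Ω) (hf : LocInt f Ω)
    (hF : IsApprox f Ω F) (h : lowerKappa F Ω ≠ ⊤) : ∃ μ σ, IsPair f Ω μ σ := by
  have key : ∀ e : E n, ‖e‖ = 1 → pvar f Ω e ≠ ⊤ := fun e he ht => by
    have := pvar_div_four_le_lowerKappa hn hf hF hΩ subset_rfl he
    rw [ht, ENNReal.top_div_of_ne_top (by norm_num)] at this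
    exact h (top_le_iff.1 this)
  refine exists_isPair_of_tvar hΩ hf fun i => ?_
  exact add_ne_top.2 ⟨key _ (by simp), key _ (by simp)⟩

lemma IsPair.exists_stronglyMeasurable (h : IsPair f Ω μ σ) :
    ∃ σ', StronglyMeasurable σ' ∧ IsPair f Ω μ σ' := by
  refine ⟨h.aesm.mk σ, h.aesm.stronglyMeasurable_mk, h.finite, h.null,
    h.aesm.stronglyMeasurable_mk.aestronglyMeasurable, ?_, fun φ hφ e => ?_⟩
  · filter_upwards [h.norm_eq, h.aesm.ae_eq_mk] with x h1 h2
    rw [← h2, h1]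
  · rw [h.integral_eq φ hφ e]
    congr 1
    refine integral_congr_ae ?_
    filter_upwards [h.aesm.ae_eq_mk] with x h2
    rw [h2]

lemma IsPair.inner_le_one (h : IsPair f Ω μ σ) (he : ‖e‖ = 1) : ∀ᵐ x ∂μ, |⟪e, σ x⟫| ≤ 1 := by
  filter_upwards [h.norm_eq] with x hx
  refine (abs_real_inner_le_norm _ _).trans ?_
  rw [he, hx, one_mul]

/-- If `σ` is close to `e` on the compact set `K` then `μ K` is nearly bounded by the one-sided
variation of `f` in any neighbourhood of `K`. -/
lemma IsPair.mul_measure_le_pvar (h : IsPair f Ω μ σ) (hK : IsCompact K) (hA : IsOpen A)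
    (hKA : K ⊆ A) (hAΩ : A ⊆ Ω) (he : ‖e‖ = 1) (hσ : ∀ x ∈ K, ‖σ x - e‖ ≤ τ) :
    ofReal (1 - τ) * μ K ≤ pvar f A e := by
  have := h.finite
  refine ENNReal.le_of_forall_pos_le_add fun η hη _ => ?_
  obtain ⟨U, hKU, hU, hUμ⟩ := K.exists_isOpen_lt_add (μ := μ) (measure_ne_top _ _)
    (coe_pos.2 hη).ne'
  obtain ⟨φ, hφ, h0, h1, hφK⟩ := exists_test_one_of_isCompact hK (hU.inter hA)
    (subset_inter hKU hKA)
  have hφ1 : ∀ x ∈ K, φ x = 1 := fun x hx => hφK.self_of_nhdsSet x hx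
  have hle := le_pvar (u := f) e (hφ.mono inter_subset_right) h0 h1
  rw [h.integral_eq φ (hφ.mono (inter_subset_right.trans hAΩ)) e, neg_neg] at hle
  have hKm := hK.isClosed.measurableSet
  have hUK : μ.real (U \ K) ≤ η := by
    rw [measureReal_def]
    refine ENNReal.toReal_le_coe_of_le_coe ?_
    rw [measure_sdiff hKU hKm.nullMeasurableSet (measure_ne_top _ _)]
    exact tsub_le_iff_left.2 hUμ.le
  have hint := h.integrable_mul_inner hφ.continuous ⟨1, fun x => by
    rw [abs_of_nonneg (h0 x)]; exact h1 x⟩ e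
  have hlow : (1 - τ) * μ.real K - η ≤ ∫ x, φ x * ⟪e, σ x⟫ ∂μ := by
    have h2 : ∫ x, (K.indicator (fun _ => 1 - τ) x - (U \ K).indicator (fun _ => (1:ℝ)) x) ∂μ ≤
        ∫ x, φ x * ⟪e, σ x⟫ ∂μ := by
      refine integral_mono_ae (((integrable_const _).indicator hKm).sub
        ((integrable_const _).indicator (hU.measurableSet.diff hKm))) hint ?_
      filter_upwards [h.inner_le_one he, h.norm_eq] with x hx hx1
      by_cases hxK : x ∈ K
      · rw [indicator_of_mem hxK, indicator_of_notMem (fun h => h.2 hxK), hφ1 x hxK,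
          one_mul, sub_zero]
        have h3 : ⟪e, σ x - e⟫ = ⟪e, σ x⟫ - 1 := by
          rw [inner_sub_right, real_inner_self_eq_norm_sq, he, one_pow]
        have h4 := abs_real_inner_le_norm e (σ x - e)
        rw [h3, he, one_mul] at h4
        linarith [(abs_le.1 h4).1, hσ x hxK]
      · rw [indicator_of_notMem hxK]
        by_cases hxU : x ∈ U
        · rw [indicator_of_mem (show x ∈ U \ K from ⟨hxU, hxK⟩)]
          have := (abs_le.1 hx).1
          nlinarith [h0 x, h1 x]
        · rw [indicator_of_notMem (fun h => hxU h.1), hφ.eq_zero (fun h => hxU h.1)]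
          simp
    rw [integral_sub ((integrable_const _).indicator hKm)
        ((integrable_const _).indicator (hU.measurableSet.diff hKm)),
      integral_indicator hKm, integral_indicator (hU.measurableSet.diff hKm), setIntegral_const,
      setIntegral_const, smul_eq_mul, smul_eq_mul, mul_one] at h2
    linarith [mul_comm (1 - τ) (μ.real K)]
  calc ofReal (1 - τ) * μ K = ofReal ((1 - τ) * μ.real K) := by
        rw [ofReal_mul' measureReal_nonneg, ofReal_measureReal]
    _ ≤ ofReal ((∫ x, φ x * ⟪e, σ x⟫ ∂μ) + η) := ofReal_le_ofReal (by linarith)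
    _ ≤ ofReal (∫ x, φ x * ⟪e, σ x⟫ ∂μ) + ofReal η := ofReal_add_le
    _ ≤ _ := by rw [ENNReal.ofReal_coe_nnreal]; gcongr

/-- `c μ` is a lower bound for the asymptotic functional on (compact subsets of) `S`. -/
def Good (Ω : Set (E n)) (F : ℝ → E n → ℝ) (μ : Measure (E n)) (c : ℝ≥0∞) (S : Set (E n)) : Prop :=
  ∀ K, IsCompact K → K ⊆ S → ∀ A, IsOpen A → K ⊆ A → A ⊆ Ω → c * μ K ≤ lowerKappa F A

lemma sum_good_le {ι : Type*} (s : Finset ι) {c : ι → ℝ≥0∞} {S K : ι → Set (E n)}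
    (hg : ∀ i ∈ s, Good Ω F μ (c i) (S i)) (hK : ∀ i ∈ s, IsCompact (K i))
    (hKS : ∀ i ∈ s, K i ⊆ S i) (hd : (s : Set ι).PairwiseDisjoint K) :
    ∀ A, IsOpen A → (∀ i ∈ s, K i ⊆ A) → A ⊆ Ω → ∑ i ∈ s, c i * μ (K i) ≤ lowerKappa F A := by
  classical
  induction s using induction_on with
  | empty => intro A _ _ _; simp
  | insert a s ha ih =>
    intro A hA hKA hAΩ
    rw [Finset.sum_insert ha]
    have hc : IsCompact (⋃ i ∈ s, K i) := s.isCompact_biUnion fun i hi =>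
      hK i (mem_insert_of_mem hi)
    have hdis : Disjoint (K a) (⋃ i ∈ s, K i) := by
      rw [Set.disjoint_iUnion₂_right]
      intro i hi
      refine hd (by simp) (by simp [hi]) ?_
      rintro rfl; exact ha hi
    obtain ⟨U, V, hU, hV, hKU, hKV, hUV⟩ := SeparatedNhds.of_isCompact_isCompact
      (hK a (mem_insert_self _ _)) hc hdis
    have h1 := hg a (mem_insert_self _ _) (K a) (hK a (mem_insert_self _ _))
      (hKS a (mem_insert_self _ _)) (A ∩ U) (hA.inter hU)
      (subset_inter (hKA a (mem_insert_self _ _)) hKU) (inter_subset_left.trans hAΩ)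
    have h2 := ih (fun i hi => hg i (mem_insert_of_mem hi))
      (fun i hi => hK i (mem_insert_of_mem hi))
      (fun i hi => hKS i (mem_insert_of_mem hi)) (hd.subset (by simp)) (A ∩ V) (hA.inter hV)
      (fun i hi => subset_inter (hKA i (mem_insert_of_mem hi))
        ((Set.subset_biUnion_of_mem (u := K) (mem_coe.2 hi)).trans hKV))
      (inter_subset_left.trans hAΩ)
    refine (add_le_add h1 h2).trans ((lowerKappa_add_le F ?_).trans (lowerKappa_mono F ?_))
    · exact hUV.mono inter_subset_right inter_subset_right
    · exact Set.union_subset inter_subset_left inter_subset_left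

lemma sum_good_measurable_le [IsFiniteMeasure μ] {ι : Type*} (s : Finset ι) {c : ι → ℝ≥0∞}
    (hc : ∀ i ∈ s, c i ≠ ⊤) {S T : ι → Set (E n)} (hg : ∀ i ∈ s, Good Ω F μ (c i) (S i))
    (hT : ∀ i ∈ s, MeasurableSet (T i)) (hTS : ∀ i ∈ s, T i ⊆ S i)
    (hd : (s : Set ι).PairwiseDisjoint T) (hA : IsOpen A) (hTA : ∀ i ∈ s, T i ⊆ A) (hAΩ : A ⊆ Ω) :
    ∑ i ∈ s, c i * μ (T i) ≤ lowerKappa F A := by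
  refine ENNReal.le_of_forall_pos_le_add fun η hη _ => ?_
  have hC : ∑ i ∈ s, c i ≠ ⊤ := ENNReal.sum_ne_top.2 hc
  set η' : ℝ≥0∞ := η / (∑ i ∈ s, c i + 1) with hη'
  have hη0 : η' ≠ 0 := (ENNReal.div_pos (coe_pos.2 hη).ne' (by finiteness)).ne'
  have hex : ∀ i, ∃ K : Set (E n), i ∈ s → K ⊆ T i ∧ IsCompact K ∧ μ (T i) ≤ μ K + η' := fun i => by
    by_cases hi : i ∈ s
    · obtain ⟨K, h1, h2, h3⟩ := (hT i hi).exists_isCompact_lt_add (measure_ne_top μ _) hη0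
      exact ⟨K, fun _ => ⟨h1, h2, h3.le⟩⟩
    · exact ⟨∅, fun h => absurd h hi⟩
  choose K hK using hex
  calc ∑ i ∈ s, c i * μ (T i) ≤ ∑ i ∈ s, (c i * μ (K i) + c i * η') := by
        refine sum_le_sum fun i hi => ?_
        rw [← mul_add]
        exact mul_le_mul_right (hK i hi).2.2 _
    _ = ∑ i ∈ s, c i * μ (K i) + (∑ i ∈ s, c i) * η' := by
        rw [Finset.sum_add_distrib, sum_mul]
    _ ≤ lowerKappa F A + η := by
        gcongr
        · exact sum_good_le s hg (fun i hi => (hK i hi).2.1)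
            (fun i hi => (hK i hi).1.trans (hTS i hi))
            (fun i hi j hj hij => (hd hi hj hij).mono (hK i hi).1 (hK j hj).1) A hA
            (fun i hi => (hK i hi).1.trans (hTA i hi)) hAΩ
        · calc (∑ i ∈ s, c i) * η' ≤ (∑ i ∈ s, c i + 1) * η' := by gcongr; exact le_self_add
            _ ≤ η := mul_div_le

lemma Good.iUnion [IsFiniteMeasure μ] {c : ℝ≥0∞} (hc : c ≠ ⊤) {S : ℕ → Set (E n)}
    {T : Set (E n)} (hS : ∀ k, MeasurableSet (S k)) (hg : ∀ k, Good Ω F μ c (S k))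
    (hT : μ (T \ ⋃ k, S k) = 0) : Good Ω F μ c T := by
  intro K hK hKT A hA hKA hAΩ
  have hKm := hK.isClosed.measurableSet
  have hm : ∀ k, MeasurableSet (K ∩ disjointed S k) := fun k => hKm.inter (.disjointed hS k)
  have h1 : μ K ≤ ∑' k, μ (K ∩ disjointed S k) := by
    rw [← measure_iUnion (fun i j hij => ((disjoint_disjointed S hij).mono
      inter_subset_right inter_subset_right)) hm, ← Set.inter_iUnion, iUnion_disjointed]
    calc μ K ≤ μ (K ∩ ⋃ k, S k) + μ (K \ ⋃ k, S k) := measure_le_inter_add_sdiff _ _ _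
      _ ≤ μ (K ∩ ⋃ k, S k) + μ (T \ ⋃ k, S k) := by gcongr
      _ = _ := by rw [hT, add_zero]
  calc c * μ K ≤ c * ∑' k, μ (K ∩ disjointed S k) := by gcongr
    _ = ∑' k, c * μ (K ∩ disjointed S k) := ENNReal.tsum_mul_left.symm
    _ ≤ _ := summable.tsum_le_of_sum_le fun s => sum_good_measurable_le s (fun _ _ => hc)
        (fun i _ => hg i) (fun i _ => hm i)
        (fun i _ => inter_subset_right.trans (disjointed_subset S i))
        (fun i _ j _ hij => (disjoint_disjointed S hij).mono
          inter_subset_right inter_subset_right) hA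
        (fun i _ => inter_subset_left.trans hKA) hAΩ

lemma IsPair.good_of_near (hn : 1 ≤ n) (hf : LocInt f Ω) (hF : IsApprox f Ω F)
    (h : IsPair f Ω μ σ) (he : ‖e‖ = 1) (τ : ℝ) :
    Good Ω F μ (ofReal (1 - τ) / 4) {x | ‖σ x - e‖ ≤ τ} := by
  intro K hK hKS A hA hKA hAΩ
  refine le_trans ?_ (pvar_div_four_le_lowerKappa hn hf hF hA hAΩ he)
  rw [ENNReal.mul_comm_div, ← mul_div_assoc]
  exact ENNReal.div_le_div_right (h.mul_measure_le_pvar hK hA hKA hAΩ he hKS) _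

lemma exists_dense_directions (hn : 1 ≤ n) : ∃ e : ℕ → E n, (∀ k, ‖e k‖ = 1) ∧
    ∀ v : E n, ‖v‖ = 1 → ∀ τ, 0 < τ → ∃ k, ‖v - e k‖ ≤ τ := by
  have hne : Nonempty (sphere (0 : E n) 1) :=
    ⟨⟨EuclideanSpace.single ⟨0, hn⟩ 1, by simp⟩⟩
  refine ⟨fun k => TopologicalSpace.denseSeq (sphere (0 : E n) 1) k, fun k => by
    simpa using (TopologicalSpace.denseSeq (sphere (0 : E n) 1) k).2, fun v hv τ hτ => ?_⟩
  obtain ⟨k, hk⟩ := (TopologicalSpace.denseRange_denseSeq (sphere (0 : E n) 1)).exists_dist_lt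
    (⟨v, by simpa using hv⟩ : sphere (0 : E n) 1) hτ
  refine ⟨k, ?_⟩
  rw [Subtype.dist_eq, dist_eq_norm] at hk
  exact hk.le

lemma IsPair.good_quarter (hn : 1 ≤ n) (hf : LocInt f Ω) (hF : IsApprox f Ω F)
    (h : IsPair f Ω μ σ) (hσ : StronglyMeasurable σ) : Good Ω F μ (1 / 4) univ := by
  have := h.finite
  obtain ⟨e, he, hd⟩ := exists_dense_directions hn
  have h1 : ∀ τ : ℝ, 0 < τ → Good Ω F μ (ofReal (1 - τ) / 4) univ := by
    intro τ hτ
    refine Good.iUnion (S := fun k => {x | ‖σ x - e k‖ ≤ τ}) ?_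
      (fun k => measurableSet_le (hσ.measurable.sub_const _).norm measurable_const)
      (fun k => h.good_of_near hn hf hF (he k) τ) ?_
    · exact ENNReal.div_ne_top ofReal_ne_top (by norm_num)
    · refine measure_mono_null ?_ (ae_iff.1 h.norm_eq)
      intro x hx hx1
      obtain ⟨k, hk⟩ := hd (σ x) hx1 τ hτ
      exact hx.2 (mem_iUnion.2 ⟨k, hk⟩)
  intro K hK hKS A hA hKA hAΩ
  have ht : Tendsto (fun τ : ℝ => ofReal (1 - τ) / 4 * μ K) (𝓝[>] 0)
      (𝓝 (ofReal (1 - 0) / 4 * μ K)) := by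
    refine ENNReal.Tendsto.mul_const ?_ (Or.inr (measure_ne_top _ _))
    refine ENNReal.Tendsto.div_const ?_ (Or.inr (by norm_num))
    have : Continuous fun τ : ℝ => ofReal (1 - τ) :=
      continuous_ofReal.comp (by fun_prop)
    exact (this.tendsto 0).mono_left nhdsWithin_le_nhds
  rw [sub_zero, ofReal_one] at ht
  refine le_of_tendsto ht ?_
  filter_upwards [self_mem_nhdsWithin] with τ hτ
  exact h1 τ hτ K hK hKS A hA hKA hAΩ

/-- The two-valued function jumping from `b` to `a` across the hyperplane orthogonal to `ν`. -/
def jumpFn (ν : E n) (a b : ℝ) (w : E n) : ℝ := if 0 < ⟪ν, w⟫ then a else b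

lemma measurable_jumpFn (ν : E n) (a b : ℝ) : Measurable (jumpFn ν a b) :=
  Measurable.ite (measurableSet_lt measurable_const (by fun_prop)) measurable_const
    measurable_const

/-- Points of `Ω` at which `f` is close to a fixed two-valued function at all scales up to `r₀`. -/
def nearJump (f : E n → ℝ) (Ω : Set (E n)) (ν : E n) (a b δ r₀ : ℝ) : Set (E n) :=
  {x | closedBall x r₀ ⊆ Ω ∧ ∀ r, 0 < r → r ≤ r₀ →
    ∫⁻ y in ball x r, ofReal |f y - jumpFn ν a b (y - x)| ≤
      ofReal δ * volume (ball x r)}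

lemma volume_ball_eq (x : E n) (hr : 0 < r) :
    volume (ball x r) = ofReal (r ^ n) * volume (ball (0 : E n) 1) := by
  rw [Measure.addHaar_ball_of_pos _ _ hr, finrank_euclideanSpace_fin]

lemma volume_real_ball_eq (x : E n) (hr : 0 < r) :
    volume.real (ball x r) = r ^ n * volume.real (ball (0 : E n) 1) := by
  rw [measureReal_def, volume_ball_eq x hr, toReal_mul,
    toReal_ofReal (by positivity), measureReal_def]

lemma inner_le_of_mem_nearJump (hf : LocInt f Ω) {a b : ℝ} (hδ : 0 ≤ δ)
    (hab : 2 * 4 ^ n * δ < |a - b|) {y : E n} (hx : x ∈ nearJump f Ω ν a b δ r₀)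
    (hy : y ∈ nearJump f Ω ν a b δ r₀) (hν : ‖ν‖ = 1) (hxy : dist y x ≤ r₀) :
    ⟪ν, y - x⟫ ≤ dist y x / 2 := by
  by_contra! hlt
  set d := dist y x with hd
  have hd0 : 0 < d := by
    rcases (dist_nonneg (x := y) (y := x)).eq_or_lt with h | h
    · rw [eq_comm, dist_eq_zero] at h
      rw [hd, h] at hlt; simp at hlt
    · exact h
  have hd' : ‖y - x‖ = d := (dist_eq_norm _ _).symm
  set w := (1 / 2 : ℝ) • (x + y) with hw
  have hwx : w - x = (1 / 2 : ℝ) • (y - x) := by rw [hw]; module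
  have hwy : w - y = -((1 / 2 : ℝ) • (y - x)) := by rw [hw]; module
  have hBx : ball w (d / 4) ⊆ ball x d := by
    refine ball_subset_ball' ?_
    rw [dist_eq_norm, hwx, norm_smul, hd']; norm_num; linarith
  have hBy : ball w (d / 4) ⊆ ball y d := by
    refine ball_subset_ball' ?_
    rw [dist_eq_norm, hwy, norm_neg, norm_smul, hd']; norm_num; linarith
  have hzin : ∀ z ∈ ball w (d / 4), |⟪ν, z - w⟫| < d / 4 := fun z hz => by
    refine (abs_real_inner_le_norm _ _).trans_lt ?_
    rw [hν, one_mul, ← dist_eq_norm]; exact hz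
  have hgx : ∀ z ∈ ball w (d / 4), jumpFn ν a b (z - x) = a := fun z hz => by
    have h1 := (abs_lt.1 (hzin z hz)).1
    have : ⟪ν, z - x⟫ = ⟪ν, z - w⟫ + 1 / 2 * ⟪ν, y - x⟫ := by
      rw [← real_inner_smul_right, ← hwx, ← inner_add_right]; congr 1; abel
    rw [jumpFn, if_pos (by linarith)]
  have hgy : ∀ z ∈ ball w (d / 4), jumpFn ν a b (z - y) = b := fun z hz => by
    have h1 := (abs_lt.1 (hzin z hz)).2
    have : ⟪ν, z - y⟫ = ⟪ν, z - w⟫ - 1 / 2 * ⟪ν, y - x⟫ := by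
      rw [← real_inner_smul_right, sub_eq_add_neg _ ⟪ν, _⟫, ← inner_neg_right, ← hwy,
        ← inner_add_right]; congr 1; abel
    rw [jumpFn, if_neg (by linarith)]
  have hfm : AEStronglyMeasurable f (volume.restrict (ball w (d / 4))) :=
    ((hf.integrableOn_compact_subset ((closedBall_subset_closedBall hxy).trans hx.1)
      (isCompact_closedBall _ _)).mono_set (hBx.trans ball_subset_closedBall)).aestronglyMeasurable
  have h1 : ofReal |a - b| * volume (ball w (d / 4)) ≤
      ofReal δ * volume (ball x d) + ofReal δ * volume (ball y d) := by
    calc ofReal |a - b| * volume (ball w (d / 4))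
        = ∫⁻ _ in ball w (d / 4), ofReal |a - b| := (setLIntegral_const _ _).symm
      _ ≤ ∫⁻ z in ball w (d / 4), (ofReal |f z - jumpFn ν a b (z - x)| +
            ofReal |f z - jumpFn ν a b (z - y)|) := by
          refine setLIntegral_mono_ae' measurableSet_ball (.of_forall fun z hz => ?_)
          rw [hgx z hz, hgy z hz, ← ofReal_add (abs_nonneg _) (abs_nonneg _)]
          refine ofReal_le_ofReal ?_
          rw [abs_sub_comm (f z) a]
          simpa using abs_add_le (a - f z) (f z - b)
      _ = (∫⁻ z in ball w (d / 4), ofReal |f z - jumpFn ν a b (z - x)|) +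
          ∫⁻ z in ball w (d / 4), ofReal |f z - jumpFn ν a b (z - y)| := by
          refine lintegral_add_left' ?_ _
          exact (hfm.aemeasurable.sub ((measurable_jumpFn ν a b).comp
            (measurable_id.sub_const x)).aemeasurable).abs.ennreal_ofReal
      _ ≤ _ := add_le_add ((lintegral_mono_set hBx).trans (hx.2 d hd0 hxy))
          ((lintegral_mono_set hBy).trans (hy.2 d hd0 hxy))
  rw [volume_ball_eq w (by positivity), volume_ball_eq x hd0, volume_ball_eq y hd0,
    ← mul_assoc, ← mul_assoc, ← add_mul, ENNReal.mul_le_mul_iff_left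
      (measure_ball_pos volume _ one_pos).ne' measure_ball_lt_top.ne,
    ← ofReal_mul (abs_nonneg _), ← ofReal_mul hδ, ← ofReal_add
      (by positivity) (by positivity), ofReal_le_ofReal_iff (by positivity), div_pow,
    mul_div_assoc', div_le_iff₀ (by positivity)] at h1
  have : 0 < d ^ n := by positivity
  nlinarith [mul_lt_mul_of_pos_right hab this]

lemma abs_inner_le_of_mem_nearJump (hf : LocInt f Ω) {a b : ℝ} (hδ : 0 ≤ δ)
    (hab : 2 * 4 ^ n * δ < |a - b|) {y : E n} (hx : x ∈ nearJump f Ω ν a b δ r₀)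
    (hy : y ∈ nearJump f Ω ν a b δ r₀) (hν : ‖ν‖ = 1) (hxy : dist y x ≤ r₀) :
    |⟪ν, y - x⟫| ≤ dist y x / 2 := by
  refine abs_le.2 ⟨?_, inner_le_of_mem_nearJump hf hδ hab hx hy hν hxy⟩
  have := inner_le_of_mem_nearJump hf hδ hab hy hx hν (by rwa [dist_comm])
  rw [← neg_sub, inner_neg_right, dist_comm] at this
  linarith

lemma integral_cube_halfspace_sign (b : Frame n) (ε : ℝ) (i₀ : Fin n) (hz : ⟪b i₀, z - x⟫ = 0) :
    ∫ y in cube b z ε, jumpFn (b i₀) 1 (-1) (y - x) = 0 := by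
  have h1 := (measurePreserving_sub_right volume z).setIntegral_preimage_emb
    (measurableEmbedding_subRight z) (fun w => jumpFn (b i₀) 1 (-1) w) (cube b 0 ε)
  have hpre : (fun x => x - z) ⁻¹' cube b 0 ε = cube b z ε := by
    ext x; simp [cube]
  rw [hpre] at h1
  have h2 : ∀ y, jumpFn (b i₀) 1 (-1) (y - x) = jumpFn (b i₀) 1 (-1) (y - z) := fun y => by
    have : ⟪b i₀, y - x⟫ = ⟪b i₀, y - z⟫ := by
      rw [← sub_add_sub_cancel y z x, inner_add_right, hz, add_zero]
    rw [jumpFn, jumpFn, this]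
  simp only [h2]
  rw [h1]
  have := integral_prod_cube b ε fun i t => if i = i₀ then (if 0 < t then 1 else -1) else 1
  simp only [prod_ite_eq', mem_univ, if_true] at this
  refine this.trans (prod_eq_zero (mem_univ i₀) ?_)
  simp only [if_true]
  refine Eq.trans ?_ (integral_Ioo_sign (ε / 2))
  apply integral_congr_ae
  refine ae_restrict_of_ae ?_
  filter_upwards [compl_mem_ae_iff.2 (measure_singleton (0:ℝ))] with t ht
  rcases lt_or_gt_of_ne (show t ≠ 0 from ht) with h | h
  · rw [Real.sign_of_neg h, if_neg h.not_gt]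
  · rw [Real.sign_of_pos h, if_pos h]

lemma le_osc_of_mem_nearJump (hε : 0 < ε) (hδ : 0 ≤ δ) (hx : x ∈ nearJump f Ω (b i₀) α β δ r₀)
    (hz : ⟪b i₀, z - x⟫ = 0) (hr : 0 < r) (hr₀ : r ≤ r₀) (hQ : cube b z ε ⊆ ball x r)
    (hf : IntegrableOn f (cube b z ε) volume) (hu : IntegrableOn u (cube b z ε) volume)
    (huf : ∀ᵐ y ∂volume.restrict (cube b z ε), |u y - f y| ≤ η) :
    |α - β| / 2 - η - δ * (volume.real (ball x r) / ε ^ n) ≤ osc u (cube b z ε) := by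
  set Q := cube b z ε with hQd
  have hQm : MeasurableSet Q := (isOpen_cube _ _ _).measurableSet
  have hv : volume Q ≠ ⊤ := by
    rw [volume_cube]; exact (pow_lt_top ofReal_lt_top).ne
  have hfin : IsFiniteMeasure (volume.restrict Q) := ⟨by simpa using hv.lt_top⟩
  set g : E n → ℝ := fun y => jumpFn (b i₀) α β (y - x) with hg
  set s₀ : E n → ℝ := fun y => jumpFn (b i₀) 1 (-1) (y - x) with hs₀
  set c := Real.sign (α - β) with hc
  have hcabs : |c| ≤ 1 := abs_real_sign_le _
  have hgm : Measurable g := (measurable_jumpFn _ _ _).comp (measurable_id.sub_const x)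
  have hsm : Measurable s₀ := (measurable_jumpFn _ _ _).comp (measurable_id.sub_const x)
  have hs1 : ∀ y, |s₀ y| = 1 := fun y => by
    simp only [hs₀, jumpFn]; split_ifs <;> simp
  have hs2 : ∀ y, |c * s₀ y| ≤ 1 := fun y => by rw [abs_mul, hs1, mul_one]; exact hcabs
  have hgs : ∀ y, g y * (c * s₀ y) = (α + β) / 2 * (c * s₀ y) + |α - β| / 2 := fun y => by
    have h3 : (α - β) * c = |α - β| := by
      rcases lt_trichotomy (α - β) 0 with h | h | h
      · rw [hc, Real.sign_of_neg h, abs_of_neg h]; ring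
      · rw [h]; simp
      · rw [hc, Real.sign_of_pos h, abs_of_pos h]; ring
    simp only [hg, hs₀, jumpFn]
    split_ifs <;> linear_combination h3 / 2
  have hs0 : ∫ y in Q, c * s₀ y = 0 := by
    rw [integral_const_mul, hs₀, integral_cube_halfspace_sign b ε i₀ hz, mul_zero]
  have hsi : Integrable (fun y => c * s₀ y) (volume.restrict Q) :=
    Integrable.of_bound (hsm.const_mul c).aestronglyMeasurable 1 (.of_forall hs2)
  have hgi : Integrable g (volume.restrict Q) := by
    refine Integrable.of_bound hgm.aestronglyMeasurable (max |α| |β|) (.of_forall fun y => ?_)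
    simp only [hg, jumpFn]; split_ifs <;> simp
  have hgsi : ∫ y in Q, g y * (c * s₀ y) = |α - β| / 2 * ε ^ n := by
    simp only [hgs]
    have h4 : Integrable (fun _ : E n => |α - β| / 2) (volume.restrict Q) := integrable_const _
    rw [integral_add (hsi.const_mul _) h4, integral_const_mul, hs0, setIntegral_const,
      volume_real_cube b z hε.le, smul_eq_mul]
    ring
  have hfgi : Integrable (fun y => |f y - g y|) (volume.restrict Q) := (hf.sub hgi).abs
  have hfg : ∫ y in Q, |f y - g y| ≤ δ * volume.real (ball x r) := by
    rw [integral_eq_lintegral_of_nonneg_ae (.of_forall fun _ => abs_nonneg _)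
      hfgi.aestronglyMeasurable]
    refine ENNReal.toReal_le_of_le_ofReal (by positivity) ?_
    rw [ofReal_mul hδ, ofReal_measureReal measure_ball_lt_top.ne]
    exact (lintegral_mono_set hQ).trans (hx.2 r hr hr₀)
  have hmain := le_osc_of_mul hv hu (hsm.const_mul c).aestronglyMeasurable hs2 hs0
  refine le_trans ?_ hmain
  have hbd : ∫ y in Q, (g y * (c * s₀ y) - |f y - g y| - η) ≤ ∫ y in Q, u y * (c * s₀ y) := by
    have hbi : ∀ {h : E n → ℝ}, Integrable h (volume.restrict Q) →
        Integrable (fun y => h y * (c * s₀ y)) (volume.restrict Q) := fun {h} hh => by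
      refine (hh.bdd_mul (c := 1) hsi.aestronglyMeasurable (.of_forall hs2)).congr
        (.of_forall fun y => mul_comm _ _)
    refine integral_mono_ae (((hbi hgi).sub hfgi).sub (integrable_const _)) (hbi hu) ?_
    filter_upwards [huf] with y hy
    have h5 : |(u y - g y) * (c * s₀ y)| ≤ |f y - g y| + η := by
      rw [abs_mul]
      calc _ ≤ |u y - g y| * 1 := by gcongr; exact hs2 y
        _ = |(u y - f y) + (f y - g y)| := by rw [mul_one]; ring_nf
        _ ≤ |u y - f y| + |f y - g y| := abs_add_le _ _
        _ ≤ _ := by linarith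
    have := (abs_le.1 h5).1
    nlinarith
  have hbi : Integrable (fun y => g y * (c * s₀ y)) (volume.restrict Q) :=
    (hgi.bdd_mul (c := 1) hsi.aestronglyMeasurable (.of_forall hs2)).congr
        (.of_forall fun y => mul_comm _ _)
  have hbi' : Integrable (fun y => g y * (c * s₀ y) - |f y - g y|) (volume.restrict Q) :=
    hbi.sub hfgi
  have hci : Integrable (fun _ : E n => η) (volume.restrict Q) := integrable_const _
  rw [integral_sub hbi' hci, integral_sub hbi hfgi, hgsi, setIntegral_const,
    smul_eq_mul] at hbd
  rw [volume_real_cube b z hε.le] at hbd ⊢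
  have he : 0 < ε ^ n := by positivity
  rw [← mul_le_mul_iff_right₀ he, mul_inv_cancel_left₀ he.ne']
  calc _ = |α - β| / 2 * ε ^ n - δ * volume.real (ball x r) - ε ^ n * η := by field_simp; ring
    _ ≤ _ := by
      refine le_trans ?_ hbd
      gcongr

/-- Coordinates tangential to the hyperplane orthogonal to `b i₀`. -/
def tang (b : Frame n) (i₀ : Fin n) (x : E n) : {j // j ≠ i₀} → ℝ :=
  fun j => ⟪b j, x⟫

lemma continuous_tang (b : Frame n) (i₀ : Fin n) :
    Continuous (tang b i₀) := continuous_pi fun j => by unfold tang; fun_prop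

lemma card_ne (i₀ : Fin n) : Fintype.card {j // j ≠ i₀} = n - 1 := by simp

lemma norm_le_of_forall_inner {w : E n} {c : ℝ} (h : ∀ i, |⟪b i, w⟫| ≤ c) : ‖w‖ ≤ n * c := by
  rw [← b.sum_repr' w]
  refine (norm_sum_le _ _).trans ?_
  have : ∀ i ∈ Finset.univ, ‖⟪b i, w⟫ • b i‖ ≤ c := by
    intro i _
    rw [norm_smul, b.norm_eq_one, mul_one, norm_eq_abs]
    exact h i
  simpa using Finset.sum_le_card_nsmul _ _ _ this

lemma exists_inner_eq (b : Frame n) (v : Fin n → ℝ) : ∃ z : E n, ∀ i, ⟪b i, z⟫ = v i :=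
  ⟨b.repr.symm (WithLp.toLp 2 v), fun i => by
    rw [← b.repr_apply_apply, LinearIsometryEquiv.apply_symm_apply]⟩

lemma lowerKappa_ge_of_nearJump (hf : LocInt f Ω) (hF : IsApprox f Ω F) (hδ : 0 < δ)
    (hr₀ : 0 < r₀) {P : Set (E n)} (hP : IsCompact P) (hPJ : P ⊆ nearJump f Ω (b i₀) α β δ r₀)
    (hA : IsOpen A) (hPA : P ⊆ A) (hAΩ : A ⊆ Ω) :
    ofReal (|α - β| / 2 - ((3 * n) ^ n * volume.real (ball (0 : E n) 1) + 1) * δ) *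
      volume (tang b i₀ '' P) ≤ lowerKappa F A := by
  have hn : (1:ℝ) ≤ n := by exact_mod_cast i₀.pos
  obtain ⟨ρ, hρ, hρA⟩ := hP.exists_cthickening_subset_open hA hPA
  have hcpt : IsCompact (cthickening ρ P) := hP.cthickening
  refine le_liminf_of_le (by isBoundedDefault) ?_
  have hsmall : ∀ᶠ ε in 𝓝[>] (0:ℝ), 3 * n * ε < min ρ r₀ := by
    have : Tendsto (fun ε : ℝ => 3 * n * ε) (𝓝[>] 0) (𝓝 (3 * n * 0)) :=
      ((continuous_const.mul continuous_id).tendsto 0).mono_left nhdsWithin_le_nhds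
    rw [mul_zero] at this
    exact this.eventually (gt_mem_nhds (lt_min hρ hr₀))
  filter_upwards [hF.close _ hcpt (hρA.trans hAΩ) δ hδ, hsmall, self_mem_nhdsWithin]
    with ε hclose hε hε0
  replace hε0 : 0 < ε := hε0
  set idx : E n → {j // j ≠ i₀} → ℤ := fun x j => ⌊⟪b j, x⟫ / ε⌋ with hidx
  have hz : ∀ x : E n, ∃ z : E n, ⟪b i₀, z - x⟫ = 0 ∧
      ∀ j : {j // j ≠ i₀}, ⟪b j, z⟫ = ε * (idx x j + 1 / 2) := fun x => by
    obtain ⟨z, hz⟩ := exists_inner_eq b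
      fun j => if h : j ≠ i₀ then ε * (idx x ⟨j, h⟩ + 1 / 2) else ⟪b i₀, x⟫
    refine ⟨z, ?_, fun j => ?_⟩
    · rw [inner_sub_right, hz, dif_neg (by simp), sub_self]
    · rw [hz, dif_pos j.2]
  choose ctr hctr0 hctr using hz
  have hQ : ∀ x, cube b (ctr x) ε ⊆ ball x (3 * n * ε) := fun x y hy => by
    have hle : ∀ i, |⟪b i, y - x⟫| ≤ ε := fun i => by
      have h1 := hy i
      have h2 : |⟪b i, ctr x - x⟫| ≤ ε / 2 := by
        by_cases hi : i = i₀
        · rw [hi, hctr0, abs_zero]; positivity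
        · rw [inner_sub_right, hctr x ⟨i, hi⟩]
          have h3 := Int.floor_le (⟪b i, x⟫ / ε)
          have h4 := Int.lt_floor_add_one (⟪b i, x⟫ / ε)
          rw [le_div_iff₀ hε0] at h3
          rw [div_lt_iff₀ hε0] at h4
          simp only [hidx]
          rw [abs_le]; constructor <;> nlinarith
      have h5 : ⟪b i, y - x⟫ = ⟪b i, y - ctr x⟫ + ⟪b i, ctr x - x⟫ := by
        rw [← inner_add_right]; congr 1; abel
      rw [h5]
      exact (abs_add_le _ _).trans (by linarith)
    rw [mem_ball, dist_eq_norm]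
    refine (norm_le_of_forall_inner hle).trans_lt ?_
    have : 0 < n * ε := by positivity
    linarith
  set Z : Set ({j // j ≠ i₀} → ℤ) := idx '' P with hZ
  have hx : ∀ k : Z, ∃ x, x ∈ P ∧ idx x = k := fun k => k.2
  choose pt hptP hptk using hx
  have hcov : volume (tang b i₀ '' P) ≤ ∑' _ : Z, ofReal (ε ^ (n - 1)) := by
    have h1 : tang b i₀ '' P ⊆ ⋃ k : Z, univ.pi fun j =>
        Icc (ε * (k : {j // j ≠ i₀} → ℤ) j) (ε * ((k : {j // j ≠ i₀} → ℤ) j + 1)) := by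
      rintro _ ⟨x, hx, rfl⟩
      refine mem_iUnion.2 ⟨⟨idx x, x, hx, rfl⟩, fun j _ => ?_⟩
      have h3 := Int.floor_le (⟪b j, x⟫ / ε)
      have h4 := Int.lt_floor_add_one (⟪b j, x⟫ / ε)
      rw [le_div_iff₀ hε0] at h3
      rw [div_lt_iff₀ hε0] at h4
      simp only [hidx, tang]
      constructor <;> nlinarith
    refine (measure_mono h1).trans ((measure_iUnion_le _).trans (ENNReal.tsum_le_tsum fun k => ?_))
    rw [Set.pi_univ_Icc, Real.volume_Icc_pi]
    have : ∀ j : {j // j ≠ i₀}, ε * ((k : {j // j ≠ i₀} → ℤ) j + 1) -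
      ε * (k : {j // j ≠ i₀} → ℤ) j = ε := fun j => by ring
    simp only [this, Finset.prod_const, card_univ, card_ne]
    rw [ofReal_pow hε0.le]
  set c := ofReal (|α - β| / 2 - ((3 * n) ^ n * volume.real (ball (0 : E n) 1) + 1) * δ)
    with hc
  have hosc : ∀ k, c ≤ ofReal (osc (F ε) (cube b (ctr (pt k)) ε)) := fun k => by
    have hr : 3 * n * ε ≤ r₀ := (hε.trans_le (min_le_right _ _)).le
    have hsub : cube b (ctr (pt k)) ε ⊆ cthickening ρ P := by
      refine (hQ _).trans (ball_subset_closedBall.trans ((closedBall_subset_closedBall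
        (hε.trans_le (min_le_left _ _)).le).trans (closedBall_subset_cthickening (hptP k) ρ)))
    refine ofReal_le_ofReal ?_
    refine le_trans (le_of_eq ?_) (le_osc_of_mem_nearJump hε0 hδ.le (hPJ (hptP k)) (hctr0 _)
      (by positivity) hr (hQ _) ((hf.integrableOn_compact_subset (hρA.trans hAΩ) hcpt).mono_set hsub)
      (((hF.locInt ε hε0).integrableOn_compact_subset (hρA.trans hAΩ) hcpt).mono_set hsub)
      (ae_restrict_of_ae_restrict_of_subset hsub hclose))
    rw [volume_real_ball_eq (pt k) (by positivity), mul_pow _ ε]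
    field_simp
    ring
  calc c * volume (tang b i₀ '' P) ≤ c * ∑' _ : Z, ofReal (ε ^ (n - 1)) := by gcongr
    _ = ∑' _ : Z, c * ofReal (ε ^ (n - 1)) := ENNReal.tsum_mul_left.symm
    _ ≤ kappa n ε (F ε) A := by
      refine summable.tsum_le_of_sum_le fun s => ?_
      refine le_trans ?_ (sum_osc_le_kappa hε0 s (fun _ => b) (fun k => ctr (pt k)) (F ε)
        (fun k _ => ?_) fun k _ k' _ hkk => ?_)
      · rw [mul_sum]
        refine sum_le_sum fun k _ => ?_
        rw [mul_comm]
        gcongr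
        exact hosc k
      · refine (hQ _).trans (ball_subset_closedBall.trans ((closedBall_subset_closedBall
          (hε.trans_le (min_le_left _ _)).le).trans
            ((closedBall_subset_cthickening (hptP k) ρ).trans hρA)))
      · have : ∃ j, (k : {j // j ≠ i₀} → ℤ) j ≠ (k' : {j // j ≠ i₀} → ℤ) j := by
          by_contra! h
          exact hkk (Subtype.ext (funext h))
        obtain ⟨j, hj⟩ := this
        refine disjoint_cube (i := j) ?_
        rw [inner_sub_right, hctr, hctr, hptk, hptk, ← mul_sub, add_sub_add_right_eq_sub, abs_mul,
          abs_of_pos hε0]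
        have : (1:ℝ) ≤ |((k : {j // j ≠ i₀} → ℤ) j : ℝ) - (k' : {j // j ≠ i₀} → ℤ) j| := by
          rw [← Int.cast_sub, ← Int.cast_abs]
          exact_mod_cast Int.one_le_abs (sub_ne_zero.2 hj)
        nlinarith

lemma volume_coord_box (b : Frame n) (l u : Fin n → ℝ) :
    volume (coords b ⁻¹' Icc l u) = ∏ i, ofReal (u i - l i) := by
  rw [(measurePreserving_coords b).measure_preimage measurableSet_Icc.nullMeasurableSet,
    Real.volume_Icc_pi]

lemma dist_tang_le (b : Frame n) (i₀ : Fin n) (x y : E n) :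
    dist (tang b i₀ x) (tang b i₀ y) ≤ dist x y := by
  refine (dist_pi_le_iff dist_nonneg).2 fun j => ?_
  rw [dist_eq, tang, tang, ← inner_sub_right, dist_eq_norm]
  simpa using abs_real_inner_le_norm (b j) (x - y)

lemma abs_jumpFn_sub_le (ν : E n) (a b : ℝ) (v w : E n) :
    |jumpFn ν a b v - jumpFn ν a b w| ≤ |a - b| := by
  unfold jumpFn
  split_ifs <;> simp [abs_sub_comm]

lemma lintegral_jumpFn_translate_le {t : ℝ} {x₀ : E n} (ht : 0 < t) (he : ‖e‖ = 1)
    {p : {j // j ≠ i₀} → ℝ} {S : Set (E n)} (hS : MeasurableSet S)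
    (hSp : ∀ x ∈ S, dist (tang b i₀ x) p < t / 2) :
    ∫⁻ x in S, ofReal |jumpFn (b i₀) α β (x + t • e - x₀) - jumpFn (b i₀) α β (x - x₀)| ≤
      ofReal |α - β| * ofReal (t ^ n) := by
  have hen : |⟪b i₀, e⟫| ≤ 1 := by
    refine (abs_real_inner_le_norm _ _).trans ?_
    rw [he, b.norm_eq_one, one_mul]
  set m : ℝ := ⟪b i₀, x₀⟫ + (if 0 ≤ ⟪b i₀, e⟫ then -t else 0) with hm
  set l : Fin n → ℝ := fun i => if h : i ≠ i₀ then p ⟨i, h⟩ - t / 2 else m with hl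
  set u : Fin n → ℝ := fun i => if h : i ≠ i₀ then p ⟨i, h⟩ + t / 2 else m + t with hu
  set B := coords b ⁻¹' Icc l u with hB
  have hBm : MeasurableSet B :=
    (measurePreserving_coords b).measurable measurableSet_Icc
  have hBv : volume B = ofReal (t ^ n) := by
    rw [hB, volume_coord_box]
    have : ∀ i, u i - l i = t := fun i => by
      simp only [hu, hl]; split_ifs <;> ring
    simp [this, ofReal_pow ht.le]
  rw [← hBv, ← setLIntegral_const, ← lintegral_indicator hBm, ← lintegral_indicator hS]
  refine lintegral_mono fun x => ?_
  by_cases hxS : x ∈ S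
  swap
  · rw [indicator_of_notMem hxS]; exact zero_le
  rw [indicator_of_mem hxS]
  by_cases hxB : x ∈ B
  · rw [indicator_of_mem hxB]
    exact ofReal_le_ofReal (abs_jumpFn_sub_le _ _ _ _ _)
  · rw [indicator_of_notMem hxB]
    rw [nonpos_iff_eq_zero, ofReal_eq_zero]
    have hxv : ¬ (m ≤ ⟪b i₀, x⟫ ∧ ⟪b i₀, x⟫ ≤ m + t) := fun hv => hxB <| by
      refine ⟨fun i => ?_, fun i => ?_⟩ <;> simp only [hl, hu, coords] <;> split_ifs with hi
      · have h1 := (dist_le_pi_dist (tang b i₀ x) p ⟨i, hi⟩).trans_lt (hSp x hxS)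
        rw [dist_eq, tang] at h1
        linarith [(abs_lt.1 h1).1]
      · rw [not_not.1 hi]; exact hv.1
      · have h1 := (dist_le_pi_dist (tang b i₀ x) p ⟨i, hi⟩).trans_lt (hSp x hxS)
        rw [dist_eq, tang] at h1
        linarith [(abs_lt.1 h1).2]
      · rw [not_not.1 hi]; exact hv.2
    have h2 : ⟪b i₀, x + t • e - x₀⟫ = ⟪b i₀, x⟫ + t * ⟪b i₀, e⟫ - ⟪b i₀, x₀⟫ := by
      rw [inner_sub_right, inner_add_right, real_inner_smul_right]
    have h4 : |t * ⟪b i₀, e⟫| ≤ t := by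
      rw [abs_mul, abs_of_pos ht]; nlinarith
    have h3 : (0 < ⟪b i₀, x + t • e - x₀⟫) ↔ 0 < ⟪b i₀, x - x₀⟫ := by
      rw [h2, inner_sub_right]
      obtain ⟨h5, h6⟩ := abs_le.1 h4
      by_cases hs : 0 ≤ ⟪b i₀, e⟫
      · have h7 : 0 ≤ t * ⟪b i₀, e⟫ := by positivity
        rw [hm, if_pos hs] at hxv
        constructor <;> intro h
        · by_contra! h8
          exact hxv ⟨by linarith, by linarith⟩
        · linarith
      · have h7 : t * ⟪b i₀, e⟫ ≤ 0 := mul_nonpos_of_nonneg_of_nonpos ht.le (not_le.1 hs).le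
        rw [hm, if_neg hs] at hxv
        constructor <;> intro h
        · linarith
        · by_contra! h8
          exact hxv ⟨by linarith, by linarith⟩
    simp only [jumpFn, h3, sub_self, abs_zero, le_refl]

lemma lintegral_translate_le_of_nearJump (hf : LocInt f Ω) {t : ℝ} {x₀ : E n}
    (hx₀ : x₀ ∈ nearJump f Ω (b i₀) α β δ r₀) (ht : 0 < t) (he : ‖e‖ = 1) {p : {j // j ≠ i₀} → ℝ}
    {S : Set (E n)} (hS : MeasurableSet S) (hSp : ∀ x ∈ S, dist (tang b i₀ x) p < t / 2)
    (hr : 0 < r) (hr₀ : r ≤ r₀) (hSr : ∀ x ∈ S, dist x x₀ + t < r) :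
    ∫⁻ x in S, ofReal (f (x + t • e) - f x) ≤
      ofReal |α - β| * ofReal (t ^ n) +
        2 * (ofReal δ * volume (ball x₀ r)) := by
  set h : E n → ℝ≥0∞ := fun y => ofReal |f y - jumpFn (b i₀) α β (y - x₀)| with hh
  have hSB : S ⊆ ball x₀ r := fun x hx => by
    rw [mem_ball]; linarith [hSr x hx]
  have hgm : Measurable fun y => jumpFn (b i₀) α β (y - x₀) :=
    (measurable_jumpFn _ _ _).comp (measurable_id.sub_const x₀)
  have hfm : AEStronglyMeasurable f (volume.restrict S) :=
    ((hf.integrableOn_compact_subset ((closedBall_subset_closedBall hr₀).trans hx₀.1)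
      (isCompact_closedBall _ _)).mono_set (hSB.trans ball_subset_closedBall)).aestronglyMeasurable
  have hhm : AEMeasurable h (volume.restrict S) :=
    (hfm.aemeasurable.sub hgm.aemeasurable).abs.ennreal_ofReal
  have hB := hx₀.2 r hr hr₀
  calc ∫⁻ x in S, ofReal (f (x + t • e) - f x)
      ≤ ∫⁻ x in S, (ofReal |jumpFn (b i₀) α β (x + t • e - x₀) -
          jumpFn (b i₀) α β (x - x₀)| + (h (x + t • e) + h x)) := by
        refine lintegral_mono fun x => ?_
        simp only [hh]
        rw [← ofReal_add (abs_nonneg _) (abs_nonneg _),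
          ← ofReal_add (abs_nonneg _) (by positivity)]
        refine ofReal_le_ofReal ?_
        have h1 := le_abs_self (jumpFn (b i₀) α β (x + t • e - x₀) - jumpFn (b i₀) α β (x - x₀))
        have h2 := le_abs_self (f (x + t • e) - jumpFn (b i₀) α β (x + t • e - x₀))
        have h3 := neg_abs_le (f x - jumpFn (b i₀) α β (x - x₀))
        linarith
    _ = (∫⁻ x in S, ofReal |jumpFn (b i₀) α β (x + t • e - x₀) -
          jumpFn (b i₀) α β (x - x₀)|) + ((∫⁻ x in S, h (x + t • e)) + ∫⁻ x in S, h x) := by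
        rw [lintegral_add_left, lintegral_add_right' _ hhm]
        refine (Measurable.abs ?_).ennreal_ofReal
        refine Measurable.sub ?_ hgm
        exact hgm.comp (measurable_id.add_const (t • e))
    _ ≤ ofReal |α - β| * ofReal (t ^ n) +
        ((∫⁻ y in ball x₀ r, h y) + ∫⁻ y in ball x₀ r, h y) := by
        refine add_le_add (lintegral_jumpFn_translate_le ht he hS hSp)
          (add_le_add ?_ (lintegral_mono_set hSB))
        rw [← lintegral_indicator hS, ← lintegral_indicator measurableSet_ball,
          ← lintegral_add_right_eq_self ((ball x₀ r).indicator h) (t • e)]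
        refine lintegral_mono fun x => ?_
        by_cases hx : x ∈ S
        · have : x + t • e ∈ ball x₀ r := by
            rw [mem_ball, dist_eq_norm, add_sub_right_comm]
            refine (norm_add_le _ _).trans_lt ?_
            rw [norm_smul, he, norm_of_nonneg ht.le, mul_one, ← dist_eq_norm]
            exact hSr x hx
          rw [indicator_of_mem hx, indicator_of_mem this]
        · rw [indicator_of_notMem hx]; exact zero_le
    _ ≤ _ := by rw [two_mul]; gcongr

lemma lintegral_cthickening_translate_le (hf : LocInt f Ω) {t : ℝ} {P : Set (E n)}
    (hP : IsCompact P) (hδ : 0 ≤ δ) (hαβ : 2 * 4 ^ n * δ < |α - β|)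
    (hPJ : P ⊆ nearJump f Ω (b i₀) α β δ r₀) (hPd : ∀ x ∈ P, ∀ y ∈ P, dist x y ≤ r₀) (ht : 0 < t)
    (htr : 14 * n * t ≤ r₀) (he : ‖e‖ = 1)
    (hfm : AEMeasurable (fun x => ofReal (f (x + t • e) - f x)) (volume.restrict (cthickening (2 * t) P))) :
    ∫⁻ x in cthickening (2 * t) P, ofReal (f (x + t • e) - f x) ≤
      ofReal t * (ofReal (|α - β| +
        2 * (14 * n) ^ n * volume.real (ball (0 : E n) 1) * δ) *
        volume (cthickening (4 * t) (tang b i₀ '' P))) := by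
  have hn : (1:ℝ) ≤ n := by exact_mod_cast i₀.pos
  set N := cthickening (2 * t) P with hN
  have hNm : MeasurableSet N := isClosed_cthickening.measurableSet
  set G : E n → ℝ≥0∞ := fun x => ofReal (f (x + t • e) - f x) with hG
  set D := ofReal (|α - β| + 2 * (14 * n) ^ n * volume.real (ball (0 : E n) 1) * δ)
    with hD
  have hνn : ‖b i₀‖ = 1 := b.norm_eq_one i₀
  have hnear : ∀ x ∈ N, ∃ y ∈ P, dist x y ≤ 2 * t := fun x hx => by
    rw [hN, hP.cthickening_eq_biUnion_closedBall (by positivity)] at hx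
    simpa using hx
  have hslice : ∀ p : {j // j ≠ i₀} → ℝ,
      ∫⁻ x in N, (ball p (t / 2)).indicator (fun _ => G x) (tang b i₀ x) ≤
      (cthickening (4 * t) (tang b i₀ '' P)).indicator
        (fun _ => D * ofReal (t ^ n)) p := fun p => by
    set S := N ∩ tang b i₀ ⁻¹' ball p (t / 2) with hS
    have hSm : MeasurableSet S :=
      hNm.inter ((continuous_tang b i₀).measurable measurableSet_ball)
    have heq : ∫⁻ x in N, (ball p (t / 2)).indicator (fun _ => G x) (tang b i₀ x) =
        ∫⁻ x in S, G x := by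
      have : ∀ x, (ball p (t / 2)).indicator (fun _ => G x) (tang b i₀ x) =
          (tang b i₀ ⁻¹' ball p (t / 2)).indicator G x := fun x => by
        simp only [indicator, Set.mem_preimage]
      simp only [this]
      rw [lintegral_indicator ((continuous_tang b i₀).measurable measurableSet_ball),
        Measure.restrict_restrict ((continuous_tang b i₀).measurable measurableSet_ball),
        Set.inter_comm, ← hS]
    rw [heq]
    rcases S.eq_empty_or_nonempty with hE | ⟨x, hxN, hxp⟩
    · rw [hE]; simp
    obtain ⟨x₀, hx₀P, hxx₀⟩ := hnear x hxN
    have hp : p ∈ cthickening (4 * t) (tang b i₀ '' P) := by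
      refine mem_cthickening_of_dist_le p (tang b i₀ x₀) _ _ ⟨x₀, hx₀P, rfl⟩ ?_
      have h1 := dist_triangle p (tang b i₀ x) (tang b i₀ x₀)
      have h2 : dist (tang b i₀ x) p < t / 2 := hxp
      have h3 := dist_tang_le b i₀ x x₀
      rw [dist_comm p (tang b i₀ x)] at h1
      linarith
    rw [indicator_of_mem hp]
    have hfar : ∀ y ∈ S, dist y x₀ + t < 14 * n * t := fun y hy => by
      obtain ⟨x₁, hx₁P, hyx₁⟩ := hnear y hy.1
      have h1 : dist (tang b i₀ x₁) (tang b i₀ x₀) ≤ 5 * t := by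
        have h2 : dist (tang b i₀ x) p < t / 2 := hxp
        have h3 : dist (tang b i₀ y) p < t / 2 := hy.2
        have h4 := dist_tang_le b i₀ x x₀
        have h5 := dist_tang_le b i₀ y x₁
        have h6 := dist_triangle4 (tang b i₀ x₁) (tang b i₀ y) (tang b i₀ x) (tang b i₀ x₀)
        have h7 := dist_triangle_right (tang b i₀ y) (tang b i₀ x) p
        rw [dist_comm (tang b i₀ x₁) (tang b i₀ y)] at h6
        linarith
      have h8 := abs_inner_le_of_mem_nearJump hf hδ hαβ (hPJ hx₀P) (hPJ hx₁P) hνn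
        (hPd _ hx₁P _ hx₀P)
      have h9 : dist x₁ x₀ ≤ dist x₁ x₀ / 2 + n * (5 * t) := by
        set w := x₁ - x₀ with hw
        have h10 : ‖w - ⟪b i₀, w⟫ • b i₀‖ ≤ n * (5 * t) := by
          refine norm_le_of_forall_inner (b := b) fun i => ?_
          rw [inner_sub_right, real_inner_smul_right]
          by_cases hi : i = i₀
          · rw [hi, real_inner_self_eq_norm_sq, hνn]
            simp only [one_pow, mul_one, sub_self, abs_zero]; positivity
          · rw [b.inner_eq_zero hi, mul_zero, sub_zero, hw, inner_sub_right]
            have h11 := (dist_le_pi_dist _ _ (⟨i, hi⟩ : {j // j ≠ i₀})).trans h1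
            rwa [dist_eq] at h11
        have h12 := norm_add_le (⟪b i₀, w⟫ • b i₀) (w - ⟪b i₀, w⟫ • b i₀)
        rw [add_sub_cancel, norm_smul, hνn, mul_one, norm_eq_abs] at h12
        rw [dist_eq_norm] at h8 ⊢
        linarith
      have h13 := dist_triangle y x₁ x₀
      have : t ≤ n * t := le_mul_of_one_le_left ht.le hn
      linarith
    have hmain := lintegral_translate_le_of_nearJump hf (hPJ hx₀P) ht he hSm
      (fun y hy => hy.2) (by positivity : 0 < 14 * n * t) htr hfar
    refine hmain.trans (le_of_eq ?_)
    rw [volume_ball_eq x₀ (by positivity), ← ofReal_measureReal (measure_ball_lt_top.ne), hD,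
      ← ofReal_mul (by positivity), ← ofReal_mul (by positivity),
      ← ofReal_mul (by positivity), ← ofReal_mul (by positivity), two_mul,
      ← ofReal_add (by positivity) (by positivity),
      ← ofReal_add (by positivity) (by positivity)]
    congr 1
    rw [mul_pow _ t]
    ring
  have hswap : ∫⁻ x in N, ∫⁻ p : {j // j ≠ i₀} → ℝ,
      (ball p (t / 2)).indicator (fun _ => G x) (tang b i₀ x) =
      ∫⁻ p : {j // j ≠ i₀} → ℝ, ∫⁻ x in N,
        (ball p (t / 2)).indicator (fun _ => G x) (tang b i₀ x) := by
    refine lintegral_lintegral_swap ?_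
    have hset : MeasurableSet {q : E n × ({j // j ≠ i₀} → ℝ) | dist (tang b i₀ q.1) q.2 < t / 2} :=
      (isOpen_lt (((continuous_tang b i₀).comp continuous_fst).dist continuous_snd)
        continuous_const).measurableSet
    exact (hfm.comp_fst (ν := (volume : Measure ({j // j ≠ i₀} → ℝ)))).indicator hset
  have hinner : ∀ x, ∫⁻ p : {j // j ≠ i₀} → ℝ,
      (ball p (t / 2)).indicator (fun _ => G x) (tang b i₀ x) =
      G x * ofReal (t ^ (n - 1)) := fun x => by
    have : ∀ p, (ball p (t / 2)).indicator (fun _ => G x) (tang b i₀ x) =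
        (ball (tang b i₀ x) (t / 2)).indicator (fun _ => G x) p := fun p => by
      simp only [indicator, mem_ball_comm]
    simp only [this]
    rw [lintegral_indicator measurableSet_ball, setLIntegral_const,
      Real.volume_pi_ball _ (by positivity), card_ne]
    congr 3; ring
  simp only [hinner] at hswap
  have hT : ofReal (t ^ (n - 1)) ≠ 0 := by
    rw [ne_eq, ofReal_eq_zero, not_le]; positivity
  rw [← ENNReal.mul_le_mul_iff_left hT ofReal_ne_top]
  calc (∫⁻ x in N, G x) * ofReal (t ^ (n - 1))
      = ∫⁻ x in N, G x * ofReal (t ^ (n - 1)) :=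
        (lintegral_mul_const' _ _ ofReal_ne_top).symm
    _ ≤ ∫⁻ p, (cthickening (4 * t) (tang b i₀ '' P)).indicator
        (fun _ => D * ofReal (t ^ n)) p := hswap.trans_le (lintegral_mono hslice)
    _ = D * ofReal (t ^ n) * volume (cthickening (4 * t) (tang b i₀ '' P)) := by
        rw [lintegral_indicator isClosed_cthickening.measurableSet, setLIntegral_const]
    _ = _ := by
        have : t ^ n = t * t ^ (n - 1) := by
          rw [← pow_succ', Nat.sub_add_cancel i₀.pos]
        rw [this, ofReal_mul ht.le]
        ring

lemma IsPair.mul_measure_le_of_nearJump (hf : LocInt f Ω) (hΩ : IsOpen Ω) (hp : IsPair f Ω μ σ)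
    (hr₀ : 0 < r₀) {P : Set (E n)} (hP : IsCompact P) (hδ : 0 ≤ δ) (hαβ : 2 * 4 ^ n * δ < |α - β|)
    (hPJ : P ⊆ nearJump f Ω (b i₀) α β δ r₀) (hPd : ∀ x ∈ P, ∀ y ∈ P, dist x y ≤ r₀)
    (he : ‖e‖ = 1) (hσ : ∀ x ∈ P, ‖σ x - e‖ ≤ τ) : ofReal (1 - τ) * μ P ≤ ofReal (|α - β| +
        2 * (14 * n) ^ n * volume.real (ball (0 : E n) 1) * δ) * volume (tang b i₀ '' P) := by
  have := hp.finite
  have hn : (1:ℝ) ≤ n := by exact_mod_cast i₀.pos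
  set D := ofReal (|α - β| + 2 * (14 * n) ^ n * volume.real (ball (0 : E n) 1) * δ)
    with hD
  have hPΩ : P ⊆ Ω := fun x hx => (hPJ hx).1 (mem_closedBall_self hr₀.le)
  have hT : IsCompact (tang b i₀ '' P) := hP.image (continuous_tang b i₀)
  refine ENNReal.le_of_forall_pos_le_add fun η hη _ => ?_
  obtain ⟨U, hPU, hU, hUμ⟩ := P.exists_isOpen_lt_add (μ := μ) (measure_ne_top _ _)
    (coe_pos.2 hη).ne'
  obtain ⟨ρ, hρ, hρU⟩ := hP.exists_cthickening_subset_open (hU.inter hΩ) (subset_inter hPU hPΩ)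
  set A := thickening (ρ / 2) P with hA
  have hAo : IsOpen A := isOpen_thickening
  have hAρ : A ⊆ cthickening ρ P :=
    (thickening_mono (by linarith) P).trans (thickening_subset_cthickening _ _)
  have hAΩ : A ⊆ Ω := hAρ.trans (hρU.trans inter_subset_right)
  have hmove : ∀ {x : E n} {s : ℝ}, x ∈ A → 0 ≤ s → s ≤ ρ / 2 → x + s • e ∈ U ∩ Ω :=
    fun {x s} hx h0 h1 => by
      obtain ⟨y, hy, hxy⟩ := mem_thickening_iff.1 hx
      refine hρU (mem_cthickening_of_dist_le _ y _ _ hy ?_)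
      rw [dist_eq_norm, add_sub_right_comm]
      refine (norm_add_le _ _).trans ?_
      rw [norm_smul, he, norm_of_nonneg h0, mul_one, ← dist_eq_norm]
      linarith
  refine (hp.mul_measure_le_pvar hP hAo (self_subset_thickening (by positivity) P) hAΩ he hσ).trans
    ?_
  have hlim : Tendsto (fun t : ℝ => D * volume (cthickening (4 * t) (tang b i₀ '' P)) + η)
      (𝓝[>] 0) (𝓝 (D * volume (tang b i₀ '' P) + η)) := by
    have h4 : Tendsto (fun t : ℝ => 4 * t) (𝓝[>] 0) (𝓝 0) := by
      have : Tendsto (fun t : ℝ => 4 * t) (𝓝 0) (𝓝 (4 * 0)) :=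
        (continuous_const.mul continuous_id).tendsto 0
      rw [mul_zero] at this
      exact this.mono_left nhdsWithin_le_nhds
    have h5 := (tendsto_measure_cthickening_of_isCompact (μ := volume) hT).comp h4
    exact (ENNReal.Tendsto.const_mul h5 (Or.inr ofReal_ne_top)).add_const _
  refine ge_of_tendsto hlim ?_
  have hsm : ∀ᶠ s in 𝓝[>] (0:ℝ), s ≤ ρ / 8 ∧ 14 * n * s ≤ r₀ := by
    have h1 : Tendsto (fun t : ℝ => 14 * n * t) (𝓝[>] 0) (𝓝 (14 * n * 0)) :=
      ((continuous_const.mul continuous_id).tendsto 0).mono_left nhdsWithin_le_nhds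
    rw [mul_zero] at h1
    refine Eventually.and ?_ (h1.eventually (ge_mem_nhds hr₀))
    exact nhdsWithin_le_nhds (ge_mem_nhds (by positivity))
  filter_upwards [self_mem_nhdsWithin] with s hs
  refine pvar_le_of_frequently hAo (hf.mono_set hAΩ) e (Eventually.frequently ?_)
  filter_upwards [hsm, self_mem_nhdsWithin, Ioo_mem_nhdsGT hs] with t ⟨ht1, ht2⟩ ht0 hts
  replace ht0 : 0 < t := ht0
  set N := cthickening (2 * t) P with hN
  have hcover : A ⊆ N ∪ A \ N := by rw [Set.union_sdiff_self]; exact Set.subset_union_right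
  have hNA : N ⊆ A := cthickening_subset_thickening' (by positivity) (by linarith) P
  have hfm : AEMeasurable (fun x => ofReal (f (x + t • e) - f x)) (volume.restrict N) := by
    have hA1 := locallyIntegrableOn_comp_add (h := t • e) hAo hf
      fun x hx => (hmove hx ht0.le (by linarith)).2
    exact (((hA1.sub (hf.mono_set hAΩ)).aestronglyMeasurable.aemeasurable).ennreal_ofReal).mono_set
      hNA
  have hnear := lintegral_cthickening_translate_le hf hP hδ hαβ hPJ hPd ht0 ht2 he hfm
  have hUP : IsOpen ((U ∩ Ω) \ P) := (hU.inter hΩ).sdiff hP.isClosed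
  have hfar : ∫⁻ x in A \ N, ofReal (f (x + t • e) - f x) ≤ ofReal t * η := by
    refine (lintegral_translate_le_pvar (U := (U ∩ Ω) \ P) (hAo.sdiff isClosed_cthickening)
      (hf.mono_set (sdiff_subset.trans inter_subset_right)) fun x hx θ hθ => ?_).trans ?_
    · rw [smul_smul]
      have h0 : 0 ≤ θ * t := mul_nonneg hθ.1 ht0.le
      have h1 : θ * t ≤ t := mul_le_of_le_one_left ht0.le hθ.2
      refine ⟨hmove hx.1 h0 (by linarith), fun hxP => hx.2 ?_⟩
      refine mem_cthickening_of_dist_le _ _ _ _ hxP ?_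
      rw [dist_eq_norm, sub_add_cancel_left, norm_neg, norm_smul, he, norm_of_nonneg h0]
      linarith
    · rw [pvar_smul _ _ ht0]
      gcongr
      refine (hp.pvar_le hUP (sdiff_subset.trans inter_subset_right) e).trans ?_
      calc ∫⁻ x in (U ∩ Ω) \ P, ofReal ⟪e, σ x⟫ ∂μ ≤ ∫⁻ x in (U ∩ Ω) \ P, 1 ∂μ := by
            refine lintegral_mono_ae (ae_restrict_of_ae ?_)
            filter_upwards [hp.inner_le_one he] with x hx
            rw [← ofReal_one]
            exact ofReal_le_ofReal ((le_abs_self _).trans hx)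
        _ = μ ((U ∩ Ω) \ P) := by simp
        _ ≤ μ (U \ P) := measure_mono (Set.sdiff_subset_sdiff_left inter_subset_left)
        _ ≤ η := by
            rw [measure_sdiff hPU hP.isClosed.measurableSet.nullMeasurableSet (measure_ne_top _ _)]
            exact tsub_le_iff_left.2 hUμ.le
  calc ∫⁻ x in A, ofReal (f (x + t • e) - f x)
      ≤ (∫⁻ x in N, ofReal (f (x + t • e) - f x)) +
          ∫⁻ x in A \ N, ofReal (f (x + t • e) - f x) :=
        (lintegral_mono_set hcover).trans (lintegral_union_le _ _ _)
    _ ≤ ofReal t * (D * volume (cthickening (4 * t) (tang b i₀ '' P))) +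
          ofReal t * η := add_le_add hnear hfar
    _ ≤ _ := by
        rw [← mul_add]
        gcongr
        exact cthickening_mono (by linarith [hts.2]) _

lemma volume_inner_eq_zero (hν : ‖ν‖ = 1) (x : E n) : volume {y : E n | ⟪ν, y - x⟫ = 0} = 0 := by
  have h1 : {y : E n | ⟪ν, y - x⟫ = 0} =
      (fun y => y - x) ⁻¹' ((ℝ ∙ ν)ᗮ : Submodule ℝ (E n)) := by
    ext y
    simp [Submodule.mem_orthogonal_singleton_iff_inner_right]
  rw [h1, (measurePreserving_sub_right volume x).measure_preimage
    (Submodule.closed_of_finiteDimensional _).measurableSet.nullMeasurableSet]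
  refine Measure.addHaar_submodule _ _ fun h => ?_
  have : ν ∈ (ℝ ∙ ν)ᗮ := h ▸ Submodule.mem_top
  rw [Submodule.mem_orthogonal_singleton_iff_inner_right, real_inner_self_eq_norm_sq, hν] at this
  norm_num at this

lemma isOpen_setOf_closedBall_subset (hΩ : IsOpen Ω) (r : ℝ) :
    IsOpen {x : E n | closedBall x r ⊆ Ω} := by
  refine Metric.isOpen_iff.2 fun x hx => ?_
  obtain ⟨δ, hδ, hsub⟩ := (isCompact_closedBall x r).exists_cthickening_subset_open hΩ hx
  refine ⟨δ, hδ, fun x' hx' y hy => hsub ?_⟩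
  refine mem_cthickening_of_dist_le y (y + (x - x')) _ _ ?_ ?_
  · rw [mem_closedBall, dist_eq_norm] at hy ⊢
    rwa [show y + (x - x') - x = y - x' by abel]
  · rw [dist_eq_norm, show y - (y + (x - x')) = x' - x by abel, ← dist_eq_norm]
    exact (mem_ball.1 hx').le

lemma tendsto_jumpFn {w : E n} (hw : ⟪ν, w⟫ ≠ 0) (a b : ℝ) {u : ℕ → E n}
    (hu : Tendsto u atTop (𝓝 w)) : ∀ᶠ k in atTop, jumpFn ν a b (u k) = jumpFn ν a b w := by
  have h1 : Tendsto (fun k => ⟪ν, u k⟫) atTop (𝓝 ⟪ν, w⟫) := tendsto_const_nhds.inner hu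
  rcases lt_or_gt_of_ne hw with h | h
  · filter_upwards [h1.eventually (gt_mem_nhds h)] with k hk
    rw [jumpFn, jumpFn, if_neg hk.not_gt, if_neg h.not_gt]
  · filter_upwards [h1.eventually (lt_mem_nhds h)] with k hk
    rw [jumpFn, jumpFn, if_pos hk, if_pos h]

lemma measurableSet_nearJump (hΩ : IsOpen Ω) (hf : LocInt f Ω) (hν : ‖ν‖ = 1) (a b δ r₀ : ℝ) :
    MeasurableSet (nearJump f Ω ν a b δ r₀) := by
  have hO := isOpen_setOf_closedBall_subset hΩ r₀
  suffices h : nearJump f Ω ν a b δ r₀ =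
      {x | closedBall x r₀ ⊆ Ω} ∩ closure (nearJump f Ω ν a b δ r₀) by
    rw [h]; exact hO.measurableSet.inter isClosed_closure.measurableSet
  refine Subset.antisymm (fun x hx => ⟨hx.1, subset_closure hx⟩) fun x hx => ⟨hx.1, ?_⟩
  intro r hr hr₀
  obtain ⟨u, hu, hux⟩ := mem_closure_iff_seq_limit.1 hx.2
  have hfm : AEMeasurable f (volume.restrict Ω) := hf.aestronglyMeasurable.aemeasurable
  have hB : ∀ z, closedBall z r₀ ⊆ Ω → ball z r ⊆ Ω := fun z hz =>
    (ball_subset_closedBall.trans (closedBall_subset_closedBall hr₀)).trans hz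
  set G : E n → E n → ℝ≥0∞ := fun z =>
    (ball z r).indicator fun y => ofReal |f y - jumpFn ν a b (y - z)| with hG
  have hGi : ∀ z, closedBall z r₀ ⊆ Ω → ∫⁻ y in Ω, G z y =
      ∫⁻ y in ball z r, ofReal |f y - jumpFn ν a b (y - z)| := fun z hz => by
    rw [lintegral_indicator measurableSet_ball, Measure.restrict_restrict measurableSet_ball,
      Set.inter_eq_left.2 (hB z hz)]
  have hGm : ∀ z, AEMeasurable (G z) (volume.restrict Ω) := fun z => by
    refine AEMeasurable.indicator ?_ measurableSet_ball
    refine AEMeasurable.ennreal_ofReal ?_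
    exact (hfm.sub ((measurable_jumpFn ν a b).comp (measurable_id.sub_const z)).aemeasurable).abs
  have hvol : ∀ z : E n, volume (ball z r) = volume (ball x r) := fun z => by
    rw [volume_ball_eq z hr, volume_ball_eq x hr]
  rw [← hGi x hx.1]
  have hle : ∀ᵐ y ∂volume.restrict Ω, G x y ≤ liminf (fun k => G (u k) y) atTop := by
    refine ae_restrict_of_ae ?_
    filter_upwards [measure_eq_zero_iff_ae_notMem.1 (volume_inner_eq_zero hν x)] with y hy
    by_cases hyx : y ∈ ball x r
    · have h1 : ∀ᶠ k in atTop, y ∈ ball (u k) r := by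
        have : Tendsto (fun k => dist y (u k)) atTop (𝓝 (dist y x)) := tendsto_const_nhds.dist hux
        exact this.eventually (gt_mem_nhds (mem_ball.1 hyx))
      have h2 := tendsto_jumpFn hy a b (tendsto_const_nhds.sub hux : Tendsto (fun k => y - u k) _ _)
      refine le_liminf_of_le (by isBoundedDefault) ?_
      filter_upwards [h1, h2] with k h1 h2
      simp only [hG]
      rw [indicator_of_mem h1, indicator_of_mem hyx, h2]
    · simp only [hG]
      rw [indicator_of_notMem hyx]; exact zero_le
  refine (lintegral_mono_ae hle).trans ((lintegral_liminf_le' fun k => hGm (u k)).trans ?_)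
  refine liminf_le_of_frequently_le' (Frequently.of_forall fun k => ?_)
  rw [hGi _ (hu k).1, ← hvol (u k)]
  exact (hu k).2 r hr hr₀

lemma lintegral_ofReal_abs_sub_eq (hf : IntegrableOn f A volume) (hA : volume A ≠ ⊤) (c : ℝ) :
    ∫⁻ y in A, ofReal |f y - c| =
      ofReal (⨍ y in A, |f y - c|) * volume A := by
  have hi : IntegrableOn (fun y => |f y - c|) A volume :=
    (hf.sub (integrableOn_const hA)).abs
  by_cases h0 : volume A = 0
  · rw [h0, mul_zero, Measure.restrict_eq_zero.2 h0, lintegral_zero_measure]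
  · rw [ofReal_setAverage hi (.of_forall fun _ => abs_nonneg _),
      ENNReal.div_mul_cancel h0 hA]

lemma eventually_closedBall_subset (hΩ : IsOpen Ω) (hx : x ∈ Ω) :
    ∀ᶠ r in 𝓝[>] (0:ℝ), closedBall x r ⊆ Ω := by
  obtain ⟨ρ, hρ, h⟩ := Metric.nhds_basis_closedBall.mem_iff.1 (hΩ.mem_nhds hx)
  filter_upwards [nhdsWithin_le_nhds (ge_mem_nhds hρ)] with r hr
  exact (closedBall_subset_closedBall hr).trans h

lemma nearJump_subset_approxDiscontSet (hf : LocInt f Ω) (hν : ‖ν‖ = 1) {a b : ℝ} (hab : a ≠ b)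
    (hr₀ : 0 < r₀) (hδ : 0 ≤ δ) (hδ' : 2 ^ (n + 2) * δ ≤ |a - b|) :
    nearJump f Ω ν a b δ r₀ ⊆ approxDiscontSet n f := by
  rintro x hx ⟨c, hc⟩
  have hab' : 0 < |a - b| := abs_pos.2 (sub_ne_zero.2 hab)
  have hev := hc.eventually (gt_mem_nhds (show 0 < |a - b| / 2 ^ (n + 2) by positivity))
  have hev' : ∀ᶠ r in 𝓝[>] (0:ℝ), r ≤ r₀ := nhdsWithin_le_nhds (ge_mem_nhds hr₀)
  obtain ⟨r, hr1, hr2, hr⟩ := (hev.and (hev'.and self_mem_nhdsWithin)).exists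
  replace hr : 0 < r := hr
  have hfi : IntegrableOn f (ball x r) volume :=
    (hf.integrableOn_compact_subset ((closedBall_subset_closedBall hr2).trans hx.1)
      (isCompact_closedBall _ _)).mono_set ball_subset_closedBall
  have hsub : ∀ s : ℝ, |s| = 1 → ball (x + (s * (r / 2)) • ν) (r / 2) ⊆ ball x r := fun s hs => by
    refine ball_subset_ball' ?_
    rw [dist_eq_norm, add_sub_cancel_left, norm_smul, hν, norm_eq_abs, abs_mul, hs,
      abs_of_pos (by positivity)]
    linarith
  have hin : ∀ s : ℝ, ∀ y ∈ ball (x + (s * (r / 2)) • ν) (r / 2),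
      |⟪ν, y - x⟫ - s * (r / 2)| < r / 2 := fun s y hy => by
    have h1 : ⟪ν, y - x⟫ - s * (r / 2) = ⟪ν, y - (x + (s * (r / 2)) • ν)⟫ := by
      rw [← sub_sub, inner_sub_right _ (y - x), real_inner_smul_right, real_inner_self_eq_norm_sq,
        hν]
      ring
    rw [h1]
    refine (abs_real_inner_le_norm _ _).trans_lt ?_
    rw [hν, one_mul, ← dist_eq_norm]; exact hy
  have key : ∀ s v : ℝ, |s| = 1 →
      (∀ y ∈ ball (x + (s * (r / 2)) • ν) (r / 2), jumpFn ν a b (y - x) = v) →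
      |v - c| < |a - b| / 2 := fun s v hs hv => by
    set B := ball (x + (s * (r / 2)) • ν) (r / 2) with hB
    have hav : 0 ≤ ⨍ y in ball x r, |f y - c| := integral_nonneg fun _ => abs_nonneg _
    have h1 : ofReal |v - c| * volume B ≤ ofReal (δ + ⨍ y in ball x r, |f y - c|) *
        volume (ball x r) := by
      rw [ofReal_add hδ hav, add_mul,
        ← lintegral_ofReal_abs_sub_eq hfi measure_ball_lt_top.ne c]
      refine le_trans ?_ (add_le_add_left (hx.2 r hr hr2) _)
      have hm : AEMeasurable (fun y => ofReal |f y - c|) (volume.restrict (ball x r)) :=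
        (hfi.aestronglyMeasurable.aemeasurable.sub_const c).abs.ennreal_ofReal
      rw [← lintegral_add_right' _ hm, ← setLIntegral_const]
      refine le_trans (setLIntegral_mono' measurableSet_ball fun y hy => ?_)
        (lintegral_mono_set (hsub s hs))
      rw [← ofReal_add (abs_nonneg _) (abs_nonneg _), hv y hy]
      refine ofReal_le_ofReal ?_
      rw [abs_sub_comm (f y) v]
      exact abs_sub_le _ _ _
    rw [hB, volume_ball_eq _ (half_pos hr), volume_ball_eq _ hr, ← mul_assoc, ← mul_assoc,
      ENNReal.mul_le_mul_iff_left (measure_ball_pos _ _ one_pos).ne' measure_ball_lt_top.ne,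
      ← ofReal_mul (abs_nonneg _), ← ofReal_mul (add_nonneg hδ hav),
      ofReal_le_ofReal_iff (mul_nonneg (add_nonneg hδ hav) (by positivity)), div_pow, mul_div_assoc', div_le_iff₀
      (by positivity)] at h1
    have h2 : |v - c| ≤ (δ + ⨍ y in ball x r, |f y - c|) * 2 ^ n := by
      refine le_of_mul_le_mul_right ?_ (pow_pos hr n)
      linarith
    rw [lt_div_iff₀ (by positivity)] at hr1
    rw [pow_add] at hr1 hδ'
    have h3 : (0:ℝ) < 2 ^ n := by positivity
    nlinarith
  have ha := key 1 a (by simp) fun y hy => by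
    have := (abs_lt.1 (hin 1 y hy)).1
    rw [jumpFn, if_pos (by linarith)]
  have hb := key (-1) b (by simp) fun y hy => by
    have := (abs_lt.1 (hin (-1) y hy)).2
    rw [jumpFn, if_neg (by linarith)]
  have := abs_sub_le a c b
  rw [abs_sub_comm c b] at this
  linarith

lemma volume_wedge_le (ν : E n) (hν : ‖ν‖ = 1) (x : E n) {θ : ℝ} (hθ : 0 ≤ θ) (hr : 0 ≤ r) :
    volume {y ∈ ball x r | |⟪ν, y - x⟫| ≤ θ * r} ≤ ofReal (2 ^ n * θ * r ^ n) := by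
  obtain ⟨b, i₀, hb⟩ := exists_basis_of_norm_eq_one hν
  set l : Fin n → ℝ := fun i => ⟪b i, x⟫ - if i = i₀ then θ * r else r with hl
  set u : Fin n → ℝ := fun i => ⟪b i, x⟫ + if i = i₀ then θ * r else r with hu
  have hsub : {y ∈ ball x r | |⟪ν, y - x⟫| ≤ θ * r} ⊆ coords b ⁻¹' Icc l u := by
    rintro y ⟨hy1, hy2⟩
    have h1 : ∀ i, |⟪b i, y⟫ - ⟪b i, x⟫| ≤ if i = i₀ then θ * r else r := fun i => by
      rw [← inner_sub_right]
      split_ifs with h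
      · rw [h, hb]; exact hy2
      · refine (abs_real_inner_le_norm _ _).trans ?_
        rw [b.norm_eq_one, one_mul, ← dist_eq_norm]
        exact (mem_ball.1 hy1).le
    exact ⟨fun i => by have := (abs_le.1 (h1 i)).1; simp only [hl, coords]; linarith,
      fun i => by have := (abs_le.1 (h1 i)).2; simp only [hu, coords]; linarith⟩
  refine (measure_mono hsub).trans ?_
  rw [volume_coord_box]
  have h2 : ∀ i, ofReal (u i - l i) =
      ofReal (2 * r) * (if i = i₀ then ofReal θ else 1) := fun i => by
    simp only [hu, hl]
    split_ifs
    · rw [← ofReal_mul (by positivity)]; congr 1; ring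
    · rw [mul_one]; congr 1; ring
  simp only [h2]
  rw [prod_mul_distrib, prod_ite_eq', if_pos (mem_univ _), Finset.prod_const,
    card_univ, Fintype.card_fin, ← ofReal_pow (by positivity),
    ← ofReal_mul (by positivity)]
  refine le_of_eq ?_
  congr 1
  rw [mul_pow]; ring

lemma abs_jumpFn_sub_le_of_close {w : E n} {a b a' b' θ : ℝ} (hη : 0 ≤ η) (ha : |a - a'| ≤ η)
    (hb : |b - b'| ≤ η) (hν : ‖ν - e‖ ≤ θ) (hw : ‖w‖ ≤ r) (hθ : 0 ≤ θ) :
    |jumpFn ν a b w - jumpFn e a' b' w| ≤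
      η + |a' - b'| * (if |⟪ν, w⟫| ≤ θ * r then 1 else 0) := by
  have h0 : |⟪ν, w⟫ - ⟪e, w⟫| ≤ θ * r := by
    rw [← inner_sub_left]
    exact (abs_real_inner_le_norm _ _).trans (mul_le_mul hν hw (norm_nonneg _) hθ)
  have h1 := abs_le.1 h0
  by_cases hs : |⟪ν, w⟫| ≤ θ * r
  · rw [if_pos hs, mul_one]
    refine (abs_sub_le _ (jumpFn ν a' b' w) _).trans (add_le_add ?_ ?_)
    · unfold jumpFn; split_ifs <;> assumption
    · unfold jumpFn; split_ifs <;> simp [abs_sub_comm]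
  · rw [if_neg hs, mul_zero, add_zero]
    rw [abs_le] at hs
    unfold jumpFn
    by_cases h2 : 0 < ⟪ν, w⟫
    · have h3 : 0 < ⟪e, w⟫ := by
        by_contra! h3
        exact hs ⟨by linarith, by linarith⟩
      rwa [if_pos h2, if_pos h3]
    · have h3 : ¬ 0 < ⟪e, w⟫ := fun h3 => hs ⟨by linarith, by linarith⟩
      rwa [if_neg h2, if_neg h3]

lemma lintegral_sub_jumpFn_le (f : E n → ℝ) (hν : ‖ν‖ = 1) (a b : ℝ) (x : E n) (r : ℝ) :
    ∫⁻ y in ball x r, ofReal |f y - jumpFn ν a b (y - x)| ≤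
      (∫⁻ y in {y ∈ ball x r | 0 < ⟪y - x, ν⟫}, ofReal |f y - a|) +
      ∫⁻ y in {y ∈ ball x r | ⟪y - x, ν⟫ < 0}, ofReal |f y - b| := by
  set P := {y ∈ ball x r | 0 < ⟪y - x, ν⟫} with hP
  set N := {y ∈ ball x r | ⟪y - x, ν⟫ < 0} with hN
  have hPm : MeasurableSet P := measurableSet_ball.inter
    (measurableSet_lt measurable_const (by fun_prop : Measurable fun y : E n => ⟪y - x, ν⟫))
  have hNm : MeasurableSet N := measurableSet_ball.inter
    (measurableSet_lt (by fun_prop : Measurable fun y : E n => ⟪y - x, ν⟫) measurable_const)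
  have hsub : ball x r ⊆ (P ∪ N) ∪ {y : E n | ⟪ν, y - x⟫ = 0} := fun y hy => by
    rcases lt_trichotomy ⟪y - x, ν⟫ 0 with h | h | h
    · exact Or.inl (Or.inr ⟨hy, h⟩)
    · right; rw [Set.mem_setOf_eq, real_inner_comm]; exact h
    · exact Or.inl (Or.inl ⟨hy, h⟩)
  refine (lintegral_mono_set hsub).trans ((lintegral_union_le _ _ _).trans ?_)
  rw [setLIntegral_measure_zero _ _ (volume_inner_eq_zero hν x), add_zero]
  refine (lintegral_union_le _ _ _).trans (add_le_add (le_of_eq ?_) (le_of_eq ?_))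
  · refine setLIntegral_congr_fun hPm fun y hy => ?_
    rw [jumpFn, if_pos (by rw [real_inner_comm]; exact hy.2)]
  · refine setLIntegral_congr_fun hNm fun y hy => ?_
    rw [jumpFn, if_neg (by rw [real_inner_comm]; exact hy.2.not_gt)]

lemma exists_mem_nearJump_of_mem_jumpSet (hΩ : IsOpen Ω) (hf : LocInt f Ω) {e : ℕ → E n}
    (he : ∀ v : E n, ‖v‖ = 1 → ∀ τ, 0 < τ → ∃ k, ‖v - e k‖ ≤ τ) {m : ℝ} (hm : 1 ≤ m)
    (hx : x ∈ jumpSet n f) (hxΩ : x ∈ Ω) :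
    ∃ (i k : ℕ) (a b : ℚ), a ≠ b ∧ x ∈ nearJump f Ω (e i) a b (|(a:ℝ) - b| / m) (1 / (k + 1)) := by
  obtain ⟨ν, hν, a₀, b₀, hab, hA, hB⟩ := hx
  set d := |a₀ - b₀| with hd
  have hd0 : 0 < d := abs_pos.2 (sub_ne_zero.2 hab)
  have hm0 : 0 < m := by linarith
  set η := d / (8 * m) with hη
  have hη0 : 0 < η := by positivity
  have hηd : η ≤ d / 8 := by
    rw [hη]; gcongr; linarith
  set ω := volume.real (ball (0 : E n) 1) with hω
  have hω0 : 0 < ω := toReal_pos (measure_ball_pos _ _ one_pos).ne' measure_ball_lt_top.ne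
  set θ := ω / (2 ^ n * (16 * m)) with hθ
  have hθ0 : 0 < θ := by positivity
  obtain ⟨i, hi⟩ := he ν hν θ hθ0
  obtain ⟨a, ha1, ha2⟩ := exists_rat_btwn (show a₀ - η < a₀ + η by linarith)
  obtain ⟨b, hb1, hb2⟩ := exists_rat_btwn (show b₀ - η < b₀ + η by linarith)
  have ha : |a₀ - a| ≤ η := abs_le.2 ⟨by linarith, by linarith⟩
  have hb : |b₀ - b| ≤ η := abs_le.2 ⟨by linarith, by linarith⟩
  have hdl : d / 2 ≤ |(a:ℝ) - b| := by
    have h1 := abs_sub_le a₀ a b₀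
    have h2 := abs_sub_le (a:ℝ) b b₀
    rw [abs_sub_comm (b:ℝ) b₀] at h2
    linarith
  have hdu : |(a:ℝ) - b| ≤ 2 * d := by
    have h1 := abs_sub_le (a:ℝ) a₀ b
    have h2 := abs_sub_le a₀ b₀ b
    rw [abs_sub_comm (a:ℝ) a₀] at h1
    linarith
  have hevA := hA.eventually (gt_mem_nhds hη0)
  have hevB := hB.eventually (gt_mem_nhds hη0)
  obtain ⟨ρ, hρ, hρs⟩ := mem_nhdsGT_iff_exists_Ioo_subset.1
    ((hevA.and hevB).and (eventually_closedBall_subset hΩ hxΩ))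
  obtain ⟨k, hk⟩ := exists_nat_one_div_lt (show (0:ℝ) < ρ from hρ)
  refine ⟨i, k, a, b, ?_, (hρs ⟨by positivity, hk⟩).2, fun r hr hrk => ?_⟩
  · rintro rfl
    rw [sub_self, abs_zero] at hdl; linarith
  obtain ⟨⟨h1, h2⟩, h3⟩ := hρs (⟨hr, hrk.trans_lt hk⟩ : r ∈ Ioo 0 ρ)
  have hfi : IntegrableOn f (ball x r) volume :=
    (hf.integrableOn_compact_subset h3 (isCompact_closedBall _ _)).mono_set ball_subset_closedBall
  have hpart : ∀ (S : Set (E n)) (c : ℝ), S ⊆ ball x r → ⨍ y in S, |f y - c| < η →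
      ∫⁻ y in S, ofReal |f y - c| ≤ ofReal η * volume (ball x r) :=
    fun S c hS hc => by
      rw [lintegral_ofReal_abs_sub_eq (hfi.mono_set hS)
        (ne_top_of_le_ne_top measure_ball_lt_top.ne (measure_mono hS))]
      gcongr
  have hg := (lintegral_sub_jumpFn_le f hν a₀ b₀ x r).trans
    (add_le_add (hpart _ _ (sep_subset _ _) h1) (hpart _ _ (sep_subset _ _) h2))
  set W := {y ∈ ball x r | |⟪ν, y - x⟫| ≤ θ * r} with hW
  have hWm : MeasurableSet W := measurableSet_ball.inter
    (measurableSet_le (by fun_prop : Measurable fun y : E n => |⟪ν, y - x⟫|) measurable_const)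
  have hWv : ofReal |(a:ℝ) - b| * volume W ≤ ofReal η * volume (ball x r) := by
    refine (mul_le_mul_right (volume_wedge_le ν hν x hθ0.le hr.le) _).trans ?_
    rw [volume_ball_eq x hr, ← ofReal_measureReal measure_ball_lt_top.ne, ← hω,
      ← ofReal_mul (abs_nonneg _), ← ofReal_mul (by positivity),
      ← ofReal_mul (by positivity)]
    refine ofReal_le_ofReal ?_
    calc |(a:ℝ) - b| * (2 ^ n * θ * r ^ n) ≤ 2 * d * (2 ^ n * θ * r ^ n) := by gcongr
      _ = η * (r ^ n * ω) := by rw [hθ, hη]; field_simp; ring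
  calc ∫⁻ y in ball x r, ofReal |f y - jumpFn (e i) a b (y - x)|
      ≤ ∫⁻ y in ball x r, (ofReal |f y - jumpFn ν a₀ b₀ (y - x)| +
          (ofReal η + W.indicator (fun _ => ofReal |(a:ℝ) - b|) y)) := by
        refine setLIntegral_mono' measurableSet_ball fun y hy => ?_
        have h4 : W.indicator (fun _ => ofReal |(a:ℝ) - b|) y =
            ofReal (|(a:ℝ) - b| * (if |⟪ν, y - x⟫| ≤ θ * r then 1 else 0)) := by
          by_cases h : |⟪ν, y - x⟫| ≤ θ * r
          · rw [indicator_of_mem (show y ∈ W from ⟨hy, h⟩), if_pos h, mul_one]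
          · rw [indicator_of_notMem (fun h' => h h'.2), if_neg h, mul_zero, ofReal_zero]
        rw [h4, ← ofReal_add hη0.le (by positivity),
          ← ofReal_add (abs_nonneg _) (by positivity)]
        refine ofReal_le_ofReal ((abs_sub_le _ (jumpFn ν a₀ b₀ (y - x)) _).trans ?_)
        gcongr
        refine abs_jumpFn_sub_le_of_close hη0.le ha hb hi ?_ hθ0.le
        rw [← dist_eq_norm]; exact (mem_ball.1 hy).le
    _ = (∫⁻ y in ball x r, ofReal |f y - jumpFn ν a₀ b₀ (y - x)|) +
          (ofReal η * volume (ball x r) + ofReal |(a:ℝ) - b| * volume W) := by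
        have hm2 : Measurable fun y => ofReal η +
            W.indicator (fun _ => ofReal |(a:ℝ) - b|) y :=
          (measurable_const.indicator hWm).const_add _
        rw [lintegral_add_right _ hm2, lintegral_add_left measurable_const, setLIntegral_const, lintegral_indicator hWm,
          Measure.restrict_restrict hWm, setLIntegral_const,
          Set.inter_eq_left.2 (sep_subset _ _)]
    _ ≤ (ofReal η * volume (ball x r) + ofReal η * volume (ball x r)) +
          (ofReal η * volume (ball x r) + ofReal η * volume (ball x r)) := by
        gcongr
    _ = ofReal (4 * η) * volume (ball x r) := by
        rw [← add_mul, ← add_mul, ← ofReal_add (by positivity) (by positivity),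
          ← ofReal_add (by positivity) (by positivity)]
        congr 2; ring
    _ ≤ _ := by
        gcongr
        rw [le_div_iff₀ hm0, hη]
        refine le_trans (le_of_eq ?_) hdl
        field_simp; ring

lemma volume_approxDiscontSet_inter (hΩ : IsOpen Ω) (hf : LocInt f Ω) :
    volume (approxDiscontSet n f ∩ Ω) = 0 := by
  refine measure_null_of_locally_null _ fun x hx => ?_
  obtain ⟨ρ, hρ, h⟩ := Metric.nhds_basis_closedBall.mem_iff.1 (hΩ.mem_nhds hx.2)
  set g := (closedBall x ρ).indicator f with hg
  have hgi : LocallyIntegrable g volume := by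
    refine Integrable.locallyIntegrable ?_
    rw [hg, integrable_indicator_iff measurableSet_closedBall]
    exact hf.integrableOn_compact_subset h (isCompact_closedBall _ _)
  refine ⟨_, inter_mem_nhdsWithin _ (ball_mem_nhds x hρ), ?_⟩
  have hae := (Besicovitch.vitaliFamily (volume : Measure (E n))).ae_tendsto_average_norm_sub hgi
  refine measure_mono_null ?_ (ae_iff.1 hae)
  rintro y ⟨⟨hyS, -⟩, hyB⟩ hy
  refine hyS ⟨g y, ?_⟩
  refine (hy.comp (Besicovitch.tendsto_filterAt volume y)).congr' ?_
  obtain ⟨δ, hδ, hsub⟩ := Metric.isOpen_iff.1 (isOpen_ball (x := x) (ε := ρ)) y hyB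
  filter_upwards [Ioo_mem_nhdsGT hδ] with r hr
  have h1 : closedBall y r ⊆ closedBall x ρ := (closedBall_subset_ball hr.2).trans
    (hsub.trans ball_subset_closedBall)
  have h2 : ball y r =ᵐ[volume] closedBall y r := by
    refine ae_eq_of_subset_of_measure_ge ball_subset_closedBall ?_ measurableSet_ball.nullMeasurableSet
      measure_closedBall_lt_top.ne
    rw [Measure.addHaar_closedBall _ _ hr.1.le, Measure.addHaar_ball_of_pos _ _ hr.1]
  simp only [Function.comp]
  rw [setAverage_congr h2, setAverage_eq, setAverage_eq]
  congr 1
  refine setIntegral_congr_fun measurableSet_closedBall fun z hz => ?_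
  simp only [hg, norm_eq_abs]
  rw [indicator_of_mem (h1 hz)]

def jumpRatio (n : ℕ) (m : ℝ) : ℝ :=
  (1 / 2 - ((3 * n) ^ n * volume.real (ball (0 : E n) 1) + 1) / m) /
    (1 + 2 * (14 * n) ^ n * volume.real (ball (0 : E n) 1) / m)

lemma IsPair.good_nearJump (hΩ : IsOpen Ω) (hf : LocInt f Ω) (hF : IsApprox f Ω F)
    (hp : IsPair f Ω μ σ) (hν : ‖ν‖ = 1) (he : ‖e‖ = 1) {a b m : ℝ} (hab : a ≠ b) (hr₀ : 0 < r₀)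
    (hm : 2 * 4 ^ n < m) (τ : ℝ) (q : E n) : Good Ω F μ (ofReal (1 - τ) * ofReal (jumpRatio n m))
      (nearJump f Ω ν a b (|a - b| / m) r₀ ∩ {x | ‖σ x - e‖ ≤ τ} ∩ closedBall q (r₀ / 2)) := by
  intro K hK hKS A hA hKA hAΩ
  obtain ⟨b, i₀, rfl⟩ := exists_basis_of_norm_eq_one hν
  rename_i β
  set d := |a - β| with hd
  have hd0 : 0 < d := abs_pos.2 (sub_ne_zero.2 hab)
  have hm0 : 0 < m := lt_trans (by positivity) hm
  have hKJ : K ⊆ nearJump f Ω (b i₀) a β (d / m) r₀ := fun x hx => (hKS hx).1.1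
  have hlow := lowerKappa_ge_of_nearJump hf hF (div_pos hd0 hm0) hr₀ hK hKJ hA hKA hAΩ
  have hup := hp.mul_measure_le_of_nearJump hf hΩ hr₀ hK (div_pos hd0 hm0).le ?_ hKJ
    (fun x hx y hy => ?_) he fun x hx => (hKS hx).1.2
  · refine le_trans ?_ hlow
    set C := 2 * (14 * (n:ℝ)) ^ n * volume.real (ball (0 : E n) 1) with hC
    have hC0 : 0 ≤ C := by positivity
    set L := (3 * (n:ℝ)) ^ n * volume.real (ball (0 : E n) 1) + 1 with hL
    calc ofReal (1 - τ) * ofReal (jumpRatio n m) * μ K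
        = ofReal (jumpRatio n m) * (ofReal (1 - τ) * μ K) := by ring
      _ ≤ ofReal (jumpRatio n m) * (ofReal (d + C * (d / m)) *
          volume (tang b i₀ '' K)) := by gcongr
      _ = ofReal (d / 2 - L * (d / m)) * volume (tang b i₀ '' K) := by
          rw [← mul_assoc, ← ofReal_mul' (by positivity)]
          congr 2
          have h1 : d + C * (d / m) = d * (1 + C / m) := by ring
          have h2 : 0 < 1 + C / m := by positivity
          rw [jumpRatio, ← hC, ← hL, h1, div_mul_eq_mul_div, div_eq_iff h2.ne']
          ring
  · rw [mul_div_assoc', div_lt_iff₀ hm0, mul_comm]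
    exact mul_lt_mul_of_pos_left hm hd0
  · have h1 := mem_closedBall.1 (hKS hx).2
    have h2 := mem_closedBall.1 (hKS hy).2
    linarith [dist_triangle_right x y q]

lemma Good.iUnion' [IsFiniteMeasure μ] {c : ℝ≥0∞} (hc : c ≠ ⊤) {ι : Type*} [Countable ι]
    [Nonempty ι] {S : ι → Set (E n)} {T : Set (E n)} (hS : ∀ k, MeasurableSet (S k))
    (hg : ∀ k, Good Ω F μ c (S k)) (hT : μ (T \ ⋃ k, S k) = 0) : Good Ω F μ c T := by
  obtain ⟨g, hg'⟩ := exists_surjective_nat ι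
  refine Good.iUnion hc (fun k => hS (g k)) (fun k => hg (g k)) ?_
  rwa [hg'.iUnion_comp]

/-- A Borel set containing the jump points of `f` in `Ω`, up to precision `1 / m`. -/
def jumpHull (f : E n → ℝ) (Ω : Set (E n)) (e : ℕ → E n) (m : ℝ) : Set (E n) :=
  ⋃ p : ℕ × ℕ × {q : ℚ × ℚ // q.1 ≠ q.2},
    nearJump f Ω (e p.1) p.2.2.1.1 p.2.2.1.2 (|(p.2.2.1.1 : ℝ) - p.2.2.1.2| / m) (1 / (p.2.1 + 1))

lemma measurableSet_jumpHull (hΩ : IsOpen Ω) (hf : LocInt f Ω) {e : ℕ → E n}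
    (he : ∀ k, ‖e k‖ = 1) (m : ℝ) : MeasurableSet (jumpHull f Ω e m) :=
  MeasurableSet.iUnion fun p => measurableSet_nearJump hΩ hf (he _) _ _ _ _

lemma jumpHull_subset (hf : LocInt f Ω) {e : ℕ → E n} (he : ∀ k, ‖e k‖ = 1) {m : ℝ}
    (hm : 2 ^ (n + 2) ≤ m) : jumpHull f Ω e m ⊆ approxDiscontSet n f ∩ Ω := by
  have hm0 : 0 < m := lt_of_lt_of_le (by positivity) hm
  refine Set.iUnion_subset fun p => subset_inter ?_ fun x hx =>
    hx.1 (mem_closedBall_self (by positivity))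
  refine nearJump_subset_approxDiscontSet hf (he _) ?_ (by positivity) (by positivity) ?_
  · exact_mod_cast p.2.2.2
  · rw [mul_div_assoc', div_le_iff₀ hm0, mul_comm]
    gcongr

lemma subset_jumpHull (hΩ : IsOpen Ω) (hf : LocInt f Ω) {e : ℕ → E n}
    (he : ∀ v : E n, ‖v‖ = 1 → ∀ τ, 0 < τ → ∃ k, ‖v - e k‖ ≤ τ) {m : ℝ} (hm : 1 ≤ m) :
    jumpSet n f ∩ Ω ⊆ jumpHull f Ω e m := by
  rintro x ⟨hx, hxΩ⟩
  obtain ⟨i, k, a, b, hab, h⟩ := exists_mem_nearJump_of_mem_jumpSet hΩ hf he hm hx hxΩ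
  exact mem_iUnion.2 ⟨(i, k, ⟨(a, b), hab⟩), h⟩

lemma IsPair.good_jumpHull (hΩ : IsOpen Ω) (hf : LocInt f Ω) (hF : IsApprox f Ω F)
    (hp : IsPair f Ω μ σ) (hσ : StronglyMeasurable σ) {e : ℕ → E n} (he : ∀ k, ‖e k‖ = 1)
    (hd : ∀ v : E n, ‖v‖ = 1 → ∀ τ, 0 < τ → ∃ k, ‖v - e k‖ ≤ τ) {m : ℝ} (hm : 2 * 4 ^ n < m)
    (hτ : 0 < τ) : Good Ω F μ (ofReal (1 - τ) * ofReal (jumpRatio n m)) (jumpHull f Ω e m) := by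
  have := hp.finite
  have : Nonempty {q : ℚ × ℚ // q.1 ≠ q.2} := ⟨⟨(0, 1), by norm_num⟩⟩
  refine Good.iUnion' (ι := (ℕ × ℕ × {q : ℚ × ℚ // q.1 ≠ q.2}) × ℕ × ℕ)
    (mul_ne_top ofReal_ne_top ofReal_ne_top)
    (S := fun p => nearJump f Ω (e p.1.1) p.1.2.2.1.1 p.1.2.2.1.2
      (|(p.1.2.2.1.1 : ℝ) - p.1.2.2.1.2| / m) (1 / (p.1.2.1 + 1)) ∩ {x | ‖σ x - e p.2.1‖ ≤ τ} ∩
      closedBall (TopologicalSpace.denseSeq (E n) p.2.2) (1 / (p.1.2.1 + 1) / 2))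
    (fun p => ?_) (fun p => ?_) ?_
  · exact ((measurableSet_nearJump hΩ hf (he _) _ _ _ _).inter
      (measurableSet_le (hσ.measurable.sub_const _).norm measurable_const)).inter
      measurableSet_closedBall
  · exact hp.good_nearJump hΩ hf hF (he _) (he _) (by exact_mod_cast p.1.2.2.2) (by positivity) hm _ _
  · refine measure_mono_null ?_ (ae_iff.1 hp.norm_eq)
    rintro x ⟨hx, hx'⟩ hx1
    obtain ⟨p, hxp⟩ := mem_iUnion.1 hx
    obtain ⟨j, hj⟩ := hd (σ x) hx1 τ hτ
    obtain ⟨k, hk⟩ := (TopologicalSpace.denseRange_denseSeq (E n)).exists_dist_lt x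
      (show (0:ℝ) < 1 / (p.2.1 + 1) / 2 by positivity)
    exact hx' (mem_iUnion.2 ⟨(p, j, k), ⟨hxp, hj⟩, hk.le⟩)

lemma isApprox_of_eLpNorm (h1 : ∀ ε, 0 < ε → LocInt (F ε) Ω)
    (h2 : ∀ K, IsCompact K → K ⊆ Ω → Tendsto (fun ε => eLpNorm (fun x => F ε x - f x) ⊤ (volume.restrict K)) (𝓝[>] (0:ℝ)) (𝓝 0)) :
    IsApprox f Ω F := by
  refine ⟨h1, fun K hK hKΩ δ hδ => ?_⟩
  filter_upwards [(h2 K hK hKΩ).eventually (gt_mem_nhds (ofReal_pos.2 hδ))] with ε hε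
  have := ae_le_eLpNormEssSup (f := fun x => F ε x - f x) (μ := volume.restrict K)
  filter_upwards [this] with x hx
  rw [eLpNorm_exponent_top] at hε
  have h3 := hx.trans hε.le
  rw [Real.enorm_eq_ofReal_abs, ofReal_le_ofReal_iff hδ.le] at h3
  exact h3

lemma tendsto_jumpRatio (n : ℕ) : Tendsto (jumpRatio n) atTop (𝓝 (1 / 2)) := by
  have h (c : ℝ) : Tendsto (fun m : ℝ => c / m) atTop (𝓝 0) := tendsto_const_nhds.div_atTop tendsto_id
  have := ((tendsto_const_nhds (x := (1 / 2 : ℝ))).sub (h ((3 * n) ^ n * volume.real (ball (0 : E n) 1)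
    + 1))).div ((tendsto_const_nhds (x := (1 : ℝ))).add (h (2 * (14 * n) ^ n *
    volume.real (ball (0 : E n) 1)))) (by norm_num)
  rw [sub_zero, add_zero, div_one] at this
  exact this

lemma IsVariationPair.le_lowerKappa (hn : 1 ≤ n) (hΩ : IsOpen Ω) (hf : LocInt f Ω)
    (hF : IsApprox f Ω F) (hp : IsVariationPair n f Ω μ σ) :
    volume.withDensity (μ.rnDeriv volume) Ω / 4 +
      μ.singularPart volume (Ω \ approxDiscontSet n f) / 4 +
      μ.singularPart volume (jumpSet n f ∩ Ω) / 2 ≤ lowerKappa F Ω := by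
  obtain ⟨σ', hσ', hp'⟩ := (IsVariationPair.isPair hp).exists_stronglyMeasurable
  have := hp'.finite
  obtain ⟨e, he, hd⟩ := exists_dense_directions hn
  set s := μ.singularPart volume with hs
  set a := volume.withDensity (μ.rnDeriv volume) with ha
  have hμ : μ = s + a := Measure.haveLebesgueDecomposition_add μ volume
  have key : ∀ m : ℝ, 2 * 4 ^ n < m → a Ω / 4 + s (Ω \ approxDiscontSet n f) / 4 +
      ofReal (1 - 1 / m) * ofReal (jumpRatio n m) * s (jumpSet n f ∩ Ω) ≤
      lowerKappa F Ω := fun m hm => by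
    have h2n : (2:ℝ) ^ (n + 2) ≤ m := by
      refine le_trans ?_ hm.le
      rw [show (4:ℝ) = 2 * 2 by norm_num, mul_pow, pow_add]
      have h1 : (2:ℝ) ≤ 2 ^ n := by
        simpa using pow_le_pow_right₀ (one_le_two : (1:ℝ) ≤ 2) hn
      nlinarith
    have hm1 : 1 ≤ m := le_trans (one_le_pow₀ one_le_two) h2n
    set J := jumpHull f Ω e m with hJ
    have hJm : MeasurableSet J := measurableSet_jumpHull hΩ hf he m
    have hJS : J ⊆ approxDiscontSet n f ∩ Ω := jumpHull_subset hf he h2n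
    have hJ0 : volume J = 0 := measure_mono_null hJS (volume_approxDiscontSet_inter hΩ hf)
    have hsum := sum_good_measurable_le (Ω := Ω) (F := F) (μ := μ) (Finset.univ : Finset Bool)
      (c := fun i => if i then ofReal (1 - 1 / m) * ofReal (jumpRatio n m) else 1 / 4)
      (S := fun i => if i then J else univ) (T := fun i => if i then J else Ω \ J) ?_ ?_ ?_ ?_ ?_
      hΩ ?_ subset_rfl
    · rw [Fintype.sum_bool, add_comm] at hsum
      simp only [if_true, Bool.false_eq_true, if_false] at hsum
      refine le_trans ?_ hsum
      have h1 : a Ω ≤ a (Ω \ J) := by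
        rw [measure_sdiff_null (withDensity_absolutelyContinuous _ _ hJ0)]
      have h2 : s (Ω \ approxDiscontSet n f) ≤ s (Ω \ J) :=
        measure_mono (Set.sdiff_subset_sdiff_right fun x hx => (hJS hx).1)
      have h3 : a (Ω \ J) + s (Ω \ J) = μ (Ω \ J) := by
        conv_rhs => rw [hμ]
        rw [Measure.add_apply, add_comm]
      have h4 : s (jumpSet n f ∩ Ω) ≤ μ J :=
        (measure_mono (subset_jumpHull hΩ hf hd hm1)).trans (Measure.singularPart_le μ volume J)
      rw [← ENNReal.add_div, mul_comm _ (μ (Ω \ J)), mul_one_div, ← h3]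
      gcongr
    · rintro (_ | _) _
      · simp
      · simpa using mul_ne_top ofReal_ne_top ofReal_ne_top
    · rintro (_ | _) _
      · simpa using hp'.good_quarter hn hf hF hσ'
      · simpa using hp'.good_jumpHull hΩ hf hF hσ' he hd hm (by positivity)
    · rintro (_ | _) _
      · simpa using hΩ.measurableSet.diff hJm
      · simpa using hJm
    · rintro (_ | _) _ <;> simp
    · rintro (_ | _) - (_ | _) - h
      · exact absurd rfl h
      · simpa [onFun] using Set.disjoint_sdiff_left
      · simpa [onFun] using Set.disjoint_sdiff_right
      · exact absurd rfl h
    · rintro (_ | _) _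
      · simpa using sdiff_subset
      · exact fun x (hx : x ∈ J) => (hJS hx).2
  have hlim : Tendsto (fun m : ℝ => a Ω / 4 + s (Ω \ approxDiscontSet n f) / 4 +
      ofReal (1 - 1 / m) * ofReal (jumpRatio n m) * s (jumpSet n f ∩ Ω)) atTop
      (𝓝 (a Ω / 4 + s (Ω \ approxDiscontSet n f) / 4 +
        ofReal (1 - 0) * ofReal (1 / 2) * s (jumpSet n f ∩ Ω))) := by
    refine tendsto_const_nhds.add (ENNReal.Tendsto.mul_const ?_ (Or.inr (measure_ne_top _ _)))
    refine ENNReal.Tendsto.mul ?_ (Or.inr ofReal_ne_top) ?_ (Or.inr ofReal_ne_top)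
    · exact (continuous_ofReal.tendsto _).comp
        (tendsto_const_nhds.sub (tendsto_const_nhds.div_atTop tendsto_id))
    · exact (continuous_ofReal.tendsto _).comp (tendsto_jumpRatio n)
  rw [sub_zero, ofReal_one, one_mul, ofReal_div_of_pos two_pos, ofReal_one,
    ofReal_ofNat, mul_comm (1 / 2 : ℝ≥0∞), mul_one_div] at hlim
  refine le_of_tendsto hlim ?_
  filter_upwards [eventually_gt_atTop (2 * 4 ^ n : ℝ)] with m hm
  exact key m hm

lemma le_lowerKappa (hn : 1 ≤ n) (hΩ : IsOpen Ω) (hf : LocInt f Ω) (hF : IsApprox f Ω F) :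
    absVar n f Ω / 4 + cantorVar n f Ω / 4 + jumpVar n f Ω / 2 ≤ lowerKappa F Ω := by
  by_cases hK : lowerKappa F Ω = ⊤
  · rw [hK]; exact le_top
  obtain ⟨μ, σ, hp⟩ := exists_isPair_of_lowerKappa hn hΩ hf hF hK
  have h : ∃ p : Measure (E n) × (E n → E n), IsVariationPair n f Ω p.1 p.2 :=
    ⟨(μ, σ), hp.isVariationPair hf⟩
  rw [absVar, cantorVar, jumpVar, dif_pos h, dif_pos h, dif_pos h]
  exact IsVariationPair.le_lowerKappa hn hΩ hf hF h.choose_spec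

open ProbabilityTheory in
lemma lintegral_abs_gaussianReal :
    ∫⁻ x, ofReal |x| ∂gaussianReal 0 1 = ofReal (2 * (√(2 * Real.pi))⁻¹) := by
  have h1 : Integrable (fun x : ℝ => |x|) (gaussianReal 0 1) := by
    simpa using ((memLp_id_gaussianReal (μ := 0) (v := 1) 1).integrable (by simp)).abs
  rw [← ofReal_integral_eq_lintegral_ofReal h1 (.of_forall fun _ => abs_nonneg _),
    integral_gaussianReal_eq_integral_smul one_ne_zero]
  congr 1
  have h2 := integral_comp_abs (f := fun x : ℝ => (√(2 * Real.pi))⁻¹ * (x * exp (-x ^ 2 / 2)))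
  have h3 := integral_rpow_mul_exp_neg_mul_rpow (p := 2) (q := 1) (b := 1 / 2) two_pos
    (by norm_num) (by norm_num)
  simp only [integral_const_mul] at h2
  have h4 : ∫ x in Ioi (0:ℝ), x * exp (-x ^ 2 / 2) = 1 := by
    rw [show (1 + 1 : ℝ) / 2 = 1 by norm_num, Real.Gamma_one] at h3
    calc _ = ∫ x in Ioi (0:ℝ), x ^ (1:ℝ) * exp (-(1 / 2) * x ^ (2:ℝ)) := by
          congr 1
          ext x
          rw [Real.rpow_one, Real.rpow_two]
          congr 2
          ring
      _ = 1 := by rw [h3, show -((1:ℝ) + 1) / 2 = -1 by norm_num, Real.rpow_neg_one]; norm_num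
  rw [h4] at h2
  rw [← mul_one (√(2 * Real.pi))⁻¹, ← h2, ← integral_const_mul]
  refine integral_congr_ae (.of_forall fun x => ?_)
  simp only [gaussianPDFReal, NNReal.coe_one, smul_eq_mul, sub_zero, sq_abs, mul_one]
  ring

open ProbabilityTheory in
lemma lintegral_abs_inner_stdGaussian_le (a : E n) : ∫⁻ y, ofReal |⟪a, y⟫| ∂stdGaussian (E n) =
      ofReal (2 * (√(2 * Real.pi))⁻¹ * ‖a‖) := by
  have h1 : (stdGaussian (E n)).map (innerSL ℝ a) = (gaussianReal 0 1).map (fun x => ‖a‖ * x) := by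
    rw [IsGaussian.map_eq_gaussianReal, variance_dual_stdGaussian, integral_strongDual_stdGaussian,
      gaussianReal_map_const_mul, innerSL_apply_norm, mul_zero, mul_one]
    congr 1
    ext
    simp
  have h2 : Measurable fun x : ℝ => ofReal |x| := by fun_prop
  calc _ = ∫⁻ x, ofReal |x| ∂((stdGaussian (E n)).map (innerSL ℝ a)) := by
        rw [lintegral_map h2 (innerSL ℝ a).continuous.measurable]; rfl
    _ = ∫⁻ x, ofReal ‖a‖ * ofReal |x| ∂gaussianReal 0 1 := by
        rw [h1, lintegral_map h2 (by fun_prop)]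
        refine lintegral_congr fun x => ?_
        rw [abs_mul, abs_norm, ofReal_mul (norm_nonneg _)]
    _ = _ := by
        rw [lintegral_const_mul _ h2, lintegral_abs_gaussianReal,
          ← ofReal_mul (norm_nonneg _), mul_comm]

/-- The standard normal distribution function. -/
def normalCdf (t : ℝ) : ℝ := ∫ s in Set.Iic t, ProbabilityTheory.gaussianPDFReal 0 1 s

open ProbabilityTheory in
lemma hasDerivAt_normalCdf (t : ℝ) : HasDerivAt normalCdf (gaussianPDFReal 0 1 t) t := by
  have hc : Continuous (gaussianPDFReal 0 1) := by unfold gaussianPDFReal; fun_prop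
  have h1 : normalCdf = fun t => normalCdf 0 + ∫ s in (0:ℝ)..t, gaussianPDFReal 0 1 s := by
    ext t
    have := intervalIntegral.integral_Iic_sub_Iic (μ := volume) (a := 0) (b := t)
      (integrable_gaussianPDFReal 0 1).integrableOn (integrable_gaussianPDFReal 0 1).integrableOn
    rw [← this, normalCdf, normalCdf]; ring
  rw [h1]
  exact (intervalIntegral.integral_hasDerivAt_right (hc.intervalIntegrable _ _)
    (hc.stronglyMeasurableAtFilter _ _) hc.continuousAt).const_add _

lemma normalCdf_eq (t : ℝ) :
    normalCdf t = ProbabilityTheory.cdf (ProbabilityTheory.gaussianReal 0 1) t := by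
  rw [ProbabilityTheory.cdf_eq_real, measureReal_def,
    ProbabilityTheory.gaussianReal_apply_eq_integral _ one_ne_zero, toReal_ofReal, normalCdf]
  exact integral_nonneg fun _ => ProbabilityTheory.gaussianPDFReal_nonneg _ _ _

lemma strictMono_normalCdf : StrictMono normalCdf :=
  strictMono_of_deriv_pos fun t => by
    rw [(hasDerivAt_normalCdf t).deriv]; exact ProbabilityTheory.gaussianPDFReal_pos _ _ _ one_ne_zero

lemma range_normalCdf : range normalCdf = Ioo 0 1 := by
  have h0 : Tendsto normalCdf atBot (𝓝 0) := by
    rw [funext normalCdf_eq]; exact ProbabilityTheory.tendsto_cdf_atBot _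
  have h1 : Tendsto normalCdf atTop (𝓝 1) := by
    rw [funext normalCdf_eq]; exact ProbabilityTheory.tendsto_cdf_atTop _
  refine Subset.antisymm ?_ fun y hy => ?_
  · rintro _ ⟨t, rfl⟩
    constructor
    · refine lt_of_le_of_lt ?_ (strictMono_normalCdf (sub_one_lt t))
      exact le_of_tendsto h0 ((eventually_le_atBot _).mono fun s hs => strictMono_normalCdf.monotone hs)
    · refine lt_of_lt_of_le (strictMono_normalCdf (lt_add_one t)) ?_
      exact ge_of_tendsto h1 ((eventually_ge_atTop _).mono fun s hs => strictMono_normalCdf.monotone hs)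
  · obtain ⟨a, ha⟩ := (h0.eventually (gt_mem_nhds hy.1)).exists
    obtain ⟨b, hb⟩ := (h1.eventually (lt_mem_nhds hy.2)).exists
    have hab : a ≤ b := strictMono_normalCdf.le_iff_le.1 (ha.trans hb).le
    obtain ⟨t, -, ht⟩ := intermediate_value_Icc hab
      (fun t _ => (hasDerivAt_normalCdf t).continuousAt.continuousWithinAt) ⟨ha.le, hb.le⟩
    exact ⟨t, ht⟩

open ProbabilityTheory in
lemma gaussianReal_map_normalCdf (c : ℝ) (hε : 0 < ε) :
    (gaussianReal 0 1).map (fun t => c + ε * (normalCdf t - 1 / 2)) =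
      ofReal ε⁻¹ • volume.restrict (Ioo (c - ε / 2) (c + ε / 2)) := by
  set ψ : ℝ → ℝ := fun t => c + ε * (normalCdf t - 1 / 2) with hψ
  have hd (t : ℝ) : HasDerivAt ψ (ε * gaussianPDFReal 0 1 t) t :=
    (((hasDerivAt_normalCdf t).sub_const _).const_mul ε).const_add c
  have hm : Monotone ψ := fun s t h => by
    have := strictMono_normalCdf.monotone h
    simp only [hψ]; gcongr
  have hψm : Measurable ψ := hm.measurable
  ext s hs
  have himg : ψ '' (ψ ⁻¹' s) = s ∩ Ioo (c - ε / 2) (c + ε / 2) := by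
    rw [Set.image_preimage_eq_inter_range]
    congr 1
    ext y
    have : y ∈ Ioo (c - ε / 2) (c + ε / 2) ↔ (y - c) / ε + 1 / 2 ∈ Ioo (0:ℝ) 1 := by
      obtain ⟨w, rfl⟩ : ∃ w, y = c + ε * w := ⟨(y - c) / ε, by field_simp; ring⟩
      rw [add_sub_cancel_left, mul_div_cancel_left₀ _ hε.ne', mem_Ioo, mem_Ioo]
      constructor <;> rintro ⟨h, h'⟩ <;> constructor <;> nlinarith
    rw [this, ← range_normalCdf]
    refine exists_congr fun t => ?_
    simp only [hψ]
    rw [← sub_eq_iff_eq_add, eq_div_iff hε.ne', eq_sub_iff_add_eq]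
    constructor <;> intro h <;> linarith
  rw [Measure.map_apply hψm hs, Measure.smul_apply, Measure.restrict_apply hs, ← himg,
    ← lintegral_deriv_eq_volume_image_of_monotoneOn (hψm hs) (fun t _ => (hd t).hasDerivWithinAt)
      (hm.monotoneOn _), gaussianReal_apply _ one_ne_zero, smul_eq_mul,
    ← lintegral_const_mul _ (by fun_prop)]
  refine lintegral_congr fun t => ?_
  rw [← ofReal_mul (by positivity), inv_mul_cancel_left₀ hε.ne']
  rfl

/-- The transport map from the standard Gaussian to the uniform distribution on a cube. -/
def cubeMap (b : Frame n) (z : E n) (ε : ℝ) (x : E n) : E n :=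
  ∑ i, (⟪b i, z⟫ + ε * (normalCdf (x i) - 1 / 2)) • b i

lemma hasFDerivAt_cubeMap (b : Frame n) (z : E n) (ε : ℝ) (x : E n) :
    HasFDerivAt (cubeMap b z ε) (∑ i, ((ε * ProbabilityTheory.gaussianPDFReal 0 1 (x i)) •
      (proj i : E n →L[ℝ] ℝ)).smulRight (b i)) x := by
  refine HasFDerivAt.fun_sum fun i _ => HasFDerivAt.smul_const ?_ _
  rw [mul_smul]
  refine HasFDerivAt.const_add _ (HasFDerivAt.const_mul (HasFDerivAt.sub_const _ ?_) _)
  exact (hasDerivAt_normalCdf (x i)).comp_hasFDerivAt x (proj i : E n →L[ℝ] ℝ).hasFDerivAt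

open ProbabilityTheory in
lemma stdGaussian_map_cubeMap (b : Frame n) (z : E n) (hε : 0 < ε) :
    (stdGaussian (E n)).map (cubeMap b z ε) =
      ofReal ε⁻¹ ^ n • volume.restrict (cube b z ε) := by
  have hc : Continuous (cubeMap b z ε) := continuous_iff_continuousAt.2 fun x =>
    (hasFDerivAt_cubeMap b z ε x).continuousAt
  have hψ (i : Fin n) : Measurable fun t => ⟪b i, z⟫ + ε * (normalCdf t - 1 / 2) := by
    have := strictMono_normalCdf.monotone.measurable; fun_prop
  have h1 : ((stdGaussian (E n)).map (cubeMap b z ε)).map (coords b) =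
      (ofReal ε⁻¹ ^ n • volume.restrict (cube b z ε)).map (coords b) := by
    rw [Measure.map_map (measurableEmbedding_coords b).measurable hc.measurable,
      ← map_pi_eq_stdGaussian, Measure.map_map
      ((measurableEmbedding_coords b).measurable.comp hc.measurable) (by fun_prop), Measure.map_smul,
      cube_eq_preimage, (measurePreserving_coords b).restrict_preimage
        (MeasurableSet.univ_pi fun _ => measurableSet_Ioo) |>.map_eq]
    have h2 : (coords b ∘ cubeMap b z ε) ∘ WithLp.toLp 2 = fun (y : Fin n → ℝ) i =>
        ⟪b i, z⟫ + ε * (normalCdf (y i) - 1 / 2) := by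
      funext y i
      simp only [Function.comp, coords, cubeMap]
      rw [inner_sum, Finset.sum_eq_single i]
      · rw [real_inner_smul_right, real_inner_self_eq_norm_sq, b.norm_eq_one]; ring
      · intro j _ hj
        rw [real_inner_smul_right, b.inner_eq_zero hj.symm, mul_zero]
      · simp
    rw [h2, Measure.pi_map_pi (fun i => (hψ i).aemeasurable)]
    simp_rw [gaussianReal_map_normalCdf _ hε]
    have (i : Fin n) : SigmaFinite (ofReal ε⁻¹ •
      (volume : Measure ℝ).restrict (Ioo (⟪b i, z⟫ - ε / 2) (⟪b i, z⟫ + ε / 2))) := by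
      have := Measure.smul_finite ((volume : Measure ℝ).restrict
        (Ioo (⟪b i, z⟫ - ε / 2) (⟪b i, z⟫ + ε / 2))) (c := ofReal ε⁻¹) ofReal_ne_top
      infer_instance
    refine Measure.pi_eq fun s hs => ?_
    rw [Measure.smul_apply, volume_pi, Measure.restrict_pi_pi, Measure.pi_pi]
    simp [prod_mul_distrib]
  have := congrArg (Measure.comap (coords b)) h1
  rwa [(measurableEmbedding_coords b).comap_map, (measurableEmbedding_coords b).comap_map] at this

/-- The distributional gradient of `u` on `Ω` is the measure `g μ`. -/
structure HasDens (u : E n → ℝ) (Ω : Set (E n)) (μ : Measure (E n)) (g : E n → E n) : Prop where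
  int : Integrable g μ
  integral_eq : ∀ φ, IsTest Ω φ → ∀ e,
    ∫ x, u x * fderiv ℝ φ x e = - ∫ x, φ x * ⟪e, g x⟫ ∂μ

section HasDens
variable {g g' : E n → E n}

lemma IsPair.integrable (hp : IsPair u Ω μ σ) : Integrable σ μ := by
  have := hp.finite
  exact Integrable.mono' (integrable_const 1) hp.aesm (hp.norm_eq.mono fun x hx => hx.le)

lemma IsPair.hasDens (hp : IsPair u Ω μ σ) : HasDens u Ω μ σ := ⟨hp.integrable, hp.integral_eq⟩

lemma HasDens.mono (h : HasDens u Ω μ g) (hU : U ⊆ Ω) : HasDens u U μ g :=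
  ⟨h.int, fun φ hφ => h.integral_eq φ (hφ.mono hU)⟩

lemma HasDens.congr (h : HasDens u Ω μ g) (huv : ∀ x ∈ Ω, v x = u x) : HasDens v Ω μ g := by
  refine ⟨h.int, fun φ hφ e => ?_⟩
  rw [← h.integral_eq φ hφ e]
  refine integral_congr_ae (.of_forall fun x => ?_)
  by_cases hx : x ∈ Ω
  · simp only [huv x hx]
  · simp only [hφ.fderiv_eq_zero hx, mul_zero]

lemma HasDens.integrable_mul_inner (h : HasDens u Ω μ g) (hφ : IsTest Ω φ) (e : E n) :
    Integrable (fun x => φ x * ⟪e, g x⟫) μ := by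
  obtain ⟨C, hC⟩ := hφ.2.exists_bound_of_continuous hφ.continuous
  exact (h.int.const_inner e).bdd_mul (c := C) hφ.continuous.aestronglyMeasurable
    (.of_forall hC)

lemma HasDens.sub (h : HasDens u Ω μ g) (h' : HasDens v Ω μ g') (hu : LocInt u Ω)
    (hv : LocInt v Ω) : HasDens (fun x => u x - v x) Ω μ fun x => g x - g' x := by
  refine ⟨h.int.sub h'.int, fun φ hφ e => ?_⟩
  simp only [sub_mul, inner_sub_right, mul_sub]
  rw [integral_sub (hφ.integrable_mul_fderiv hu e) (hφ.integrable_mul_fderiv hv e),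
    integral_sub (h.integrable_mul_inner hφ e) (h'.integrable_mul_inner hφ e),
    h.integral_eq φ hφ, h'.integral_eq φ hφ]
  ring

lemma HasDens.neg (h : HasDens u Ω μ g) : HasDens (fun x => -u x) Ω μ fun x => -g x := by
  refine ⟨h.int.neg, fun φ hφ e => ?_⟩
  simp only [neg_mul, inner_neg_right, mul_neg, integral_neg, h.integral_eq φ hφ]

lemma HasDens.pvar_le (h : HasDens u Ω μ g) (hU : IsOpen U) (hUΩ : U ⊆ Ω) (e : E n) :
    pvar u U e ≤ ∫⁻ x in U, ofReal ⟪e, g x⟫ ∂μ := by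
  refine iSup_le fun φ => iSup_le fun hφ => iSup_le fun h0 => iSup_le fun h1 => ?_
  rw [h.integral_eq φ (hφ.mono hUΩ) e, neg_neg]
  exact ofReal_integral_test_mul_le hU.measurableSet (fun x hx => hφ.eq_zero hx) h0 h1 _

lemma HasDens.le_pvar (h : HasDens u Ω μ g) (hU : IsOpen U) (hUΩ : U ⊆ Ω) (e : E n) :
    ∫⁻ x in U, ofReal ⟪e, g x⟫ ∂μ ≤ pvar u U e := by
  refine lintegral_ofReal_le_of_forall_test hU
    ((h.int.const_inner e).locallyIntegrable.locallyIntegrableOn _) fun φ hφ h0 h1 => ?_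
  rw [← neg_neg (∫ x, φ x * ⟪e, g x⟫ ∂μ), ← h.integral_eq φ (hφ.mono hUΩ) e]
  exact BMOGamma.le_pvar e hφ h0 h1

lemma HasDens.tvar_le (h : HasDens u Ω μ g) (hU : IsOpen U) (hUΩ : U ⊆ Ω) (e : E n) :
    tvar u U e ≤ ofReal ‖e‖ * ∫⁻ x in U, ‖g x‖ₑ ∂μ := by
  have hm : AEMeasurable (fun x => ofReal ⟪e, g x⟫) (μ.restrict U) :=
    ((h.int.const_inner e).aestronglyMeasurable.aemeasurable.ennreal_ofReal).restrict
  refine (add_le_add (h.pvar_le hU hUΩ e) (h.pvar_le hU hUΩ (-e))).trans ?_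
  rw [← lintegral_add_left' hm, ← lintegral_const_mul' _ _ ofReal_ne_top]
  refine lintegral_mono fun x => ?_
  simp only [inner_neg_left]
  rw [← ofReal_abs_eq, ← ofReal_norm_eq_enorm, ← ofReal_mul (norm_nonneg _)]
  exact ofReal_le_ofReal (abs_real_inner_le_norm _ _)

lemma HasDens.lintegral_translate_le (h : HasDens u Ω μ g) (hu : LocInt u Ω) (hA : IsOpen A)
    (hU : IsOpen U) (hUΩ : U ⊆ Ω) (hAU : ∀ x ∈ A, ∀ θ ∈ Icc (0:ℝ) 1, x + θ • z ∈ U) :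
    ∫⁻ x in A, ofReal |u (x + z) - u x| ≤ ofReal ‖z‖ * ∫⁻ x in U, ‖g x‖ₑ ∂μ :=
  (lintegral_abs_translate_le_tvar hA (hu.mono_set hUΩ) hAU).trans (h.tvar_le hU hUΩ z)

lemma IsPair.lintegral_enorm (hp : IsPair u Ω μ σ) (U : Set (E n)) :
    ∫⁻ x in U, ‖σ x‖ₑ ∂μ = μ U := by
  rw [← setLIntegral_one]
  refine lintegral_congr_ae (ae_restrict_of_ae ?_)
  filter_upwards [hp.norm_eq] with x hx
  rw [← ofReal_norm_eq_enorm, hx, ofReal_one]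

end HasDens

/-- A smooth bump supported in the unit ball, of integral one. -/
def bump (n : ℕ) : E n → ℝ :=
  (⟨1 / 2, 1, by norm_num, by norm_num⟩ : ContDiffBump (0 : E n)).normed volume

/-- The mollifier at scale `R`. -/
def rho (n : ℕ) (R : ℝ) (x : E n) : ℝ := (R ^ n)⁻¹ * bump n (R⁻¹ • x)

/-- Mollification at scale `R`. -/
def moll (R : ℝ) (u : E n → ℝ) (x : E n) : ℝ := ∫ t, u t * rho n R (x - t)

lemma contDiff_bump : ContDiff ℝ 1 (bump n) := ContDiffBump.contDiff_normed _

lemma bump_nonneg (x : E n) : 0 ≤ bump n x := ContDiffBump.nonneg_normed _ _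

lemma tsupport_bump : tsupport (bump n) = closedBall 0 1 := ContDiffBump.tsupport_normed_eq _

lemma contDiff_rho (R : ℝ) : ContDiff ℝ 1 (rho n R) :=
  contDiff_const.mul (contDiff_bump.comp (contDiff_const_smul _))

lemma rho_nonneg (hR : 0 < R) (x : E n) : 0 ≤ rho n R x :=
  mul_nonneg (by positivity) (bump_nonneg _)

lemma rho_eq_zero (hR : 0 < R) (hx : R < ‖x‖) : rho n R x = 0 := by
  refine mul_eq_zero_of_right _ (image_eq_zero_of_notMem_tsupport ?_)
  rw [tsupport_bump, mem_closedBall_zero_iff, norm_smul, norm_inv, norm_of_nonneg hR.le,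
    not_le, lt_inv_mul_iff₀ hR, mul_one]
  exact hx

lemma tsupport_rho_subset (hR : 0 < R) : tsupport (rho n R) ⊆ closedBall 0 R := by
  refine closure_minimal (fun x hx => ?_) isClosed_closedBall
  by_contra h
  exact hx (rho_eq_zero hR (by simpa using h))

lemma hasCompactSupport_rho (hR : 0 < R) : HasCompactSupport (rho n R) :=
  (isCompact_closedBall 0 R).of_isClosed_subset (isClosed_tsupport _) (tsupport_rho_subset hR)

lemma integral_rho (hR : 0 < R) : ∫ x, rho n R x = 1 := by
  simp only [rho]
  rw [integral_const_mul, Measure.integral_comp_inv_smul_of_nonneg _ _ hR.le]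
  simp only [finrank_euclideanSpace, Fintype.card_fin, smul_eq_mul]
  rw [bump, ContDiffBump.integral_normed, mul_one, inv_mul_cancel₀ (by positivity)]

lemma isTest_rho_sub (hR : 0 < R) (hx : closedBall x R ⊆ Ω) :
    IsTest Ω fun t => rho n R (x - t) := by
  have hsupp : tsupport (fun t => rho n R (x - t)) ⊆ closedBall x R := by
    refine closure_minimal (fun t ht => ?_) isClosed_closedBall
    by_contra h
    refine ht (rho_eq_zero hR ?_)
    rwa [mem_closedBall, dist_comm, dist_eq_norm, not_le] at h
  exact ⟨(contDiff_rho R).comp (contDiff_const.sub contDiff_id),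
    (isCompact_closedBall x R).of_isClosed_subset (isClosed_tsupport _) hsupp, hsupp.trans hx⟩

lemma moll_eq_convolution (R : ℝ) (u : E n → ℝ) :
    moll R u = convolution u (rho n R) (ContinuousLinearMap.mul ℝ ℝ) volume := rfl

lemma contDiff_moll (hR : 0 < R) (hu : LocallyIntegrable u) : ContDiff ℝ 1 (moll R u) := by
  rw [moll_eq_convolution]
  exact (hasCompactSupport_rho hR).contDiff_convolution_right _ hu (contDiff_rho R)

lemma moll_congr (hR : 0 < R) (h : ∀ t ∈ closedBall x R, u t = v t) :
    moll R u x = moll R v x := by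
  refine integral_congr_ae (.of_forall fun t => ?_)
  by_cases ht : t ∈ closedBall x R
  · simp only [h t ht]
  · have : rho n R (x - t) = 0 := rho_eq_zero hR (by
      rwa [mem_closedBall, dist_comm, dist_eq_norm, not_le] at ht)
    simp only [this, mul_zero]

lemma hasFDerivAt_moll {g : E n → E n} (hd : HasDens u Ω μ g) (hΩ : IsOpen Ω) (hu : LocInt u Ω)
    (hR : 0 < R) (hx : closedBall x R ⊆ Ω) :
    HasFDerivAt (moll R u) (innerSL ℝ (∫ y, rho n R (x - y) • g y ∂μ)) x := by
  obtain ⟨δ, hδ, hs⟩ := (isCompact_closedBall x R).exists_cthickening_subset_open hΩ hx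
  rw [cthickening_closedBall hδ.le hR.le] at hs
  set K := closedBall x (δ + R)
  have hK : IsCompact K := isCompact_closedBall _ _
  have hi : Integrable (K.indicator u) :=
    (integrable_indicator_iff hK.measurableSet).2 (hu.integrableOn_compact_subset hs hK)
  have h1 := (hasCompactSupport_rho hR).hasFDerivAt_convolution_right (ContinuousLinearMap.mul ℝ ℝ)
    hi.locallyIntegrable (contDiff_rho (n := n) R) x
  have h2 : moll R u =ᶠ[𝓝 x] convolution (K.indicator u) (rho n R)
      (ContinuousLinearMap.mul ℝ ℝ) volume := by
    filter_upwards [ball_mem_nhds x hδ] with y hy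
    rw [← moll_eq_convolution]
    refine moll_congr hR fun t ht => (indicator_of_mem ?_ _).symm
    exact mem_closedBall.2 ((dist_triangle t y x).trans (by
      linarith [mem_closedBall.1 ht, mem_ball.1 hy]))
  refine (h1.congr_of_eventuallyEq h2).congr_fderiv ?_
  ext e
  have ht := isTest_rho_sub (Ω := Ω) hR hx
  have hg : Integrable (fun y => rho n R (x - y) • g y) μ := by
    obtain ⟨C, hC⟩ := ht.2.exists_bound_of_continuous ht.continuous
    exact hd.int.bdd_smul C ht.continuous.aestronglyMeasurable (.of_forall hC)
  rw [convolution_precompR_apply _ hi.locallyIntegrable ((hasCompactSupport_rho hR).fderiv ℝ)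
    ((contDiff_rho R).continuous_fderiv one_ne_zero), innerSL_apply_apply, real_inner_comm,
    ← integral_inner hg]
  have h3 := hd.integral_eq _ ht e
  have h4 (y : E n) : fderiv ℝ (fun t => rho n R (x - t)) y e = -fderiv ℝ (rho n R) (x - y) e := by
    have h5 := ((contDiff_rho (n := n) R).differentiable one_ne_zero (x - y)).hasFDerivAt.comp y
      ((hasFDerivAt_id y).const_sub x)
    rw [HasFDerivAt.fderiv (f := fun t => rho n R (x - t)) h5]
    simp
  simp only [inner_smul_right]
  rw [← neg_eq_iff_eq_neg, ← integral_neg] at h3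
  rw [← h3]
  refine integral_congr_ae (.of_forall fun y => ?_)
  simp only [h4, mul_apply', mul_neg, neg_neg]
  by_cases hy : y ∈ K
  · rw [indicator_of_mem hy]
  · have : fderiv ℝ (rho n R) (x - y) = 0 := by
      refine image_eq_zero_of_notMem_tsupport fun h => hy ?_
      have := tsupport_rho_subset hR (tsupport_fderiv_subset ℝ h)
      rw [mem_closedBall_zero_iff, ← dist_eq_norm, dist_comm] at this
      exact mem_closedBall.2 (this.trans (by linarith))
    simp [this]

/-- Mollification moves a function by at most the largest translation defect. -/
lemma lintegral_moll_sub_le (hum : Measurable u) (hu : LocInt u Ω) (hA : MeasurableSet A)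
    (hR : 0 < R) (hAΩ : ∀ x ∈ A, closedBall x R ⊆ Ω) (δ : ℝ) {N : ℝ≥0∞}
    (h : ∀ z, ‖z‖ ≤ R → ∫⁻ x in A, ofReal (|u (x - z) - u x| - δ) ≤ N) :
    ∫⁻ x in A, ofReal (|moll R u x - u x| - δ) ≤ N := by
  have hρ : Integrable (rho n R) :=
    (contDiff_rho R).continuous.integrable_of_hasCompactSupport (hasCompactSupport_rho hR)
  have hρm : Measurable (rho n R) := (contDiff_rho R).continuous.measurable
  have h1 (x : E n) (hx : x ∈ A) : ofReal (|moll R u x - u x| - δ) ≤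
      ∫⁻ z, ofReal (rho n R z) * ofReal (|u (x - z) - u x| - δ) := by
    have ht := isTest_rho_sub (Ω := Ω) hR (hAΩ x hx)
    have hi : Integrable fun z => u (x - z) * rho n R z := by
      have := (integrable_mul_of_tsupport hu ht.continuous ht.2 ht.3).comp_sub_left x
      simpa using this
    have hi' : Integrable fun z => rho n R z * u (x - z) := by simpa only [mul_comm] using hi
    have h2 : moll R u x - u x = ∫ z, rho n R z * (u (x - z) - u x) := by
      have h3 : moll R u x = ∫ z, u (x - z) * rho n R z := by
        rw [moll, ← integral_sub_left_eq_self _ volume x]; simp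
      simp only [mul_sub]
      rw [integral_sub hi' (hρ.mul_const _), integral_mul_const,
        integral_rho hR, one_mul, h3]
      simp only [mul_comm]
    have h4 : Integrable fun z => rho n R z * |u (x - z) - u x| := by
      have : Integrable fun z => rho n R z * (u (x - z) - u x) := by
        simp only [mul_sub]
        exact hi'.sub (hρ.mul_const _)
      refine this.abs.congr (.of_forall fun z => ?_)
      simp only [abs_mul, abs_of_nonneg (rho_nonneg hR z)]
    have h5 : |moll R u x - u x| - δ ≤ ∫ z, rho n R z * (|u (x - z) - u x| - δ) := by
      simp only [mul_sub _ _ δ]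
      rw [integral_sub h4 (hρ.mul_const _), integral_mul_const, integral_rho hR, one_mul, h2]
      refine sub_le_sub_right ((abs_integral_le_integral_abs).trans (le_of_eq ?_)) _
      simp only [abs_mul, abs_of_nonneg (rho_nonneg hR _)]
    refine (ofReal_le_ofReal h5).trans ((ofReal_integral_le_lintegral_ofReal _).trans ?_)
    exact lintegral_mono fun z => (ofReal_mul (rho_nonneg hR z)).le
  calc _ ≤ ∫⁻ x in A, ∫⁻ z, ofReal (rho n R z) * ofReal (|u (x - z) - u x| - δ) :=
        setLIntegral_mono' hA h1
    _ = ∫⁻ z, ∫⁻ x in A, ofReal (rho n R z) * ofReal (|u (x - z) - u x| - δ) := by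
        rw [lintegral_lintegral_swap]
        exact Measurable.aemeasurable (by fun_prop)
    _ ≤ ∫⁻ z, ofReal (rho n R z) * N := by
        refine lintegral_mono fun z => ?_
        simp only
        rw [lintegral_const_mul _ (by fun_prop)]
        by_cases hz : ‖z‖ ≤ R
        · exact mul_le_mul_right (h z hz) _
        · simp [rho_eq_zero hR (not_le.1 hz)]
    _ = N := by
        rw [lintegral_mul_const _ (by fun_prop), ← ofReal_integral_eq_lintegral_ofReal hρ
          (.of_forall (rho_nonneg hR)), integral_rho hR]
        simp

open ProbabilityTheory in
lemma lintegral_sub_stdGaussian_le (hv : ContDiff ℝ 1 v) :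
    ∫⁻ x, ∫⁻ y, ofReal |v y - v x| ∂stdGaussian (E n) ∂stdGaussian (E n) ≤
      ofReal (√(2 * Real.pi) / 2) * ∫⁻ x, ‖fderiv ℝ v x‖ₑ ∂stdGaussian (E n) := by
  set γ := stdGaussian (E n)
  have hfc : Continuous (fderiv ℝ v) := hv.continuous_fderiv one_ne_zero
  let G : E n × E n → ℝ≥0∞ := fun p => ‖fderiv ℝ v p.1 p.2‖ₑ
  have hG : Continuous G := by
    refine continuous_enorm.comp ?_
    exact (hfc.comp continuous_fst).clm_apply continuous_snd
  have h1 (p : E n × E n) : ofReal |v p.2 - v p.1| ≤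
      ∫⁻ θ in Icc 0 (Real.pi / 2), G (ContinuousLinearMap.rotation θ p) := by
    have hd (θ : ℝ) : HasDerivAt (fun θ : ℝ => v (cos θ • p.1 + sin θ • p.2))
        (fderiv ℝ v (cos θ • p.1 + sin θ • p.2)
          (-sin θ • p.1 + cos θ • p.2)) θ :=
      (hv.differentiable one_ne_zero _).hasFDerivAt.comp_hasDerivAt θ
        (((Real.hasDerivAt_cos θ).smul_const _).add ((Real.hasDerivAt_sin θ).smul_const _))
    have hs : ContDiff ℝ 1 fun θ : ℝ => v (cos θ • p.1 + sin θ • p.2) := by fun_prop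
    have := enorm_sub_le_lintegral_deriv_of_contDiffOn_Icc (a := 0) (b := Real.pi / 2)
      hs.contDiffOn (by positivity)
    simp only [Real.cos_pi_div_two, Real.sin_pi_div_two, Real.cos_zero, Real.sin_zero, zero_smul,
      one_smul, zero_add, add_zero] at this
    rw [← norm_eq_abs, ofReal_norm_eq_enorm]
    refine this.trans (le_of_eq (lintegral_congr fun θ => ?_))
    rw [(hd θ).deriv, ContinuousLinearMap.rotation_apply]
  have hm : Measurable fun q : (E n × E n) × ℝ => G (ContinuousLinearMap.rotation q.2 q.1) := by
    refine hG.measurable.comp (Continuous.measurable ?_)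
    simp only [ContinuousLinearMap.rotation_apply]
    fun_prop
  have h2 (θ : ℝ) : ∫⁻ p, G (ContinuousLinearMap.rotation θ p) ∂γ.prod γ = ∫⁻ p, G p ∂γ.prod γ := by
    rw [← lintegral_map hG.measurable (ContinuousLinearMap.rotation θ).continuous.measurable,
      IsGaussian.map_rotation_eq_self (integral_id_stdGaussian) θ]
  have h3 : ∫⁻ p, G p ∂γ.prod γ =
      ofReal (2 * (√(2 * Real.pi))⁻¹) * ∫⁻ x, ‖fderiv ℝ v x‖ₑ ∂γ := by
    rw [lintegral_prod _ hG.measurable.aemeasurable, ← lintegral_const_mul' _ _ ofReal_ne_top]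
    refine lintegral_congr fun x => ?_
    rw [← ofReal_norm_eq_enorm, ← ofReal_mul (by positivity),
      ← (InnerProductSpace.toDual ℝ (E n)).symm.norm_map, ← lintegral_abs_inner_stdGaussian_le]
    refine lintegral_congr fun y => ?_
    rw [InnerProductSpace.toDual_symm_apply, ← norm_eq_abs, ofReal_norm_eq_enorm]
  calc _ = ∫⁻ p, ofReal |v p.2 - v p.1| ∂γ.prod γ := by
        rw [lintegral_prod _ (Measurable.aemeasurable ?_)]
        have := hv.continuous.measurable
        fun_prop
    _ ≤ ∫⁻ p, (∫⁻ θ in Icc 0 (Real.pi / 2), G (ContinuousLinearMap.rotation θ p)) ∂γ.prod γ :=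
        lintegral_mono h1
    _ = ∫⁻ θ in Icc (0 : ℝ) (Real.pi / 2), (∫⁻ p, G p ∂γ.prod γ) := by
        rw [lintegral_lintegral_swap hm.aemeasurable]
        simp only [h2]
    _ = _ := by
        rw [lintegral_const, h3, Measure.restrict_apply_univ, Real.volume_Icc, sub_zero,
          mul_comm, ← mul_assoc, ← ofReal_mul (by positivity)]
        congr 2
        have h4 : √(2 * Real.pi) * √(2 * Real.pi) = 2 * Real.pi := Real.mul_self_sqrt (by positivity)
        have : √(2 * Real.pi) ≠ 0 := by positivity
        generalize √(2 * Real.pi) = s at *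
        field_simp
        nlinarith

lemma continuous_gaussianPDF : Continuous (ProbabilityTheory.gaussianPDFReal 0 1) := by
  unfold ProbabilityTheory.gaussianPDFReal; fun_prop

lemma contDiff_cubeMap (b : Frame n) (z : E n) (ε : ℝ) : ContDiff ℝ 1 (cubeMap b z ε) := by
  have h : ContDiff ℝ 1 normalCdf := by
    rw [contDiff_one_iff_deriv]
    refine ⟨fun t => (hasDerivAt_normalCdf t).differentiableAt, ?_⟩
    rw [funext fun t => (hasDerivAt_normalCdf t).deriv]
    exact continuous_gaussianPDF
  unfold cubeMap
  fun_prop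

lemma norm_fderiv_comp_cubeMap_le {g : E n → ℝ} (hg : ContDiff ℝ 1 g) (b : Frame n) (z : E n)
    (hε : 0 < ε) (x : E n) : ‖fderiv ℝ (g ∘ cubeMap b z ε) x‖ ≤
      ε * (√(2 * Real.pi))⁻¹ * ‖fderiv ℝ g (cubeMap b z ε x)‖ := by
  have hT := hasFDerivAt_cubeMap b z ε x
  rw [((hg.differentiable one_ne_zero _).hasFDerivAt.comp x hT).fderiv, mul_comm]
  refine (opNorm_comp_le _ _).trans
    (mul_le_mul_of_nonneg_left ?_ (norm_nonneg _))
  refine opNorm_le_bound _ (by positivity) fun y => ?_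
  have hp (t : ℝ) : 0 ≤ ProbabilityTheory.gaussianPDFReal 0 1 t ∧
      ProbabilityTheory.gaussianPDFReal 0 1 t ≤ (√(2 * Real.pi))⁻¹ := by
    refine ⟨ProbabilityTheory.gaussianPDFReal_nonneg _ _ _, ?_⟩
    rw [ProbabilityTheory.gaussianPDFReal]
    simp only [NNReal.coe_one, mul_one]
    refine mul_le_of_le_one_right (by positivity) (Real.exp_le_one_iff.2 ?_)
    have := sq_nonneg (t - 0)
    linarith
  refine le_of_sq_le_sq ?_ (by positivity)
  simp only [ContinuousLinearMap.sum_apply, smulRight_apply,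
    ContinuousLinearMap.smul_apply, PiLp.proj_apply, smul_eq_mul]
  rw [← b.sum_sq_norm_inner_right, mul_pow, norm_sq_eq y, mul_sum]
  refine sum_le_sum fun i _ => ?_
  rw [inner_sum, Finset.sum_eq_single i]
  · rw [inner_smul_right, real_inner_self_eq_norm_sq, b.norm_eq_one, one_pow, mul_one, norm_mul,
      mul_pow, norm_mul, norm_of_nonneg hε.le, norm_of_nonneg (hp _).1]
    have := (hp (x i)).2
    have := (hp (x i)).1
    gcongr
  · intro j _ hj
    rw [inner_smul_right, b.inner_eq_zero hj.symm, mul_zero]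
  · simp

/-- The sharp Poincaré inequality on cubes, for smooth functions. -/
lemma lintegral_cube_sub_le {g : E n → ℝ} (hg : ContDiff ℝ 1 g) (b : Frame n) (z : E n)
    (hε : 0 < ε) : ∫⁻ x in cube b z ε, ∫⁻ y in cube b z ε, ofReal |g y - g x| ≤
      ofReal (ε ^ (n + 1) / 2) * ∫⁻ x in cube b z ε, ‖fderiv ℝ g x‖ₑ := by
  have hT := contDiff_cubeMap b z ε
  have hTm : Measurable (cubeMap b z ε) := hT.continuous.measurable
  have hgm := hg.continuous.measurable
  have hdm : Measurable fun x => ‖fderiv ℝ g x‖ₑ :=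
    (continuous_enorm.comp (hg.continuous_fderiv one_ne_zero)).measurable
  have hkey := lintegral_sub_stdGaussian_le (hg.comp hT)
  set c : ℝ≥0∞ := ofReal ε⁻¹ ^ n with hc
  have hcT : c ≠ ⊤ := by finiteness
  have hmap := stdGaussian_map_cubeMap b z hε
  have h1 : ∫⁻ x, ∫⁻ y, ofReal |(g ∘ cubeMap b z ε) y - (g ∘ cubeMap b z ε) x|
      ∂ProbabilityTheory.stdGaussian (E n) ∂ProbabilityTheory.stdGaussian (E n) =
      c * (c * ∫⁻ x in cube b z ε, ∫⁻ y in cube b z ε, ofReal |g y - g x|) := by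
    have h2 (s : ℝ) : ∫⁻ y, ofReal |(g ∘ cubeMap b z ε) y - s|
        ∂ProbabilityTheory.stdGaussian (E n) =
        c * ∫⁻ y in cube b z ε, ofReal |g y - s| := by
      rw [← smul_eq_mul, ← lintegral_smul_measure, ← hmap, lintegral_map (by fun_prop) hTm]; rfl
    simp only [h2]
    rw [lintegral_const_mul' _ _ hcT]
    congr 1
    rw [← smul_eq_mul, ← lintegral_smul_measure, ← hmap, lintegral_map ?_ hTm]; rfl
    exact Measurable.lintegral_prod_right' (f := fun p : E n × E n => ofReal |g p.2 - g p.1|)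
      (by fun_prop)
  have h3 : ∫⁻ x, ‖fderiv ℝ (g ∘ cubeMap b z ε) x‖ₑ ∂ProbabilityTheory.stdGaussian (E n) ≤
      ofReal (ε * (√(2 * Real.pi))⁻¹) * (c * ∫⁻ x in cube b z ε, ‖fderiv ℝ g x‖ₑ) := by
    rw [← smul_eq_mul c, ← lintegral_smul_measure, ← hmap, lintegral_map hdm hTm,
      ← lintegral_const_mul' _ _ ofReal_ne_top]
    refine lintegral_mono fun x => ?_
    rw [← ofReal_norm_eq_enorm, ← ofReal_norm_eq_enorm, ← ofReal_mul (by positivity)]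
    exact ofReal_le_ofReal (norm_fderiv_comp_cubeMap_le hg b z hε x)
  rw [h1] at hkey
  have h4 := hkey.trans (mul_le_mul_right h3 _)
  have hcc : c * ofReal (ε ^ n) = 1 := by
    rw [hc, ← ofReal_pow (by positivity), ← ofReal_mul (by positivity), ← mul_pow,
      inv_mul_cancel₀ hε.ne', one_pow, ofReal_one]
  have hc' : c ≠ 0 := left_ne_zero_of_mul_eq_one hcc
  rw [← mul_assoc (ofReal _), ← ofReal_mul (by positivity),
    mul_left_comm (ofReal _) c,
    ENNReal.mul_le_mul_iff_right hc' hcT] at h4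
  have h5 := mul_le_mul_right h4 (ofReal (ε ^ n))
  rw [← mul_assoc, mul_comm _ c, hcc, one_mul, ← mul_assoc, ← ofReal_mul (by positivity)] at h5
  refine h5.trans (le_of_eq ?_)
  congr 2
  have : √(2 * Real.pi) ≠ 0 := by positivity
  field_simp
  ring

lemma osc_eq_zero (hQ : volume Q ≠ ⊤) (hum : Measurable u) (h : ¬ IntegrableOn u Q) :
    osc u Q = 0 := by
  have h0 : ⨍ y in Q, u y = 0 := by rw [setAverage_eq, integral_undef h, smul_zero]
  rw [osc, h0, setAverage_eq, integral_undef, smul_zero]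
  simp only [sub_zero]
  exact fun hi => h ((integrable_norm_iff hum.aestronglyMeasurable.restrict).1 hi)

lemma ofReal_osc_eq (hQ : volume Q ≠ ⊤) (h : IntegrableOn u Q) : ofReal (osc u Q) =
      (volume Q)⁻¹ * ∫⁻ x in Q, ofReal |u x - ⨍ y in Q, u y| := by
  have := isFiniteMeasure_restrict.2 hQ
  rw [osc, ofReal_setAverage
    (f := fun x => |u x - ⨍ y in Q, u y|) (Integrable.abs (Integrable.sub h (integrable_const _)))
    (.of_forall fun _ => abs_nonneg _), ENNReal.div_eq_inv_mul]

lemma ofReal_abs_sub_setAverage_le (hQ0 : volume Q ≠ 0) (hQ : volume Q ≠ ⊤)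
    (h : IntegrableOn u Q) (c : ℝ) :
    ofReal |c - ⨍ y in Q, u y| ≤ (volume Q)⁻¹ * ∫⁻ y in Q, ofReal |u y - c| := by
  have := isFiniteMeasure_restrict.2 hQ
  have h1 : ⨍ y in Q, (u y - c) = (⨍ y in Q, u y) - c := by
    have hv : volume.real Q ≠ 0 := (toReal_pos hQ0 hQ).ne'
    rw [setAverage_eq, setAverage_eq, integral_sub h (integrable_const _), setIntegral_const,
      smul_sub, smul_smul, inv_mul_cancel₀ hv, one_smul]
  have hi : IntegrableOn (fun y => u y - c) Q := Integrable.sub h (integrable_const _)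
  rw [abs_sub_comm, ← h1, ← ENNReal.div_eq_inv_mul, ← ofReal_setAverage hi.abs
    (.of_forall fun _ => abs_nonneg _)]
  refine ofReal_le_ofReal ?_
  rw [setAverage_eq, setAverage_eq, smul_eq_mul, smul_eq_mul, abs_mul, abs_inv, abs_of_nonneg measureReal_nonneg]
  exact mul_le_mul_of_nonneg_left abs_integral_le_integral_abs (by positivity)

lemma ofReal_osc_le (hQ0 : volume Q ≠ 0) (hQ : volume Q ≠ ⊤) (hum : Measurable u) :
    ofReal (osc u Q) ≤
      (volume Q)⁻¹ * ((volume Q)⁻¹ * ∫⁻ x in Q, ∫⁻ y in Q, ofReal |u y - u x|) := by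
  by_cases h : IntegrableOn u Q
  · rw [ofReal_osc_eq hQ h]
    refine (mul_le_mul_right (lintegral_mono fun x =>
      ofReal_abs_sub_setAverage_le hQ0 hQ h (u x)) _).trans (le_of_eq ?_)
    rw [lintegral_const_mul' _ _ (inv_ne_top.2 hQ0)]
  · rw [osc_eq_zero hQ hum h, ofReal_zero]; exact zero_le

lemma ofReal_osc_le_add (hQ0 : volume Q ≠ 0) (hQ : volume Q ≠ ⊤) (hum : Measurable u)
    (hvm : Measurable v) : ofReal (osc u Q) ≤
      ofReal (osc v Q) + 2 * ((volume Q)⁻¹ * ∫⁻ x in Q, ofReal |u x - v x|) := by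
  have hV : (volume Q)⁻¹ ≠ ⊤ := inv_ne_top.2 hQ0
  have := isFiniteMeasure_restrict.2 hQ
  by_cases h : IntegrableOn u Q
  swap
  · rw [osc_eq_zero hQ hum h, ofReal_zero]; exact zero_le
  by_cases hd : ∫⁻ x in Q, ofReal |u x - v x| = ⊤
  · rw [hd, mul_top (ENNReal.inv_ne_zero.2 hQ), mul_top two_ne_zero, add_top]
    exact le_top
  have hdi : IntegrableOn (fun x => u x - v x) Q := by
    refine ⟨(hum.sub hvm).aestronglyMeasurable, ?_⟩
    rw [hasFiniteIntegral_iff_norm]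
    exact lt_top_iff_ne_top.2 hd
  have hv : IntegrableOn v Q := by
    have h1 : IntegrableOn (fun x => u x - (u x - v x)) Q := Integrable.sub h hdi
    simpa only [sub_sub_cancel] using h1
  rw [ofReal_osc_eq hQ h, ofReal_osc_eq hQ hv]
  set D := ∫⁻ x in Q, ofReal |u x - v x|
  set a := ⨍ y in Q, u y
  set b := ⨍ y in Q, v y
  have hab : ofReal |b - a| ≤ (volume Q)⁻¹ * D := by
    have h1 : a - b = ⨍ y in Q, (u y - v y) := by
      rw [setAverage_eq, integral_sub h hv, smul_sub, ← setAverage_eq, ← setAverage_eq]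
    rw [abs_sub_comm, h1]
    have := ofReal_abs_sub_setAverage_le hQ0 hQ hdi 0
    simpa only [zero_sub, abs_neg, sub_zero] using this
  calc _ ≤ (volume Q)⁻¹ * ∫⁻ x in Q, (ofReal |v x - b| + (ofReal |u x - v x| + ofReal |b - a|)) := by
        gcongr with x
        rw [← ofReal_add (abs_nonneg _) (abs_nonneg _),
          ← ofReal_add (abs_nonneg _) (by positivity)]
        refine ofReal_le_ofReal ?_
        have e : u x - a = (v x - b) + ((u x - v x) + (b - a)) := by ring
        rw [e]
        exact (abs_add_le _ _).trans (add_le_add_right (abs_add_le _ _) _)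
    _ = (volume Q)⁻¹ * (∫⁻ x in Q, ofReal |v x - b|) +
          ((volume Q)⁻¹ * D + ofReal |b - a|) := by
        rw [lintegral_add_left (by fun_prop), lintegral_add_left (by fun_prop), lintegral_const,
          Measure.restrict_apply_univ, mul_add, mul_add, mul_comm (ofReal _), ← mul_assoc,
          ENNReal.inv_mul_cancel hQ0 hQ, one_mul]
    _ ≤ _ := by
        rw [two_mul]
        exact add_le_add_right (add_le_add_right hab _) _

lemma lintegral_lintegral_sub_le {g : E n → ℝ} (hum : Measurable u) (hgm : Measurable g)
    (Q : Set (E n)) : ∫⁻ x in Q, ∫⁻ y in Q, ofReal |u y - u x| ≤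
      (∫⁻ x in Q, ∫⁻ y in Q, ofReal |g y - g x|) +
        2 * (volume Q * ∫⁻ x in Q, ofReal |g x - u x|) := by
  have h1 (x y : E n) : ofReal |u y - u x| ≤ ofReal |g y - g x| +
      (ofReal |g y - u y| + ofReal |g x - u x|) := by
    rw [← ofReal_add (abs_nonneg _) (abs_nonneg _),
      ← ofReal_add (abs_nonneg _) (by positivity)]
    refine ofReal_le_ofReal ?_
    have e : u y - u x = (g y - g x) + (-(g y - u y) + (g x - u x)) := by ring
    rw [e, ← abs_neg (g y - u y)]
    exact (abs_add_le _ _).trans (add_le_add_right (abs_add_le _ _) _)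
  calc _ ≤ ∫⁻ x in Q, ∫⁻ y in Q, (ofReal |g y - g x| +
      (ofReal |g y - u y| + ofReal |g x - u x|)) :=
        lintegral_mono fun x => lintegral_mono fun y => h1 x y
    _ = _ := by
        have h2 (x : E n) : ∫⁻ y in Q, (ofReal |g y - g x| +
            (ofReal |g y - u y| + ofReal |g x - u x|)) =
            (∫⁻ y in Q, ofReal |g y - g x|) + ((∫⁻ y in Q, ofReal |g y - u y|) +
              ofReal |g x - u x| * volume Q) := by
          rw [lintegral_add_left (by fun_prop), lintegral_add_left (by fun_prop), lintegral_const,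
            Measure.restrict_apply_univ]
        simp only [h2]
        rw [lintegral_add_left, lintegral_add_left (by fun_prop), lintegral_const,
          Measure.restrict_apply_univ, lintegral_mul_const _ (by fun_prop), two_mul, mul_comm (volume Q)]
        exact Measurable.lintegral_prod_right' (f := fun p : E n × E n => ofReal |g p.2 - g p.1|)
          (by fun_prop)

lemma lintegral_enorm_fderiv_moll_le [IsFiniteMeasure μ] (hd : HasDens u U μ σ)
    (hσ : ∀ᵐ x ∂μ, ‖σ x‖ = 1) (hU : IsOpen U) (hu : LocInt u U) (hR : 0 < R) {V : Set (E n)}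
    (hAm : MeasurableSet A) (hV : MeasurableSet V) (hAU : ∀ x ∈ A, closedBall x R ⊆ U ∩ V) :
    ∫⁻ x in A, ‖fderiv ℝ (moll R u) x‖ₑ ≤ μ V := by
  have hρm : Measurable (rho n R) := (contDiff_rho R).continuous.measurable
  have h1 (x : E n) (hx : x ∈ A) : ‖fderiv ℝ (moll R u) x‖ₑ ≤
      ∫⁻ y in V, ofReal (rho n R (x - y)) ∂μ := by
    rw [(hasFDerivAt_moll hd hU hu hR ((hAU x hx).trans inter_subset_left)).fderiv,
      ← ofReal_norm_eq_enorm, innerSL_apply_norm, ofReal_norm_eq_enorm]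
    refine (enorm_integral_le_lintegral_enorm _).trans ?_
    rw [← lintegral_indicator hV]
    refine lintegral_mono_ae (hσ.mono fun y hy => ?_)
    rw [← ofReal_norm_eq_enorm, norm_smul, hy, mul_one, norm_of_nonneg (rho_nonneg hR _)]
    by_cases hyV : y ∈ V
    · rw [indicator_of_mem hyV]
    · rw [rho_eq_zero hR, ofReal_zero]; · exact zero_le
      by_contra hc
      exact hyV (hAU x hx (by rwa [mem_closedBall, dist_comm, dist_eq_norm, ← not_lt])).2
  calc _ ≤ ∫⁻ x in A, ∫⁻ y in V, ofReal (rho n R (x - y)) ∂μ := setLIntegral_mono' hAm h1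
    _ ≤ ∫⁻ x, ∫⁻ y in V, ofReal (rho n R (x - y)) ∂μ := setLIntegral_le_lintegral _ _
    _ = ∫⁻ y in V, (∫⁻ x, ofReal (rho n R (x - y))) ∂μ :=
        lintegral_lintegral_swap (Measurable.aemeasurable (by fun_prop))
    _ = μ V := by
        have h2 (y : E n) : ∫⁻ x, ofReal (rho n R (x - y)) = 1 := by
          rw [lintegral_sub_right_eq_self (fun x => ofReal (rho n R x)) y,
            ← ofReal_integral_eq_lintegral_ofReal
              ((contDiff_rho R).continuous.integrable_of_hasCompactSupport (hasCompactSupport_rho hR))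
              (.of_forall (rho_nonneg hR)), integral_rho hR, ofReal_one]
        simp only [h2, setLIntegral_one]

lemma IsPair.lintegral_cube_sub_le_of_closure (hp : IsPair u Ω μ σ) (hum : Measurable u)
    (hu : LocInt u Ω) (b : Frame n) (z : E n) (hε : 0 < ε) {V : Set (E n)} (hVo : IsOpen V)
    (hVΩ : V ⊆ Ω) (hQ : closure (cube b z ε) ⊆ V) :
    ∫⁻ x in cube b z ε, ∫⁻ y in cube b z ε, ofReal |u y - u x| ≤
      ofReal (ε ^ (n + 1) / 2) * μ V := by
  have := hp.finite
  set Q := cube b z ε with hQdef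
  have hQm : MeasurableSet Q := (isOpen_cube b z ε).measurableSet
  have hQb : Bornology.IsBounded Q := isBounded_closedBall.subset (cube_subset_closedBall b z ε)
  have hcpt : IsCompact (closure Q) := hQb.isCompact_closure
  obtain ⟨δ, hδ, hs⟩ := hcpt.exists_cthickening_subset_open hVo hQ
  set W := cthickening δ (closure Q) with hW
  have hWc : IsCompact W := hcpt.cthickening
  set U := thickening δ (closure Q) with hU
  have hUW : U ⊆ W := thickening_subset_cthickening _ _
  have hUo : IsOpen U := isOpen_thickening
  set u1 := W.indicator u with hu1
  have hu1m : Measurable u1 := hum.indicator hWc.measurableSet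
  have hu1i : Integrable u1 := by
    rw [hu1, integrable_indicator_iff hWc.measurableSet]
    exact (hu.mono_set (hs.trans hVΩ)).integrableOn_isCompact hWc
  have hd : HasDens u1 U μ σ := (hp.hasDens.mono (hUW.trans (hs.trans hVΩ))).congr fun x hx =>
    indicator_of_mem (hUW hx) _
  have hu1l : LocInt u1 U := hu1i.locallyIntegrable.locallyIntegrableOn _
  have hball {R : ℝ} (hR : R < δ) (x : E n) (hx : x ∈ Q) : closedBall x R ⊆ U := fun y hy =>
    mem_thickening_iff.2 ⟨x, subset_closure hx, (mem_closedBall.1 hy).trans_lt hR⟩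
  have hQU : Q ⊆ U := fun x hx => hball hδ x hx (mem_closedBall_self le_rfl)
  have e1 : ∫⁻ x in Q, ∫⁻ y in Q, ofReal |u y - u x| =
      ∫⁻ x in Q, ∫⁻ y in Q, ofReal |u1 y - u1 x| :=
    setLIntegral_congr_fun hQm fun x hx => setLIntegral_congr_fun hQm fun y hy => by
      simp only [hu1, indicator_of_mem (hUW (hQU hx)), indicator_of_mem (hUW (hQU hy))]
  have key (R : ℝ) (hR : R ∈ Ioo 0 δ) :
      ∫⁻ x in Q, ∫⁻ y in Q, ofReal |u1 y - u1 x| ≤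
        ofReal (ε ^ (n + 1) / 2) * μ V +
          2 * (volume Q * (ofReal R * μ V)) := by
    have hg := contDiff_moll hR.1 hu1i.locallyIntegrable
    have hUV : U ⊆ V := hUW.trans hs
    refine (lintegral_lintegral_sub_le hu1m hg.continuous.measurable Q).trans ?_
    have h1 := lintegral_cube_sub_le hg b z hε
    have h2 := lintegral_enorm_fderiv_moll_le hd hp.norm_eq hUo hu1l hR.1 hQm hVo.measurableSet
      fun x hx => subset_inter (hball hR.2 x hx) ((hball hR.2 x hx).trans hUV)
    have h3 := lintegral_moll_sub_le hu1m hu1l hQm hR.1 (hball hR.2) 0 (N := ofReal R * μ V)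
      fun w hw => by
        simp only [sub_zero, sub_eq_add_neg _ w]
        refine (hd.lintegral_translate_le hu1l (isOpen_cube b z ε) hUo subset_rfl (z := -w)
          fun x hx θ hθ => hball hR.2 x hx ?_).trans ?_
        · rw [mem_closedBall, dist_self_add_left, norm_smul, norm_neg, norm_of_nonneg hθ.1]
          exact (mul_le_of_le_one_left (norm_nonneg _) hθ.2).trans hw
        · rw [hp.lintegral_enorm, norm_neg]
          gcongr
    simp only [sub_zero] at h3
    exact add_le_add (h1.trans (mul_le_mul_right h2 _))
      (mul_le_mul_right (mul_le_mul_right h3 _) _)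
  rw [e1]
  have hlim : Tendsto (fun R : ℝ => ofReal (ε ^ (n + 1) / 2) * μ V +
      2 * (volume Q * (ofReal R * μ V))) (𝓝[>] 0) (𝓝 (ofReal (ε ^ (n + 1) / 2) * μ V +
      2 * (volume Q * (ofReal 0 * μ V)))) := by
    have h0 : Tendsto (fun R : ℝ => ofReal R) (𝓝[>] 0) (𝓝 (ofReal 0)) :=
      (continuous_ofReal.tendsto 0).mono_left nhdsWithin_le_nhds
    have hQt : volume Q ≠ ⊤ := hQb.measure_lt_top.ne
    exact tendsto_const_nhds.add (ENNReal.Tendsto.const_mul (ENNReal.Tendsto.const_mul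
      (ENNReal.Tendsto.mul_const h0 (Or.inr (measure_ne_top μ V))) (Or.inr hQt)) (Or.inr (by simp)))
  have := ge_of_tendsto hlim (Filter.mem_of_superset (Ioo_mem_nhdsGT hδ) key)
  simpa using this

lemma IsPair.ofReal_osc_cube_le (hn : 1 ≤ n) (hp : IsPair u Ω μ σ) (hum : Measurable u)
    (hu : LocInt u Ω) (b : Frame n) (z : E n) (hε : 0 < ε) (hQ : cube b z ε ⊆ Ω) :
    ofReal (ε ^ (n - 1)) * ofReal (osc u (cube b z ε)) ≤ μ (cube b z ε) / 2 := by
  let F : E n × E n → ℝ≥0∞ := fun p => ofReal |u p.2 - u p.1|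
  have hF : Measurable F := by fun_prop
  have hprod (η : ℝ) : ∫⁻ x in cube b z η, ∫⁻ y in cube b z η, ofReal |u y - u x| =
      (volume.prod volume).withDensity F (cube b z η ×ˢ cube b z η) := by
    have hm := (isOpen_cube b z η).measurableSet
    rw [withDensity_apply _ (hm.prod hm), ← Measure.prod_restrict, lintegral_prod _ hF.aemeasurable]
  have hmono {η η' : ℝ} (h : η ≤ η') : cube b z η ⊆ cube b z η' := fun x hx i =>
    (hx i).trans_le (by linarith)
  set η : ℕ → ℝ := fun k => ε * (1 - 1 / (k + 2)) with hη
  have hη0 (k : ℕ) : 0 < η k := by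
    refine mul_pos hε (sub_pos.2 ((div_lt_one (by positivity)).2 ?_))
    have : (0:ℝ) ≤ k := k.cast_nonneg
    linarith
  have hη1 (k : ℕ) : η k < ε := by
    have : (0:ℝ) < 1 / (k + 2) := by positivity
    simp only [hη]; nlinarith
  have hηm : Monotone η := fun k l hkl => by
    have : (1:ℝ) / (l + 2) ≤ 1 / (k + 2) := by
      have : (k:ℝ) ≤ l := Nat.cast_le.2 hkl
      gcongr
    simp only [hη]; gcongr
  have hηt : Tendsto η atTop (𝓝 ε) := by
    have h : Tendsto (fun k : ℕ => 1 / ((k : ℝ) + 2)) atTop (𝓝 0) := by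
      have := (tendsto_one_div_add_atTop_nhds_zero_nat (𝕜 := ℝ)).comp (tendsto_add_atTop_nat 1)
      refine this.congr fun k => ?_
      simp only [Function.comp, Nat.cast_add, Nat.cast_one]; ring_nf
    have := (h.const_sub 1).const_mul ε
    rwa [sub_zero, mul_one] at this
  have hcl (k : ℕ) : closure (cube b z (η k)) ⊆ cube b z ε := by
    have hc : IsClosed {x : E n | ∀ i, |⟪b i, x - z⟫| ≤ η k / 2} := by
      simp only [Set.ofPred_forall]
      exact isClosed_iInter fun i => isClosed_le (by fun_prop) continuous_const
    refine (closure_minimal (fun x hx i => (hx i).le) hc).trans fun x hx i => (hx i).trans_lt ?_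
    linarith [hη1 k]
  have h1 : ∫⁻ x in cube b z ε, ∫⁻ y in cube b z ε, ofReal |u y - u x| ≤
      ofReal (ε ^ (n + 1) / 2) * μ (cube b z ε) := by
    have hun : cube b z ε ×ˢ cube b z ε = ⋃ k, cube b z (η k) ×ˢ cube b z (η k) := by
      refine Subset.antisymm (fun p hp => ?_) (Set.iUnion_subset fun k =>
        Set.prod_mono (hmono (hη1 k).le) (hmono (hη1 k).le))
      have h2 : ∀ᶠ k in atTop, ∀ i, |⟪b i, p.1 - z⟫| < η k / 2 ∧ |⟪b i, p.2 - z⟫| < η k / 2 := by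
        refine eventually_all.2 fun i => ?_
        have h3 := hηt.div_const 2
        exact (h3.eventually_const_lt (hp.1 i)).and (h3.eventually_const_lt (hp.2 i))
      obtain ⟨k, hk⟩ := h2.exists
      exact mem_iUnion.2 ⟨k, fun i => (hk i).1, fun i => (hk i).2⟩
    rw [hprod, hun, (monotone_nat_of_le_succ fun k => Set.prod_mono (hmono (hηm k.le_succ))
      (hmono (hηm k.le_succ))).measure_iUnion]
    refine iSup_le fun k => ?_
    rw [← hprod]
    refine (hp.lintegral_cube_sub_le_of_closure hum hu b z (hη0 k) (isOpen_cube b z ε) hQ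
      (hcl k)).trans ?_
    have := hη0 k
    have := hη1 k
    gcongr
  have hv : volume (cube b z ε) = ofReal (ε ^ n) := by
    rw [volume_cube, ofReal_pow hε.le]
  have hv0 : volume (cube b z ε) ≠ 0 := by
    rw [hv]; exact (ofReal_pos.2 (by positivity)).ne'
  refine (mul_le_mul_right (ofReal_osc_le hv0 (by rw [hv]; exact ofReal_ne_top) hum) _).trans ?_
  refine (mul_le_mul_right (mul_le_mul_right (mul_le_mul_right h1 _) _) _).trans (le_of_eq ?_)
  rw [hv, ← ENNReal.ofReal_inv_of_pos (by positivity), ← mul_assoc, ← mul_assoc, ← mul_assoc,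
    ← ofReal_mul (by positivity), ← ofReal_mul (by positivity),
    ← ofReal_mul (by positivity)]
  have : ε ^ (n - 1) * (ε ^ n)⁻¹ * (ε ^ n)⁻¹ * (ε ^ (n + 1) / 2) = 1 / 2 := by
    obtain ⟨m, rfl⟩ := Nat.exists_eq_add_of_le' hn
    simp only [Nat.add_sub_cancel]
    field_simp
    ring
  rw [this, ofReal_div_of_pos two_pos, ofReal_one, ofReal_ofNat,
    one_div, mul_comm, ← div_eq_mul_inv]

lemma measure_le_of_forall_isOpen {m₁ m₂ : Measure (E n)} [m₂.OuterRegular]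
    (h : ∀ U, IsOpen U → m₁ U ≤ m₂ U) (s : Set (E n)) : m₁ s ≤ m₂ s := by
  rw [s.measure_eq_iInf_isOpen m₂]
  exact le_iInf fun U => le_iInf fun hs => le_iInf fun hU => (measure_mono hs).trans (h U hU)

section Trunc
variable {g g' : E n → E n}

lemma pvar_le_pvar (hU : IsOpen U) (hu : LocInt u U) (hv : LocInt v U)
    (huv : ∀ x y, ofReal (u x - u y) ≤ ofReal (v x - v y)) (h : E n) : pvar u U h ≤ pvar v U h := by
  refine iSup_le fun φ => iSup_le fun hφ => iSup_le fun h0 => iSup_le fun h1 => ?_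
  obtain ⟨B, δ, hB, hδ, hφB, hBU, hBδ⟩ := hφ.exists_margin hU
  refine (le_pvar h hφB h0 h1).trans (pvar_le_of_frequently hB (hu.mono_set hBU) h ?_)
  refine Eventually.frequently ?_
  have hev : ∀ᶠ t in 𝓝[>] (0:ℝ), t * ‖h‖ < δ := by
    refine (Tendsto.mono_left ?_ nhdsWithin_le_nhds).eventually (gt_mem_nhds hδ)
    exact (continuous_mul_const ‖h‖).tendsto' 0 0 (zero_mul _)
  filter_upwards [hev, self_mem_nhdsWithin] with t ht (ht0 : 0 < t)
  rw [← pvar_smul v U ht0]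
  refine (lintegral_mono fun x => huv _ _).trans (lintegral_translate_le_pvar hB hv ?_)
  intro x hx θ hθ
  refine hBδ x hx _ ?_
  rw [dist_self_add_left, norm_smul, norm_smul, norm_of_nonneg hθ.1, norm_of_nonneg ht0.le]
  exact (mul_le_of_le_one_left (by positivity) hθ.2).trans_lt ht

lemma HasDens.ae_inner_le [IsFiniteMeasure μ] (hΩ : IsOpen Ω) (hμ : μ Ωᶜ = 0)
    (hg : HasDens u Ω μ g) (hg' : HasDens v Ω μ g') (hu : LocInt u Ω) (hv : LocInt v Ω)
    (huv : ∀ x y, ofReal (u x - u y) ≤ ofReal (v x - v y)) :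
    ∀ᵐ x ∂μ, ∀ h : E n, ofReal ⟪h, g x⟫ ≤ ofReal ⟪h, g' x⟫ := by
  have key : ∀ h : E n, ∀ᵐ x ∂μ, ofReal ⟪h, g x⟫ ≤ ofReal ⟪h, g' x⟫ := by
    intro h
    have hm : ∀ {G : E n → E n}, Integrable G μ →
        AEMeasurable (fun x => ofReal ⟪h, G x⟫) μ := fun hG =>
      (hG.const_inner h).aestronglyMeasurable.aemeasurable.ennreal_ofReal
    refine ae_le_of_forall_setLIntegral_le_of_sigmaFinite₀ (hm hg.int) fun s hs _ => ?_
    have hfin : IsFiniteMeasure (μ.withDensity fun x => ofReal ⟪h, g' x⟫) :=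
      isFiniteMeasure_withDensity_ofReal (hg'.int.const_inner h).2
    rw [← withDensity_apply _ hs, ← withDensity_apply _ hs]
    refine measure_le_of_forall_isOpen (fun U hU => ?_) s
    rw [withDensity_apply _ hU.measurableSet, withDensity_apply _ hU.measurableSet]
    have hUΩ : (U ∩ Ω : Set (E n)) =ᵐ[μ] U :=
      inter_ae_eq_left_of_ae_eq_univ (ae_eq_univ.2 hμ)
    rw [← Measure.restrict_congr_set hUΩ]
    exact (hg.le_pvar (hU.inter hΩ) inter_subset_right h).trans
      ((pvar_le_pvar (hU.inter hΩ) (hu.mono_set inter_subset_right)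
        (hv.mono_set inter_subset_right) huv h).trans
        (hg'.pvar_le (hU.inter hΩ) inter_subset_right h))
  obtain ⟨D, hDc, hDd⟩ := TopologicalSpace.exists_countable_dense (E n)
  filter_upwards [(ae_ball_iff hDc).2 fun h _ => key h] with x hx h
  have hc : IsClosed {h : E n | ofReal ⟪h, g x⟫ ≤ ofReal ⟪h, g' x⟫} :=
    isClosed_le (continuous_ofReal.comp (by fun_prop))
      (continuous_ofReal.comp (by fun_prop))
  exact hc.closure_subset_iff.2 (fun h hh => hx h hh) (hDd h)

lemma IsPair.exists_hasDens (hn : 0 < n) (hΩ : IsOpen Ω) (hp : IsPair f Ω μ σ) (hf : LocInt f Ω)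
    (hu : LocInt u Ω) (huv : ∀ x y, ofReal (u x - u y) ≤ ofReal (f x - f y)) :
    ∃ g, HasDens u Ω μ g := by
  have := hp.finite
  have hle : ∀ V ⊆ Ω, IsOpen V → ∀ h : E n, tvar u V h ≤ ofReal ‖h‖ * μ V := by
    intro V hV hVo h
    exact (add_le_add (pvar_le_pvar hVo (hu.mono_set hV) (hf.mono_set hV) huv h)
      (pvar_le_pvar hVo (hu.mono_set hV) (hf.mono_set hV) huv (-h))).trans
      (hp.tvar_le_mul hVo hV h)
  obtain ⟨m, s, hm⟩ := exists_isPair_of_tvar hΩ hu fun i =>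
    ((hle Ω subset_rfl hΩ _).trans_lt (by finiteness)).ne
  have := hm.finite
  have hms : ∀ s, m s ≤ (n • μ) s := by
    refine measure_le_of_forall_isOpen fun U hU => ?_
    have hUΩ : (U ∩ Ω : Set (E n)) =ᵐ[m] U :=
      inter_ae_eq_left_of_ae_eq_univ (ae_eq_univ.2 hm.null)
    rw [← measure_congr hUΩ, ← hm.lintegral_enorm]
    have hU' := hU.inter hΩ
    have hm' : ∀ h : E n, AEMeasurable (fun x => ofReal ⟪h, s x⟫) (m.restrict (U ∩ Ω)) :=
      fun h => ((hm.integrable.const_inner h).aestronglyMeasurable.aemeasurable.ennreal_ofReal).restrict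
    have h1 : ∀ i : Fin n, ∫⁻ x in U ∩ Ω, ofReal |⟪EuclideanSpace.single i (1:ℝ), s x⟫| ∂m
        ≤ μ U := by
      intro i
      simp only [ofReal_abs_eq]
      rw [lintegral_add_left' (hm' _)]
      simp only [← inner_neg_left]
      refine (add_le_add (hm.hasDens.le_pvar hU' inter_subset_right _)
        (hm.hasDens.le_pvar hU' inter_subset_right _)).trans
        ((hle _ inter_subset_right hU' _).trans ?_)
      simpa using measure_mono inter_subset_left
    calc ∫⁻ x in U ∩ Ω, ‖s x‖ₑ ∂m
        ≤ ∫⁻ x in U ∩ Ω, ∑ i : Fin n, ofReal |⟪EuclideanSpace.single i (1:ℝ), s x⟫| ∂m := by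
          refine lintegral_mono fun x => ?_
          rw [← ENNReal.ofReal_sum_of_nonneg fun _ _ => abs_nonneg _, ← ofReal_norm_eq_enorm]
          refine ofReal_le_ofReal ?_
          simp only [inner_single_one]
          rw [EuclideanSpace.norm_eq]
          refine Real.sqrt_le_iff.2 ⟨Finset.sum_nonneg fun _ _ => abs_nonneg _, ?_⟩
          exact Finset.sum_sq_le_sq_sum_of_nonneg fun _ _ => abs_nonneg _
      _ = ∑ i : Fin n, ∫⁻ x in U ∩ Ω, ofReal |⟪EuclideanSpace.single i (1:ℝ), s x⟫| ∂m :=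
          lintegral_finsetSum' _ fun i _ => by
            simp only [ofReal_abs_eq, ← inner_neg_left]
            exact (hm' _).add (hm' _)
      _ ≤ ∑ _i : Fin n, μ U := sum_le_sum fun i _ => h1 i
      _ = (n • μ) U := by simp
  have hac : m ≪ μ := by
    intro t ht
    refine le_antisymm ((hms t).trans ?_) (zero_le)
    simp [ht]
  have := Measure.haveLebesgueDecomposition_of_sigmaFinite m μ
  refine ⟨fun x => (m.rnDeriv μ x).toReal • s x, (integrable_rnDeriv_smul_iff hac).2 hm.integrable,
    fun φ hφ e => ?_⟩
  rw [hm.integral_eq φ hφ e, ← integral_rnDeriv_smul hac]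
  congr 2 with x
  rw [inner_smul_right, smul_eq_mul]
  ring

/-- The gradients of the truncations `min f q` are `F q` times that of `f`. -/
structure TruncDens (f : E n → ℝ) (Ω : Set (E n)) (μ : Measure (E n)) (σ : E n → E n)
    (F : ℚ → E n → ℝ) : Prop where
  pair : IsPair f Ω μ σ
  loc : LocInt f Ω
  dens : ∀ q : ℚ, HasDens (fun y => min (f y) q) Ω μ fun x => F q x • σ x
  aesm : ∀ q, AEStronglyMeasurable (F q) μ

lemma locallyIntegrableOn_const (c : ℝ) : LocInt (fun _ : E n => c) Ω :=
  (locallyIntegrable_const c).locallyIntegrableOn _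

lemma locallyIntegrableOn_min (hf : LocInt f Ω) (c : ℝ) : LocInt (fun x => min (f x) c) Ω := by
  have h := locallyIntegrableOn_lipschitz_comp hf (F := fun x => min x c - min 0 c) (by fun_prop)
    fun x => by
      have := abs_min_sub_min_le_max x c 0 c
      simpa using this
  simpa [Pi.add_def] using h.add (locallyIntegrableOn_const (min 0 c))

lemma ofReal_min_sub_min_le {s t : ℝ} (hst : s ≤ t) (a b : ℝ) :
    ofReal (min a s - min b s) ≤ ofReal (min a t - min b t) := by
  rcases le_total b a with h | h
  · refine ofReal_le_ofReal ?_
    rcases le_total a s with h1 | h1 <;> rcases le_total b s with h2 | h2 <;>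
    rcases le_total a t with h3 | h3 <;> rcases le_total b t with h4 | h4 <;>
    simp only [min_eq_left, min_eq_right, h1, h2, h3, h4] <;> linarith
  · rw [ofReal_of_nonpos (sub_nonpos.2 (min_le_min_right s h))]
    exact zero_le

lemma ofReal_min_sub_min_le_sub (s a b : ℝ) : ofReal (min a s - min b s) ≤ ofReal (a - b) := by
  have h := ofReal_min_sub_min_le (le_max_left s (max a b)) a b
  rwa [min_eq_left ((le_max_left a b).trans (le_max_right _ _)),
    min_eq_left ((le_max_right a b).trans (le_max_right _ _))] at h

lemma IsPair.exists_truncDens (hn : 0 < n) (hΩ : IsOpen Ω) (hp : IsPair f Ω μ σ)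
    (hf : LocInt f Ω) : ∃ F, TruncDens f Ω μ σ F := by
  have := hp.finite
  choose g hg using fun q : ℚ => hp.exists_hasDens hn hΩ hf (locallyIntegrableOn_min hf q)
    fun x y => ofReal_min_sub_min_le_sub q (f x) (f y)
  refine ⟨fun q x => ⟪g q x, σ x⟫, hp, hf, fun q => ?_, fun q => (hg q).int.1.inner hp.aesm⟩
  have hae : ∀ᵐ x ∂μ, g q x = ⟪g q x, σ x⟫ • σ x := by
    filter_upwards [(hg q).ae_inner_le hΩ hp.null hp.hasDens (locallyIntegrableOn_min hf q) hf
      fun x y => ofReal_min_sub_min_le_sub q (f x) (f y), hp.norm_eq] with x hx h1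
    set w := g q x - ⟪g q x, σ x⟫ • σ x with hw
    have hwσ : ⟪w, σ x⟫ = 0 := by
      rw [hw, inner_sub_left, inner_smul_left, real_inner_self_eq_norm_sq, h1]; simp
    have h := hx w
    have hgw : ⟪w, g q x⟫ = ‖w‖ ^ 2 := by
      have : g q x = w + ⟪g q x, σ x⟫ • σ x := by rw [hw]; abel
      rw [this, inner_add_right, inner_smul_right, hwσ, mul_zero, add_zero,
        real_inner_self_eq_norm_sq]
    rw [hwσ, hgw, ofReal_zero, nonpos_iff_eq_zero, ofReal_eq_zero] at h
    have : w = 0 := norm_eq_zero.1 (pow_eq_zero_iff (two_ne_zero) |>.1 (le_antisymm h (by positivity)))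
    exact sub_eq_zero.1 this
  refine ⟨(hg q).int.congr hae, fun φ hφ e => ?_⟩
  rw [(hg q).integral_eq φ hφ e]
  congr 1
  refine integral_congr_ae (hae.mono fun x hx => ?_)
  show φ x * ⟪e, g q x⟫ = φ x * ⟪e, ⟪g q x, σ x⟫ • σ x⟫
  rw [← hx]

lemma IsPair.neg (hp : IsPair f Ω μ σ) : IsPair (fun x => -f x) Ω μ fun x => -σ x :=
  ⟨hp.finite, hp.null, hp.aesm.neg, by simpa using hp.norm_eq, hp.hasDens.neg.integral_eq⟩

lemma HasDens.const (c : ℝ) : HasDens (fun _ => c) Ω μ fun _ => 0 := by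
  refine ⟨integrable_zero _ _ _, fun φ hφ e => ?_⟩
  have h := integral_mul_fderiv_eq_neg_fderiv_mul_of_integrable (μ := (volume : Measure (E n)))
    (f := fun _ => c) (g := φ) (v := e) (by simp)
    (hφ.integrable_mul_fderiv (locallyIntegrableOn_const c) e)
    (hφ.integrable_mul (locallyIntegrableOn_const c)) (by fun_prop)
    (fun x _ => hφ.differentiable x)
  simpa using h

lemma TruncDens.neg {F : ℚ → E n → ℝ} (h : TruncDens f Ω μ σ F) :
    TruncDens (fun x => -f x) Ω μ (fun x => -σ x) fun q x => 1 - F (-q) x := by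
  refine ⟨h.pair.neg, h.loc.neg, fun q => ?_, fun q => aestronglyMeasurable_const.sub (h.aesm _)⟩
  have h1 := ((h.dens (-q)).sub h.pair.hasDens (locallyIntegrableOn_min h.loc _) h.loc).sub
    (HasDens.const (-q : ℝ)) ((locallyIntegrableOn_min h.loc _).sub h.loc)
    (locallyIntegrableOn_const _)
  have hu : (fun x => min (f x) ((-q : ℚ) : ℝ) - f x - (-q : ℝ)) = fun x => min (-f x) q := by
    funext x
    push_cast
    rcases le_total (f x) (-q) with h | h
    · rw [min_eq_left h, min_eq_right (by linarith)]; ring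
    · rw [min_eq_right h, min_eq_left (by linarith)]; ring
  have hg : (fun x => F (-q) x • σ x - σ x - 0) = fun x => (1 - F (-q) x) • -σ x := by
    funext x
    module
  rwa [hu, hg] at h1

lemma TruncDens.ae_le_one (hΩ : IsOpen Ω) {F : ℚ → E n → ℝ} (h : TruncDens f Ω μ σ F) :
    ∀ᵐ x ∂μ, ∀ q, F q x ≤ 1 := by
  have := h.pair.finite
  refine ae_all_iff.2 fun q => ?_
  filter_upwards [(h.dens q).ae_inner_le hΩ h.pair.null h.pair.hasDens
    (locallyIntegrableOn_min h.loc q) h.loc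
    fun x y => ofReal_min_sub_min_le_sub q (f x) (f y), h.pair.norm_eq] with x hx h1
  have := hx (σ x)
  rw [inner_smul_right, real_inner_self_eq_norm_sq, h1, one_pow, mul_one] at this
  exact (ofReal_le_ofReal_iff zero_le_one).1 this

lemma TruncDens.ae_nonneg (hΩ : IsOpen Ω) {F : ℚ → E n → ℝ} (h : TruncDens f Ω μ σ F) :
    ∀ᵐ x ∂μ, ∀ q, 0 ≤ F q x := by
  filter_upwards [h.neg.ae_le_one hΩ] with x hx q
  have := hx (-q)
  rw [neg_neg] at this
  linarith

lemma TruncDens.ae_monotone (hΩ : IsOpen Ω) {F : ℚ → E n → ℝ} (h : TruncDens f Ω μ σ F) :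
    ∀ᵐ x ∂μ, Monotone fun q => F q x := by
  have := h.pair.finite
  have key : ∀ s t : ℚ, ∀ᵐ x ∂μ, s ≤ t → F s x ≤ F t x := by
    intro s t
    by_cases hst : s ≤ t
    swap
    · simp [hst]
    filter_upwards [(h.dens s).ae_inner_le hΩ h.pair.null (h.dens t)
      (locallyIntegrableOn_min h.loc s) (locallyIntegrableOn_min h.loc t)
      fun x y => ofReal_min_sub_min_le (Rat.cast_le.2 hst) (f x) (f y), h.pair.norm_eq,
      h.ae_nonneg hΩ] with x hx h1 h0 _
    have := hx (σ x)
    rw [inner_smul_right, inner_smul_right, real_inner_self_eq_norm_sq, h1, one_pow, mul_one,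
      mul_one] at this
    exact (ofReal_le_ofReal_iff (h0 t)).1 this
  filter_upwards [ae_all_iff.2 fun s => ae_all_iff.2 (key s)] with x hx s t hst using hx s t hst

lemma TruncDens.ae_tendsto_atTop (hΩ : IsOpen Ω) {F : ℚ → E n → ℝ} (h : TruncDens f Ω μ σ F) :
    ∀ᵐ x ∂μ, Tendsto (fun q => F q x) atTop (𝓝 1) := by
  have := h.pair.finite
  have hcast : Tendsto (fun k : ℕ => (k : ℚ)) atTop atTop := tendsto_natCast_atTop_atTop
  set G : E n → ℝ := fun x => ⨆ q, F q x with hG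
  have hlim : ∀ᵐ x ∂μ, Tendsto (fun q => F q x) atTop (𝓝 (G x)) := by
    filter_upwards [h.ae_monotone hΩ, h.ae_le_one hΩ] with x hm h1
    exact tendsto_atTop_ciSup hm ⟨1, by rintro _ ⟨q, rfl⟩; exact h1 q⟩
  have hGm : AEStronglyMeasurable G μ := aestronglyMeasurable_of_tendsto_ae atTop
    (fun k : ℕ => h.aesm k) (hlim.mono fun x hx => hx.comp hcast)
  have hσi := h.pair.integrable
  have hGd : HasDens f Ω μ fun x => G x • σ x := by
    have hb : ∀ k : ℕ, ∀ᵐ x ∂μ, ‖F k x • σ x‖ ≤ 1 := by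
      intro k
      filter_upwards [h.ae_nonneg hΩ, h.ae_le_one hΩ, h.pair.norm_eq] with x h0 h1 hs
      rw [norm_smul, hs, mul_one, norm_of_nonneg (h0 _)]
      exact h1 _
    refine ⟨Integrable.mono' (integrable_const 1) (hGm.smul h.pair.aesm) ?_, fun φ hφ e => ?_⟩
    · filter_upwards [hlim, ae_all_iff.2 hb] with x hx hb
      exact le_of_tendsto' ((hx.comp hcast).smul_const (σ x)).norm hb
    obtain ⟨C, hC⟩ := hφ.2.exists_bound_of_continuous hφ.continuous
    have t1 : Tendsto (fun k : ℕ => ∫ x, min (f x) ((k : ℚ) : ℝ) * fderiv ℝ φ x e) atTop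
        (𝓝 (∫ x, f x * fderiv ℝ φ x e)) := by
      refine tendsto_integral_of_dominated_convergence (fun x => ‖f x * fderiv ℝ φ x e‖)
        (fun k => (hφ.integrable_mul_fderiv (locallyIntegrableOn_min h.loc _) e).1)
        (hφ.integrable_mul_fderiv h.loc e).norm (fun k => Eventually.of_forall fun x => ?_)
        (.of_forall fun x => ?_)
      · simp only [norm_mul]
        refine mul_le_mul_of_nonneg_right ?_ (norm_nonneg _)
        have : (0:ℝ) ≤ ((k : ℚ) : ℝ) := by positivity
        rcases le_total (f x) ((k : ℚ) : ℝ) with h | h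
        · rw [min_eq_left h]
        · rw [min_eq_right h, norm_of_nonneg this]
          exact h.trans (Real.le_norm_self _)
      · refine tendsto_const_nhds.congr' ?_
        filter_upwards [eventually_ge_atTop ⌈f x⌉₊] with k hk
        rw [min_eq_left]
        simpa using Nat.ceil_le.1 hk
    have t2 : Tendsto (fun k : ℕ => ∫ x, φ x * ⟪e, F k x • σ x⟫ ∂μ) atTop
        (𝓝 (∫ x, φ x * ⟪e, G x • σ x⟫ ∂μ)) := by
      refine tendsto_integral_of_dominated_convergence (fun x => C * ‖e‖)
        (fun k => ((h.dens k).integrable_mul_inner hφ e).1) (integrable_const _)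
        (fun k => ?_) ?_
      · filter_upwards [hb k] with x hx
        rw [norm_mul]
        refine mul_le_mul (hC x) ((norm_inner_le_norm _ _).trans
          (mul_le_of_le_one_right (norm_nonneg _) hx)) (norm_nonneg _)
          ((norm_nonneg _).trans (hC x))
      · filter_upwards [hlim] with x hx
        exact tendsto_const_nhds.mul (tendsto_const_nhds.inner
          ((hx.comp hcast).smul_const (σ x)))
    exact tendsto_nhds_unique t1 (t2.neg.congr fun k => ((h.dens k).integral_eq φ hφ e).symm)
  filter_upwards [hlim, h.ae_le_one hΩ, h.pair.norm_eq, h.pair.hasDens.ae_inner_le hΩ h.pair.null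
    hGd h.loc h.loc fun _ _ => le_rfl] with x hx h1 hs hle
  have h2 := hle (σ x)
  rw [inner_smul_right, real_inner_self_eq_norm_sq, hs, one_pow, mul_one] at h2
  have h3 : 1 ≤ G x := by
    by_contra hc
    exact absurd ((ENNReal.ofReal_lt_ofReal_iff zero_lt_one).2 (not_le.1 hc)) (not_lt.2 h2)
  rwa [le_antisymm (le_of_tendsto' hx h1) h3] at hx

lemma TruncDens.ae_tendsto_atBot (hΩ : IsOpen Ω) {F : ℚ → E n → ℝ} (h : TruncDens f Ω μ σ F) :
    ∀ᵐ x ∂μ, Tendsto (fun q => F q x) atBot (𝓝 0) := by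
  filter_upwards [h.neg.ae_tendsto_atTop hΩ] with x hx
  have h2 := (hx.comp tendsto_neg_atBot_atTop).const_sub 1
  simpa [comp_def] using h2

end Trunc

/-- `x` is a Lebesgue point of `g` with respect to `μ`, along closed balls. -/
def LebPt (μ : Measure (E n)) (g : E n → E n) (x : E n) : Prop :=
  ∀ τ : ℝ, 0 < τ → ∃ R > 0, ∀ ρ ∈ Icc 0 R,
    ∫⁻ y in closedBall x ρ, ‖g y - g x‖ₑ ∂μ ≤ ofReal τ * μ (closedBall x ρ)

lemma ae_lebPt [IsFiniteMeasure μ] {g : E n → E n} (hg : Integrable g μ) :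
    ∀ᵐ x ∂μ, LebPt μ g x := by
  filter_upwards [(Besicovitch.vitaliFamily μ).ae_tendsto_lintegral_enorm_sub_div
    hg.locallyIntegrable] with x hx τ hτ
  have h1 := (hx.comp (Besicovitch.tendsto_filterAt μ x)).eventually
    (Iio_mem_nhds (ofReal_pos.2 hτ))
  obtain ⟨R, hR, h⟩ := (mem_nhdsGT_iff_exists_Ioc_subset).1 h1
  refine ⟨R, hR, fun ρ hρ => ?_⟩
  rcases hρ.1.eq_or_lt with h0 | h0
  · rw [← h0, closedBall_zero, lintegral_singleton, sub_self, enorm_zero, zero_mul]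
    exact zero_le
  have h2 : (∫⁻ y in closedBall x ρ, ‖g y - g x‖ₑ ∂μ) / μ (closedBall x ρ) < ofReal τ :=
    h ⟨h0, hρ.2⟩
  exact (ENNReal.div_le_iff_le_mul (Or.inr ofReal_ne_top)
    (Or.inl (measure_ne_top _ _))).1 h2.le

lemma LebPt.sub {g g' : E n → E n} (hg : LebPt μ g x) (hg' : LebPt μ g' x)
    (hm : AEStronglyMeasurable g μ) : LebPt μ (fun y => g y - g' y) x := by
  intro τ hτ
  obtain ⟨R, hR, h⟩ := hg (τ / 2) (by positivity)
  obtain ⟨R', hR', h'⟩ := hg' (τ / 2) (by positivity)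
  refine ⟨min R R', lt_min hR hR', fun ρ hρ => ?_⟩
  calc ∫⁻ y in closedBall x ρ, ‖g y - g' y - (g x - g' x)‖ₑ ∂μ
      ≤ ∫⁻ y in closedBall x ρ, (‖g y - g x‖ₑ + ‖g' y - g' x‖ₑ) ∂μ := by
        refine lintegral_mono fun y => ?_
        rw [sub_sub_sub_comm]
        exact enorm_sub_le
    _ = _ := lintegral_add_left' (hm.sub aestronglyMeasurable_const).enorm.restrict _
    _ ≤ _ := add_le_add (h ρ ⟨hρ.1, hρ.2.trans (min_le_left _ _)⟩)
        (h' ρ ⟨hρ.1, hρ.2.trans (min_le_right _ _)⟩)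
    _ = _ := by rw [← add_mul, ← ofReal_add (by positivity) (by positivity), add_halves]

lemma LebPt.neg {g : E n → E n} (hg : LebPt μ g x) : LebPt μ (fun y => -g y) x := by
  intro τ hτ
  obtain ⟨R, hR, h⟩ := hg τ hτ
  refine ⟨R, hR, fun ρ hρ => (le_of_eq ?_).trans (h ρ hρ)⟩
  refine lintegral_congr fun y => ?_
  rw [neg_sub_neg, ← enorm_neg, neg_sub]

lemma lintegral_radial_le {m m' : Measure (E n)} {η : E n → ℝ} {c : ℝ≥0∞} (hc : Continuous η)
    (h0 : ∀ y, 0 ≤ η y) (hR : ∀ y ∉ closedBall x R, η y = 0)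
    (hη : ∀ y y', dist y' x ≤ dist y x → η y ≤ η y')
    (h : ∀ ρ ∈ Icc 0 R, m' (closedBall x ρ) ≤ c * m (closedBall x ρ)) (hct : c ≠ ⊤) :
    ∫⁻ y, ofReal (η y) ∂m' ≤ c * ∫⁻ y, ofReal (η y) ∂m := by
  rw [lintegral_eq_lintegral_meas_le _ (.of_forall h0) hc.measurable.aemeasurable,
    lintegral_eq_lintegral_meas_le _ (.of_forall h0) hc.measurable.aemeasurable,
    ← lintegral_const_mul' _ _ hct]
  refine setLIntegral_mono' measurableSet_Ioi fun t (ht : 0 < t) => ?_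
  rcases Set.eq_empty_or_nonempty {y | t ≤ η y} with he | hne
  · simp [he]
  have hsub : {y | t ≤ η y} ⊆ closedBall x R := fun y (hy : t ≤ η y) => by
    by_contra hyR
    rw [hR y hyR] at hy
    linarith
  have hcpt : IsCompact {y | t ≤ η y} := (isCompact_closedBall x R).of_isClosed_subset
    (isClosed_le continuous_const hc) hsub
  obtain ⟨z, hz, hmax⟩ := hcpt.exists_isMaxOn hne (f := fun y => dist y x) (by fun_prop)
  have heq : {y | t ≤ η y} = closedBall x (dist z x) :=
    Subset.antisymm (fun y hy => hmax hy) fun y hy => le_trans hz (hη z y hy)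
  rw [heq]
  exact h _ ⟨dist_nonneg, hsub hz⟩

/-- The profile of the radial test functions. -/
def radial (n : ℕ) (z : E n) : ℝ := expNegInvGlue (1 - ‖z‖ ^ 2 / 4)

lemma contDiff_radial : ContDiff ℝ 1 (radial n) :=
  (expNegInvGlue.contDiff (n := 1)).comp
    (contDiff_const.sub ((contDiff_norm_sq ℝ).div_const 4))

lemma radial_eq_zero (hz : 2 ≤ ‖z‖) : radial n z = 0 :=
  expNegInvGlue.zero_of_nonpos (by nlinarith)

lemma radial_anti {w : E n} (h : ‖w‖ ≤ ‖z‖) : radial n z ≤ radial n w := by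
  refine expNegInvGlue.monotone ?_
  have := pow_le_pow_left₀ (norm_nonneg _) h 2
  linarith

lemma isTest_radial (hr : 0 < r) (hΩ : closedBall x (2 * r) ⊆ Ω) :
    IsTest Ω fun y => radial n (r⁻¹ • (y - x)) := by
  have hsub : tsupport (fun y => radial n (r⁻¹ • (y - x))) ⊆ closedBall x (2 * r) := by
    refine closure_minimal (fun y hy => ?_) isClosed_closedBall
    by_contra h
    refine hy (radial_eq_zero ?_)
    rw [mem_closedBall, not_le, dist_eq_norm] at h
    rw [norm_smul, norm_inv, norm_of_nonneg hr.le, le_inv_mul_iff₀ hr]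
    linarith
  exact ⟨contDiff_radial.comp (by fun_prop), (isCompact_closedBall x (2 * r)).of_isClosed_subset
    (isClosed_tsupport _) hsub, hsub.trans hΩ⟩

lemma exists_radial_bound (n : ℕ) : ∃ L > 0, ∀ z : E n, ‖fderiv ℝ (radial n) z‖ ≤ L := by
  have hcs : HasCompactSupport (radial n) := by
    refine HasCompactSupport.intro (isCompact_closedBall (0 : E n) 2) fun z hz => radial_eq_zero ?_
    simpa using le_of_not_ge (by simpa using hz)
  obtain ⟨L, hL⟩ := (hcs.fderiv ℝ).exists_bound_of_continuous
    (contDiff_radial.continuous_fderiv one_ne_zero)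
  exact ⟨max L 1, by positivity, fun z => (hL z).trans (le_max_left _ _)⟩

lemma exists_flux (n : ℕ) : ∃ c₀ > 0, ∃ L > 0, ∀ {u : E n → ℝ} {Ω : Set (E n)}
    {μ : Measure (E n)} {g : E n → E n} {x ν : E n} {p τ r : ℝ} (k : ℝ), HasDens u Ω μ g →
    IsFiniteMeasure μ → LocInt u Ω → 0 < r → closedBall x (2 * r) ⊆ Ω →
    ‖ν‖ = 1 → (∀ ρ ∈ Icc 0 (2 * r), ∫⁻ y in closedBall x ρ, ‖g y - p • ν‖ₑ ∂μ ≤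
      ofReal τ * μ (closedBall x ρ)) → 0 ≤ τ → τ ≤ p →
    ofReal ((p - τ) * c₀) * μ (closedBall x r) ≤
      ofReal (L / r) * ∫⁻ y in closedBall x (2 * r), ofReal |u y - k| := by
  obtain ⟨L, hL, hbd⟩ := exists_radial_bound n
  refine ⟨expNegInvGlue (3 / 4), expNegInvGlue.pos_of_pos (by norm_num), L, hL, ?_⟩
  intro u Ω μ g x ν p τ r k hd hfin hu hr hΩ hν hdev hτ hτp
  set η : E n → ℝ := fun y => radial n (r⁻¹ • (y - x)) with hηdef
  have hη : IsTest Ω η := isTest_radial hr hΩ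
  have hη0 : ∀ y, 0 ≤ η y := fun y => expNegInvGlue.nonneg _
  have hηR : ∀ y ∉ closedBall x (2 * r), η y = 0 := fun y hy =>
    (isTest_radial hr subset_rfl).eq_zero hy
  have hηi : Integrable η μ := hη.continuous.integrable_of_hasCompactSupport hη.2
  have hdi : Integrable (fun y => η y * ‖g y - p • ν‖) μ := by
    obtain ⟨C, hC⟩ := hη.2.exists_bound_of_continuous hη.continuous
    exact (hd.int.sub (integrable_const _)).norm.bdd_mul (c := C)
      hη.continuous.aestronglyMeasurable (.of_forall hC)
  have hcake : ∫ y, η y * ‖g y - p • ν‖ ∂μ ≤ τ * ∫ y, η y ∂μ := by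
    have hgm : AEMeasurable (fun y => ‖g y - p • ν‖ₑ) μ :=
      (hd.int.1.sub aestronglyMeasurable_const).enorm
    have h := lintegral_radial_le (m := μ) (m' := μ.withDensity fun y => ‖g y - p • ν‖ₑ)
      (c := ofReal τ) hη.continuous hη0 hηR (fun y y' h => radial_anti (by
        rw [dist_eq_norm, dist_eq_norm] at h
        rw [norm_smul, norm_smul]
        gcongr)) (fun ρ hρ => by
        rw [withDensity_apply _ measurableSet_closedBall]
        exact hdev ρ hρ) ofReal_ne_top
    rw [lintegral_withDensity_eq_lintegral_mul₀ hgm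
        (hη.continuous.measurable.ennreal_ofReal.aemeasurable),
      ← ofReal_integral_eq_lintegral_ofReal hηi (.of_forall hη0),
      ← ofReal_mul hτ] at h
    rw [← ofReal_le_ofReal_iff (mul_nonneg hτ (integral_nonneg hη0)),
      ofReal_integral_eq_lintegral_ofReal hdi
        (.of_forall fun y => mul_nonneg (hη0 y) (norm_nonneg _))]
    refine (le_of_eq (lintegral_congr fun y => ?_)).trans h
    rw [ofReal_mul (hη0 y), ofReal_norm_eq_enorm, Pi.mul_apply, mul_comm]
  have hlow : (p - τ) * ∫ y, η y ∂μ ≤ ∫ y, η y * ⟪ν, g y⟫ ∂μ := by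
    have h1 : ∫ y, (p * η y - η y * ‖g y - p • ν‖) ∂μ ≤ ∫ y, η y * ⟪ν, g y⟫ ∂μ := by
      refine integral_mono ((hηi.const_mul p).sub hdi) (hd.integrable_mul_inner hη ν) fun y => ?_
      have h2 : ⟪ν, g y⟫ = p + ⟪ν, g y - p • ν⟫ := by
        rw [inner_sub_right, inner_smul_right, real_inner_self_eq_norm_sq, hν]
        ring
      have h3 := neg_le_of_abs_le ((abs_real_inner_le_norm ν (g y - p • ν)).trans_eq
        (by rw [hν, one_mul]))
      show p * η y - η y * ‖g y - p • ν‖ ≤ η y * ⟪ν, g y⟫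
      rw [h2]
      nlinarith [hη0 y]
    rw [integral_sub (hηi.const_mul p) hdi, integral_const_mul] at h1
    linarith
  have hup : ofReal (∫ y, η y * ⟪ν, g y⟫ ∂μ) ≤
      ofReal (L / r) * ∫⁻ y in closedBall x (2 * r), ofReal |u y - k| := by
    have h1 := (hd.sub (HasDens.const k) hu (locallyIntegrableOn_const k)).integral_eq η hη ν
    simp only [sub_zero] at h1
    rw [← neg_neg (∫ y, η y * ⟪ν, g y⟫ ∂μ), ← h1, ← integral_neg]
    refine (ofReal_integral_le_lintegral_ofReal _).trans ?_
    rw [← lintegral_const_mul' _ _ ofReal_ne_top,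
      ← lintegral_indicator measurableSet_closedBall]
    refine lintegral_mono fun y => ?_
    by_cases hy : y ∈ closedBall x (2 * r)
    · rw [indicator_of_mem hy, ← ofReal_mul (by positivity)]
      refine ofReal_le_ofReal ((neg_le_abs _).trans ?_)
      rw [abs_mul, mul_comm]
      refine mul_le_mul_of_nonneg_right ?_ (abs_nonneg _)
      have hfd : fderiv ℝ η y = (fderiv ℝ (radial n) (r⁻¹ • (y - x))).comp
          (r⁻¹ • ContinuousLinearMap.id ℝ (E n)) := by
        have h2 : HasFDerivAt (fun y => r⁻¹ • (y - x)) (r⁻¹ • ContinuousLinearMap.id ℝ (E n)) y :=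
          ((hasFDerivAt_id y).sub_const x).const_smul r⁻¹
        exact (((contDiff_radial.differentiable one_ne_zero _).hasFDerivAt).comp y h2).fderiv
      rw [hfd, ContinuousLinearMap.comp_apply, ContinuousLinearMap.smul_apply,
        ContinuousLinearMap.id_apply, map_smul, smul_eq_mul, abs_mul,
        abs_of_pos (inv_pos.2 hr), div_eq_inv_mul]
      refine mul_le_mul_of_nonneg_left ?_ (inv_pos.2 hr).le
      exact ((fderiv ℝ (radial n) _).le_opNorm ν).trans (by rw [hν, mul_one]; exact hbd _)
    · rw [(isTest_radial hr subset_rfl).fderiv_eq_zero hy, mul_zero, neg_zero, ofReal_zero]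
      exact zero_le
  refine le_trans ?_ hup
  rw [← ofReal_measureReal, ← ofReal_mul (mul_nonneg (by linarith) (expNegInvGlue.nonneg _))]
  refine ofReal_le_ofReal (le_trans ?_ hlow)
  rw [mul_assoc]
  refine mul_le_mul_of_nonneg_left ?_ (by linarith)
  rw [mul_comm, ← smul_eq_mul, ← setIntegral_const]
  refine (setIntegral_mono_on (integrable_const _).integrableOn hηi.integrableOn
    measurableSet_closedBall fun y hy => ?_).trans
    (setIntegral_le_integral hηi (.of_forall hη0))
  refine expNegInvGlue.monotone ?_
  rw [mem_closedBall, dist_eq_norm] at hy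
  have h4 : ‖r⁻¹ • (y - x)‖ ≤ 1 := by
    rw [norm_smul, norm_inv, norm_of_nonneg hr.le, inv_mul_le_iff₀ hr]
    linarith
  nlinarith [norm_nonneg (r⁻¹ • (y - x))]

lemma lintegral_lintegral_le_of_pvar {A' B : Set (E n)} (hB : IsOpen B) (hBc : Convex ℝ B)
    (hv : LocInt v B) (hvm : Measurable v) (hA : MeasurableSet A) (hA' : MeasurableSet A')
    (hAB : A ⊆ B) (hAB' : A' ⊆ B) {N : ℝ≥0∞} (hR : ∀ y ∈ A, ∀ y' ∈ A', ‖y' - y‖ < R)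
    (hN : ∀ y ∈ A, ∀ y' ∈ A', pvar v B (y' - y) ≤ N) :
    ∫⁻ y in A, (∫⁻ y' in A', ofReal (v y' - v y)) ≤ volume (ball (0 : E n) R) * N := by
  set Ψ : E n × E n → ℝ≥0∞ := (A ×ˢ A').indicator fun p => ofReal (v p.2 - v p.1) with hΨ
  have hΨm : Measurable Ψ := by
    refine Measurable.indicator ?_ (hA.prod hA')
    fun_prop
  have h1 : ∫⁻ y in A, (∫⁻ y' in A', ofReal (v y' - v y)) = ∫⁻ y, ∫⁻ h, Ψ (y, y + h) := by
    rw [← lintegral_indicator hA]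
    refine lintegral_congr fun y => ?_
    rw [lintegral_add_left_eq_self (fun y' => Ψ (y, y')) y]
    by_cases hy : y ∈ A
    · rw [indicator_of_mem hy, ← lintegral_indicator hA']
      refine lintegral_congr fun y' => ?_
      by_cases hy' : y' ∈ A' <;> simp [hΨ, hy, hy']
    · simp [hΨ, hy]
  rw [h1, lintegral_lintegral_swap (by
    exact (hΨm.comp (measurable_fst.prodMk (measurable_fst.add measurable_snd))).aemeasurable),
    mul_comm, ← setLIntegral_const, ← lintegral_indicator measurableSet_ball]
  refine lintegral_mono fun h => ?_
  by_cases hex : ∃ y ∈ A, y + h ∈ A'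
  swap
  · push Not at hex
    refine (le_of_eq ?_).trans zero_le
    refine lintegral_eq_zero_of_ae_eq_zero (.of_forall fun y => ?_)
    by_cases hy : y ∈ A
    · simp [hΨ, hex y hy]
    · simp [hΨ, hy]
  obtain ⟨y₀, hy₀, hy₀'⟩ := hex
  have hR' := hR y₀ hy₀ _ hy₀'
  have hN' := hN y₀ hy₀ _ hy₀'
  rw [add_sub_cancel_left] at hR' hN'
  rw [indicator_of_mem (by simpa using hR')]
  refine le_trans ?_ hN'
  have hA₀ : IsOpen (B ∩ (fun y => y + h) ⁻¹' B) := hB.inter (hB.preimage (by fun_prop))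
  refine le_trans ?_ (lintegral_translate_le_pvar hA₀ hv (h := h) fun y hy θ hθ => ?_)
  · rw [← lintegral_indicator hA₀.measurableSet]
    refine lintegral_mono fun y => ?_
    by_cases hy : y ∈ A ∧ y + h ∈ A'
    · have hm : y ∈ B ∩ (fun y => y + h) ⁻¹' B := ⟨hAB hy.1, hAB' hy.2⟩
      rw [indicator_of_mem hm]
      exact Set.indicator_le_self _ _ _
    · rw [hΨ, indicator_of_notMem (by simpa using hy)]
      exact zero_le
  · exact hBc.add_smul_mem hy.1 hy.2 hθ

lemma HasDens.exists_lintegral_sub_le {g : E n → E n} (hd : HasDens u Ω μ g) (hu : LocInt u Ω)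
    (hum : Measurable u) (hr : 0 < r) (hΩ : ball x r ⊆ Ω) :
    ∫⁻ y in ball x r, (∫⁻ y' in ball x r, ofReal |u y' - u y|) ≤
      volume (ball (0 : E n) (2 * r)) *
        (ofReal (4 * r) * ∫⁻ y in ball x r, ‖g y‖ₑ ∂μ) := by
  set N := ofReal (2 * r) * ∫⁻ y in ball x r, ‖g y‖ₑ ∂μ with hN
  have hR : ∀ y ∈ ball x r, ∀ y' ∈ ball x r, ‖y' - y‖ < 2 * r := fun y hy y' hy' => by
    rw [← dist_eq_norm]
    linarith [dist_triangle_right y' y x, mem_ball.1 hy, mem_ball.1 hy']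
  have hle : ∀ y ∈ ball x r, ∀ y' ∈ ball x r, tvar u (ball x r) (y' - y) ≤ N :=
    fun y hy y' hy' => (hd.tvar_le isOpen_ball hΩ _).trans
      (mul_le_mul_left (ofReal_le_ofReal (hR y hy y' hy').le) _)
  have h1 := lintegral_lintegral_le_of_pvar (v := u) (N := N) isOpen_ball (convex_ball x r)
    (hu.mono_set hΩ) hum measurableSet_ball measurableSet_ball subset_rfl subset_rfl hR
    fun y hy y' hy' => le_self_add.trans (hle y hy y' hy')
  have h2 := lintegral_lintegral_le_of_pvar (v := fun y => -u y) (N := N) isOpen_ball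
    (convex_ball x r) (hu.mono_set hΩ).neg hum.neg measurableSet_ball measurableSet_ball subset_rfl
    subset_rfl hR fun y hy y' hy' => by
      rw [pvar_neg_fun]
      exact le_add_self.trans (hle y hy y' hy')
  have h3 : ofReal (4 * r) * ∫⁻ y in ball x r, ‖g y‖ₑ ∂μ = N + N := by
    rw [hN, ← add_mul, ← ofReal_add (by positivity) (by positivity)]
    congr 2
    ring
  rw [h3, mul_add]
  refine le_trans (le_of_eq ?_) (add_le_add h1 h2)
  rw [← lintegral_add_left (Measurable.lintegral_prod_right'
    (f := fun p : E n × E n => ofReal (u p.2 - u p.1)) (by fun_prop))]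
  refine lintegral_congr fun y => ?_
  rw [← lintegral_add_left (by fun_prop)]
  refine lintegral_congr fun y' => ?_
  rw [ofReal_abs_eq]
  congr 2
  ring

/-- Differentiation properties of the gradient measure at `x`, and of its truncations. -/
structure GoodPt (f : E n → ℝ) (Ω : Set (E n)) (μ : Measure (E n)) (σ : E n → E n)
    (F : ℚ → E n → ℝ) (x : E n) : Prop where
  td : TruncDens f Ω μ σ F
  isOpen : IsOpen Ω
  meas : Measurable f
  mem : x ∈ Ω
  norm_eq : ‖σ x‖ = 1
  leb : LebPt μ σ x
  lebF : ∀ q, LebPt μ (fun y => F q y • σ y) x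
  mono : Monotone fun q => F q x
  nonneg : ∀ q, 0 ≤ F q x
  le_one : ∀ q, F q x ≤ 1
  top : Tendsto (fun q => F q x) atTop (𝓝 1)
  bot : Tendsto (fun q => F q x) atBot (𝓝 0)
  dens : ∃ C > 0, ∀ᶠ r in 𝓝[>] (0:ℝ), r ^ n ≤ C * μ.real (closedBall x r)

lemma ae_eventually_pow_le (μ : Measure (E n)) [IsFiniteMeasure μ] : ∀ᵐ x ∂μ,
    ∃ C > 0, ∀ᶠ r in 𝓝[>] (0:ℝ), r ^ n ≤ C * μ.real (closedBall x r) := by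
  filter_upwards [(Besicovitch.vitaliFamily μ).ae_tendsto_rnDeriv (volume : Measure (E n)),
    Measure.rnDeriv_ne_top (volume : Measure (E n)) μ] with x hx hxt
  set W := volume.real (ball (0 : E n) 1)
  have hW : 0 < W := toReal_pos (measure_ball_pos _ _ one_pos).ne' measure_ball_lt_top.ne
  obtain ⟨c, hc⟩ := exists_nat_gt ((volume : Measure (E n)).rnDeriv μ x).toReal
  have hc0 : (0:ℝ) < c := ENNReal.toReal_nonneg.trans_lt hc
  refine ⟨c / W, by positivity, ?_⟩
  have h1 := (hx.comp (Besicovitch.tendsto_filterAt μ x)).eventually_lt_const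
    ((ENNReal.lt_ofReal_iff_toReal_lt hxt).2 hc)
  filter_upwards [h1, self_mem_nhdsWithin] with r hr (hr0 : 0 < r)
  have h2 : volume (closedBall x r) / μ (closedBall x r) < ofReal c := hr
  have h3 := (ENNReal.div_le_iff_le_mul (Or.inr ofReal_ne_top)
    (Or.inl (measure_ne_top _ _))).1 h2.le
  rw [Measure.addHaar_closedBall _ _ hr0.le, finrank_euclideanSpace_fin] at h3
  have h4 := toReal_mono (mul_ne_top ofReal_ne_top (measure_ne_top _ _)) h3
  rw [toReal_mul, toReal_mul, toReal_ofReal (by positivity),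
    toReal_ofReal hc0.le] at h4
  rw [div_mul_eq_mul_div, le_div_iff₀ hW]
  exact h4

lemma TruncDens.ae_goodPt {F : ℚ → E n → ℝ} (h : TruncDens f Ω μ σ F) (hΩ : IsOpen Ω)
    (hf : Measurable f) : ∀ᵐ x ∂μ, GoodPt f Ω μ σ F x := by
  have := h.pair.finite
  have h1 : ∀ᵐ x ∂μ, x ∈ Ω := by
    rw [ae_iff]
    exact h.pair.null
  filter_upwards [h1, h.pair.norm_eq, ae_lebPt h.pair.integrable,
    ae_all_iff.2 fun q => ae_lebPt (h.dens q).int, h.ae_monotone hΩ, h.ae_nonneg hΩ,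
    h.ae_le_one hΩ, h.ae_tendsto_atTop hΩ, h.ae_tendsto_atBot hΩ, ae_eventually_pow_le μ]
    with x a1 a2 a3 a4 a5 a6 a7 a8 a9 a10
  exact ⟨h, hΩ, hf, a1, a2, a3, a4, a5, a6, a7, a8, a9, a10⟩

section GoodPt
variable {F : ℚ → E n → ℝ}

lemma GoodPt.neg (h : GoodPt f Ω μ σ F x) :
    GoodPt (fun y => -f y) Ω μ (fun y => -σ y) (fun q y => 1 - F (-q) y) x := by
  refine ⟨h.td.neg, h.isOpen, h.meas.neg, h.mem, by simpa using h.norm_eq, h.leb.neg, fun q => ?_,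
    fun q q' hq => sub_le_sub_left (h.mono (neg_le_neg hq)) 1, fun q => sub_nonneg.2 (h.le_one _),
    fun q => sub_le_self _ (h.nonneg _), ?_, ?_, h.dens⟩
  · have := (h.lebF (-q)).sub h.leb (h.td.dens (-q)).int.aestronglyMeasurable
    refine cast (congrArg (fun g => LebPt μ g x) (funext fun y => ?_)) this
    rw [sub_smul, smul_neg, one_smul, smul_neg]
    abel
  · simpa [comp_def] using (h.bot.comp tendsto_neg_atTop_atBot).const_sub 1
  · simpa [comp_def] using (h.top.comp tendsto_neg_atBot_atTop).const_sub 1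

lemma LebPt.eventually {g : E n → E n} (hg : LebPt μ g x) (hτ : 0 < τ) :
    ∀ᶠ r in 𝓝[>] (0:ℝ), ∀ ρ ∈ Icc 0 r,
      ∫⁻ y in closedBall x ρ, ‖g y - g x‖ₑ ∂μ ≤ ofReal τ * μ (closedBall x ρ) := by
  obtain ⟨R, hR, h⟩ := hg τ hτ
  filter_upwards [nhdsWithin_le_nhds (ge_mem_nhds hR)] with r hr ρ hρ
  exact h ρ ⟨hρ.1, hρ.2.trans hr⟩

lemma eventually_mul {p : ℝ → Prop} {c : ℝ} (hc : 0 < c) (h : ∀ᶠ r in 𝓝[>] (0:ℝ), p r) :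
    ∀ᶠ r in 𝓝[>] (0:ℝ), p (c * r) := by
  have : Tendsto (fun r : ℝ => c * r) (𝓝[>] 0) (𝓝[>] 0) := by
    refine tendsto_nhdsWithin_iff.2 ⟨?_, ?_⟩
    · have := (continuous_const_mul c).tendsto (0:ℝ)
      rw [mul_zero] at this
      exact this.mono_left nhdsWithin_le_nhds
    · filter_upwards [self_mem_nhdsWithin] with r hr using mul_pos hc hr
  exact this.eventually h

lemma exists_eventually_flux (n : ℕ) : ∃ A > 0, ∀ {u : E n → ℝ} {Ω : Set (E n)}
    {μ : Measure (E n)} {g : E n → E n} {x ν : E n} {p : ℝ}, HasDens u Ω μ g →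
    IsFiniteMeasure μ → LocInt u Ω → IsOpen Ω → x ∈ Ω → ‖ν‖ = 1 →
    LebPt μ g x → g x = p • ν → 0 < p → ∀ᶠ r in 𝓝[>] (0:ℝ), ∀ k I : ℝ, 0 ≤ I →
      ∫⁻ y in closedBall x (2 * r), ofReal |u y - k| ≤ ofReal I →
      p * (r * μ.real (closedBall x r)) ≤ A * I := by
  obtain ⟨c₀, hc₀, L, hL, h⟩ := exists_flux n
  refine ⟨2 * L / c₀, by positivity, ?_⟩
  intro u Ω μ g x ν p hd hfin hu hΩ hx hν hg hgx hp
  filter_upwards [eventually_mul two_pos (hg.eventually (half_pos hp)),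
    eventually_mul two_pos (eventually_closedBall_subset hΩ hx), self_mem_nhdsWithin]
    with r h1 h2 (hr : 0 < r) k I hI h3
  rw [hgx] at h1
  have h4 := (h k hd hfin hu hr h2 hν h1 (half_pos hp).le (half_le_self hp.le)).trans
    (mul_le_mul_right h3 _)
  rw [sub_half, ← ofReal_measureReal, ← ofReal_mul (by positivity),
    ← ofReal_mul (by positivity), ofReal_le_ofReal_iff (by positivity)] at h4
  calc p * (r * μ.real (closedBall x r)) = 2 * r / c₀ * (p / 2 * c₀ * μ.real (closedBall x r)) := by
        field_simp
    _ ≤ 2 * r / c₀ * (L / r * I) := by gcongr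
    _ = _ := by field_simp

/-- Volume of the unit ball. -/
def ballVol (n : ℕ) : ℝ := volume.real (ball (0 : E n) 1)

lemma ballVol_pos : 0 < ballVol n :=
  toReal_pos (measure_ball_pos _ _ one_pos).ne' measure_ball_lt_top.ne

lemma volume_ball_eq_ofReal (y : E n) (hr : 0 < r) :
    volume (ball y r) = ofReal (r ^ n * ballVol n) := by
  rw [← ofReal_measureReal measure_ball_lt_top.ne, volume_real_ball_eq y hr, ballVol]

/-- The constant of the flux inequality. -/
def fluxConst (n : ℕ) : ℝ := (exists_eventually_flux n).choose

lemma fluxConst_pos : 0 < fluxConst n := (exists_eventually_flux n).choose_spec.1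

lemma GoodPt.eventually_flux (h : GoodPt f Ω μ σ F x) {s : ℚ} (hs : 0 < F s x) :
    ∀ᶠ r in 𝓝[>] (0:ℝ), ∀ I : ℝ, 0 ≤ I →
      ∫⁻ y in closedBall x (2 * r), ofReal (s - f y) ≤ ofReal I →
      F s x * (r * μ.real (closedBall x r)) ≤ fluxConst n * I := by
  filter_upwards [(exists_eventually_flux n).choose_spec.2 (h.td.dens s) h.td.pair.finite
    (locallyIntegrableOn_min h.td.loc s) h.isOpen h.mem h.norm_eq (h.lebF s) rfl hs]
    with r hr I hI h1
  refine hr s I hI ((lintegral_mono fun y => ENNReal.ofReal_le_ofReal_iff'.2 ?_).trans h1)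
  rcases le_total (f y) s with h2 | h2
  · rw [min_eq_left h2, abs_of_nonpos (sub_nonpos.2 h2), neg_sub]
    exact Or.inl le_rfl
  · rw [min_eq_right h2, sub_self, abs_zero]
    exact Or.inr le_rfl

lemma GoodPt.eventually_flux_sub (h : GoodPt f Ω μ σ F x) {s t : ℚ} (hst : F s x < F t x) :
    ∀ᶠ r in 𝓝[>] (0:ℝ), (F t x - F s x) * (r * μ.real (closedBall x r)) ≤
      fluxConst n * ((t - s) * ((2 * r) ^ n * ballVol n)) := by
  have hs : (s : ℝ) ≤ t := by
    rcases le_total s t with h1 | h1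
    · exact_mod_cast h1
    · exact absurd (h.mono h1) hst.not_ge
  filter_upwards [(exists_eventually_flux n).choose_spec.2 ((h.td.dens t).sub (h.td.dens s)
    (locallyIntegrableOn_min h.td.loc t) (locallyIntegrableOn_min h.td.loc s)) h.td.pair.finite
    ((locallyIntegrableOn_min h.td.loc t).sub (locallyIntegrableOn_min h.td.loc s)) h.isOpen h.mem
    h.norm_eq ((h.lebF t).sub (h.lebF s) (h.td.dens t).int.aestronglyMeasurable)
    (sub_smul _ _ _).symm (sub_pos.2 hst), self_mem_nhdsWithin] with r hr (hr0 : 0 < r)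
  refine hr 0 _ (mul_nonneg (sub_nonneg.2 hs) (by have := @ballVol_pos n; positivity)) ?_
  calc ∫⁻ y in closedBall x (2 * r), ofReal |min (f y) t - min (f y) s - 0|
      ≤ ∫⁻ y in closedBall x (2 * r), ofReal (t - s) := by
        refine lintegral_mono fun y => ofReal_le_ofReal ?_
        rw [sub_zero, abs_of_nonneg (sub_nonneg.2 (min_le_min_left _ hs))]
        rcases le_total (f y) s with h2 | h2
        · rw [min_eq_left h2, min_eq_left (h2.trans hs)]
          linarith
        · rw [min_eq_right h2]
          exact sub_le_sub_right (min_le_right _ _) _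
    _ = _ := by
        rw [setLIntegral_const, Measure.addHaar_closedBall _ _ (by positivity),
          ← Measure.addHaar_ball_of_pos _ x (by positivity),
          volume_ball_eq_ofReal _ (by positivity), ← ofReal_mul (sub_nonneg.2 hs)]

lemma GoodPt.eventually_exists_center (h : GoodPt f Ω μ σ F x) :
    ∀ᶠ r in 𝓝[>] (0:ℝ), ∃ c, ∫⁻ y in ball x r, ofReal |f y - c| ≤
      ofReal (2 ^ (n + 2) * (r * μ.real (closedBall x r))) := by
  have := h.td.pair.finite
  filter_upwards [eventually_closedBall_subset h.isOpen h.mem, self_mem_nhdsWithin]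
    with r h1 (hr : 0 < r)
  have h2 := h.td.pair.hasDens.exists_lintegral_sub_le h.td.loc h.meas hr
    (ball_subset_closedBall.trans h1)
  have hm : Measurable fun y => ∫⁻ y' in ball x r, ofReal |f y' - f y| :=
    Measurable.lintegral_prod_right' (f := fun p : E n × E n => ofReal |f p.2 - f p.1|)
      (by have := h.meas; fun_prop)
  obtain ⟨y, hy, h3⟩ := exists_le_setLAverage (measure_ball_pos volume x hr).ne'
    measure_ball_lt_top.ne hm.aemeasurable
  refine ⟨f y, h3.trans ?_⟩
  rw [setLAverage_eq]
  refine div_le_of_le_mul (h2.trans ?_)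
  have h4 : ∫⁻ y in ball x r, ‖σ y‖ₑ ∂μ ≤ ofReal (μ.real (closedBall x r)) := by
    rw [ofReal_measureReal, h.td.pair.lintegral_enorm]
    exact measure_mono ball_subset_closedBall
  refine (mul_le_mul_right (mul_le_mul_right h4 _) _).trans (le_of_eq ?_)
  have := @ballVol_pos n
  rw [volume_ball_eq_ofReal _ hr, volume_ball_eq_ofReal _ (by positivity),
    ← ofReal_mul (by positivity), ← ofReal_mul (by positivity),
    ← ofReal_mul (by positivity)]
  congr 1
  ring
end GoodPt

section GoodPt
variable {F : ℚ → E n → ℝ}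

lemma GoodPt.eventually_lintegral_le (h : GoodPt f Ω μ σ F x) (s : ℝ) {l : ℝ} (hl1 : l < 1)
    (hη : 0 < η) (hτ : 0 < τ) : ∀ᶠ r in 𝓝[>] (0:ℝ), ∀ A : Set (E n),
      MeasurableSet A → A ⊆ ball x r → (∀ y ∈ A, s ≤ f y ∧ ⟪y - x, σ x⟫ ≤ -(l * r)) →
      ofReal (η * r ^ n) ≤ volume A →
      ∫⁻ y in closedBall x (l * r), ofReal (s - f y) ≤
        ofReal (2 ^ (n + 1) * ballVol n * τ / η * (r * μ.real (closedBall x r))) := by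
  have := h.td.pair.finite
  have hW := @ballVol_pos n
  filter_upwards [h.leb.eventually hτ, eventually_closedBall_subset h.isOpen h.mem,
    self_mem_nhdsWithin] with r h1 h2 (hr : 0 < r) A hA hAr hAf hAv
  set m := μ.real (closedBall x r)
  have hsub : closedBall x (l * r) ⊆ ball x r := closedBall_subset_ball (by nlinarith)
  have hR : ∀ y ∈ A, ∀ y' ∈ closedBall x (l * r), ‖y' - y‖ < 2 * r := fun y hy y' hy' => by
    rw [← dist_eq_norm]
    linarith [dist_triangle_right y' y x, mem_ball.1 (hAr hy), mem_ball.1 (hsub hy')]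
  have h3 := lintegral_lintegral_le_of_pvar (v := fun y => -f y)
    (N := ofReal (2 * r) * (ofReal τ * μ (closedBall x r))) isOpen_ball
    (convex_ball x r) (h.td.loc.mono_set (ball_subset_closedBall.trans h2)).neg h.meas.neg hA
    measurableSet_closedBall hAr hsub hR fun y hy y' hy' => by
      rw [pvar_neg_fun]
      refine (h.td.pair.hasDens.pvar_le isOpen_ball (ball_subset_closedBall.trans h2) _).trans ?_
      refine le_trans ?_ (mul_le_mul_right (h1 r ⟨hr.le, le_rfl⟩) _)
      rw [← lintegral_const_mul' _ _ ofReal_ne_top]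
      refine (lintegral_mono_set ball_subset_closedBall).trans (lintegral_mono fun z => ?_)
      rw [← ofReal_norm_eq_enorm, ← ofReal_mul (by positivity)]
      refine ofReal_le_ofReal ?_
      have e1 : ⟪y' - x, σ x⟫ ≥ -(l * r) := by
        have e2 := abs_real_inner_le_norm (y' - x) (σ x)
        rw [h.norm_eq, mul_one, ← dist_eq_norm] at e2
        linarith [neg_abs_le ⟪y' - x, σ x⟫, mem_closedBall.1 hy']
      have e3 : ⟪-(y' - y), σ z⟫ = ⟪-(y' - y), σ z - σ x⟫ + (⟪y - x, σ x⟫ - ⟪y' - x, σ x⟫) := by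
        rw [← inner_sub_left, inner_sub_right]
        have : y - x - (y' - x) = -(y' - y) := by abel
        rw [this]
        ring
      have e4 := real_inner_le_norm (-(y' - y)) (σ z - σ x)
      rw [norm_neg] at e4
      have e5 := mul_le_mul_of_nonneg_right (hR y hy y' hy').le (norm_nonneg (σ z - σ x))
      linarith [(hAf y hy).2]
  have h4 : volume A * ∫⁻ y in closedBall x (l * r), ofReal (s - f y) ≤
      ∫⁻ y in A, (∫⁻ y' in closedBall x (l * r), ofReal (-f y' - -f y)) := by
    rw [mul_comm, ← setLIntegral_const]
    refine setLIntegral_mono' hA fun y hy => lintegral_mono fun y' => ofReal_le_ofReal ?_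
    linarith [(hAf y hy).1]
  have h5 := (mul_le_mul_left hAv _).trans (h4.trans h3)
  rw [volume_ball_eq_ofReal _ (by positivity), ← ofReal_measureReal,
    ← ofReal_mul (by positivity), ← ofReal_mul (by positivity),
    ← ofReal_mul (by positivity)] at h5
  have hηr : 0 < η * r ^ n := by positivity
  refine (ENNReal.mul_le_mul_iff_right (ofReal_pos.2 hηr).ne' ofReal_ne_top).1
    (h5.trans (le_of_eq ?_))
  rw [← ofReal_mul hηr.le]
  congr 1
  field_simp
  ring

lemma GoodPt.eventually_decay (h : GoodPt f Ω μ σ F x) {s : ℚ} (hs : 0 < F s x) {l κ : ℝ}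
    (hl : 0 < l) (hl1 : l < 1) (hη : 0 < η) (hκ : 0 < κ) :
    ∀ᶠ r in 𝓝[>] (0:ℝ), ∀ A : Set (E n), MeasurableSet A → A ⊆ ball x r →
      (∀ y ∈ A, (s : ℝ) ≤ f y ∧ ⟪y - x, σ x⟫ ≤ -(l * r)) → ofReal (η * r ^ n) ≤ volume A →
      μ.real (closedBall x (l / 2 * r)) ≤ κ * μ.real (closedBall x r) := by
  have hW := @ballVol_pos n
  have hA₀ := @fluxConst_pos n
  set τ := κ * η * l * F s x / (fluxConst n * 2 ^ (n + 2) * ballVol n) with hτ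
  filter_upwards [h.eventually_lintegral_le s hl1 hη (τ := τ) (by positivity),
    eventually_mul (half_pos hl) (h.eventually_flux hs), self_mem_nhdsWithin]
    with r h1 h2 (hr : 0 < r) A hA hAr hAf hAv
  have h3 := h1 A hA hAr hAf hAv
  rw [show l * r = 2 * (l / 2 * r) by ring] at h3
  have h4 := h2 _ (by positivity) h3
  have h5 : fluxConst n * (2 ^ (n + 1) * ballVol n * τ / η * (r * μ.real (closedBall x r))) =
      F s x * (l / 2 * r) * (κ * μ.real (closedBall x r)) := by
    rw [hτ]
    field_simp
    ring
  rw [h5, ← mul_assoc] at h4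
  exact le_of_mul_le_mul_left h4 (by positivity)

lemma mem_ball_shift {y : E n} (hν : ‖ν‖ = 1) (hr : 0 < r)
    (hy : y ∈ ball (x - (3 / 4 * r) • ν) (1 / 4 * r)) :
    y ∈ ball x r ∧ ⟪y - x, ν⟫ ≤ -(1 / 2 * r) := by
  rw [mem_ball, dist_eq_norm] at hy
  have h1 : y - x = (y - (x - (3 / 4 * r) • ν)) + (-(3 / 4 * r)) • ν := by
    rw [neg_smul]; abel
  refine ⟨?_, ?_⟩
  · rw [mem_ball, dist_eq_norm, h1]
    refine (norm_add_le _ _).trans_lt ?_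
    rw [norm_smul, hν, mul_one, norm_neg, norm_of_nonneg (by positivity)]
    linarith
  · rw [h1, inner_add_left, inner_smul_left, real_inner_self_eq_norm_sq, hν]
    have := real_inner_le_norm (y - (x - (3 / 4 * r) • ν)) ν
    rw [hν, mul_one] at this
    simp only [conj_trivial]
    linarith

lemma abs_sub_mul_le_of_lintegral_le (hf : Measurable f) {c c' I I' : ℝ} (hr : 0 < r)
    (hI : 0 ≤ I) (hI' : 0 ≤ I') (h : ∫⁻ y in ball x r, ofReal |f y - c| ≤ ofReal I)
    (h' : ∫⁻ y in ball x r, ofReal |f y - c'| ≤ ofReal I') :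
    |c - c'| * (r ^ n * ballVol n) ≤ I + I' := by
  have hW := @ballVol_pos n
  rw [← ofReal_le_ofReal_iff (by positivity), ofReal_add hI hI',
    ofReal_mul (abs_nonneg _), ← volume_ball_eq_ofReal x hr, ← setLIntegral_const]
  refine le_trans ?_ (add_le_add h h')
  rw [← lintegral_add_left (by fun_prop)]
  refine lintegral_mono fun y => ?_
  rw [← ofReal_add (abs_nonneg _) (abs_nonneg _)]
  refine ofReal_le_ofReal ?_
  rw [abs_sub_comm (f y) c]
  exact abs_sub_le _ _ _

/-- The constant bounding the distance of centers to the levels carrying variation. -/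
def driftConst (n : ℕ) : ℝ := 2 ^ (n + 4) * 4 ^ n / ballVol n

lemma driftConst_pos : 0 < driftConst n := by
  have := @ballVol_pos n
  unfold driftConst
  positivity

lemma GoodPt.eventually_lt (h : GoodPt f Ω μ σ F x) {s : ℚ} (hs : 0 < F s x) :
    ∀ᶠ r in 𝓝[>] (0:ℝ), ∀ c, ∫⁻ y in ball x r, ofReal |f y - c| ≤
      ofReal (2 ^ (n + 2) * (r * μ.real (closedBall x r))) →
      c < s + driftConst n * (r * μ.real (closedBall x r) / r ^ n) := by
  have hW := @ballVol_pos n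
  have hD := @driftConst_pos n
  set κ : ℝ := (1 / 4) ^ n / 2 with hκ
  have hκ0 : 0 < κ := by positivity
  obtain ⟨C, hC, hCr⟩ := h.dens
  obtain ⟨R, hR, key⟩ := mem_nhdsGT_iff_exists_Ioc_subset.1 ((h.eventually_decay hs
    (l := 1 / 2) (η := ballVol n * κ) (κ := κ) (by norm_num) (by norm_num) (by positivity)
    hκ0).and (h.eventually_exists_center.and hCr))
  set m : ℝ → ℝ := fun r => μ.real (closedBall x r) with hm
  have step : ∀ r ∈ Ioc 0 R, ∀ c, ∫⁻ y in ball x r, ofReal |f y - c| ≤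
      ofReal (2 ^ (n + 2) * (r * m r)) → s + driftConst n * (r * m r / r ^ n) ≤ c →
      m (1 / 4 * r) ≤ κ * m r ∧ ∃ c', ∫⁻ y in ball x (1 / 4 * r), ofReal |f y - c'| ≤
      ofReal (2 ^ (n + 2) * (1 / 4 * r * m (1 / 4 * r))) ∧
      s + driftConst n * (1 / 4 * r * m (1 / 4 * r) / (1 / 4 * r) ^ n) ≤ c' := by
    intro r hr c hc hsc
    obtain ⟨hdec, -, hCm⟩ := key hr
    have hr0 := hr.1
    have hm0 : 0 < m r := by
      have : 0 < C * m r := (pow_pos hr0 n).trans_le hCm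
      exact pos_of_mul_pos_right this hC.le
    set P := ball (x - (3 / 4 * r) • σ x) (1 / 4 * r) with hP
    have hPm : MeasurableSet P := measurableSet_ball
    have hfs : MeasurableSet {y | (s:ℝ) ≤ f y} := measurableSet_le measurable_const h.meas
    have hd0 : 0 < driftConst n * (r * m r / r ^ n) := by positivity
    have hdec' : m (1 / 4 * r) ≤ κ * m r := by
      have := hdec (P ∩ {y | (s:ℝ) ≤ f y}) (hPm.inter hfs)
        (fun y hy => (mem_ball_shift h.norm_eq hr0 hy.1).1)
        (fun y hy => ⟨hy.2, (mem_ball_shift h.norm_eq hr0 hy.1).2⟩) ?_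
      · rwa [show (1:ℝ) / 2 / 2 = 1 / 4 by norm_num] at this
      have h1 : volume (P \ {y | (s:ℝ) ≤ f y}) ≤ ofReal (ballVol n * κ * r ^ n) := by
        have h2 : ofReal (driftConst n * (r * m r / r ^ n)) *
            volume (P \ {y | (s:ℝ) ≤ f y}) ≤ ofReal (2 ^ (n + 2) * (r * m r)) := by
          refine le_trans ?_ hc
          rw [← setLIntegral_const]
          refine (setLIntegral_mono' (hPm.diff hfs) fun y hy => ?_).trans
            (lintegral_mono_set fun y hy => (mem_ball_shift h.norm_eq hr0 hy.1).1)
          refine ofReal_le_ofReal ?_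
          have h3 : f y < s := not_le.1 hy.2
          rw [abs_sub_comm]
          exact le_trans (by linarith) (le_abs_self _)
        refine (ENNReal.mul_le_mul_iff_right (ofReal_pos.2 hd0).ne'
          ofReal_ne_top).1 (h2.trans ?_)
        rw [← ofReal_mul hd0.le]
        refine ofReal_le_ofReal ((le_mul_of_one_le_right
          (show 0 ≤ 2 ^ (n + 2) * (r * m r) by positivity) one_le_two).trans_eq ?_)
        rw [hκ, driftConst, div_pow, one_pow]
        field_simp
        ring
      have h2 := measure_le_inter_add_sdiff volume P {y | (s:ℝ) ≤ f y}
      rw [hP, volume_ball_eq_ofReal _ (by positivity), ← hP,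
        show (1 / 4 * r) ^ n * ballVol n = ballVol n * κ * r ^ n + ballVol n * κ * r ^ n by
          rw [hκ, mul_pow]; ring, ofReal_add (by positivity) (by positivity)] at h2
      exact ENNReal.le_of_add_le_add_right ofReal_ne_top (h2.trans (add_le_add_right h1 _))
    refine ⟨hdec', ?_⟩
    have hr4 : 1 / 4 * r ∈ Ioc 0 R := ⟨by positivity, by linarith [hr.2]⟩
    obtain ⟨-, ⟨c', hc'⟩, -⟩ := key hr4
    refine ⟨c', hc', ?_⟩
    have hm1 : 0 ≤ m (1 / 4 * r) := measureReal_nonneg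
    have h1 := abs_sub_mul_le_of_lintegral_le h.meas (by positivity) (by positivity)
      (by positivity) ((lintegral_mono_set (ball_subset_ball (by linarith))).trans hc) hc'
    have hq : driftConst n * (r * m r / r ^ n) * ((1 / 4 * r) ^ n * ballVol n) =
        2 ^ (n + 4) * (r * m r) := by
      rw [driftConst, mul_pow, div_pow, one_pow]
      field_simp
    have hκ1 : κ ≤ 1 := by
      have : (1 / 4 : ℝ) ^ n ≤ 1 := pow_le_one₀ (by norm_num) (by norm_num)
      linarith
    have hle : m (1 / 4 * r) ≤ m r := hdec'.trans (mul_le_of_le_one_left hm0.le hκ1)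
    have h2 : |c - c'| ≤ driftConst n * (r * m r / r ^ n) / 2 := by
      refine le_of_mul_le_mul_right (h1.trans ?_)
        (show 0 < (1 / 4 * r) ^ n * ballVol n by positivity)
      rw [div_mul_eq_mul_div _ 2 ((1 / 4 * r) ^ n * ballVol n), hq, pow_add, pow_add]
      change _ * (r * m r) + _ * (1 / 4 * r * m (1 / 4 * r)) ≤ _
      have : (2:ℝ) ^ n * (r * m (1 / 4 * r)) ≤ 2 ^ n * (r * m r) := by gcongr
      have : 0 ≤ (2:ℝ) ^ n * (r * m r) := by positivity
      linarith
    have h3 : driftConst n * (1 / 4 * r * m (1 / 4 * r) / (1 / 4 * r) ^ n) ≤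
        driftConst n * (r * m r / r ^ n) / 2 := by
      calc driftConst n * (1 / 4 * r * m (1 / 4 * r) / (1 / 4 * r) ^ n)
          ≤ driftConst n * (1 / 4 * r * (κ * m r) / (1 / 4 * r) ^ n) := by gcongr
        _ = driftConst n * (r * m r / r ^ n) / 8 := by
          rw [hκ, mul_pow, div_pow, one_pow]
          field_simp
          norm_num
        _ ≤ _ := by linarith
    linarith [(abs_le.1 h2).2]
  filter_upwards [Ioc_mem_nhdsGT hR] with r hr c hc
  by_contra! hcon
  have hind : ∀ k : ℕ, m ((1 / 4) ^ k * r) ≤ κ ^ k * m r ∧ ∃ c,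
      ∫⁻ y in ball x ((1 / 4) ^ k * r), ofReal |f y - c| ≤
      ofReal (2 ^ (n + 2) * ((1 / 4) ^ k * r * m ((1 / 4) ^ k * r))) ∧
      s + driftConst n * ((1 / 4) ^ k * r * m ((1 / 4) ^ k * r) / ((1 / 4) ^ k * r) ^ n) ≤ c := by
    intro k
    induction k with
    | zero => exact ⟨by simp, c, by simpa using hc, by simpa using hcon⟩
    | succ k ih =>
      obtain ⟨h1, c, h2, h3⟩ := ih
      have hk : (1 / 4 : ℝ) ^ k ≤ 1 := pow_le_one₀ (by norm_num) (by norm_num)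
      have := step _ ⟨mul_pos (by positivity) hr.1,
        (mul_le_of_le_one_left hr.1.le hk).trans hr.2⟩ c h2 h3
      rw [pow_succ', pow_succ', mul_assoc (1 / 4)]
      exact ⟨this.1.trans ((mul_le_mul_of_nonneg_left h1 hκ0.le).trans_eq (by ring)), this.2⟩
  have hlim : ∀ k : ℕ, r ^ n ≤ C * m r * (1 / 2) ^ k := by
    intro k
    have hk : (1 / 4 : ℝ) ^ k ≤ 1 := pow_le_one₀ (by norm_num) (by norm_num)
    have h1 := (key ⟨mul_pos (pow_pos (by norm_num) k) hr.1,
      (mul_le_of_le_one_left hr.1.le hk).trans hr.2⟩).2.2.trans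
      (mul_le_mul_of_nonneg_left (hind k).1 hC.le)
    have h2 : κ ^ k = ((1 / 4 : ℝ) ^ k) ^ n * (1 / 2) ^ k := by
      rw [hκ, div_eq_mul_one_div, mul_pow, pow_right_comm]
    rw [mul_pow, h2] at h1
    refine le_of_mul_le_mul_left (h1.trans_eq ?_) (show 0 < ((1 / 4 : ℝ) ^ k) ^ n by positivity)
    ring
  have h0 := ge_of_tendsto' ((tendsto_pow_atTop_nhds_zero_of_lt_one (r := (1 / 2 : ℝ))
    (by norm_num) (by norm_num)).const_mul (C * m r)) hlim
  rw [mul_zero] at h0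
  exact (pow_pos hr.1 n).not_ge h0
end GoodPt

lemma tendsto_setAverage_of_eventually_le (hΩ : IsOpen Ω) (hf : LocInt f Ω) (hx : x ∈ Ω)
    {S : ℝ → Set (E n)} (hS : ∀ r, S r ⊆ ball x r) {a c C : ℝ} (ha : 0 < a)
    (hv : ∀ r, 0 < r → ofReal (a * r ^ n) ≤ volume (S r))
    (h : ∀ δ > 0, ∀ᶠ r in 𝓝[>] (0:ℝ), ∫⁻ y in S r, ofReal |f y - c| ≤ ofReal (C * δ * r ^ n)) :
    Tendsto (fun r => ⨍ y in S r, |f y - c|) (𝓝[>] 0) (𝓝 0) := by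
  rw [Metric.tendsto_nhds]
  intro δ hδ
  filter_upwards [h (δ * a / (2 * (|C| + 1))) (by positivity),
    eventually_closedBall_subset hΩ hx, self_mem_nhdsWithin] with r h1 h2 (hr : 0 < r)
  have h0 : 0 ≤ ⨍ y in S r, |f y - c| := by
    rw [setAverage_eq]
    exact smul_nonneg (by positivity) (integral_nonneg fun _ => abs_nonneg _)
  rw [Real.dist_0_eq_abs, abs_of_nonneg h0]
  rw [lintegral_ofReal_abs_sub_eq ((hf.integrableOn_compact_subset h2
    (isCompact_closedBall _ _)).mono_set ((hS r).trans ball_subset_closedBall))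
    ((measure_mono (hS r)).trans_lt measure_ball_lt_top).ne] at h1
  have h3 := (mul_le_mul_right (hv r hr) _).trans h1
  rw [← ofReal_mul h0] at h3
  have hC : C * (δ * a / (2 * (|C| + 1))) * r ^ n ≤ δ / 2 * (a * r ^ n) := by
    calc C * (δ * a / (2 * (|C| + 1))) * r ^ n
        ≤ (|C| + 1) * (δ * a / (2 * (|C| + 1))) * r ^ n := by
          gcongr
          linarith [le_abs_self C]
      _ = _ := by field_simp
  have h4 := (ofReal_le_ofReal_iff (by positivity)).1 (h3.trans (ofReal_le_ofReal hC))
  linarith [le_of_mul_le_mul_right h4 (by positivity)]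

section GoodPt
variable {F : ℚ → E n → ℝ}

lemma GoodPt.eventually_gt (h : GoodPt f Ω μ σ F x) {t : ℚ} (ht : F t x < 1) :
    ∀ᶠ r in 𝓝[>] (0:ℝ), ∀ c, ∫⁻ y in ball x r, ofReal |f y - c| ≤
      ofReal (2 ^ (n + 2) * (r * μ.real (closedBall x r))) →
      t - driftConst n * (r * μ.real (closedBall x r) / r ^ n) < c := by
  filter_upwards [h.neg.eventually_lt (s := -t) (by simpa using ht)] with r hr c hc
  have := hr (-c) (by simpa only [neg_sub_neg, abs_sub_comm] using hc)
  push_cast at this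
  linarith

lemma GoodPt.eventually_energy_le_of_lt (h : GoodPt f Ω μ σ F x) {s t : ℚ} (hst : F s x < F t x) :
    ∀ᶠ r in 𝓝[>] (0:ℝ), (F t x - F s x) * (r * μ.real (closedBall x r) / r ^ n) ≤
      fluxConst n * 2 ^ n * ballVol n * (t - s) := by
  filter_upwards [h.eventually_flux_sub hst, self_mem_nhdsWithin] with r hr (hr0 : 0 < r)
  rw [← mul_div_assoc, div_le_iff₀ (by positivity)]
  refine hr.trans_eq ?_
  rw [mul_pow]
  ring

lemma GoodPt.exists_pos (h : GoodPt f Ω μ σ F x) : ∃ q, 0 < F q x :=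
  (h.top.eventually_const_lt one_pos).exists

lemma GoodPt.exists_lt_one (h : GoodPt f Ω μ σ F x) : ∃ q, F q x < 1 :=
  (h.bot.eventually_lt_const one_pos).exists

lemma GoodPt.exists_energy_le (h : GoodPt f Ω μ σ F x) : ∃ M > 0,
    ∀ᶠ r in 𝓝[>] (0:ℝ), r * μ.real (closedBall x r) / r ^ n ≤ M := by
  obtain ⟨t, ht⟩ := h.exists_pos
  obtain ⟨s, hs⟩ := (h.bot.eventually_lt_const ht).exists
  refine ⟨max 1 (fluxConst n * 2 ^ n * ballVol n * (t - s) / (F t x - F s x)), by positivity, ?_⟩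
  filter_upwards [h.eventually_energy_le_of_lt hs] with r hr
  exact le_max_of_le_right ((le_div_iff₀' (sub_pos.2 hs)).2 hr)

lemma GoodPt.exists_eq_one (h : GoodPt f Ω μ σ F x) : ∃ q, F q x = 1 := by
  by_contra! hcon
  obtain ⟨s, hs⟩ := h.exists_pos
  obtain ⟨M, -, hMr⟩ := h.exists_energy_le
  obtain ⟨t, ht⟩ := exists_rat_gt (s + 2 * driftConst n * M)
  obtain ⟨r, h1, h2, h3, c, hc⟩ := ((h.eventually_lt hs).and ((h.eventually_gt (t := t)
    ((h.le_one t).lt_of_ne (hcon t))).and (hMr.and h.eventually_exists_center))).exists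
  have := mul_le_mul_of_nonneg_left h3 (driftConst_pos (n := n)).le
  linarith [h1 c hc, h2 c hc]

lemma GoodPt.exists_eq_zero (h : GoodPt f Ω μ σ F x) : ∃ q, F q x = 0 := by
  obtain ⟨q, hq⟩ := h.neg.exists_eq_one
  exact ⟨-q, by linarith⟩

lemma GoodPt.exists_dirac (h : GoodPt f Ω μ σ F x)
    (hd : ∀ s t : ℚ, s < t → F s x = 0 ∨ F t x = 1) :
    ∃ c : ℝ, (∀ s : ℚ, s < c → F s x = 0) ∧ ∀ t : ℚ, c < t → F t x = 1 := by
  set Z : Set ℝ := {a | ∃ q : ℚ, F q x = 0 ∧ (q : ℝ) = a}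
  obtain ⟨q₀, hq₀⟩ := h.exists_eq_zero
  obtain ⟨s₀, hs₀⟩ := h.exists_pos
  have hbdd : BddAbove Z := by
    refine ⟨s₀, ?_⟩
    rintro _ ⟨q, hq, rfl⟩
    by_contra! hlt
    exact (hs₀.trans_le (h.mono (Rat.cast_lt.1 hlt).le)).ne' hq
  refine ⟨sSup Z, fun s hs => ?_, fun t ht => ?_⟩
  · obtain ⟨_, ⟨q, hq, rfl⟩, hlt⟩ := exists_lt_of_lt_csSup (show Z.Nonempty from ⟨_, q₀, hq₀, rfl⟩) hs
    exact le_antisymm (hq ▸ h.mono (Rat.cast_lt.1 hlt).le) (h.nonneg s)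
  · obtain ⟨s, hs, hst⟩ := exists_rat_btwn ht
    exact (hd s t (Rat.cast_lt.1 hst)).resolve_left fun h0 => hs.not_ge (le_csSup hbdd ⟨s, h0, rfl⟩)

lemma GoodPt.notMem_approxDiscontSet (h : GoodPt f Ω μ σ F x)
    (hd : ∀ s t : ℚ, s < t → F s x = 0 ∨ F t x = 1) : x ∉ approxDiscontSet n f := by
  obtain ⟨c, hc0, hc1⟩ := h.exists_dirac hd
  refine not_not.2 ⟨c, ?_⟩
  have hD := @driftConst_pos n
  have hW := @ballVol_pos n
  refine tendsto_setAverage_of_eventually_le h.isOpen h.td.loc h.mem (fun r => subset_rfl)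
    (a := ballVol n) (C := 2 ^ (n + 2) * (2 * fluxConst n * 2 ^ n * ballVol n) + (1 + driftConst n *
      (2 * fluxConst n * 2 ^ n * ballVol n)) * ballVol n) hW (fun r hr => ?_) fun δ hδ => ?_
  · rw [volume_ball_eq_ofReal _ hr, mul_comm]
  obtain ⟨s, hs, hs'⟩ := exists_rat_btwn (sub_lt_self c hδ)
  obtain ⟨t, ht, ht'⟩ := exists_rat_btwn (lt_add_of_pos_right c hδ)
  have hs0 := hc0 s hs'
  have ht1 := hc1 t ht
  filter_upwards [h.eventually_lt (s := t) (by simp [ht1]),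
    h.eventually_gt (t := s) (by simp [hs0]), h.eventually_energy_le_of_lt (s := s) (t := t)
    (by simp [hs0, ht1]), h.eventually_exists_center, self_mem_nhdsWithin]
    with r h1 h2 h3 ⟨c', h4⟩ (hr : 0 < r)
  set M := r * μ.real (closedBall x r) / r ^ n with hM
  have hrm : r * μ.real (closedBall x r) = M * r ^ n := by rw [hM]; field_simp
  have hM1 : M ≤ 2 * fluxConst n * 2 ^ n * ballVol n * δ := by
    rw [ht1, hs0, sub_zero, one_mul] at h3
    have : fluxConst n * 2 ^ n * ballVol n * (t - s) ≤ fluxConst n * 2 ^ n * ballVol n * (2 * δ) :=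
      mul_le_mul_of_nonneg_left (by linarith)
        (mul_pos (mul_pos fluxConst_pos (by positivity)) hW).le
    linarith
  have hcc : |c' - c| ≤ δ + driftConst n * M := by
    rw [abs_le]
    constructor <;> linarith [h1 c' h4, h2 c' h4]
  have hM0 : 0 ≤ M := by positivity
  calc ∫⁻ y in ball x r, ofReal |f y - c|
      ≤ ∫⁻ y in ball x r, (ofReal |f y - c'| + ofReal (δ + driftConst n * M)) := by
        refine lintegral_mono fun y => ?_
        rw [← ofReal_add (abs_nonneg _) (by positivity)]
        exact ofReal_le_ofReal ((abs_sub_le _ c' _).trans (by linarith))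
    _ = (∫⁻ y in ball x r, ofReal |f y - c'|) +
        ofReal (δ + driftConst n * M) * volume (ball x r) := by
        rw [lintegral_add_right _ measurable_const, setLIntegral_const]
    _ ≤ ofReal (2 ^ (n + 2) * (M * r ^ n)) +
        ofReal ((δ + driftConst n * M) * (r ^ n * ballVol n)) := by
        rw [volume_ball_eq_ofReal _ hr, ← ofReal_mul (by positivity), ← hrm]
        gcongr
    _ ≤ _ := by
        rw [← ofReal_add (by positivity) (by positivity)]
        refine ofReal_le_ofReal ?_
        calc 2 ^ (n + 2) * (M * r ^ n) + (δ + driftConst n * M) * (r ^ n * ballVol n)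
            = (2 ^ (n + 2) * M + (δ + driftConst n * M) * ballVol n) * r ^ n := by ring
          _ ≤ (2 ^ (n + 2) * (2 * fluxConst n * 2 ^ n * ballVol n * δ) + (δ + driftConst n *
              (2 * fluxConst n * 2 ^ n * ballVol n * δ)) * ballVol n) * r ^ n := by gcongr
          _ = _ := by ring

lemma GoodPt.exists_le_energy (h : GoodPt f Ω μ σ F x) {s t : ℚ} (hst : s < t) (hs : 0 < F s x)
    (ht : F t x < 1) : ∃ M > 0,
    ∀ᶠ r in 𝓝[>] (0:ℝ), M ≤ r * μ.real (closedBall x r) / r ^ n := by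
  have hD := @driftConst_pos n
  have hst' : (0:ℝ) < t - s := sub_pos.2 (Rat.cast_lt.2 hst)
  refine ⟨(t - s) / (2 * driftConst n), by positivity, ?_⟩
  filter_upwards [h.eventually_lt hs, h.eventually_gt ht, h.eventually_exists_center]
    with r h1 h2 ⟨c, hc⟩
  rw [div_le_iff₀ (by positivity)]
  linarith [h1 c hc, h2 c hc]

lemma GoodPt.eventually_volume_lt (h : GoodPt f Ω μ σ F x)
    (hlow : ∃ M > 0, ∀ᶠ r in 𝓝[>] (0:ℝ), M ≤ r * μ.real (closedBall x r) / r ^ n) {t : ℚ}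
    (ht : F t x < 1) {l : ℝ} (hl : 0 < l) (hl1 : l < 1) (hη : 0 < η) : ∀ᶠ r in 𝓝[>] (0:ℝ),
    ∀ A : Set (E n), MeasurableSet A → A ⊆ ball x r →
      (∀ y ∈ A, f y ≤ t ∧ l * r ≤ ⟪y - x, σ x⟫) → volume A < ofReal (η * r ^ n) := by
  obtain ⟨M₀, hM₀, hlow⟩ := hlow
  obtain ⟨M₁, hM₁, hup⟩ := h.exists_energy_le
  have hl2 := half_pos hl
  filter_upwards [h.neg.eventually_decay (s := -t) (by simpa using ht) hl hl1 hη
    (κ := M₀ * (l / 2) ^ n / (l / 2) / (2 * M₁)) (by positivity), hup, eventually_mul hl2 hlow,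
    self_mem_nhdsWithin] with r h1 h2 h3 (hr : 0 < r) A hA hAr hAf
  by_contra! hcon
  have h4 := h1 A hA hAr (fun y hy => ⟨by push_cast; exact neg_le_neg (hAf y hy).1, by
    rw [inner_neg_right]; exact neg_le_neg (hAf y hy).2⟩) hcon
  have h5 : l / 2 * r * μ.real (closedBall x (l / 2 * r)) / (l / 2 * r) ^ n ≤ M₀ / 2 := by
    calc l / 2 * r * μ.real (closedBall x (l / 2 * r)) / (l / 2 * r) ^ n
        ≤ l / 2 * r * (M₀ * (l / 2) ^ n / (l / 2) / (2 * M₁) * μ.real (closedBall x r)) /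
          (l / 2 * r) ^ n := by gcongr
      _ = M₀ / (2 * M₁) * (r * μ.real (closedBall x r) / r ^ n) := by
          rw [mul_pow]
          field_simp
      _ ≤ M₀ / (2 * M₁) * M₁ := by gcongr
      _ = _ := by field_simp
  linarith

lemma GoodPt.eventually_tail_le (h : GoodPt f Ω μ σ F x)
    (hlow : ∃ M > 0, ∀ᶠ r in 𝓝[>] (0:ℝ), M ≤ r * μ.real (closedBall x r) / r ^ n) {c : ℚ}
    (hc : F c x = 0) (hη : 0 < η) : ∀ᶠ r in 𝓝[>] (0:ℝ),
    ∫⁻ y in ball x r, ofReal (c - f y) ≤ ofReal (η * r ^ n) := by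
  have := h.td.pair.finite
  have hW := @ballVol_pos n
  obtain ⟨M₁, hM₁, hup⟩ := h.exists_energy_le
  set a : ℝ := (1 / 4) ^ n * ballVol n / 2 with ha
  have ha0 : 0 < a := by positivity
  set τ := η * a / (2 ^ n * ballVol n * 4 * M₁) with hτ
  filter_upwards [h.eventually_volume_lt hlow (t := c) (by simp [hc]) one_half_pos
    (by norm_num) ha0, hup, (h.lebF c).eventually (τ := τ) (by positivity),
    eventually_closedBall_subset h.isOpen h.mem, self_mem_nhdsWithin] with r h1 h2 h3 h4 (hr : 0 < r)
  set P := ball (x - (3 / 4 * r) • -σ x) (1 / 4 * r) with hP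
  have hPm : MeasurableSet P := measurableSet_ball
  have hfc : MeasurableSet {y | f y ≤ (c:ℝ)} := measurableSet_le h.meas measurable_const
  have hsh := fun y (hy : y ∈ P) => mem_ball_shift (by rw [norm_neg, h.norm_eq]) hr hy
  have h5 := h1 (P ∩ {y | f y ≤ (c:ℝ)}) (hPm.inter hfc) (fun y hy => (hsh y hy.1).1)
    fun y hy => ⟨hy.2, by have := (hsh y hy.1).2; rw [inner_neg_right] at this; linarith⟩
  have h6 : ofReal (a * r ^ n) ≤ volume (P \ {y | f y ≤ (c:ℝ)}) := by
    have h2 := measure_le_inter_add_sdiff volume P {y | f y ≤ (c:ℝ)}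
    rw [hP, volume_ball_eq_ofReal _ (by positivity), ← hP,
      show (1 / 4 * r) ^ n * ballVol n = a * r ^ n + a * r ^ n by
        rw [ha, mul_pow]; ring, ofReal_add (by positivity) (by positivity)] at h2
    exact ENNReal.le_of_add_le_add_left ofReal_ne_top
      (h2.trans (add_le_add_left h5.le _))
  have h7 := (h.td.dens c).exists_lintegral_sub_le (locallyIntegrableOn_min h.td.loc _)
    (h.meas.min measurable_const) hr (ball_subset_closedBall.trans h4)
  have h8 : ∫⁻ y in ball x r, ‖F c y • σ y‖ₑ ∂μ ≤ ofReal (τ * (M₁ * r ^ n / r)) := by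
    refine (lintegral_mono_set ball_subset_closedBall).trans ?_
    have := h3 r ⟨hr.le, le_rfl⟩
    simp only [hc, zero_smul, sub_zero] at this
    refine this.trans ?_
    rw [← ofReal_measureReal, ← ofReal_mul (by positivity)]
    refine ofReal_le_ofReal (mul_le_mul_of_nonneg_left ?_ (by positivity))
    rw [div_le_iff₀ (by positivity)] at h2
    rw [le_div_iff₀ hr]
    linarith
  have h9 : volume (P \ {y | f y ≤ (c:ℝ)}) * ∫⁻ y in ball x r, ofReal (c - f y) ≤
      ∫⁻ y in ball x r, (∫⁻ y' in ball x r, ofReal |min (f y') c - min (f y) c|) := by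
    rw [mul_comm, ← setLIntegral_const]
    refine (setLIntegral_mono' (hPm.diff hfc) fun y hy => lintegral_mono fun y' =>
      ENNReal.ofReal_le_ofReal_iff'.2 ?_).trans
      (lintegral_mono_set fun y hy => (hsh y hy.1).1)
    have hcy : (c:ℝ) < f y := not_le.1 hy.2
    rw [min_eq_right hcy.le]
    rcases le_total (f y') c with h' | h'
    · rw [min_eq_left h', abs_of_nonpos (sub_nonpos.2 h'), neg_sub]
      exact Or.inl le_rfl
    · exact Or.inr (sub_nonpos.2 h')
  have h10 := ((mul_le_mul_left h6 _).trans (h9.trans h7)).trans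
    (mul_le_mul_right (mul_le_mul_right h8 _) _)
  rw [volume_ball_eq_ofReal _ (by positivity), ← ofReal_mul (by positivity),
    ← ofReal_mul (by positivity)] at h10
  have har : 0 < a * r ^ n := by positivity
  refine (ENNReal.mul_le_mul_iff_right (ofReal_pos.2 har).ne' ofReal_ne_top).1
    (h10.trans (le_of_eq ?_))
  rw [← ofReal_mul har.le]
  congr 1
  rw [hτ, mul_pow]
  field_simp

lemma GoodPt.exists_tendsto_upper (h : GoodPt f Ω μ σ F x)
    (hlow : ∃ M > 0, ∀ᶠ r in 𝓝[>] (0:ℝ), M ≤ r * μ.real (closedBall x r) / r ^ n) :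
    ∃ b : ℝ, (∀ q : ℚ, F q x < 1 → q ≤ b) ∧
      Tendsto (fun r : ℝ => ⨍ y in {y ∈ ball x r | 0 < ⟪y - x, σ x⟫}, |f y - b|)
        (𝓝[>] 0) (𝓝 0) := by
  have hW := @ballVol_pos n
  set Z : Set ℝ := {a | ∃ q : ℚ, F q x < 1 ∧ (q : ℝ) = a}
  obtain ⟨q₀, hq₀⟩ := h.exists_lt_one
  obtain ⟨q₁, hq₁⟩ := h.exists_eq_one
  obtain ⟨q₂, hq₂⟩ := h.exists_eq_zero
  have hbdd : BddAbove Z := by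
    refine ⟨q₁, ?_⟩
    rintro _ ⟨q, hq, rfl⟩
    by_contra! hlt
    exact (hq.trans_le (hq₁ ▸ h.mono (Rat.cast_lt.1 hlt).le)).false
  refine ⟨sSup Z, fun q hq => le_csSup hbdd ⟨q, hq, rfl⟩, ?_⟩
  set b := sSup Z
  refine tendsto_setAverage_of_eventually_le h.isOpen h.td.loc h.mem (fun r y hy => hy.1)
    (a := (1 / 4) ^ n * ballVol n) (C := 2 * ballVol n + 3) (by positivity) (fun r hr => ?_)
    fun δ hδ => ?_
  · rw [show (1 / 4) ^ n * ballVol n * r ^ n = (1 / 4 * r) ^ n * ballVol n by rw [mul_pow]; ring,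
      ← volume_ball_eq_ofReal (x - (3 / 4 * r) • -σ x) (by positivity)]
    refine measure_mono fun y hy => ?_
    obtain ⟨e1, e2⟩ := mem_ball_shift (by rw [norm_neg, h.norm_eq]) hr hy
    rw [inner_neg_right] at e2
    exact ⟨e1, by linarith⟩
  obtain ⟨_, ⟨t, ht, rfl⟩, htb⟩ := exists_lt_of_lt_csSup (show Z.Nonempty from ⟨_, q₀, hq₀, rfl⟩) (sub_lt_self b hδ)
  obtain ⟨d, hd, hdb⟩ := exists_rat_btwn (lt_add_of_pos_right b hδ)
  have hd1 : F d x = 1 := by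
    by_contra hne
    exact hd.not_ge (le_csSup hbdd ⟨d, (h.le_one d).lt_of_ne hne, rfl⟩)
  set c := min q₂ t with hcdef
  have hc0 : F c x = 0 := le_antisymm (hq₂ ▸ h.mono (min_le_left _ _)) (h.nonneg c)
  have hct : (c:ℝ) ≤ t := Rat.cast_le.2 (min_le_right _ _)
  set T : ℝ := t - c with hT
  have hT0 : 0 ≤ T := sub_nonneg.2 hct
  set l : ℝ := δ / ((T + δ) * 2 ^ (n + 1)) with hl
  have hl0 : 0 < l := by positivity
  have hl1 : l < 1 := by
    rw [hl, div_lt_one (by positivity)]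
    have : (1:ℝ) < 2 ^ (n + 1) := one_lt_pow₀ one_lt_two (by omega)
    nlinarith
  have hTl : T * (l + 2 ^ n * l) ≤ δ := by
    have e1 : l * ((T + δ) * 2 ^ (n + 1)) = δ := by rw [hl]; field_simp
    have e2 : (1:ℝ) ≤ 2 ^ n := one_le_pow₀ one_le_two
    have e3 : T * (l + 2 ^ n * l) ≤ T * (2 ^ n * l + 2 ^ n * l) := by gcongr; nlinarith
    have e4 : 0 ≤ δ * (2 ^ n * l) := by positivity
    rw [pow_succ] at e1
    nlinarith
  filter_upwards [h.eventually_volume_lt hlow ht hl0 hl1 hl0, h.eventually_tail_le hlow hc0 hδ,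
    h.neg.eventually_tail_le hlow (c := -d) (by simp [hd1]) hδ, self_mem_nhdsWithin]
    with r h1 h2 h3 (hr : 0 < r)
  set U := {y ∈ ball x r | 0 < ⟪y - x, σ x⟫} with hU
  have hUm : MeasurableSet U := measurableSet_ball.inter
    (measurableSet_lt measurable_const (by fun_prop : Measurable fun y => ⟪y - x, σ x⟫))
  have hft : MeasurableSet {y | f y ≤ (t:ℝ)} := measurableSet_le h.meas measurable_const
  have hvol : volume (U ∩ {y | f y ≤ (t:ℝ)}) ≤ ofReal ((l + 2 ^ n * l) * r ^ n) := by
    have hmA : MeasurableSet {y | l * r ≤ ⟪y - x, σ x⟫} :=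
      measurableSet_le measurable_const (by fun_prop : Measurable fun y => ⟪y - x, σ x⟫)
    have e1 := h1 (U ∩ {y | f y ≤ (t:ℝ)} ∩ {y | l * r ≤ ⟪y - x, σ x⟫}) ((hUm.inter hft).inter hmA)
      (fun y hy => hy.1.1.1) fun y hy => ⟨hy.1.2, hy.2⟩
    refine (measure_le_inter_add_sdiff volume _ {y | l * r ≤ ⟪y - x, σ x⟫}).trans ?_
    rw [add_mul, ofReal_add (by positivity) (by positivity)]
    refine add_le_add e1.le ((measure_mono fun y hy => ?_).trans
      (volume_wedge_le (σ x) h.norm_eq x hl0.le hr.le))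
    have hy2 : ⟪y - x, σ x⟫ < l * r := not_le.1 hy.2
    refine ⟨hy.1.1.1, ?_⟩
    rw [real_inner_comm, abs_of_pos hy.1.1.2]
    exact hy2.le
  have hpt : ∀ y, ofReal |f y - b| ≤ ofReal (2 * δ) +
      ofReal (((-d : ℚ) : ℝ) - -f y) + ofReal (c - f y) +
      {y | f y ≤ (t:ℝ)}.indicator (fun _ => ofReal T) y := by
    intro y
    have key : |f y - b| ≤ 2 * δ + max (f y - d) 0 + max (c - f y) 0 +
        {y | f y ≤ (t:ℝ)}.indicator (fun _ => T) y := by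
      have e1 := le_max_left (f y - d) 0
      have e2 := le_max_right (f y - d) 0
      have e3 := le_max_left (c - f y) 0
      have e4 := le_max_right (c - f y) 0
      by_cases hy : f y ≤ t
      · rw [indicator_of_mem (show y ∈ {y | f y ≤ (t:ℝ)} from hy), abs_le]
        constructor <;> linarith
      · rw [indicator_of_notMem (show y ∉ {y | f y ≤ (t:ℝ)} from hy), abs_le]
        constructor <;> linarith
    refine (ofReal_le_ofReal key).trans ?_
    refine ofReal_add_le.trans (add_le_add (ofReal_add_le.trans (add_le_add
      (ofReal_add_le.trans (add_le_add le_rfl ?_)) ?_)) ?_)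
    · rw [ofReal_max, ofReal_zero, max_eq_left zero_le]
      push_cast
      rw [neg_sub_neg]
    · rw [ofReal_max, ofReal_zero, max_eq_left zero_le]
    · by_cases hy : y ∈ {y | f y ≤ (t:ℝ)} <;> simp [hy]
  calc ∫⁻ y in U, ofReal |f y - b| ≤ ∫⁻ y in U, (ofReal (2 * δ) +
      ofReal (((-d : ℚ) : ℝ) - -f y) + ofReal (c - f y) +
      {y | f y ≤ (t:ℝ)}.indicator (fun _ => ofReal T) y) := lintegral_mono hpt
    _ = ofReal (2 * δ) * volume U + (∫⁻ y in U, ofReal (((-d : ℚ) : ℝ) - -f y)) +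
        (∫⁻ y in U, ofReal (c - f y)) +
        ofReal T * volume (U ∩ {y | f y ≤ (t:ℝ)}) := by
        have := h.meas
        rw [lintegral_add_right _ (measurable_const.indicator hft), lintegral_add_right _
          (by fun_prop), lintegral_add_right _ (by fun_prop), setLIntegral_const,
          lintegral_indicator_const hft, Measure.restrict_apply hft, Set.inter_comm]
    _ ≤ ofReal (2 * δ) * ofReal (r ^ n * ballVol n) + ofReal (δ * r ^ n) +
        ofReal (δ * r ^ n) +
        ofReal T * ofReal ((l + 2 ^ n * l) * r ^ n) := by
        refine add_le_add (add_le_add (add_le_add (mul_le_mul_right ?_ _) ?_) ?_)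
          (mul_le_mul_right hvol _)
        · rw [← volume_ball_eq_ofReal x hr]
          exact measure_mono fun y hy => hy.1
        · exact (lintegral_mono_set fun y hy => hy.1).trans h3
        · exact (lintegral_mono_set fun y hy => hy.1).trans h2
    _ ≤ _ := by
        rw [← ofReal_mul (by positivity), ← ofReal_mul (by positivity),
          ← ofReal_add (by positivity) (by positivity),
          ← ofReal_add (by positivity) (by positivity),
          ← ofReal_add (by positivity) (by positivity)]
        refine ofReal_le_ofReal ?_
        have := mul_le_mul_of_nonneg_right hTl (pow_nonneg hr.le n)
        linarith

lemma GoodPt.mem_jumpSet (h : GoodPt f Ω μ σ F x) {s t : ℚ} (hst : s < t) (hs : 0 < F s x)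
    (ht : F t x < 1) : x ∈ jumpSet n f := by
  have hlow := h.exists_le_energy hst hs ht
  obtain ⟨b, hb, hbl⟩ := h.exists_tendsto_upper hlow
  obtain ⟨a, ha, hal⟩ := h.neg.exists_tendsto_upper hlow
  refine ⟨σ x, h.norm_eq, b, -a, ?_, hbl, ?_⟩
  · have h1 := hb t ht
    have h2 := ha (-s) (by simpa using hs)
    push_cast at h2
    have : (s : ℝ) < t := Rat.cast_lt.2 hst
    intro h3
    linarith
  · refine hal.congr fun r => ?_
    have : ∀ y, |-f y - a| = |f y - -a| := fun y => by
      rw [← abs_neg]; congr 1; ring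
    simp only [this, inner_neg_right, Left.neg_pos_iff]

/-- Off the jump set the truncation densities of a good point are concentrated at one level. -/
lemma GoodPt.exists_dirac_of_notMem (h : GoodPt f Ω μ σ F x) (hx : x ∉ jumpSet n f) :
    x ∉ approxDiscontSet n f ∧
      ∃ c : ℝ, (∀ s : ℚ, s < c → F s x = 0) ∧ ∀ t : ℚ, c < t → F t x = 1 := by
  have hd : ∀ s t : ℚ, s < t → F s x = 0 ∨ F t x = 1 := by
    intro s t hst
    by_contra! hcon
    exact hx (h.mem_jumpSet hst ((h.nonneg s).lt_of_ne' hcon.1) ((h.le_one t).lt_of_ne hcon.2))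
  exact ⟨h.notMem_approxDiscontSet hd, h.exists_dirac hd⟩
end GoodPt

section Quarter

/-- Integral of `Ψ (s + a · y)` over the box `[-r, r]ⁿ`. -/
def boxInt (r : ℝ) (a : Fin n → ℝ) (Ψ : ℝ → ℝ) (s : ℝ) : ℝ :=
  ∫ y in Icc (fun _ : Fin n => -r) (fun _ => r), Ψ (s + ∑ i, a i * y i)

/-- Monotonicity in the absolute value. -/
def AbsMono (Ψ : ℝ → ℝ) : Prop := ∀ s t, |s| ≤ |t| → Ψ s ≤ Ψ t

lemma continuous_boxInt (a : Fin n → ℝ) {Ψ : ℝ → ℝ} (hΨ : Continuous Ψ) :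
    Continuous (boxInt r a Ψ) :=
  continuous_parametric_integral_of_continuous
    (f := fun s (y : Fin n → ℝ) => Ψ (s + ∑ i, a i * y i)) (by fun_prop) isCompact_Icc

lemma boxInt_succ (hr : 0 ≤ r) (a : Fin (n + 1) → ℝ) {Ψ : ℝ → ℝ} (hΨ : Continuous Ψ) (s : ℝ) :
    boxInt r a Ψ s = ∫ x in (-r)..r, boxInt r (fun i => a i.succ) Ψ (s + a 0 * x) := by
  have mp := (volume_preserving_piFinSuccAbove (fun _ : Fin (n + 1) => ℝ) 0).symm
  rw [boxInt, ← mp.setIntegral_preimage_emb (MeasurableEquiv.measurableEmbedding _),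
    show (MeasurableEquiv.piFinSuccAbove (fun _ : Fin (n + 1) => ℝ) 0).symm ⁻¹'
      Icc (fun _ => -r) (fun _ => r) = Icc (-r) r ×ˢ Icc (fun _ => -r) (fun _ => r) by
        ext p
        simp [Pi.le_def, Fin.forall_fin_succ, MeasurableEquiv.piFinSuccAbove, Prod.le_def], Measure.volume_eq_prod, setIntegral_prod, intervalIntegral.integral_of_le (by linarith),
    ← integral_Icc_eq_integral_Ioc]
  · simp [boxInt, Fin.sum_univ_succ, MeasurableEquiv.piFinSuccAbove, add_assoc]
  · rw [← Measure.volume_eq_prod]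
    refine ContinuousOn.integrableOn_compact (isCompact_Icc.prod isCompact_Icc)
      (Continuous.continuousOn ?_)
    have : (fun p : ℝ × (Fin n → ℝ) => Ψ (s + ∑ i, a i *
        (MeasurableEquiv.piFinSuccAbove (fun _ : Fin (n + 1) => ℝ) 0).symm p i)) =
        fun p => Ψ (s + (a 0 * p.1 + ∑ i : Fin n, a i.succ * p.2 i)) := by
      funext p; simp [Fin.sum_univ_succ, MeasurableEquiv.piFinSuccAbove]
    rw [this]
    fun_prop

lemma AbsMono.intervalIntegral {K : ℝ → ℝ} (hK : AbsMono K) (hc : Continuous K) (hr : 0 ≤ r)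
    (a : ℝ) : AbsMono fun s => ∫ x in (-r)..r, K (s + a * x) := by
  have hW (s : ℝ) : ∫ x in (-r)..r, K (s + a * x) = ∫ x in (-r)..r, K (|s| + a * x) := by
    rcases abs_cases s with ⟨h, -⟩ | ⟨h, -⟩
    · rw [h]
    · rw [h]
      have := intervalIntegral.integral_comp_neg (a := -r) (b := r) fun x => K (-s + a * x)
      rw [neg_neg] at this
      rw [← this]
      exact intervalIntegral.integral_congr fun x _ =>
        le_antisymm (hK _ _ (by rw [← abs_neg]; ring_nf; rfl)) (hK _ _ (by rw [← abs_neg]; ring_nf; rfl))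
  intro s t hst
  simp only [hW s, hW t]
  have hs := abs_nonneg s
  have hi (c d : ℝ) : IntervalIntegrable K volume c d := hc.intervalIntegrable _ _
  rcases eq_or_ne a 0 with rfl | ha
  · simp only [zero_mul, add_zero, intervalIntegral.integral_const, smul_eq_mul]
    exact mul_le_mul_of_nonneg_left (hK _ _ (by simpa using hst)) (by linarith)
  have h1 : a * ((∫ x in (-r)..r, K (|t| + a * x)) - ∫ x in (-r)..r, K (|s| + a * x)) =
      ∫ x in |s|..|t|, (K (x + a * r) - K (x - a * r)) := by
    rw [mul_sub, intervalIntegral.mul_integral_comp_add_mul,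
      intervalIntegral.mul_integral_comp_add_mul, intervalIntegral.integral_interval_sub_interval_comm'
      (hi _ _) (hi _ _) (hi _ _), 
      intervalIntegral.integral_sub (Continuous.intervalIntegrable (by fun_prop) _ _)
        (Continuous.intervalIntegrable (by fun_prop) _ _),
      intervalIntegral.integral_comp_add_right, intervalIntegral.integral_comp_sub_right]
    simp only [mul_neg, sub_eq_add_neg]
  have h2 : 0 ≤ a * ∫ x in |s|..|t|, (K (x + a * r) - K (x - a * r)) := by
    rw [← intervalIntegral.integral_const_mul]
    refine intervalIntegral.integral_nonneg hst fun x hx => ?_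
    have hx0 : 0 ≤ x := hs.trans hx.1
    rcases le_total 0 a with h | h
    · refine mul_nonneg h (sub_nonneg.2 (hK _ _ (sq_le_sq.1 ?_)))
      nlinarith [mul_nonneg hx0 (mul_nonneg h hr)]
    · refine mul_nonneg_of_nonpos_of_nonpos h (sub_nonpos.2 (hK _ _ (sq_le_sq.1 ?_)))
      nlinarith [mul_nonneg hx0 (mul_nonneg (neg_nonneg.2 h) hr)]
  rw [← h1, ← mul_assoc] at h2
  exact sub_nonneg.1 (nonneg_of_mul_nonneg_right h2 (mul_self_pos.2 ha))

lemma AbsMono.boxInt (hr : 0 ≤ r) {Ψ : ℝ → ℝ} (hΨ : AbsMono Ψ) (hc : Continuous Ψ) :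
    ∀ {n : ℕ} (a : Fin n → ℝ), AbsMono (boxInt r a Ψ)
  | 0, a => fun s t hst => by simpa [BMOGamma.boxInt, Icc, measureReal_def, volume_pi] using hΨ s t hst
  | n + 1, a => by
    rw [funext (boxInt_succ hr a hc)]
    exact (AbsMono.boxInt hr hΨ hc _).intervalIntegral (continuous_boxInt _ hc) hr _

lemma boxInt_sq (hr : 0 ≤ r) : ∀ {n : ℕ} (a : Fin n → ℝ) (s : ℝ),
    boxInt r a (· ^ 2) s = (2 * r) ^ n * (s ^ 2 + (∑ i, a i ^ 2) * (r ^ 2 / 3))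
  | 0, a, s => by simp [boxInt, Icc, measureReal_def, volume_pi]
  | n + 1, a, s => by
    rw [boxInt_succ hr a (by fun_prop), funext fun x => boxInt_sq hr (fun i => a i.succ) (s + a 0 * x)]
    have : ∀ x : ℝ, (2 * r) ^ n * ((s + a 0 * x) ^ 2 + (∑ i : Fin n, a i.succ ^ 2) * (r ^ 2 / 3)) =
      (2 * r) ^ n * (s ^ 2 + (∑ i : Fin n, a i.succ ^ 2) * (r ^ 2 / 3)) +
        (((2 * r) ^ n * (2 * s * a 0)) * x + ((2 * r) ^ n * a 0 ^ 2) * x ^ 2) := fun x => by ring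
    simp only [this]
    have hi {φ : ℝ → ℝ} (hφ : Continuous φ) : IntervalIntegrable φ volume (-r) r :=
      hφ.intervalIntegrable _ _
    rw [intervalIntegral.integral_add (hi (by fun_prop)) (hi (by fun_prop)),
      intervalIntegral.integral_add (hi (by fun_prop)) (hi (by fun_prop)),
      intervalIntegral.integral_const, intervalIntegral.integral_const_mul,
      intervalIntegral.integral_const_mul, integral_id, integral_pow, Fin.sum_univ_succ, smul_eq_mul]
    push_cast
    ring

lemma boxInt_abs_le (hr : 0 ≤ r) (a : Fin n → ℝ) :
    boxInt r a (|·|) 0 ≤ (2 * r) ^ n * ((∑ i, a i ^ 2) * (r ^ 2 / 2) + 1 / 8) := by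
  set Ψ : ℝ → ℝ := fun t => |t| ^ 4 / 8 - |t| ^ 3 / 6 + |t| ^ 2 / 16
  have hΨ : AbsMono Ψ := fun s t hst => by
    have hs := abs_nonneg s
    have : Ψ t - Ψ s = (|t| - |s|) / 12 * (|s| * (|s| - 1 / 2) ^ 2 +
      4 * ((|s| + |t|) / 2 * ((|s| + |t|) / 2 - 1 / 2) ^ 2) + |t| * (|t| - 1 / 2) ^ 2) := by
      simp only [Ψ]; ring
    have h2 : 0 ≤ |t| - |s| := by linarith
    have : 0 ≤ Ψ t - Ψ s := by rw [this]; positivity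
    linarith
  have hc : Continuous Ψ := by fun_prop
  have hi {φ : ℝ → ℝ} (hφ : Continuous φ) (s : ℝ) : IntegrableOn
      (fun y => φ (s + ∑ i, a i * y i)) (Icc (fun _ : Fin n => -r) (fun _ => r)) :=
    ContinuousOn.integrableOn_compact isCompact_Icc (Continuous.continuousOn (by fun_prop))
  have key (h : ℝ) (hh : 0 < h) : boxInt r a (|·|) 0 ≤
      (2 * r) ^ n * ((∑ i, a i ^ 2) * (r ^ 2 / 2) + 1 / 8) + (2 * r) ^ n / 4 * h ^ 2 := by
    have h1 := hΨ.boxInt hr hc a 0 h (by simp)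
    have h2 := hΨ.boxInt hr hc a 0 (-h) (by simp)
    have hp (t : ℝ) : Ψ (h + t) + Ψ (-h + t) ≤ 2 * Ψ t + h ^ 2 * (3 / 2 * t ^ 2) +
        h ^ 2 * (1 / 8 + h ^ 2 / 4) - h ^ 2 * |t| := by
      have h3 : 2 * |t| ^ 3 + 6 * |t| * h ^ 2 ≤ |h + t| ^ 3 + |-h + t| ^ 3 := by
        rcases le_total h |t| with hc | hc
        · rcases abs_cases t with ⟨e, -⟩ | ⟨e, -⟩ <;> rw [e] at hc ⊢
          · rw [abs_of_nonneg (by linarith), abs_of_nonneg (by linarith)]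
            exact le_of_eq (by ring)
          · rw [abs_of_nonpos (by linarith), abs_of_nonpos (by linarith)]
            exact le_of_eq (by ring)
        · have := pow_nonneg (sub_nonneg.2 hc) 3
          rw [abs_of_nonneg (a := h + t) (by linarith [(abs_le.1 hc).1]),
            abs_of_nonpos (a := -h + t) (by linarith [(abs_le.1 hc).2])]
          linear_combination 2 * this + 6 * h * sq_abs t
      have e (s : ℝ) : |s| ^ 4 = s ^ 4 := Even.pow_abs (by decide) s
      simp only [Ψ, sq_abs, e]
      linear_combination h3 / 6
    have A := ((hi hc h).add (hi hc (-h)))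
    have B := (hi (φ := (|·|)) (by fun_prop) 0).const_mul (h ^ 2)
    have D := (hi hc 0).const_mul 2
    have D' := (hi (φ := (· ^ 2)) (by fun_prop) 0).const_mul (h ^ 2 * (3 / 2))
    have D'' : IntegrableOn (fun _ => h ^ 2 * (1 / 8 + h ^ 2 / 4))
        (Icc (fun _ : Fin n => -r) (fun _ => r)) :=
      integrableOn_const isCompact_Icc.measure_ne_top
    have h3 := setIntegral_mono (A.add B) ((D.add D').add D'') fun y => by
      have := hp (∑ i, a i * y i)
      simp only [Pi.add_apply, zero_add]
      linarith
    rw [integral_add' A B, integral_add' (hi hc h) (hi hc (-h)), integral_add' (D.add D') D'',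
      integral_add' D D', integral_const_mul, integral_const_mul, integral_const_mul,
      setIntegral_const] at h3
    have h4 := boxInt_sq hr a 0
    have h5 : volume.real (Icc (fun _ : Fin n => -r) (fun _ => r)) = (2 * r) ^ n := by
      rw [measureReal_def, Real.volume_Icc_pi_toReal fun _ => by linarith]
      simp; ring
    simp only [boxInt] at h1 h2 h4 ⊢
    rw [h4, h5, smul_eq_mul] at h3
    refine le_of_mul_le_mul_left ?_ (pow_pos hh 2)
    linear_combination h1 + h2 + h3
  refine ge_of_tendsto (x := 𝓝[>] (0 : ℝ)) (f := fun h : ℝ => (2 * r) ^ n * ((∑ i, a i ^ 2) *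
    (r ^ 2 / 2) + 1 / 8) + (2 * r) ^ n / 4 * h ^ 2) ?_ (eventually_mem_nhdsWithin.mono key)
  exact tendsto_nhdsWithin_of_tendsto_nhds ((by fun_prop : Continuous _).tendsto' _ _ (by simp))

lemma lintegral_abs_inner_cube_le (b : Frame n) (z p : E n) (hε : 0 < ε) :
    ∫⁻ x in cube b z ε, ofReal |⟪p, x - z⟫| ≤ ofReal (ε ^ n * (ε * ‖p‖ / 4)) := by
  rcases eq_or_ne p 0 with rfl | hp0
  · simp
  have hp := norm_pos_iff.2 hp0
  set a : Fin n → ℝ := fun i => ⟪b i, p⟫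
  have hS : ∑ i, a i ^ 2 = ‖p‖ ^ 2 := by
    simpa [a, real_inner_comm] using b.sum_sq_norm_inner_right p
  have hle : boxInt (ε / 2) a (|·|) 0 ≤ ε ^ n * (ε * ‖p‖ / 4) := by
    have h1 := boxInt_abs_le (r := ε / 2) (by positivity) fun i => (ε * ‖p‖)⁻¹ * a i
    have h2 : boxInt (ε / 2) (fun i => (ε * ‖p‖)⁻¹ * a i) (|·|) 0 =
        (ε * ‖p‖)⁻¹ * boxInt (ε / 2) a (|·|) 0 := by
      simp only [boxInt, mul_assoc, ← mul_sum, zero_add, abs_mul, integral_const_mul]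
      rw [abs_of_nonneg (by positivity)]
    rw [h2, mul_div_cancel₀ _ two_ne_zero, inv_mul_le_iff₀ (by positivity)] at h1
    refine h1.trans (le_of_eq ?_)
    simp only [mul_pow, ← mul_sum, hS]
    field_simp
    norm_num
  refine le_trans ?_ (ofReal_le_ofReal hle)
  have hc : IntegrableOn (fun y : Fin n → ℝ => |0 + ∑ i, a i * y i|)
      (Icc (fun _ : Fin n => -(ε / 2)) (fun _ => ε / 2)) :=
    ContinuousOn.integrableOn_compact isCompact_Icc (Continuous.continuousOn (by fun_prop))
  rw [boxInt, ofReal_integral_eq_lintegral_ofReal hc (.of_forall fun _ => abs_nonneg _),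
    ← (measurePreserving_coords b).setLIntegral_comp_preimage_emb (measurableEmbedding_coords b),
    ← lintegral_indicator (isOpen_cube b z ε).measurableSet,
    ← lintegral_add_right_eq_self _ z, ← lintegral_indicator ((measurableEmbedding_coords b).measurable
      measurableSet_Icc)]
  refine lintegral_mono fun x => ?_
  by_cases hx : x + z ∈ cube b z ε
  swap
  · simp [hx]
  rw [indicator_of_mem hx]
  have hx' : x ∈ coords b ⁻¹' Icc (fun _ : Fin n => -(ε / 2)) (fun _ => ε / 2) := by
    have h1 (i) : |⟪b i, x⟫| < ε / 2 := by simpa using hx i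
    exact ⟨fun i => (abs_lt.1 (h1 i)).1.le, fun i => (abs_lt.1 (h1 i)).2.le⟩
  rw [indicator_of_mem hx', add_sub_cancel_right, zero_add, ← b.sum_inner_mul_inner p x]
  simp [a, coords, real_inner_comm]
end Quarter

section MollOsc

lemma measurable_moll (hum : Measurable u) (R : ℝ) : Measurable (moll R u) := by
  have hρ : Measurable (rho n R) := (contDiff_rho R).continuous.measurable
  have : Measurable fun p : E n × E n => u p.2 * rho n R (p.1 - p.2) := by fun_prop
  exact this.stronglyMeasurable.integral_prod_right.measurable

lemma exists_abs_rho_sub_le (n : ℕ) : ∃ L : ℝ, 0 ≤ L ∧ ∀ R > 0, ∀ x y : E n,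
    |rho n R x - rho n R y| ≤ L * ‖x - y‖ / (R * R ^ n) := by
  obtain ⟨L, hL⟩ := contDiff_bump.lipschitzWith_of_hasCompactSupport (f := bump n)
    ((isCompact_closedBall 0 1).of_isClosed_subset (isClosed_tsupport _) tsupport_bump.subset)
    one_ne_zero
  refine ⟨L, L.2, fun R hR x y => ?_⟩
  have := hL.dist_le_mul (R⁻¹ • x) (R⁻¹ • y)
  rw [dist_eq, dist_eq_norm, ← smul_sub, norm_smul, norm_inv, norm_of_nonneg hR.le] at this
  rw [rho, rho, ← mul_sub, abs_mul, abs_of_nonneg (by positivity)]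
  refine (mul_le_mul_of_nonneg_left this (by positivity)).trans (le_of_eq ?_)
  field_simp

lemma lintegral_lintegral_kernel_le [IsFiniteMeasure μ] {k : E n → ℝ≥0∞} (hk : Measurable k)
    (A V : Set (E n)) : ∫⁻ x in A, ∫⁻ y in V, k (x - y) ∂μ ≤ (∫⁻ x, k x) * μ V :=
  calc _ ≤ ∫⁻ x, ∫⁻ y in V, k (x - y) ∂μ := setLIntegral_le_lintegral _ _
    _ = ∫⁻ y in V, (∫⁻ x, k (x - y)) ∂μ :=
        lintegral_lintegral_swap (Measurable.aemeasurable (by fun_prop))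
    _ = _ := by simp only [lintegral_sub_right_eq_self k, setLIntegral_const]

lemma ofReal_osc_affine_le (b : Frame n) (z p : E n) (hε : 0 < ε) (c : ℝ) :
    ofReal (osc (fun x => c + ⟪p, x - z⟫) (cube b z ε)) ≤ ofReal (ε * ‖p‖ / 4) := by
  have hV : volume (cube b z ε) = ofReal (ε ^ n) := by
    rw [volume_cube]; exact (ofReal_pow hε.le n).symm
  have hε' : 0 < ε ^ n := by positivity
  have hQ : volume (cube b z ε) ≠ ⊤ := by simp [hV]
  have hQ0 : volume (cube b z ε) ≠ 0 := by simp [hV, hε']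
  have hm := (isOpen_cube b z ε).measurableSet
  have hi {φ : E n → ℝ} (hφ : Continuous φ) : IntegrableOn φ (cube b z ε) :=
    (hφ.continuousOn.integrableOn_compact (isCompact_closedBall z (n * ε))).mono_set
      (cube_subset_closedBall _ _ _)
  have h0 : ∫ x in cube b z ε, ⟪p, x - z⟫ = 0 := by
    rw [← integral_indicator hm]
    set ψ := (cube b z ε).indicator fun x => ⟪p, x - z⟫
    have h1 (x : E n) : ψ (z + z - x) = -ψ x := by
      have h2 : z + z - x - z = -(x - z) := by abel
      have : z + z - x ∈ cube b z ε ↔ x ∈ cube b z ε := by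
        simp only [cube, Set.mem_ofPred_eq, h2, inner_neg_right, abs_neg]
      by_cases hx : x ∈ cube b z ε
      · simp only [ψ, indicator_of_mem hx, indicator_of_mem (this.2 hx), h2, inner_neg_right]
      · simp only [ψ, indicator_of_notMem hx, indicator_of_notMem (mt this.1 hx), neg_zero]
    have h2 := integral_sub_left_eq_self ψ volume (z + z)
    simp only [h1, integral_neg] at h2
    linarith
  have h1 : ⨍ x in cube b z ε, (c + ⟪p, x - z⟫) = c := by
    rw [setAverage_eq, integral_add (hi continuous_const) (hi (by fun_prop)), h0, add_zero,
      setIntegral_const, smul_smul, inv_mul_cancel₀, one_smul]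
    exact (toReal_pos hQ0 hQ).ne'
  rw [ofReal_osc_eq hQ (hi (by fun_prop)), h1, ENNReal.inv_mul_le_iff hQ0 hQ]
  simp only [add_sub_cancel_left]
  rw [hV, ← ofReal_mul hε'.le]
  exact lintegral_abs_inner_cube_le b z p hε

lemma convex_cube (b : Frame n) (z : E n) (ε : ℝ) :
    Convex ℝ (cube b z ε) := fun x hx y hy s t hs ht hst i => by
  have h : ⟪b i, s • x + t • y - z⟫ = s * ⟪b i, x - z⟫ + t * ⟪b i, y - z⟫ := by
    simp only [inner_sub_right, inner_add_right, inner_smul_right]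
    linear_combination ⟪b i, z⟫ * hst
  have := convex_ball (0 : ℝ) (ε / 2) (mem_ball_zero_iff.2 (hx i)) (mem_ball_zero_iff.2 (hy i)) hs ht hst
  rw [h]
  exact mem_ball_zero_iff.1 this

/-- The kernel controlling oscillations of mollifications. -/
def oscKer (n : ℕ) (R c : ℝ) (w : E n) : ℝ :=
  rho n R w / 4 + (closedBall 0 (3 * R)).indicator (fun _ => c) w

lemma exists_ofReal_osc_moll_le (n : ℕ) (hn : 1 ≤ n) : ∃ C : ℝ, 0 ≤ C ∧
    ∀ {u : E n → ℝ} {Ω : Set (E n)} {μ : Measure (E n)} {σ : E n → E n}, IsOpen Ω →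
    IsPair u Ω μ σ → Measurable u → LocInt u Ω → ∀ {R ε : ℝ}, 0 < R → 0 < ε →
    n * ε ≤ R → ∀ b z, (∀ x ∈ cube b z ε, closedBall x R ⊆ Ω) →
    ofReal (ε ^ (n - 1)) * ofReal (osc (moll R u) (cube b z ε)) ≤
      ∫⁻ x in cube b z ε, ∫⁻ y, ofReal (oscKer n R (C * ε / (R * R ^ n)) (x - y)) ∂μ := by
  obtain ⟨L, hL, hLip⟩ := exists_abs_rho_sub_le n
  refine ⟨(1 / 4 + 2 * n) * (L * n), by positivity, fun {u Ω μ σ} hΩ hp hum hu {R ε} hR hε hεR b z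
    hQΩ => ?_⟩
  have := hp.finite
  set Q := cube b z ε
  set d : ℝ := L * (n * ε) / (R * R ^ n) with hd
  have hd0 : 0 ≤ d := by positivity
  set D : ℝ := d * μ.real (closedBall z (2 * R))
  have hD0 : 0 ≤ D := by positivity
  set p : E n → E n := fun w => ∫ y, rho n R (w - y) • σ y ∂μ
  have hzQ : z ∈ Q := mem_cube_self b z hε
  have hρi {w : E n} (hw : w ∈ Q) : Integrable (fun y => rho n R (w - y)) μ :=
    (isTest_rho_sub hR (hQΩ w hw)).continuous.integrable_of_hasCompactSupport
      (isTest_rho_sub hR (hQΩ w hw)).hasCompactSupport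
  have hpi {w : E n} (hw : w ∈ Q) : Integrable (fun y => rho n R (w - y) • σ y) μ :=
    (hρi hw).mono ((hρi hw).1.smul hp.aesm) (hp.norm_eq.mono fun y hy => by
      rw [norm_smul, hy, mul_one])
  have hB : IntegrableOn (fun _ => d) (closedBall z (2 * R)) μ :=
    integrableOn_const (measure_ne_top _ _)
  have hBi := hB.integrable_indicator measurableSet_closedBall
  have hBe : ∫ y, (closedBall z (2 * R)).indicator (fun _ => d) y ∂μ = D := by
    rw [integral_indicator measurableSet_closedBall, setIntegral_const, smul_eq_mul, mul_comm]
  have hdiff {w : E n} (hw : w ∈ Q) (y : E n) : |rho n R (w - y) - rho n R (z - y)| ≤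
      (closedBall z (2 * R)).indicator (fun _ => d) y := by
    have hwz := norm_le_of_mem_cube hw
    by_cases hy : y ∈ closedBall z (2 * R)
    · rw [indicator_of_mem hy]
      refine (hLip R hR _ _).trans ?_
      rw [sub_sub_sub_cancel_right]
      simp only [hd]
      gcongr
    · rw [indicator_of_notMem hy]
      rw [mem_closedBall, not_le, dist_comm, dist_eq_norm] at hy
      have := norm_sub_le_norm_sub_add_norm_sub z w y
      rw [norm_sub_rev z w] at this
      rw [rho_eq_zero hR (x := w - y) (by linarith), rho_eq_zero hR (x := z - y) (by linarith),
        sub_zero, abs_zero]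
  have hpd {w : E n} (hw : w ∈ Q) : ‖p w - p z‖ ≤ D := by
    rw [← hBe, ← integral_sub (hpi hw) (hpi hzQ)]
    refine norm_integral_le_of_norm_le hBi (hp.norm_eq.mono fun y hy => ?_)
    rw [← sub_smul, norm_smul, hy, mul_one]
    exact hdiff hw y
  have hpz {x : E n} (hx : x ∈ Q) : ‖p z‖ ≤ (∫ y, rho n R (x - y) ∂μ) + D := by
    rw [← hBe, ← integral_add (hρi hx) hBi]
    refine norm_integral_le_of_norm_le ((hρi hx).add hBi) (hp.norm_eq.mono fun y hy => ?_)
    rw [norm_smul, hy, mul_one, norm_of_nonneg (rho_nonneg hR _)]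
    linarith [(abs_le.1 (hdiff hx y)).1]
  have hlin {x : E n} (hx : x ∈ Q) :
      |moll R u x - (moll R u z + ⟪p z, x - z⟫)| ≤ D * (n * ε) := by
    have := (convex_cube b z ε).norm_image_sub_le_of_norm_hasFDerivWithin_le' (φ := innerSL ℝ (p z))
      (C := D) (fun w hw => (hasFDerivAt_moll hp.hasDens hΩ hu hR (hQΩ w hw)).hasFDerivWithinAt)
      (fun w hw => by rw [← map_sub, innerSL_apply_norm]; exact hpd hw) hzQ hx
    rw [innerSL_apply_apply, norm_eq_abs, sub_sub] at this
    exact this.trans (mul_le_mul_of_nonneg_left (norm_le_of_mem_cube hx) hD0)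
  have hV : volume Q = ofReal (ε ^ n) := by
    rw [volume_cube]; exact (ofReal_pow hε.le n).symm
  have hε' : 0 < ε ^ n := by positivity
  have hQ : volume Q ≠ ⊤ := by simp [hV]
  have hQ0 : volume Q ≠ 0 := by simp [hV, hε']
  have h1 : ofReal (osc (moll R u) Q) ≤ ofReal (ε * (‖p z‖ / 4 + 2 * n * D)) := by
    refine (ofReal_osc_le_add hQ0 hQ (measurable_moll hum R)
      (v := fun x => moll R u z + ⟪p z, x - z⟫) (by fun_prop)).trans ?_
    have h2 : (volume Q)⁻¹ * ∫⁻ x in Q, ofReal |moll R u x - (moll R u z + ⟪p z, x - z⟫)| ≤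
        ofReal (D * (n * ε)) := by
      rw [ENNReal.inv_mul_le_iff hQ0 hQ, mul_comm, ← setLIntegral_const]
      exact setLIntegral_mono' (isOpen_cube b z ε).measurableSet fun x hx =>
        ofReal_le_ofReal (hlin hx)
    refine (add_le_add (ofReal_osc_affine_le b z (p z) hε _) (mul_le_mul_right h2 2)).trans
      (le_of_eq ?_)
    rw [two_mul (ofReal _), ← ofReal_add (by positivity) (by positivity),
      ← ofReal_add (by positivity) (by positivity)]
    congr 1; ring
  refine (mul_le_mul_right h1 _).trans ?_
  rw [← ofReal_mul (by positivity), ← mul_assoc, ← pow_succ, Nat.sub_add_cancel hn,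
    ofReal_mul hε'.le, ← hV, mul_comm, ← setLIntegral_const]
  refine setLIntegral_mono' (isOpen_cube b z ε).measurableSet fun x hx => ?_
  have hd' : (1 / 4 + 2 * n) * (L * n) * ε / (R * R ^ n) = (1 / 4 + 2 * n) * d := by
    rw [hd]; ring
  have hi2 : Integrable (fun y => (closedBall (0 : E n) (3 * R)).indicator
      (fun _ => (1 / 4 + 2 * n) * d) (x - y)) μ :=
    Integrable.of_bound ((measurable_const.indicator measurableSet_closedBall).comp
      (measurable_const.sub measurable_id)).aestronglyMeasurable _
      (.of_forall fun _ => norm_indicator_le_norm_self _ _)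
  have hk : Integrable (fun y => oscKer n R ((1 / 4 + 2 * n) * d) (x - y)) μ :=
    ((hρi hx).div_const 4).add hi2
  have hxz := norm_le_of_mem_cube hx
  rw [hd', ← ofReal_integral_eq_lintegral_ofReal hk (.of_forall fun y => add_nonneg
    (div_nonneg (rho_nonneg hR _) (by norm_num)) (Set.indicator_nonneg (fun _ _ => by positivity) _))]
  refine ofReal_le_ofReal ?_
  have h3 : (1 / 4 + 2 * n) * D ≤ ∫ y, (closedBall (0 : E n) (3 * R)).indicator
      (fun _ => (1 / 4 + 2 * n) * d) (x - y) ∂μ := by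
    rw [← hBe, ← integral_const_mul]
    refine integral_mono (hBi.const_mul _) hi2 fun y => ?_
    by_cases hy : y ∈ closedBall z (2 * R)
    · have : x - y ∈ closedBall (0 : E n) (3 * R) := by
        rw [mem_closedBall_zero_iff]
        have := norm_sub_le_norm_sub_add_norm_sub x z y
        rw [mem_closedBall, dist_comm, dist_eq_norm] at hy
        linarith
      simp only [indicator_of_mem hy, indicator_of_mem this, le_refl]
    · simp only [indicator_of_notMem hy, mul_zero]
      exact Set.indicator_nonneg (fun _ _ => by positivity) _
  simp only [oscKer]
  rw [integral_add ((hρi hx).div_const 4) hi2, integral_div]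
  linarith [hpz hx]

lemma lintegral_oscKer {c : ℝ} (hR : 0 < R) (hc : 0 ≤ c) : ∫⁻ w : E n, ofReal (oscKer n R c w) =
    ofReal (1 / 4 + c * ((3 * R) ^ n * volume.real (ball (0 : E n) 1))) := by
  have h1 : Integrable (rho n R) :=
    (contDiff_rho R).continuous.integrable_of_hasCompactSupport (hasCompactSupport_rho hR)
  have h2 : Integrable ((closedBall (0 : E n) (3 * R)).indicator fun _ => c) :=
    (integrableOn_const measure_closedBall_lt_top.ne).integrable_indicator measurableSet_closedBall
  have h3 : Integrable (oscKer n R c) := (h1.div_const 4).add h2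
  rw [← ofReal_integral_eq_lintegral_ofReal h3 (.of_forall fun y =>
    add_nonneg (div_nonneg (rho_nonneg hR _) (by norm_num)) (Set.indicator_nonneg (fun _ _ => hc) _))]
  simp only [oscKer]
  rw [integral_add (h1.div_const 4) h2, integral_div, integral_rho hR,
    integral_indicator measurableSet_closedBall, setIntegral_const, measureReal_def,
    Measure.addHaar_closedBall _ _ (by positivity), toReal_mul,
    toReal_ofReal (by positivity), ← measureReal_def, finrank_euclideanSpace,
    Fintype.card_fin, smul_eq_mul, mul_comm c]

lemma exists_sum_osc_moll_le (n : ℕ) (hn : 1 ≤ n) : ∃ C : ℝ, 0 ≤ C ∧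
    ∀ {u : E n → ℝ} {Ω : Set (E n)} {μ : Measure (E n)} {σ : E n → E n}, IsOpen Ω →
    IsPair u Ω μ σ → Measurable u → LocInt u Ω → ∀ {R ε : ℝ}, 0 < R → 0 < ε →
    n * ε ≤ R → ∀ {V V' : Set (E n)}, MeasurableSet V' → (∀ x ∈ V, closedBall x (3 * R) ⊆ Ω ∩ V') →
    ∀ F : Finset (Set (E n)), (∀ Q ∈ F, ∃ b z, Q = cube b z ε ∧ Q ⊆ V) →
      (F : Set (Set (E n))).Pairwise Disjoint →
      ∑ Q ∈ F, ofReal (ε ^ (n - 1)) * ofReal (osc (moll R u) Q) ≤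
        ofReal (1 / 4 + C * (ε / R)) * μ V' := by
  obtain ⟨C, hC, h⟩ := exists_ofReal_osc_moll_le n hn
  refine ⟨C * (3 ^ n * volume.real (ball (0 : E n) 1)), by positivity,
    fun {u Ω μ σ} hΩ hp hum hu {R ε} hR hε hεR {V V'} hV' hV F hF hd => ?_⟩
  have := hp.finite
  set c := C * ε / (R * R ^ n)
  have hm : Measurable fun w : E n => ofReal (oscKer n R c w) :=
    (((contDiff_rho R).continuous.measurable.div_const 4).add
      (measurable_const.indicator measurableSet_closedBall)).ennreal_ofReal
  have hFm (Q) (hQ : Q ∈ F) : MeasurableSet Q := by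
    obtain ⟨b, z, rfl, -⟩ := hF Q hQ
    exact (isOpen_cube b z ε).measurableSet
  calc _ ≤ ∑ Q ∈ F, ∫⁻ x in Q, ∫⁻ y in V', ofReal (oscKer n R c (x - y)) ∂μ := by
        refine sum_le_sum fun Q hQ => ?_
        obtain ⟨b, z, rfl, hQV⟩ := hF Q hQ
        refine (h hΩ hp hum hu hR hε hεR b z fun x hx => (closedBall_subset_closedBall
          (by linarith)).trans ((hV x (hQV hx)).trans inter_subset_left)).trans ?_
        refine setLIntegral_mono' (isOpen_cube b z ε).measurableSet fun x hx => ?_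
        rw [← lintegral_indicator hV']
        refine lintegral_mono fun y => ?_
        by_cases hy : y ∈ V'
        · rw [indicator_of_mem hy]
        · have : 3 * R < ‖x - y‖ := by
            by_contra! hc
            exact hy (hV x (hQV hx) (by rwa [mem_closedBall, dist_comm, dist_eq_norm])).2
          have h0 : oscKer n R c (x - y) = 0 := by
            rw [oscKer, rho_eq_zero hR (by linarith), indicator_of_notMem
              (by rw [mem_closedBall_zero_iff]; exact this.not_ge), zero_div, add_zero]
          rw [h0, ofReal_zero]
          exact zero_le
    _ = ∫⁻ x in ⋃ Q ∈ F, Q, ∫⁻ y in V', ofReal (oscKer n R c (x - y)) ∂μ :=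
        (lintegral_biUnion_finset hd hFm _).symm
    _ ≤ _ := by
        refine (lintegral_lintegral_kernel_le hm _ _).trans (le_of_eq ?_)
        rw [lintegral_oscKer hR (by positivity)]
        congr 3
        simp only [c, mul_pow]
        field_simp

end MollOsc

/-- Close to `K`, the increments of `f` exceed `δ` only by little. -/
def TransSmall (f : E n → ℝ) (Ω : Set (E n)) (δ : ℝ) (K : Set (E n)) : Prop :=
  ∀ τ : ℝ≥0∞, τ ≠ 0 → ∃ V, IsOpen V ∧ K ⊆ V ∧ V ⊆ Ω ∧ ∃ r > 0, ∀ z : E n, ‖z‖ ≤ r →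
    ∫⁻ x in V, ofReal (|f (x + z) - f x| - δ) ≤ ofReal ‖z‖ * τ

section TransSmall
variable {K' : Set (E n)}
  {F : ℚ → E n → ℝ}

lemma TransSmall.union (h : TransSmall f Ω δ K) (h' : TransSmall f Ω δ K') :
    TransSmall f Ω δ (K ∪ K') := by
  intro τ hτ
  obtain ⟨V, hV, hKV, hVΩ, r, hr, H⟩ := h (τ / 2) (by simpa using hτ)
  obtain ⟨V', hV', hKV', hVΩ', r', hr', H'⟩ := h' (τ / 2) (by simpa using hτ)
  refine ⟨V ∪ V', hV.union hV', Set.union_subset_union hKV hKV', Set.union_subset hVΩ hVΩ',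
    min r r', lt_min hr hr', fun z hz => (lintegral_union_le _ _ _).trans ?_⟩
  refine (add_le_add (H z (hz.trans (min_le_left _ _))) (H' z (hz.trans (min_le_right _ _)))).trans ?_
  rw [← mul_add, ENNReal.add_halves]

lemma transSmall_biUnion {ι : Type*} {K : ι → Set (E n)} (h : ∀ i, TransSmall f Ω δ (K i))
    (s : Finset ι) : TransSmall f Ω δ (⋃ i ∈ s, K i) := by
  induction s using induction_on with
  | empty => exact fun τ _ => ⟨∅, isOpen_empty, by simp, Set.empty_subset _, 1, one_pos, by simp⟩
  | insert a s _ ih => rw [Finset.set_biUnion_insert]; exact (h a).union ih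

lemma TruncDens.transSmall (h : TruncDens f Ω μ σ F) (hΩ : IsOpen Ω) {a b : ℚ} (hab : a ≤ b)
    (hδ : (b - a : ℝ) ≤ δ) (hK : IsCompact K) (hKΩ : K ⊆ Ω) (hF : ∀ x ∈ K, F b x = 1 ∧ F a x = 0) :
    TransSmall f Ω δ K := by
  intro τ hτ
  have hfin := h.pair.finite
  have hab' : (a : ℝ) ≤ b := by exact_mod_cast hab
  have hl := (locallyIntegrableOn_min h.loc (b : ℝ)).sub (locallyIntegrableOn_min h.loc a)
  have hv := h.pair.hasDens.sub ((h.dens b).sub (h.dens a) (locallyIntegrableOn_min h.loc _)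
    (locallyIntegrableOn_min h.loc _)) h.loc hl
  set g : E n → E n := fun x => σ x - (F b x • σ x - F a x • σ x) with hg
  have : IsFiniteMeasure (μ.withDensity fun x => ‖g x‖ₑ) :=
    isFiniteMeasure_withDensity hv.int.hasFiniteIntegral.ne
  have h0 : (μ.withDensity fun x => ‖g x‖ₑ) K = 0 := by
    rw [withDensity_apply _ hK.measurableSet, setLIntegral_congr_fun (g := fun _ => 0)
      hK.measurableSet fun x hx => ?_, lintegral_zero]
    simp [hg, hF x hx]
  obtain ⟨U, hKU, hU, hUτ⟩ := K.exists_isOpen_lt_of_lt τ (h0.trans_lt (pos_iff_ne_zero.2 hτ))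
  obtain ⟨r, hr, hrU⟩ := hK.exists_cthickening_subset_open (hU.inter hΩ)
    (subset_inter hKU hKΩ)
  have hsub : thickening (r / 2) K ⊆ U ∩ Ω :=
    ((thickening_subset_cthickening _ _).trans (cthickening_mono (by linarith) _)).trans hrU
  refine ⟨thickening (r / 2) K, isOpen_thickening, self_subset_thickening (by positivity) _,
    hsub.trans inter_subset_right, r / 2, by positivity, fun z hz => ?_⟩
  have key := hv.lintegral_translate_le (h.loc.sub hl) (z := z) (isOpen_thickening (δ := r / 2)
    (E := K)) (hU.inter hΩ) inter_subset_right fun x hx θ hθ => ?_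
  · refine ((lintegral_mono fun x => ofReal_le_ofReal ?_).trans key).trans ?_
    · set s := f (x + z)
      set t := f x
      rw [tsub_le_iff_right, abs_le]
      have e1 := le_abs_self (s - (min s b - min s a) - (t - (min t b - min t a)))
      have e2 := neg_abs_le (s - (min s b - min s a) - (t - (min t b - min t a)))
      have e (p : ℝ) : 0 ≤ min p b - min p a ∧ min p b - min p a ≤ b - a := by
        rcases min_cases p (b : ℝ) with hp | hp <;> rcases min_cases p (a : ℝ) with hq | hq <;>
          constructor <;> linarith
      constructor <;> linarith [(e s).1, (e s).2, (e t).1, (e t).2]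
    · gcongr
      rw [← withDensity_apply _ (hU.inter hΩ).measurableSet]
      exact (measure_mono inter_subset_left).trans hUτ.le
  · obtain ⟨y, hy, hxy⟩ := mem_thickening_iff.1 hx
    refine hrU (mem_cthickening_of_dist_le _ y _ _ hy ?_)
    have h1 : dist (x + θ • z) x ≤ r / 2 := by
      rw [dist_self_add_left, norm_smul, norm_of_nonneg hθ.1]
      exact (mul_le_of_le_one_left (norm_nonneg _) hθ.2).trans hz
    linarith [dist_triangle (x + θ • z) x y]

lemma TruncDens.exists_transSmall (h : TruncDens f Ω μ σ F) (hΩ : IsOpen Ω) (hf : Measurable f)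
    (hδ : 0 < δ) {J : Set (E n)} (hJm : MeasurableSet J) (hJ : jumpSet n f ∩ Ω ⊆ J) {η : ℝ≥0∞}
    (hη : η ≠ 0) : ∃ K, IsCompact K ∧ K ⊆ Ω \ J ∧ TransSmall f Ω δ K ∧ μ ((Ω \ J) \ K) ≤ η := by
  have hfin := h.pair.finite
  obtain ⟨q, hq0, hqδ⟩ := exists_rat_btwn (half_pos hδ)
  have hX : MeasurableSet (Ω \ J) := hΩ.measurableSet.diff hJm
  have hC (k : ℤ) : NullMeasurableSet ((F ((k + 1) * q) ⁻¹' {1} ∩ F ((k - 1) * q) ⁻¹' {0}) ∩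
      (Ω \ J)) μ :=
    (((h.aesm _).aemeasurable.nullMeasurableSet_preimage (measurableSet_singleton _)).inter
      ((h.aesm _).aemeasurable.nullMeasurableSet_preimage (measurableSet_singleton _))).inter
      hX.nullMeasurableSet
  choose A hAC hAm hAe using fun k => (hC k).exists_measurable_subset_ae_eq
  obtain ⟨w, hw0, hw⟩ := ENNReal.exists_pos_sum_of_countable' hη ℤ
  choose K hKA hK hKw using fun k => (hAm k).exists_isCompact_sdiff_lt (measure_ne_top μ _)
    (hw0 k).ne'
  have hlim := tendsto_measure_iInter_atTop (μ := μ) (s := fun s : Finset ℤ => (Ω \ J) \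
    ⋃ k ∈ s, K k) (fun s => (hX.diff (s.measurableSet_biUnion fun k _ =>
      (hK k).measurableSet)).nullMeasurableSet) (fun s t hst => Set.sdiff_subset_sdiff_right
      (Set.biUnion_subset_biUnion_left hst)) ⟨∅, measure_ne_top _ _⟩
  have hle : μ (⋂ s : Finset ℤ, (Ω \ J) \ ⋃ k ∈ s, K k) < η := by
    refine lt_of_le_of_lt (b := ∑' k, μ (A k \ K k)) ?_
      ((ENNReal.tsum_le_tsum fun k => (hKw k).le).trans_lt hw)
    refine le_trans (measure_mono_ae ?_) (measure_iUnion_le _)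
    filter_upwards [h.ae_goodPt hΩ hf, ae_all_iff.2 fun k => (hAe k).mem_iff] with x hx hxA hxs
    have hxs := Set.mem_iInter.1 hxs
    have hxX := (hxs ∅).1
    obtain ⟨-, c, hc0, hc1⟩ := hx.exists_dirac_of_notMem fun hxJ => hxX.2 (hJ ⟨hxJ, hxX.1⟩)
    have h1 := Int.floor_le (c / q)
    have h2 := Int.lt_floor_add_one (c / q)
    rw [le_div_iff₀ hq0] at h1
    rw [div_lt_iff₀ hq0] at h2
    refine mem_iUnion.2 ⟨⌊c / q⌋, (hxA _).2 ⟨⟨hc1 _ ?_, hc0 _ ?_⟩, hxX⟩, fun hxK =>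
      (hxs {⌊c / q⌋}).2 (by simpa using hxK)⟩
    · push_cast; exact h2
    · push_cast; linarith
  obtain ⟨s, hs⟩ := (hlim.eventually_lt_const hle).exists
  refine ⟨⋃ k ∈ s, K k, s.isCompact_biUnion fun k _ => hK k, Set.iUnion₂_subset fun k _ =>
    ((hKA k).trans (hAC k)).trans inter_subset_right, transSmall_biUnion (fun k => ?_) s, hs.le⟩
  have hq : (0 : ℚ) < q := by exact_mod_cast hq0
  refine h.transSmall hΩ (a := (k - 1) * q) (b := (k + 1) * q) (by nlinarith) ?_ (hK k)
    (((hKA k).trans (hAC k)).trans fun x hx => hx.2.1) fun x hx => (hAC k (hKA k hx)).1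
  push_cast
  linarith

end TransSmall

lemma sum_osc_le_add (hn : 1 ≤ n) (hu : Measurable u) (hv : Measurable v) (hε : 0 < ε)
    {S : Set (E n)} {F : Finset (Set (E n))} (hF : ∀ Q ∈ F, ∃ b z, Q = cube b z ε ∧ Q ⊆ S)
    (hd : (F : Set (Set (E n))).Pairwise Disjoint) :
    ∑ Q ∈ F, ofReal (ε ^ (n - 1)) * ofReal (osc u Q) ≤
      ∑ Q ∈ F, ofReal (ε ^ (n - 1)) * ofReal (osc v Q) +
        ofReal (2 / ε) * ∫⁻ x in S, ofReal |u x - v x| := by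
  have hm : ∀ Q ∈ F, MeasurableSet (id Q) := fun Q hQ => by
    obtain ⟨b, z, rfl, -⟩ := hF Q hQ
    exact (isOpen_cube b z ε).measurableSet
  refine le_trans (sum_le_sum (g := fun Q => ofReal (ε ^ (n - 1)) *
    ofReal (osc v Q) + ofReal (2 / ε) * ∫⁻ x in Q, ofReal |u x - v x|)
    fun Q hQ => ?_) ?_
  · obtain ⟨b, z, rfl, -⟩ := hF Q hQ
    have hvol := volume_cube b z (ε := ε)
    rw [← ofReal_pow hε.le] at hvol
    refine (mul_le_mul_right (ofReal_osc_le_add (by rw [hvol]; simp; positivity)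
      (by rw [hvol]; exact ofReal_ne_top) hu hv) _).trans_eq ?_
    have e : ofReal (ε ^ (n - 1)) * 2 = ofReal (ε ^ (n - 1) * 2) := by
      rw [ofReal_mul (by positivity), ofReal_ofNat]
    rw [mul_add, hvol, ← ENNReal.ofReal_inv_of_pos (by positivity), ← mul_assoc, ← mul_assoc, e,
      ← ofReal_mul (p := ε ^ (n - 1) * 2) (by positivity)]
    congr 3
    obtain ⟨m, rfl⟩ := Nat.exists_eq_add_of_le' hn
    simp only [Nat.add_sub_cancel]
    field_simp
    ring
  · rw [Finset.sum_add_distrib, ← mul_sum F _ (ofReal (2 / ε)),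
      ← lintegral_biUnion_finset (fun Q hQ R hR hQR => hd hQ hR hQR) hm]
    gcongr
    exact Set.iUnion₂_subset fun Q hQ => (hF Q hQ).choose_spec.choose_spec.2

lemma abs_clamp (hδ : 0 ≤ δ) (t : ℝ) : |max (-δ) (min δ t)| ≤ δ ∧
    |max (-δ) (min δ t)| ≤ |t| ∧ (|max (-δ) (min δ t) - t| ≤ |t| - δ ∨ max (-δ) (min δ t) = t) := by
  rcases le_total δ t with h | h
  · rw [min_eq_left h, max_eq_right (by linarith), abs_of_nonneg hδ, abs_of_nonneg (hδ.trans h),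
      abs_sub_comm, abs_of_nonneg (by linarith)]
    exact ⟨le_rfl, h, Or.inl le_rfl⟩
  rw [min_eq_right h]
  rcases le_total (-δ) t with h' | h'
  · rw [max_eq_right h']
    exact ⟨abs_le.2 ⟨h', h⟩, le_rfl, Or.inr rfl⟩
  · rw [max_eq_left h', abs_neg, abs_of_nonneg hδ, abs_of_nonpos (by linarith : t ≤ 0),
      abs_of_nonneg (by linarith)]
    exact ⟨le_rfl, by linarith, Or.inl (by linarith)⟩

lemma exists_patch (n : ℕ) (hn : 1 ≤ n) : ∃ C : ℝ, 0 ≤ C ∧ ∀ {f : E n → ℝ} {Ω K : Set (E n)}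
    {μ : Measure (E n)} {σ : E n → E n}, IsOpen Ω → IsPair f Ω μ σ → Measurable f →
    LocInt f Ω → IsCompact K → ∀ {ρ δ ε R : ℝ} {τ : ℝ≥0∞},
    thickening ρ K ⊆ Ω → 0 ≤ δ → 0 < ε → 0 < R → n * ε ≤ R → R ≤ ρ / 16 →
    μ (thickening ρ K \ K) ≤ τ → (∀ z, ‖z‖ ≤ R → ∫⁻ x in thickening (ρ / 2) K,
      ofReal (|f (x + z) - f x| - δ) ≤ ofReal ‖z‖ * τ) →
    ∃ u, Measurable u ∧ (∀ x, |u x - f x| ≤ δ) ∧ kappa n ε u Ω ≤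
      ofReal (1 / 4 + C * (ε / R)) * μ (thickening ρ K) + μ (Ω \ K) / 2 +
        2 * (ofReal (2 / ε * R) * τ) := by
  obtain ⟨C, hC, H⟩ := exists_sum_osc_moll_le n hn
  refine ⟨C, hC, fun {f Ω K μ σ} hΩ hp hfm hf hK {ρ δ ε R τ} hρΩ hδ hε hR hεR hRρ hτ hP => ?_⟩
  have hρ : 0 < ρ := by linarith
  set V₁ := thickening (ρ / 2) K with hV₁
  set V₀ := cthickening (ρ / 4) K with hV₀
  set g := moll R f with hg
  set d : E n → ℝ := fun x => max (-δ) (min δ (g x - f x)) with hd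
  have hV₁m : MeasurableSet V₁ := isOpen_thickening.measurableSet
  have hgm : Measurable g := measurable_moll hfm R
  have hdm : Measurable d := by fun_prop
  have hum : Measurable fun x => f x + V₁.indicator d x := hfm.add (hdm.indicator hV₁m)
  have near (x z : E n) (hx : x ∈ V₁) (hz : ‖z‖ < ρ / 2) : x + z ∈ thickening ρ K := by
    obtain ⟨y, hy, hxy⟩ := mem_thickening_iff.1 hx
    have := dist_triangle (x + z) x y
    rw [dist_self_add_left] at this
    exact mem_thickening_iff.2 ⟨y, hy, by linarith⟩
  have ball (x : E n) (hx : x ∈ V₁) : closedBall x (3 * R) ⊆ Ω ∩ thickening ρ K := fun y hy => by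
    have := near x (y - x) hx (by rw [← dist_eq_norm]; linarith [mem_closedBall.1 hy])
    rw [add_sub_cancel] at this
    exact ⟨hρΩ this, this⟩
  have ball' (x : E n) (hx : x ∈ V₁) : closedBall x R ⊆ Ω := fun y hy =>
    (ball x hx (closedBall_subset_closedBall (by linarith) hy)).1
  have hmul : ∀ I ≤ ofReal R * τ, ofReal (2 / ε) * I ≤
      ofReal (2 / ε * R) * τ := fun I hI => (mul_le_mul_right hI _).trans_eq (by
    rw [ofReal_mul (by positivity), mul_assoc])
  refine ⟨_, hum, fun x => ?_, kappa_le_of_forall fun F hF hFd => ?_⟩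
  · rw [add_sub_cancel_left, indicator]
    split_ifs
    · exact (abs_clamp hδ _).1
    · simpa
  rw [← Finset.sum_filter_add_sum_filter_not F (· ⊆ V₁), two_mul, add_add_add_comm]
  refine add_le_add ?_ ?_
  · have hF' : ∀ Q ∈ F.filter (· ⊆ V₁), ∃ b z, Q = cube b z ε ∧ Q ⊆ V₁ := fun Q hQ => by
      obtain ⟨hQ, hQV⟩ := mem_filter.1 hQ
      obtain ⟨b, z, h, -⟩ := hF Q hQ
      exact ⟨b, z, h, hQV⟩
    have hFd' := hFd.mono (Finset.coe_subset.2 (F.filter_subset (· ⊆ V₁)))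
    refine (sum_osc_le_add hn hum hgm hε hF' hFd').trans (add_le_add (H hΩ hp hfm hf hR hε hεR
      isOpen_thickening.measurableSet ball _ hF' hFd') (hmul _ ?_))
    refine le_trans (setLIntegral_mono' hV₁m fun x hx => ENNReal.ofReal_le_ofReal_iff'.2 ?_)
      (lintegral_moll_sub_le hfm hf hV₁m hR ball' δ fun z hz => ?_)
    · rw [indicator_of_mem hx, show f x + d x - g x = d x - (g x - f x) by ring]
      exact (abs_clamp hδ (g x - f x)).2.2.imp id fun h => by rw [hd]; simp [h]
    · have := hP (-z) (by rwa [norm_neg])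
      rw [norm_neg] at this
      exact this.trans (mul_le_mul_left (ofReal_le_ofReal hz) _)
  · have hF' : ∀ Q ∈ F.filter (¬ · ⊆ V₁), ∃ b z, Q = cube b z ε ∧ Q ⊆ Ω \ V₀ := fun Q hQ => by
      obtain ⟨hQ, hQV⟩ := mem_filter.1 hQ
      obtain ⟨b, z, rfl, h⟩ := hF Q hQ
      refine ⟨b, z, rfl, fun x hx => ⟨h hx, fun hx0 => hQV fun y hy => ?_⟩⟩
      rw [hV₀, hK.cthickening_eq_biUnion_closedBall (by positivity)] at hx0
      obtain ⟨w, hw, hxw⟩ := Set.mem_iUnion₂.1 hx0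
      have h1 := norm_le_of_mem_cube hx
      have h2 := norm_le_of_mem_cube hy
      rw [← dist_eq_norm] at h1 h2
      have := dist_triangle4 y z x w
      rw [dist_comm z x] at this
      exact mem_thickening_iff.2 ⟨w, hw, by linarith [mem_closedBall.1 hxw]⟩
    have hFd' := hFd.mono (Finset.coe_subset.2 (F.filter_subset (¬ · ⊆ V₁)))
    refine (sum_osc_le_add hn hum hfm hε hF' hFd').trans (add_le_add ?_ (hmul _ ?_))
    · refine (sum_le_sum (g := fun Q => μ Q / 2) fun Q hQ => ?_).trans ?_
      · obtain ⟨b, z, rfl, h⟩ := hF' Q hQ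
        exact hp.ofReal_osc_cube_le hn hfm hf b z hε (h.trans sdiff_subset)
      · simp only [div_eq_mul_inv]
        rw [← sum_mul]
        refine mul_le_mul_left ?_ _
        refine (measure_biUnion_finset (f := id) (fun Q hQ R hR h => hFd' hQ hR h)
          fun Q hQ => ?_).symm.trans_le (measure_mono (Set.iUnion₂_subset fun Q hQ => ?_))
        · obtain ⟨b, z, rfl, -⟩ := hF' Q hQ
          exact (isOpen_cube b z ε).measurableSet
        · exact (hF' Q hQ).choose_spec.choose_spec.2.trans
            (Set.sdiff_subset_sdiff_right (self_subset_cthickening _))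
    · have hA : IsOpen (V₁ \ V₀) := isOpen_thickening.sdiff isClosed_cthickening
      calc ∫⁻ x in Ω \ V₀, ofReal |f x + V₁.indicator d x - f x|
          ≤ ∫⁻ x in Ω \ V₀, V₁.indicator (fun x => ofReal (|g x - f x| - 0)) x := by
            refine lintegral_mono fun x => ?_
            rw [add_sub_cancel_left]
            by_cases hx : x ∈ V₁
            · rw [indicator_of_mem hx, indicator_of_mem hx, sub_zero]
              exact ofReal_le_ofReal (abs_clamp hδ (g x - f x)).2.1
            · simp [indicator_of_notMem hx]
        _ ≤ ∫⁻ x in V₁ \ V₀, ofReal (|g x - f x| - 0) := by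
            rw [setLIntegral_indicator hV₁m]
            exact lintegral_mono_set fun x hx => ⟨hx.1, hx.2.2⟩
        _ ≤ ofReal R * τ :=
            lintegral_moll_sub_le hfm hf hA.measurableSet hR (fun x hx => ball' x hx.1) 0
              fun z hz => ?_
      simp only [sub_zero, sub_eq_add_neg _ z]
      refine (hp.hasDens.lintegral_translate_le hf hA (isOpen_thickening.sdiff hK.isClosed)
        (sdiff_subset.trans hρΩ) fun x hx θ hθ => ?_).trans ?_
      · have hz' : ‖θ • -z‖ ≤ R := by
          rw [norm_smul, norm_neg, norm_of_nonneg hθ.1]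
          exact (mul_le_of_le_one_left (norm_nonneg _) hθ.2).trans hz
        refine ⟨near x _ hx.1 (by linarith), fun hxK => hx.2 ?_⟩
        refine mem_cthickening_of_dist_le _ _ _ _ hxK ?_
        rw [dist_self_add_right]
        linarith
      · rw [hp.lintegral_enorm, norm_neg]
        gcongr

lemma TruncDens.eventually_exists_approx (hn : 1 ≤ n) {F : ℚ → E n → ℝ}
    (h : TruncDens f Ω μ σ F) (hΩ : IsOpen Ω) (hf : Measurable f) {J : Set (E n)}
    (hJm : MeasurableSet J) (hJ : jumpSet n f ∩ Ω ⊆ J) (hδ : 0 < δ) {η : ℝ≥0∞} (hη : η ≠ 0) :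
    ∀ᶠ ε in 𝓝[>] (0:ℝ), ∃ u, Measurable u ∧ (∀ x, |u x - f x| ≤ δ) ∧
      kappa n ε u Ω ≤ μ (Ω \ J) / 4 + μ J / 2 + η := by
  have hfin := h.pair.finite
  have he : η / 4 ≠ 0 := by simpa using hη
  obtain ⟨K, hK, hKJ, hKt, hKη⟩ := h.exists_transSmall hΩ hf hδ hJm hJ he
  obtain ⟨C, hC, H⟩ := exists_patch n hn
  obtain ⟨D, hD, hDη, hDn⟩ : ∃ D : ℝ, 0 < D ∧ ofReal (C / D) * μ univ ≤ η / 4 ∧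
      n ≤ D := by
    have h1 := ENNReal.Tendsto.mul_const (ENNReal.tendsto_ofReal
      ((tendsto_const_nhds (x := C)).div_atTop tendsto_id)) (Or.inr (measure_ne_top μ univ))
    rw [ofReal_zero, zero_mul] at h1
    exact ((eventually_gt_atTop 0).and ((h1.eventually_le_const (pos_iff_ne_zero.2 he)).and
      (eventually_ge_atTop (n : ℝ)))).exists
  set τ := min (η / 4) (η / 4 / (2 * ofReal (2 * D))) with hτ
  have hτ0 : τ ≠ 0 := by
    refine (lt_min (pos_iff_ne_zero.2 he) (ENNReal.div_pos he ?_)).ne'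
    exact mul_ne_top ENNReal.ofNat_ne_top ofReal_ne_top
  obtain ⟨V, hV, hKV, hVΩ, r, hr, hVr⟩ := hKt τ hτ0
  obtain ⟨ρ₀, hρ₀, hρV⟩ := hK.exists_cthickening_subset_open hV hKV
  obtain ⟨ρ, hρτ, hρ, hρ'⟩ := (((tendsto_measure_cthickening_of_isCompact (μ := μ) hK).mono_left
    nhdsWithin_le_nhds |>.eventually_le_const (ENNReal.lt_add_right (measure_ne_top μ K) hτ0)).and
      (Ioo_mem_nhdsGT hρ₀)).exists
  have hTV : thickening ρ K ⊆ V := (thickening_subset_cthickening _ _).trans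
    ((cthickening_mono hρ'.le _).trans hρV)
  have hTτ : μ (thickening ρ K) ≤ μ K + τ :=
    (measure_mono (thickening_subset_cthickening _ _)).trans hρτ
  filter_upwards [Ioo_mem_nhdsGT (show 0 < min (ρ / 16) r / D by positivity)] with ε ⟨hε, hε'⟩
  rw [lt_div_iff₀ hD, mul_comm] at hε'
  obtain ⟨u, hum, huδ, hu⟩ := H hΩ h.pair hf h.loc hK (hTV.trans hVΩ) hδ.le hε (mul_pos hD hε)
    (mul_le_mul_of_nonneg_right hDn hε.le) (hε'.le.trans (min_le_left _ _)) (τ := τ)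
    (by rw [measure_sdiff (self_subset_thickening hρ _) hK.measurableSet.nullMeasurableSet
          (measure_ne_top _ _)]; exact tsub_le_iff_left.2 hTτ)
    fun z hz => (lintegral_mono_set ((thickening_mono (by linarith) _).trans hTV)).trans
      (hVr z (hz.trans (hε'.le.trans (min_le_right _ _))))
  refine ⟨u, hum, huδ, hu.trans ?_⟩
  have e1 : C * (ε / (D * ε)) = C / D := by field_simp
  have e2 : 2 / ε * (D * ε) = 2 * D := by field_simp
  rw [e1, e2, ofReal_add (by norm_num) (by positivity), add_mul]
  have h1 : ofReal (1 / 4) * μ (thickening ρ K) ≤ μ (Ω \ J) / 4 + η / 4 := by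
    rw [ofReal_div_of_pos (by norm_num), ofReal_one, ofReal_ofNat, mul_comm,
      mul_one_div]
    refine (ENNReal.div_le_div_right hTτ _).trans ?_
    rw [ENNReal.add_div]
    refine add_le_add (ENNReal.div_le_div_right (measure_mono hKJ) _) (le_trans (b := τ) ?_ (min_le_left _ _))
    exact div_le_of_le_mul (le_mul_of_one_le_right' (by norm_num))
  have h2 : ofReal (C / D) * μ (thickening ρ K) ≤ η / 4 := le_trans (by gcongr; simp) hDη
  have h3 : μ (Ω \ K) / 2 ≤ μ J / 2 + η / 4 := by
    have : Ω \ K ⊆ J ∪ (Ω \ J) \ K := fun x hx =>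
      (em (x ∈ J)).imp_right fun hxJ => ⟨⟨hx.1, hxJ⟩, hx.2⟩
    refine (ENNReal.div_le_div_right ((measure_mono this).trans (measure_union_le _ _)) _).trans ?_
    rw [ENNReal.add_div]
    exact add_le_add le_rfl ((div_le_of_le_mul (le_mul_of_one_le_right' (by norm_num))).trans
      hKη)
  have h4 : 2 * (ofReal (2 * D) * τ) ≤ η / 4 := by
    rw [← mul_assoc]
    exact (mul_le_mul_right (min_le_right _ _) _).trans mul_div_le
  refine (add_le_add (add_le_add (add_le_add h1 h2) h3) h4).trans_eq ?_
  have h5 : η = η / 4 + η / 4 + η / 4 + η / 4 := by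
    rw [← two_mul, add_assoc, ← two_mul, ← add_mul, mul_comm, show (2 + 2 : ℝ≥0∞) = 4 by norm_num,
      ENNReal.div_mul_cancel (by norm_num) (by norm_num)]
  conv_rhs => rw [h5]
  ring

lemma exists_family {L : ℝ≥0∞} (hf : Measurable f)
    (H : ∀ δ : ℝ, 0 < δ → ∀ᶠ ε in 𝓝[>] (0:ℝ), ∃ u, Measurable u ∧ (∀ x, |u x - f x| ≤ δ) ∧ kappa n ε u Ω ≤ L + ofReal δ) :
    ∃ G : ℝ → E n → ℝ, (∀ ε, Measurable (G ε)) ∧ (∀ ε, ∃ M, ∀ x, |G ε x - f x| ≤ M) ∧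
      (∀ δ : ℝ, 0 < δ → ∀ᶠ ε in 𝓝[>] (0:ℝ), ∀ x, |G ε x - f x| ≤ δ) ∧
      limsup (fun ε => kappa n ε (G ε) Ω) (𝓝[>] (0:ℝ)) ≤ L := by
  set S : ℝ → Set ℝ := fun ε => {t | 0 < t ∧ ∃ u, Measurable u ∧ (∀ x, |u x - f x| ≤ t) ∧
    kappa n ε u Ω ≤ L + ofReal t} with hS
  have hpick (ε : ℝ) : ∃ u, Measurable u ∧ (∃ M, ∀ x, |u x - f x| ≤ M) ∧ (0 < ε → ∀ t ∈ S ε,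
      (∀ x, |u x - f x| ≤ t + ε) ∧ kappa n ε u Ω ≤ L + ofReal (t + ε)) := by
    by_cases h : 0 < ε ∧ (S ε).Nonempty
    · obtain ⟨s, ⟨-, u, hu, hus, huL⟩, hs⟩ :=
        exists_lt_of_csInf_lt h.2 (lt_add_of_pos_right (sInf (S ε)) h.1)
      refine ⟨u, hu, ⟨s, hus⟩, fun _ t ht => ?_⟩
      have : s ≤ t + ε := hs.le.trans (add_le_add_left (csInf_le ⟨0, fun t ht => ht.1.le⟩ ht) _)
      exact ⟨fun x => (hus x).trans this, huL.trans (add_le_add_right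
        (ofReal_le_ofReal this) _)⟩
    · exact ⟨f, hf, ⟨0, by simp⟩, fun hε t ht => absurd ⟨hε, t, ht⟩ h⟩
  choose G hGm hGM hG using hpick
  have hG' (δ : ℝ) (hδ : 0 < δ) : ∀ᶠ ε in 𝓝[>] (0:ℝ), (∀ x, |G ε x - f x| ≤ δ) ∧
      kappa n ε (G ε) Ω ≤ L + ofReal δ := by
    filter_upwards [H (δ / 2) (half_pos hδ), Ioo_mem_nhdsGT (half_pos hδ)] with ε h ⟨h0, h1⟩
    have h2 := hG ε h0 (δ / 2) ⟨half_pos hδ, h⟩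
    exact ⟨fun x => (h2.1 x).trans (by linarith), h2.2.trans (add_le_add_right
      (ofReal_le_ofReal (by linarith)) _)⟩
  refine ⟨G, hGm, hGM, fun δ hδ => (hG' δ hδ).mono fun _ h => h.1,
    ENNReal.le_of_forall_pos_le_add fun e he _ => limsup_le_of_le (h := ?_)⟩
  filter_upwards [hG' e he] with ε h
  simpa using h.2

lemma tendsto_setAverage_congr {g : E n → ℝ} (hΩ : IsOpen Ω) (h : f =ᵐ[volume.restrict Ω] g)
    (hx : x ∈ Ω) {A : ℝ → Set (E n)} (hA : ∀ r, A r ⊆ ball x r) (c : ℝ) :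
    Tendsto (fun r => ⨍ y in A r, |f y - c| ∂volume) (𝓝[>] 0) (𝓝 0) ↔
      Tendsto (fun r => ⨍ y in A r, |g y - c| ∂volume) (𝓝[>] 0) (𝓝 0) := by
  refine tendsto_congr' ?_
  obtain ⟨ρ, hρ, hρΩ⟩ := Metric.isOpen_iff.1 hΩ x hx
  filter_upwards [Ioo_mem_nhdsGT hρ] with r hr
  refine average_congr ?_
  filter_upwards [ae_restrict_of_ae_restrict_of_subset
    (((hA r).trans (ball_subset_ball hr.2.le)).trans hρΩ) h] with y hy
  rw [hy]

lemma mem_approxDiscontSet_congr {g : E n → ℝ} (hΩ : IsOpen Ω) (h : f =ᵐ[volume.restrict Ω] g)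
    (hx : x ∈ Ω) : x ∈ approxDiscontSet n f ↔ x ∈ approxDiscontSet n g :=
  not_congr (exists_congr fun c => tendsto_setAverage_congr hΩ h hx (fun _ => subset_rfl) c)

lemma mem_jumpSet_congr {g : E n → ℝ} (hΩ : IsOpen Ω) (h : f =ᵐ[volume.restrict Ω] g)
    (hx : x ∈ Ω) : x ∈ jumpSet n f ↔ x ∈ jumpSet n g :=
  exists_congr fun _ => and_congr_right fun _ => exists_congr fun a => exists_congr fun b =>
    and_congr_right fun _ => and_congr
      (tendsto_setAverage_congr hΩ h hx (fun _ => sep_subset _ _) a)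
      (tendsto_setAverage_congr hΩ h hx (fun _ => sep_subset _ _) b)

lemma exists_limsup_kappa_le (hn : 1 ≤ n) (hΩ : IsOpen Ω) (hfm : Measurable f) (hf : LocInt f Ω)
    (hp : IsVariationPair n f Ω μ σ) :
    ∃ G : ℝ → E n → ℝ, (∀ ε, Measurable (G ε)) ∧ (∀ ε, ∃ M, ∀ x, |G ε x - f x| ≤ M) ∧
      (∀ δ : ℝ, 0 < δ → ∀ᶠ ε in 𝓝[>] (0:ℝ), ∀ x, |G ε x - f x| ≤ δ) ∧
      limsup (fun ε => kappa n ε (G ε) Ω) (𝓝[>] (0:ℝ)) ≤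
        volume.withDensity (μ.rnDeriv volume) Ω / 4 +
          μ.singularPart volume (Ω \ approxDiscontSet n f) / 4 +
          μ.singularPart volume (jumpSet n f ∩ Ω) / 2 := by
  have := hp.1
  obtain ⟨F, h⟩ := (IsVariationPair.isPair hp).exists_truncDens hn hΩ hf
  obtain ⟨e, he, hd⟩ := exists_dense_directions hn
  set J := jumpHull f Ω e (2 ^ (n + 2)) with hJ
  have hJm : MeasurableSet J := measurableSet_jumpHull hΩ hf he _
  have hJS : J ⊆ approxDiscontSet n f ∩ Ω := jumpHull_subset hf he le_rfl
  have hJJ : jumpSet n f ∩ Ω ⊆ J := subset_jumpHull hΩ hf hd (one_le_pow₀ one_le_two)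
  obtain ⟨G, h1, h2, h3, h4⟩ := exists_family (L := μ (Ω \ J) / 4 + μ J / 2) hfm fun δ hδ =>
    h.eventually_exists_approx hn hΩ hfm hJm hJJ hδ (ofReal_pos.2 hδ).ne'
  refine ⟨G, h1, h2, h3, h4.trans ?_⟩
  set s := μ.singularPart volume with hs
  set a := volume.withDensity (μ.rnDeriv volume) with ha
  have hμ : μ = s + a := Measure.haveLebesgueDecomposition_add μ volume
  have haJ : a J = 0 := withDensity_absolutelyContinuous _ _
    (measure_mono_null hJS (volume_approxDiscontSet_inter hΩ hf))
  have hae : ∀ᵐ x ∂s, x ∉ jumpSet n f → x ∉ approxDiscontSet n f :=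
    ((h.ae_goodPt hΩ hfm).filter_mono (ae_mono (Measure.singularPart_le μ volume))).mono
      fun x hx hxJ => (hx.exists_dirac_of_notMem hxJ).1
  have e1 : s (Ω \ J) ≤ s (Ω \ approxDiscontSet n f) := measure_mono_ae <|
    hae.mono fun x hx hxJ => ⟨hxJ.1, hx fun h => hxJ.2 (hJJ ⟨h, hxJ.1⟩)⟩
  have e2 : s J ≤ s (jumpSet n f ∩ Ω) := measure_mono_ae <|
    hae.mono fun x hx hxJ => ⟨by_contra fun h => hx h (hJS hxJ).1, (hJS hxJ).2⟩
  conv_lhs => rw [hμ]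
  rw [Measure.add_apply, Measure.add_apply, haJ, add_zero, add_comm (s _), ENNReal.add_div]
  gcongr
  exact sdiff_subset

lemma exists_recovery (hn : 1 ≤ n) (hΩ : IsOpen Ω) (hf : LocInt f Ω) :
    ∃ F : ℝ → E n → ℝ, (∀ ε, 0 < ε → LocInt (F ε) Ω) ∧
      (∀ ε, 0 < ε → ∀ K, IsCompact K → K ⊆ Ω →
        eLpNorm (fun x => F ε x - f x) ⊤ (volume.restrict K) < ⊤) ∧
      (∀ K, IsCompact K → K ⊆ Ω → Tendsto (fun ε => eLpNorm (fun x => F ε x - f x) ⊤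
        (volume.restrict K)) (𝓝[>] (0:ℝ)) (𝓝 0)) ∧
      limsup (fun ε => kappa n ε (F ε) Ω) (𝓝[>] (0:ℝ)) ≤
        absVar n f Ω / 4 + cantorVar n f Ω / 4 + jumpVar n f Ω / 2 := by
  by_cases h : ∃ p : Measure (E n) × (E n → E n), IsVariationPair n f Ω p.1 p.2
  swap
  · refine ⟨fun _ => f, fun _ _ => hf, by simp only [sub_self, eLpNorm_zero']; simp,
      by simp only [sub_self, eLpNorm_zero']; simp, ?_⟩
    rw [absVar, dif_neg h, ENNReal.top_div_of_ne_top ENNReal.ofNat_ne_top, top_add, top_add]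
    exact le_top
  obtain ⟨g, hgm, hfg⟩ := hf.aestronglyMeasurable
  have hg : LocInt g Ω := (locallyIntegrableOn_iff hΩ.isLocallyClosed).2
    fun K hKΩ hK => (hf.integrableOn_compact_subset hKΩ hK).congr
      (ae_restrict_of_ae_restrict_of_subset hKΩ hfg)
  have hp : IsVariationPair n g Ω h.choose.1 h.choose.2 := by
    obtain ⟨h1, h2, h3, h4, h5⟩ := h.choose_spec
    refine ⟨h1, h2, h3, h4, fun Φ a b c => ?_⟩
    rw [← h5 Φ a b c]
    exact integral_congr_ae (hfg.symm.mono fun x hx => by simp only [hx])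
  obtain ⟨G, hGm, hGM, hG, hL⟩ := exists_limsup_kappa_le hn hΩ hgm.measurable hg hp
  have hb {u : E n → ℝ} {δ : ℝ} (hu : ∀ x, |u x - g x| ≤ δ) {K : Set (E n)} (hK : K ⊆ Ω) :
      eLpNorm (fun x => u x - f x) ⊤ (volume.restrict K) ≤ ofReal δ := by
    rw [eLpNorm_exponent_top]
    refine eLpNormEssSup_le_of_ae_bound ?_
    filter_upwards [ae_restrict_of_ae_restrict_of_subset hK hfg] with x hx
    rw [hx]
    exact hu x
  refine ⟨G, fun ε _ => ?_, fun ε _ K _ hK => ?_, fun K _ hK => ?_, ?_⟩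
  · obtain ⟨M, hM⟩ := hGM ε
    refine (locallyIntegrableOn_iff hΩ.isLocallyClosed).2 fun K hKΩ hK => ?_
    refine ((hg.integrableOn_compact_subset hKΩ hK).norm.add (integrableOn_const
      hK.measure_ne_top (C := M))).mono' (hGm ε).aestronglyMeasurable (ae_of_all _ fun x => ?_)
    have := abs_sub_abs_le_abs_sub (G ε x) (g x)
    simp only [Pi.add_apply, norm_eq_abs]
    linarith [hM x]
  · obtain ⟨M, hM⟩ := hGM ε
    exact (hb hM hK).trans_lt ofReal_lt_top
  · refine ENNReal.tendsto_nhds_zero.2 fun δ hδ => ?_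
    obtain ⟨q, hq0, hq⟩ := ENNReal.lt_iff_exists_nnreal_btwn.1 hδ
    filter_upwards [hG q (by exact_mod_cast hq0)] with ε hε
    exact (hb hε hK).trans (by simpa using hq.le)
  · rw [absVar, cantorVar, jumpVar, dif_pos h, dif_pos h, dif_pos h]
    have hS : Ω \ approxDiscontSet n g = Ω \ approxDiscontSet n f := Set.ext fun x =>
      and_congr_right fun hx => not_congr (mem_approxDiscontSet_congr hΩ hfg.symm hx)
    have hJ : jumpSet n g ∩ Ω = jumpSet n f ∩ Ω := Set.ext fun x =>
      and_congr_left fun hx => mem_jumpSet_congr hΩ hfg.symm hx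
    rwa [hS, hJ] at hL

end BMOGamma

/-- The functionals `κ_ε(·, Ω)` `Γ_∞`-converge as `ε → 0` to
`f ↦ (1/4)|D^a f|(Ω) + (1/4)|D^c f|(Ω) + (1/2)|D^j f|(Ω)` on `L¹_loc(Ω)`. -/
theorem gammaInfty_convergence
    (n : ℕ) (hn : 1 ≤ n)
    (Ω : Set (EuclideanSpace ℝ (Fin n))) (hΩ : IsOpen Ω) :
    (∀ f : EuclideanSpace ℝ (Fin n) → ℝ, LocallyIntegrableOn f Ω volume →
      ∀ F : ℝ → EuclideanSpace ℝ (Fin n) → ℝ,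
        (∀ ε, 0 < ε → LocallyIntegrableOn (F ε) Ω volume) →
        (∀ ε, 0 < ε → ∀ K, IsCompact K → K ⊆ Ω →
          eLpNorm (fun x => F ε x - f x) ⊤ (volume.restrict K) < ⊤) →
        (∀ K, IsCompact K → K ⊆ Ω →
          Tendsto (fun ε => eLpNorm (fun x => F ε x - f x) ⊤
            (volume.restrict K)) (𝓝[>] (0:ℝ)) (𝓝 0)) →
        absVar n f Ω / 4 + cantorVar n f Ω / 4 + jumpVar n f Ω / 2 ≤
          liminf (fun ε => kappa n ε (F ε) Ω) (𝓝[>] (0:ℝ))) ∧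
    (∀ f : EuclideanSpace ℝ (Fin n) → ℝ, LocallyIntegrableOn f Ω volume →
      ∃ F : ℝ → EuclideanSpace ℝ (Fin n) → ℝ,
        (∀ ε, 0 < ε → LocallyIntegrableOn (F ε) Ω volume) ∧
        (∀ ε, 0 < ε → ∀ K, IsCompact K → K ⊆ Ω →
          eLpNorm (fun x => F ε x - f x) ⊤ (volume.restrict K) < ⊤) ∧
        (∀ K, IsCompact K → K ⊆ Ω →
          Tendsto (fun ε => eLpNorm (fun x => F ε x - f x) ⊤
            (volume.restrict K)) (𝓝[>] (0:ℝ)) (𝓝 0)) ∧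
        limsup (fun ε => kappa n ε (F ε) Ω) (𝓝[>] (0:ℝ)) ≤
          absVar n f Ω / 4 + cantorVar n f Ω / 4 + jumpVar n f Ω / 2) := by
  exact ⟨fun f hf F h1 _ h3 => BMOGamma.le_lowerKappa hn hΩ hf (BMOGamma.isApprox_of_eLpNorm h1 h3),
    fun f hf => BMOGamma.exists_recovery hn hΩ hf⟩

end
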